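/- Let n ≥ 2 be an integer, let Γ ∈ 𝒰, and let K be a homogeneous Calderón–Zygmund kernel on ℝ^n. Suppose 1 < p < 2n/(2n−1) and p′/n < r ≤ p′ (p′ = p/(p−1)). Then there exists a constant C such that for every integer l ≥ 1, every m ∈ ℤ, and every Schwartz function f on ℝ^n one has ‖𝓗_{j,l}f‖_{W_{r,p}(j∈S_{l,m})} ≤ C · 2^{(m+l)(1/r − n/p′)} ‖f‖_{L^p(ℝ^n)}, with C independent of m and l. -/

import Mathlib

open MeasureTheory Filter Set
open scoped ENNReal NNReal FourierTransform Topology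

noncomputable section

/-- `ℝⁿ` as a Euclidean space. -/
abbrev Rn (n : ℕ) := EuclideanSpace ℝ (Fin n)

/-- The class `𝒰` of phase functions: `Γ` is continuous on `[0,∞)`, smooth on `(0,∞)`,
`Γ(0) = 0`, `Γ′ > 0` on `(0,∞)`, with the bounds `c_{1,j} ≤ |s^j Γ^{(j)}(s)/Γ(s)|` for
`j = 1, 2` and `|s^j Γ^{(j)}(s)/Γ(s)| ≤ c_{2,j}` for all `j ≥ 1`. -/
structure IsGammaU (Γ : ℝ → ℝ) : Prop where
  continuousOn : ContinuousOn Γ (Set.Ici 0)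
  smooth : ContDiffOn ℝ (⊤ : ℕ∞) Γ (Set.Ioi 0)
  map_zero : Γ 0 = 0
  deriv_pos : ∀ s > (0 : ℝ), 0 < deriv Γ s
  lower : ∀ j ∈ ({1, 2} : Set ℕ), ∃ c > (0 : ℝ), ∀ s > (0 : ℝ),
    c ≤ |s ^ j * iteratedDeriv j Γ s / Γ s|
  upper : ∀ j : ℕ, 1 ≤ j → ∃ c > (0 : ℝ), ∀ s > (0 : ℝ),
    |s ^ j * iteratedDeriv j Γ s / Γ s| ≤ c

/-- `K` is a homogeneous Calderón–Zygmund kernel on `ℝⁿ`: `K(t) = Ω(t)/‖t‖ⁿ` with `Ω` smooth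
away from the origin, homogeneous of degree `0`, and of mean value zero on the unit sphere. -/
def IsHomCZKernel (n : ℕ) (K : Rn n → ℝ) : Prop :=
  ∃ Ω : Rn n → ℝ,
    ContDiffOn ℝ (⊤ : ℕ∞) Ω {x : Rn n | x ≠ 0} ∧
    (∀ c : ℝ, 0 < c → ∀ t : Rn n, Ω (c • t) = Ω t) ∧
    (∫ θ : Metric.sphere (0 : Rn n) 1, Ω θ ∂((volume : Measure (Rn n)).toSphere) = 0) ∧
    (∀ t : Rn n, t ≠ 0 → K t = Ω t / ‖t‖ ^ n)

/-- The `r`-variation of a family `(a_u)_{u ∈ 𝒦}`. -/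
def variation {ι : Type*} [LinearOrder ι] (r : ℝ) (𝒦 : Set ι) (a : ι → ℂ) : ℝ≥0∞ :=
  ⨆ (J : ℕ) (u : Fin (J + 1) → ι) (_ : StrictMono u) (_ : ∀ i, u i ∈ 𝒦),
    (∑ i : Fin J, (‖a (u i.succ) - a (u i.castSucc)‖₊ : ℝ≥0∞) ^ r) ^ (1 / r)

/-- The `λ`-jump counting function of a family `(a_u)_{u ∈ 𝒦}`. -/
def jumpCount {ι : Type*} [LinearOrder ι] (lam : ℝ) (𝒦 : Set ι) (a : ι → ℂ) : ℝ≥0∞ :=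
  ⨆ (J : ℕ) (s : Fin J → ι) (t : Fin J → ι) (_ : ∀ i, s i ∈ 𝒦) (_ : ∀ i, t i ∈ 𝒦)
    (_ : ∀ i, s i < t i) (_ : ∀ i j : Fin J, i < j → t i < s j)
    (_ : ∀ i, lam < ‖a (t i) - a (s i)‖), (J : ℝ≥0∞)

/-- The `L^p` norm of an `ℝ≥0∞`-valued function. -/
def lpNormENN {α : Type*} [MeasurableSpace α] (p : ℝ) (g : α → ℝ≥0∞) (μ : Measure α) : ℝ≥0∞ :=
  (∫⁻ x, g x ^ p ∂μ) ^ (1 / p)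

/-- The fixed Littlewood–Paley cutoff `ψ : ℝ → [0,1]`, supported in `{1/2 ≤ |s| ≤ 2}`,
with `∑_{l ∈ ℤ} ψ(2^{-l} s) = 1` for `s ≠ 0`. -/
def IsLPCutoff (ψ : ℝ → ℝ) : Prop :=
  ContDiff ℝ (⊤ : ℕ∞) ψ ∧ (∀ s, ψ s ∈ Set.Icc (0 : ℝ) 1) ∧
    (∀ s, ψ s ≠ 0 → |s| ∈ Set.Icc (1/2 : ℝ) 2) ∧
    (∀ s : ℝ, s ≠ 0 → HasSum (fun l : ℤ => ψ ((2 : ℝ) ^ (-l) * s)) 1)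

/-- `k_* = sup{ m ∈ ℤ : 2^k Γ(2^m) ≤ 1 }`. -/
def kstar (Γ : ℝ → ℝ) (k : ℤ) : ℤ :=
  sSup {m : ℤ | (2 : ℝ) ^ k * Γ ((2 : ℝ) ^ m) ≤ 1}

/-- The localized modulated integral `H_l^{(u)} f(x) = ∫ f(x−t) e^{iuΓ(|t|)} ψ_l(t) K(t) dt`. -/
def Hloc {n : ℕ} (Γ : ℝ → ℝ) (K : Rn n → ℝ) (ψ : ℝ → ℝ) (u : ℝ) (l : ℤ)
    (f : Rn n → ℂ) (x : Rn n) : ℂ :=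
  ∫ t : Rn n, f (x - t) * Complex.exp (Complex.I * Complex.ofReal (u * Γ ‖t‖)) *
    Complex.ofReal (ψ ((2 : ℝ) ^ (-l) * ‖t‖) * K t)

/-- The fixed cutoff `χ : ℝ → [0,1]`, supported in `[1/2, 4]` and equal to `1` on `[1,2]`. -/
def IsChiCutoff (χ : ℝ → ℝ) : Prop :=
  ContDiff ℝ (⊤ : ℕ∞) χ ∧ (∀ u, χ u ∈ Set.Icc (0 : ℝ) 1) ∧
    (∀ u, χ u ≠ 0 → u ∈ Set.Icc (1/2 : ℝ) 4) ∧ (∀ u ∈ Set.Icc (1 : ℝ) 2, χ u = 1)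

/-- The Littlewood–Paley piece `Δ_i g` (`i ≥ 0`) on `ℝ`. -/
def deltaHigh (ψ : ℝ → ℝ) (i : ℕ) (g : ℝ → ℂ) : ℝ → ℂ :=
  𝓕⁻ fun τ : ℝ => Complex.ofReal (ψ ((2 : ℝ) ^ (-(i : ℤ)) * |τ|)) * 𝓕 g τ

/-- The low-frequency piece `Δ_{-1} g` on `ℝ`. -/
def deltaLow (ψ : ℝ → ℝ) (g : ℝ → ℂ) : ℝ → ℂ :=
  𝓕⁻ fun τ : ℝ => Complex.ofReal (1 - ∑' i : ℕ, ψ ((2 : ℝ) ^ (-(i : ℤ)) * |τ|)) * 𝓕 g τ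

/-- The Besov norm `‖g‖_{B_{r,1}^{1/r}(ℝ)} = ‖Δ_{-1}g‖_{L^r} + ∑_{i≥0} 2^{i/r} ‖Δ_i g‖_{L^r}`. -/
def besovNorm (ψ : ℝ → ℝ) (r : ℝ) (g : ℝ → ℂ) : ℝ≥0∞ :=
  eLpNorm (deltaLow ψ g) (ENNReal.ofReal r) volume +
    ∑' i : ℕ, ENNReal.ofReal ((2 : ℝ) ^ ((i : ℝ) / r)) *
      eLpNorm (deltaHigh ψ i g) (ENNReal.ofReal r) volume

/-- The index set `S_{l,m} = { j ∈ ℤ : 2^{m+l} ≤ Γ(2^{l+j_*})/Γ(2^{j_*}) < 2^{m+l+1} }`. -/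
def Slm (Γ : ℝ → ℝ) (l m : ℤ) : Set ℤ :=
  {j : ℤ | (2 : ℝ) ^ (m + l) ≤ Γ ((2 : ℝ) ^ (l + kstar Γ j)) / Γ ((2 : ℝ) ^ (kstar Γ j)) ∧
    Γ ((2 : ℝ) ^ (l + kstar Γ j)) / Γ ((2 : ℝ) ^ (kstar Γ j)) < (2 : ℝ) ^ (m + l + 1)}

namespace ShortVariation

/-- `f` is smooth and its derivatives of order at most `N` are bounded by `M`. -/
def SB {E : Type*} [NormedAddCommGroup E] [NormedSpace ℝ E] (N : ℕ) (M : ℝ) (f : E → ℝ) : Prop :=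
  ContDiff ℝ (⊤ : ℕ∞) f ∧ ∀ i ≤ N, ∀ x, ‖iteratedFDeriv ℝ i f x‖ ≤ M

section SBlemmas

variable {E : Type*} [NormedAddCommGroup E] [NormedSpace ℝ E] {N : ℕ} {M M' : ℝ} {f g : E → ℝ}

theorem SB.abs_le (hf : SB N M f) (x : E) : |f x| ≤ M := by
  have := hf.2 0 (Nat.zero_le _) x
  simpa using this

theorem SB.nonneg (hf : SB N M f) : 0 ≤ M := (abs_nonneg _).trans (hf.abs_le 0)

theorem SB.mono {N' : ℕ} (hf : SB N M f) (hN : N' ≤ N) (hM : M ≤ M') : SB N' M' f :=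
  ⟨hf.1, fun i hi x => (hf.2 i (hi.trans hN) x).trans hM⟩

theorem SB.add (hf : SB N M f) (hg : SB N M' g) : SB N (M + M') (fun x => f x + g x) := by
  refine ⟨hf.1.add hg.1, fun i hi x => ?_⟩
  have h1 := hf.1.of_le (m := i) (by exact_mod_cast le_top)
  have h2 := hg.1.of_le (m := i) (by exact_mod_cast le_top)
  have := iteratedFDeriv_add_apply (x := x) (i := i) h1.contDiffAt h2.contDiffAt
  have h3 : iteratedFDeriv ℝ i (fun x => f x + g x) x =
      iteratedFDeriv ℝ i f x + iteratedFDeriv ℝ i g x := this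
  rw [h3]
  exact (norm_add_le _ _).trans (add_le_add (hf.2 i hi x) (hg.2 i hi x))

theorem SB.const (c : ℝ) : SB N |c| (fun _ : E => c) := by
  refine ⟨contDiff_const, fun i _ x => ?_⟩
  rcases Nat.eq_zero_or_pos i with rfl | h
  · simp
  · rw [iteratedFDeriv_const_of_ne (by lia)]; simp

theorem SB.sum {ι : Type*} (s : Finset ι) {F : ι → E → ℝ} (h : ∀ i ∈ s, SB N M (F i)) :
    SB N (s.card * M) (fun x => ∑ i ∈ s, F i x) := by
  classical
  induction s using Finset.induction_on with
  | empty => simpa using SB.const (E := E) (N := N) 0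
  | insert a s ha ih =>
    simp only [Finset.sum_insert ha, Finset.card_insert_of_notMem ha]
    have := (h a (by simp)).add (ih fun i hi => h i (by simp [hi]))
    refine this.mono le_rfl (le_of_eq ?_)
    push_cast; ring

theorem SB.mul (hf : SB N M f) (hg : SB N M' g) : SB N (2 ^ N * M * M') (fun x => f x * g x) := by
  refine ⟨hf.1.mul hg.1, fun i hi x => ?_⟩
  have hM := hf.nonneg
  have hM' := hg.nonneg
  refine (norm_iteratedFDeriv_mul_le hf.1 hg.1 x (n := i) (by exact_mod_cast le_top)).trans ?_
  calc _ ≤ ∑ k ∈ Finset.range (i + 1), (i.choose k : ℝ) * M * M' := by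
        refine Finset.sum_le_sum fun k hk => ?_
        have : k ≤ i := by simpa [Nat.lt_succ_iff] using hk
        have a1 := hf.2 k (this.trans hi) x
        have a2 := hg.2 (i - k) ((Nat.sub_le _ _).trans hi) x
        gcongr
    _ = 2 ^ i * M * M' := by
        rw [← Finset.sum_mul, ← Finset.sum_mul]
        congr 2
        exact_mod_cast Nat.sum_range_choose i
    _ ≤ _ := by
        gcongr
        norm_num

theorem SB.fderiv_apply (hf : SB (N + 1) M f) (v : E) (hv : ‖v‖ ≤ 1) :
    SB N M (fun x => fderiv ℝ f x v) := by
  have hs : ContDiff ℝ (⊤ : ℕ∞) (fderiv ℝ f) := hf.1.fderiv_right (by simp)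
  refine ⟨hs.clm_apply contDiff_const, fun i hi x => ?_⟩
  have h := ContinuousLinearMap.norm_iteratedFDeriv_comp_left
    (ContinuousLinearMap.apply ℝ ℝ v) (hs.contDiffAt (x := x)) (n := i) (by exact_mod_cast le_top)
  have e : (fun x => fderiv ℝ f x v) = (ContinuousLinearMap.apply ℝ ℝ v) ∘ fderiv ℝ f := rfl
  rw [e]
  refine h.trans ?_
  rw [norm_iteratedFDeriv_fderiv]
  have h1 : ‖ContinuousLinearMap.apply ℝ ℝ v‖ ≤ 1 := by
    refine ContinuousLinearMap.opNorm_le_bound _ zero_le_one fun L => ?_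
    simp only [ContinuousLinearMap.apply_apply, one_mul]
    exact (L.le_opNorm v).trans (mul_le_of_le_one_right (norm_nonneg _) hv)
  calc _ ≤ 1 * M := by
        refine mul_le_mul h1 (hf.2 _ (by lia) x) (norm_nonneg _) zero_le_one
    _ = M := one_mul _

theorem SB.comp_add (hf : SB N M f) (y : E) : SB N M (fun x => f (x + y)) := by
  refine ⟨hf.1.comp (contDiff_id.add contDiff_const), fun i hi x => ?_⟩
  rw [iteratedFDeriv_comp_add_right]
  exact hf.2 i hi _

theorem SB.comp_sub (hf : SB N M f) (y : E) : SB N M (fun x => f (x - y)) := by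
  simpa [sub_eq_add_neg] using hf.comp_add (-y)

theorem SB.const_mul (hf : SB N M f) (c : ℝ) : SB N (|c| * M) (fun x => c * f x) := by
  refine ⟨contDiff_const.mul hf.1, fun i hi x => ?_⟩
  have h1 := hf.1.of_le (m := i) (by exact_mod_cast le_top)
  have : iteratedFDeriv ℝ i (fun x => c * f x) x = c • iteratedFDeriv ℝ i f x :=
    iteratedFDeriv_const_smul_apply (a := c) h1.contDiffAt
  rw [this, norm_smul]
  exact mul_le_mul_of_nonneg_left (hf.2 i hi x) (norm_nonneg _)

theorem SB.comp (N : ℕ) (M : ℝ) {ζ : ℝ → ℝ} (hζ : ContDiff ℝ (⊤ : ℕ∞) ζ) :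
    ∃ C, ∀ f : E → ℝ, SB N M f → SB N C (fun x => ζ (f x)) := by
  have hb : ∀ i, ∃ B, ∀ t ∈ Icc (-M) M, ‖iteratedFDeriv ℝ i ζ t‖ ≤ B := fun i =>
    isCompact_Icc.exists_bound_of_continuousOn
      (hζ.continuous_iteratedFDeriv (m := i) (by exact_mod_cast le_top)).continuousOn
  choose B hB using hb
  set B0 : ℝ := ∑ i ∈ Finset.range (N + 1), |B i| with hB0
  have hBi : ∀ i ≤ N, ∀ t ∈ Icc (-M) M, ‖iteratedFDeriv ℝ i ζ t‖ ≤ B0 := fun i hi t ht =>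
    (hB i t ht).trans ((le_abs_self _).trans
      (Finset.single_le_sum (f := fun i => |B i|) (fun _ _ => abs_nonneg _) (by simp; lia)))
  have hB0' : 0 ≤ B0 := Finset.sum_nonneg fun _ _ => abs_nonneg _
  refine ⟨N.factorial * B0 * (max 1 M) ^ N, fun f hf => ⟨hζ.comp hf.1, fun i hi x => ?_⟩⟩
  have := norm_iteratedFDeriv_comp_le hζ hf.1 (n := i) (by exact_mod_cast le_top) x
    (C := B0) (D := max 1 M) (fun k hk => hBi k (hk.trans hi) _ (_root_.abs_le.1 (hf.abs_le x)))
    (fun k hk1 hk => ((hf.2 k (hk.trans hi) x).trans (le_max_right 1 M)).trans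
      (le_self_pow₀ (le_max_left _ _) (by lia)))
  refine this.trans ?_
  have h1 : (1 : ℝ) ≤ max 1 M := le_max_left _ _
  gcongr

end SBlemmas

theorem exists_smooth_inv {δ : ℝ} (hδ : 0 < δ) :
    ∃ ζ : ℝ → ℝ, ContDiff ℝ (⊤ : ℕ∞) ζ ∧ ∀ t, δ ≤ t → ζ t = 1 / t := by
  refine ⟨fun t => Real.smoothTransition (2 * t / δ - 1) / t, ?_, fun t ht => ?_⟩
  · rw [contDiff_iff_contDiffAt]
    intro t
    rcases lt_or_ge t (δ / 2) with h | h
    · have : (fun t => Real.smoothTransition (2 * t / δ - 1) / t) =ᶠ[𝓝 t] fun _ => 0 := by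
        filter_upwards [Iio_mem_nhds h] with s hs
        rw [Real.smoothTransition.zero_of_nonpos, zero_div]
        have : 2 * s / δ ≤ 1 := by rw [div_le_one hδ]; linarith [mem_Iio.1 hs]
        linarith
      exact contDiffAt_const.congr_of_eventuallyEq this
    · have ht : t ≠ 0 := by linarith
      refine ContDiffAt.div ?_ contDiffAt_id ht
      refine Real.smoothTransition.contDiff.contDiffAt.comp t ?_
      fun_prop
  · simp only
    rw [Real.smoothTransition.one_of_one_le]
    have : 2 ≤ 2 * t / δ := by rw [le_div_iff₀ hδ]; linarith
    linarith

end ShortVariation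

namespace ShortVariation

/-- The partial derivative in the `q`-th coordinate direction. -/
def pd {n : ℕ} (q : Fin n) (f : Rn n → ℝ) (x : Rn n) : ℝ :=
  fderiv ℝ f x (EuclideanSpace.single q 1)

theorem SB.pd {n N : ℕ} {M : ℝ} {f : Rn n → ℝ} (hf : SB (N + 1) M f) (q : Fin n) :
    SB N M (pd q f) :=
  hf.fderiv_apply _ (by simp)

/-- The unimodular oscillating factor. -/
def osc {n : ℕ} (lam : ℝ) (Φ : Rn n → ℝ) (x : Rn n) : ℂ :=
  Complex.exp (Complex.I * (lam * Φ x : ℝ))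

theorem norm_osc {n : ℕ} (lam : ℝ) (Φ : Rn n → ℝ) (x : Rn n) : ‖osc lam Φ x‖ = 1 := by
  rw [osc, mul_comm]; exact Complex.norm_exp_ofReal_mul_I _

theorem hasFDerivAt_osc {n : ℕ} (lam : ℝ) {Φ : Rn n → ℝ} (hΦ : ContDiff ℝ (⊤ : ℕ∞) Φ) (x : Rn n) :
    HasFDerivAt (osc lam Φ)
      (osc lam Φ x • (Complex.I * lam : ℂ) • Complex.ofRealCLM.comp (fderiv ℝ Φ x)) x := by
  have h1 : HasFDerivAt Φ (fderiv ℝ Φ x) x := (hΦ.differentiable (by simp) x).hasFDerivAt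
  have h2 : HasFDerivAt (fun y => (Φ y : ℂ)) (Complex.ofRealCLM.comp (fderiv ℝ Φ x)) x :=
    Complex.ofRealCLM.hasFDerivAt.comp x h1
  have h3 := (h2.const_mul (Complex.I * lam : ℂ)).cexp
  have e : osc lam Φ = fun y => Complex.exp (Complex.I * lam * (Φ y : ℂ)) := by
    ext y; simp [osc, mul_assoc]
  rw [e]
  exact h3

theorem continuous_osc {n : ℕ} (lam : ℝ) {Φ : Rn n → ℝ} (hΦ : ContDiff ℝ (⊤ : ℕ∞) Φ) :
    Continuous (osc lam Φ) := by
  have := hΦ.continuous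
  unfold osc
  fun_prop

theorem hasCompactSupport_of_ball {n : ℕ} {β : Type*} [Zero β] {a : Rn n → β} {x0 : Rn n} {R : ℝ}
    (h : ∀ x, a x ≠ 0 → ‖x - x0‖ ≤ R) : HasCompactSupport a := by
  refine HasCompactSupport.of_support_subset_isCompact (isCompact_closedBall x0 R) fun x hx => ?_
  rw [mem_closedBall_iff_norm]
  exact h x hx

theorem hasCompactSupport_pd {n : ℕ} {h : Rn n → ℝ} (hc : HasCompactSupport h) (q : Fin n) :
    HasCompactSupport (pd q h) := by
  refine HasCompactSupport.intro' (hc.fderiv (𝕜 := ℝ)).isCompact (isClosed_tsupport _)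
    fun x hx => ?_
  simp [pd, image_eq_zero_of_notMem_tsupport hx]

theorem integrable_osc_mul {n : ℕ} (lam : ℝ) {Φ g : Rn n → ℝ} (hΦ : ContDiff ℝ (⊤ : ℕ∞) Φ)
    (hg : Continuous g) (hc : HasCompactSupport g) :
    Integrable fun x => osc lam Φ x * (g x : ℂ) := by
  refine Continuous.integrable_of_hasCompactSupport
    ((continuous_osc lam hΦ).mul (Complex.continuous_ofReal.comp hg)) ?_
  exact HasCompactSupport.mul_left (HasCompactSupport.comp_left hc Complex.ofReal_zero)

theorem osc_ibp {n : ℕ} (lam : ℝ) {Φ h : Rn n → ℝ} (hΦ : ContDiff ℝ (⊤ : ℕ∞) Φ)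
    (hh : ContDiff ℝ (⊤ : ℕ∞) h) (hc : HasCompactSupport h) (q : Fin n) :
    Complex.I * lam * ∫ x, osc lam Φ x * ((h x * pd q Φ x : ℝ) : ℂ) =
      - ∫ x, osc lam Φ x * (pd q h x : ℂ) := by
  set v : Rn n := EuclideanSpace.single q 1
  have hO := continuous_osc lam hΦ
  have hd : ∀ x, HasFDerivAt (fun y => (h y : ℂ)) (Complex.ofRealCLM.comp (fderiv ℝ h x)) x :=
    fun x => Complex.ofRealCLM.hasFDerivAt.comp x (hh.differentiable (by simp) x).hasFDerivAt
  have hfd : ∀ x, fderiv ℝ (fun y => (h y : ℂ)) x v = (pd q h x : ℂ) := fun x => by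
    rw [(hd x).fderiv]; rfl
  have hfo : ∀ x, fderiv ℝ (osc lam Φ) x v = osc lam Φ x * (Complex.I * lam * (pd q Φ x : ℂ)) :=
    fun x => by rw [(hasFDerivAt_osc lam hΦ x).fderiv]; simp [pd, v]
  have cpd : ∀ {g : Rn n → ℝ}, ContDiff ℝ (⊤ : ℕ∞) g → Continuous (pd q g) := fun hg =>
    (hg.continuous_fderiv (by simp)).clm_apply continuous_const
  have hcpd := hasCompactSupport_pd hc q
  have e1 : Continuous fun x => (h x : ℂ) := Complex.continuous_ofReal.comp hh.continuous
  have key := integral_mul_fderiv_eq_neg_fderiv_mul_of_integrable (μ := (volume : Measure (Rn n)))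
    (f := fun y => (h y : ℂ)) (g := osc lam Φ) (v := v) ?_ ?_ ?_
    (fun x _ => (hd x).differentiableAt) (fun x _ => (hasFDerivAt_osc lam hΦ x).differentiableAt)
  · simp only [hfd, hfo] at key
    rw [← integral_const_mul]
    have k1 : ∀ x, Complex.I * lam * (osc lam Φ x * ((h x * pd q Φ x : ℝ) : ℂ)) =
        (h x : ℂ) * (osc lam Φ x * (Complex.I * lam * (pd q Φ x : ℂ))) := fun x => by
      push_cast; ring
    simp_rw [k1, key, mul_comm]
  · simp only [hfd]
    refine Continuous.integrable_of_hasCompactSupport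
      ((Complex.continuous_ofReal.comp (cpd hh)).mul hO) ?_
    exact (hcpd.comp_left Complex.ofReal_zero).mul_right
  · simp only [hfo]
    refine Continuous.integrable_of_hasCompactSupport (e1.mul (hO.mul (continuous_const.mul
      (Complex.continuous_ofReal.comp (cpd hΦ))))) ?_
    exact (hc.comp_left Complex.ofReal_zero).mul_right
  · refine Continuous.integrable_of_hasCompactSupport (e1.mul hO) ?_
    exact (hc.comp_left Complex.ofReal_zero).mul_right

set_option maxHeartbeats 1000000 in
theorem nonstationary_phase (n N : ℕ) (M R : ℝ) : ∃ C : ℝ, 0 ≤ C ∧ ∀ (Φ a : Rn n → ℝ) (x0 : Rn n)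
    (lam : ℝ), 0 < lam → ContDiff ℝ (⊤ : ℕ∞) Φ → (∀ q, SB N M (pd q Φ)) → SB N M a →
    (∀ x, a x ≠ 0 → ‖x - x0‖ ≤ R) → (∀ x, a x ≠ 0 → 1 ≤ M * ∑ q, pd q Φ x ^ 2) →
    ‖∫ x, osc lam Φ x * (a x : ℂ)‖ ≤ C / lam ^ N := by
  induction N generalizing M with
  | zero =>
    set V := volume.real (Metric.closedBall (0 : Rn n) R) with hV
    refine ⟨|M| * V, by positivity, fun Φ a x0 lam hl hΦ hpd ha hs hT => ?_⟩
    have hM := ha.nonneg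
    have e : ∫ x, osc lam Φ x * (a x : ℂ) =
        ∫ x in Metric.closedBall x0 R, osc lam Φ x * (a x : ℂ) := by
      rw [setIntegral_eq_integral_of_forall_compl_eq_zero]
      intro x hx
      by_contra h
      refine hx (mem_closedBall_iff_norm.2 (hs x fun h0 => h (by simp [h0])))
    rw [e, pow_zero, div_one, abs_of_nonneg hM]
    have hV' : volume.real (Metric.closedBall x0 R) = V := by
      rw [hV, Measure.real, Measure.real, Measure.addHaar_closedBall_center]
    rw [← hV']
    refine norm_setIntegral_le_of_norm_le_const measure_closedBall_lt_top fun x _ => ?_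
    rw [norm_mul, norm_osc, one_mul, Complex.norm_real]
    exact ha.abs_le x
  | succ N ih =>
    by_cases hM : 0 < M
    swap
    · refine ⟨0, le_rfl, fun Φ a x0 lam hl hΦ hpd ha hs hT => ?_⟩
      have : ∀ x, a x = 0 := fun x => by
        have := ha.abs_le x
        have h2 : |a x| ≤ 0 := by linarith
        simpa using h2
      simp [this]
    obtain ⟨ζ, hζ, hζe⟩ := exists_smooth_inv (δ := 1 / M) (by positivity)
    set M1 : ℝ := (Finset.univ : Finset (Fin n)).card * (2 ^ (N + 1) * M * M) with hM1
    obtain ⟨M2, hM2⟩ := SB.comp (E := Rn n) (N + 1) M1 hζ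
    set M3 : ℝ := 2 ^ (N + 1) * M * (2 ^ (N + 1) * M * M2) with hM3
    set M4 : ℝ := max M ((Finset.univ : Finset (Fin n)).card * M3) with hM4
    obtain ⟨C, hC0, hC⟩ := ih M4
    refine ⟨C, hC0, fun Φ a x0 lam hl hΦ hpd ha hs hT => ?_⟩
    set T : Rn n → ℝ := fun x => ∑ q, pd q Φ x * pd q Φ x with hTdef
    have hTe : ∀ x, ∑ q, pd q Φ x ^ 2 = T x := fun x => by simp [hTdef, pow_two]
    have hTS : SB (N + 1) M1 T := SB.sum _ fun q _ => (hpd q).mul (hpd q)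
    set h : Fin n → Rn n → ℝ := fun q x => a x * (pd q Φ x * ζ (T x)) with hh
    have hhS : ∀ q, SB (N + 1) M3 (h q) := fun q => ha.mul ((hpd q).mul (hM2 T hTS))
    set b : Rn n → ℝ := fun x => ∑ q, pd q (h q) x with hb
    have hbS : SB N M4 b :=
      (SB.sum _ fun q _ => (hhS q).pd q).mono le_rfl (le_max_right _ _)
    have hac : HasCompactSupport a := hasCompactSupport_of_ball hs
    have hTc : Continuous T := hTS.1.continuous
    have hts : ∀ x, b x ≠ 0 → x ∈ tsupport a := fun x hx => by
      by_contra hxa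
      refine hx (Finset.sum_eq_zero fun q _ => ?_)
      have h0 : h q =ᶠ[𝓝 x] fun _ => 0 := by
        filter_upwards [notMem_tsupport_iff_eventuallyEq.1 hxa] with y hy
        simp [hh, hy]
      simp [pd, h0.fderiv_eq]
    have hclo : ∀ {P : Rn n → Prop}, IsClosed {x | P x} → (∀ x, a x ≠ 0 → P x) →
        ∀ x, b x ≠ 0 → P x := fun hP hPa x hx => by
      exact closure_minimal (fun y hy => hPa y hy) hP (hts x hx)
    have hbs : ∀ x, b x ≠ 0 → ‖x - x0‖ ≤ R :=
      hclo (isClosed_le (by fun_prop) continuous_const) hs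
    have hbT : ∀ x, b x ≠ 0 → 1 ≤ M4 * ∑ q, pd q Φ x ^ 2 := fun x hx => by
      have := hclo (P := fun x => 1 ≤ M * T x)
        (isClosed_le continuous_const (continuous_const.mul hTc))
        (fun x hx => by rw [← hTe]; exact hT x hx) x hx
      rw [hTe]
      have h0 : 0 ≤ T x := by rw [← hTe]; positivity
      exact this.trans (mul_le_mul_of_nonneg_right (le_max_left _ _) h0)
    have hmain := hC Φ b x0 lam hl hΦ (fun q => (hpd q).mono (Nat.le_succ N) (le_max_left _ _))
      hbS hbs hbT
    have hO := continuous_osc lam hΦ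
    have hhc : ∀ q, HasCompactSupport (h q) := fun q => hac.mul_right
    have hint1 : ∀ q, Integrable fun x => osc lam Φ x * ((h q x * pd q Φ x : ℝ) : ℂ) := fun q =>
      integrable_osc_mul lam hΦ ((hhS q).1.continuous.mul (hpd q).1.continuous) (hhc q).mul_right
    have hint2 : ∀ q, Integrable fun x => osc lam Φ x * (pd q (h q) x : ℂ) := fun q =>
      integrable_osc_mul lam hΦ ((hhS q).pd q).1.continuous (hasCompactSupport_pd (hhc q) q)
    have e1 : ∫ x, osc lam Φ x * (a x : ℂ) =
        ∑ q, ∫ x, osc lam Φ x * ((h q x * pd q Φ x : ℝ) : ℂ) := by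
      rw [← integral_finsetSum _ fun q _ => hint1 q]
      congr 1
      ext x
      rw [← Finset.mul_sum]
      congr 1
      rw [← Complex.ofReal_sum]
      congr 1
      by_cases hx : a x = 0
      · simp [hh, hx]
      · have h1 := hT x hx
        rw [hTe] at h1
        have h2 : 1 / M ≤ T x := by rw [div_le_iff₀ hM]; linarith
        have h3 : 0 < T x := lt_of_lt_of_le (by positivity) h2
        have : ∑ q, h q x * pd q Φ x = a x * ζ (T x) * T x := by
          simp only [hh, hTdef, Finset.mul_sum]
          refine Finset.sum_congr rfl fun q _ => by ring
        rw [this, hζe _ h2]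
        field_simp
    have e2 : Complex.I * lam * ∫ x, osc lam Φ x * (a x : ℂ) =
        - ∫ x, osc lam Φ x * (b x : ℂ) := by
      rw [e1, Finset.mul_sum]
      simp_rw [fun q => osc_ibp lam hΦ (hhS q).1 (hhc q) q]
      rw [Finset.sum_neg_distrib, ← integral_finsetSum _ fun q _ => hint2 q]
      congr 2
      ext x
      simp [hb, Finset.mul_sum]
    have e3 : lam * ‖∫ x, osc lam Φ x * (a x : ℂ)‖ = ‖∫ x, osc lam Φ x * (b x : ℂ)‖ := by
      rw [← norm_neg (∫ x, osc lam Φ x * (b x : ℂ)), ← e2, norm_mul, norm_mul]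
      simp [abs_of_pos hl]
    rw [pow_succ, ← div_div, le_div_iff₀ hl, mul_comm, e3]
    exact hmain

end ShortVariation

namespace ShortVariation

/-- Bounded measurable functions. -/
def BM {n : ℕ} (h : Rn n → ℂ) : Prop := Measurable h ∧ ∃ B : ℝ, ∀ x, ‖h x‖ ≤ B

/-- The integral operator with kernel `kk`. -/
def opK {n : ℕ} (kk : Rn n → Rn n → ℂ) (h : Rn n → ℂ) (x : Rn n) : ℂ := ∫ y, kk x y * h y

/-- The squared `L²` norm. -/
def sqn {n : ℕ} (h : Rn n → ℂ) : ℝ≥0∞ := ∫⁻ x, ‖h x‖ₑ ^ 2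

variable {n : ℕ}

theorem measurable_opK {kk : Rn n → Rn n → ℂ} (hk : Measurable (Function.uncurry kk))
    {h : Rn n → ℂ} (hh : Measurable h) : Measurable (opK kk h) := by
  have : StronglyMeasurable (Function.uncurry fun x y => kk x y * h y) :=
    (hk.mul (hh.comp measurable_snd)).stronglyMeasurable
  exact this.integral_prod_right.measurable

theorem integrable_of_bdd_support {α : Type*} [MeasurableSpace α] {μ : Measure α} {F : α → ℂ}
    (hF : Measurable F) {B : ℝ} (hB : ∀ x, ‖F x‖ ≤ B) {s : Set α} (hs : μ s < ∞)
    (hsupp : ∀ x, F x ≠ 0 → x ∈ s) : Integrable F μ := by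
  rw [← integrableOn_iff_integrable_of_support_subset (s := s) (fun x hx => hsupp x hx)]
  exact Measure.integrableOn_of_bounded hs.ne hF.aestronglyMeasurable (ae_of_all _ hB)

theorem two_mul_le_sq_add_sq (a b : ℝ≥0∞) : 2 * (a * b) ≤ a ^ 2 + b ^ 2 := by
  rcases eq_or_ne a ∞ with rfl | ha
  · simp
  rcases eq_or_ne b ∞ with rfl | hb
  · simp
  lift a to ℝ≥0 using ha
  lift b to ℝ≥0 using hb
  norm_cast
  rw [← NNReal.coe_le_coe]
  push_cast
  nlinarith [sq_nonneg ((a : ℝ) - b)]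

theorem schur_compact {kk : Rn n → Rn n → ℂ} (hk : Measurable (Function.uncurry kk)) {B R : ℝ}
    (hB : ∀ x y, ‖kk x y‖ ≤ B) (hR : ∀ x y, kk x y ≠ 0 → ‖x - y‖ ≤ R) {w : Rn n → ℝ≥0∞}
    (hw : Measurable w)
    (hkw : ∀ y y', ‖∫ x, kk x y * (starRingEnd ℂ) (kk x y')‖ₑ ≤ w (y - y'))
    {h : Rn n → ℂ} (hh : BM h) {ρ : ℝ} (hρ : ∀ y, h y ≠ 0 → ‖y‖ ≤ ρ) :
    sqn (opK kk h) ≤ (∫⁻ z, w z) * sqn h := by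
  obtain ⟨hm, Bh, hBh⟩ := hh
  set μ : Measure (Rn n) := volume
  set Q : Rn n → (Rn n × Rn n) → ℂ := fun x z =>
    (kk x z.1 * h z.1) * (starRingEnd ℂ) (kk x z.2 * h z.2) with hQ
  have hconj : Measurable (starRingEnd ℂ : ℂ → ℂ) := Complex.continuous_conj.measurable
  have hk1 : Measurable fun q : Rn n × Rn n => kk q.1 q.2 := hk
  have hQm : Measurable (Function.uncurry Q) := by
    have a1 : Measurable fun q : Rn n × Rn n × Rn n => kk q.1 q.2.1 :=
      hk1.comp (measurable_fst.prodMk (measurable_fst.comp measurable_snd))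
    have a2 : Measurable fun q : Rn n × Rn n × Rn n => kk q.1 q.2.2 :=
      hk1.comp (measurable_fst.prodMk (measurable_snd.comp measurable_snd))
    exact (a1.mul (hm.comp (measurable_fst.comp measurable_snd))).mul
      (hconj.comp (a2.mul (hm.comp (measurable_snd.comp measurable_snd))))
  have hB0 : 0 ≤ B := (norm_nonneg _).trans (hB 0 0)
  have hBh0 : 0 ≤ Bh := (norm_nonneg _).trans (hBh 0)
  have hQi : Integrable (Function.uncurry Q) (μ.prod (μ.prod μ)) := by
    refine integrable_of_bdd_support hQm (B := (B * Bh) * (B * Bh)) (fun q => ?_)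
      (s := Metric.closedBall 0 (R + ρ) ×ˢ (Metric.closedBall 0 ρ ×ˢ Metric.closedBall 0 ρ)) ?_
      fun q hq => ?_
    · simp only [Function.uncurry, hQ, norm_mul, RCLike.norm_conj]
      gcongr <;> first | exact hB _ _ | exact hBh _
    · rw [Measure.prod_prod, Measure.prod_prod]
      exact ENNReal.mul_lt_top measure_closedBall_lt_top
        (ENNReal.mul_lt_top measure_closedBall_lt_top measure_closedBall_lt_top)
    · obtain ⟨x, y, y'⟩ := q
      simp only [Function.uncurry, hQ, ne_eq, mul_eq_zero, map_eq_zero, not_or] at hq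
      obtain ⟨⟨q1, q2⟩, q3, q4⟩ := hq
      simp only [mem_prod, mem_closedBall_zero_iff]
      refine ⟨?_, hρ _ q2, hρ _ q4⟩
      calc ‖x‖ = ‖(x - y) + y‖ := by simp
        _ ≤ _ := (norm_add_le _ _).trans (add_le_add (hR _ _ q1) (hρ _ q2))
  have hF : ∀ x, opK kk h x * (starRingEnd ℂ) (opK kk h x) = ∫ z, Q x z ∂(μ.prod μ) := fun x => by
    simp only [hQ]
    rw [integral_prod_mul (μ := μ) (ν := μ) (fun y => kk x y * h y)
      (fun y => (starRingEnd ℂ) (kk x y * h y)), integral_conj]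
    rfl
  have hswap := integral_integral_swap hQi
  have hFi : Integrable (fun x => ∫ z, Q x z ∂(μ.prod μ)) μ := hQi.integral_prod_left
  have h1 : sqn (opK kk h) = ‖∫ x, ∫ z, Q x z ∂(μ.prod μ) ∂μ‖ₑ := by
    have e : ∀ x, ∫ z, Q x z ∂(μ.prod μ) = ((‖opK kk h x‖ ^ 2 : ℝ) : ℂ) := fun x => by
      rw [← hF x, Complex.mul_conj, Complex.normSq_eq_norm_sq]
    simp_rw [e] at hFi ⊢
    have hFr : Integrable (fun x => ‖opK kk h x‖ ^ 2) μ := by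
      have := hFi.norm
      refine this.congr (ae_of_all _ fun x => ?_)
      simp
    rw [show ∫ x, ((‖opK kk h x‖ ^ 2 : ℝ) : ℂ) ∂μ = ((∫ x, ‖opK kk h x‖ ^ 2 ∂μ : ℝ) : ℂ) from
      integral_ofReal, ← ofReal_norm, Complex.norm_real, Real.norm_of_nonneg
      (integral_nonneg fun x => by positivity),
      ofReal_integral_eq_lintegral_ofReal hFr (ae_of_all _ fun x => by positivity)]
    unfold sqn
    congr 1
    ext x
    rw [ENNReal.ofReal_pow (norm_nonneg _), ofReal_norm]
  have hw1 : Measurable fun z : Rn n × Rn n => w (z.1 - z.2) :=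
    hw.comp (measurable_fst.sub measurable_snd)
  rw [h1, hswap]
  have h2 : ‖∫ z, ∫ x, Q x z ∂μ ∂(μ.prod μ)‖ₑ ≤
      ∫⁻ z, (‖h z.1‖ₑ * ‖h z.2‖ₑ) * w (z.1 - z.2) ∂(μ.prod μ) := by
    refine (enorm_integral_le_lintegral_enorm _).trans (lintegral_mono fun z => ?_)
    have : ∫ x, Q x z ∂μ = (h z.1 * (starRingEnd ℂ) (h z.2)) *
        ∫ x, kk x z.1 * (starRingEnd ℂ) (kk x z.2) ∂μ := by
      rw [← integral_const_mul]
      congr 1; ext x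
      simp only [hQ, map_mul]; ring
    rw [this, enorm_mul, enorm_mul]
    have hc : ‖(starRingEnd ℂ) (h z.2)‖ₑ = ‖h z.2‖ₑ := by
      rw [← ofReal_norm, RCLike.norm_conj, ofReal_norm]
    rw [hc]
    exact mul_le_mul_right (hkw _ _) _
  refine h2.trans ?_
  have hen : Measurable fun y => ‖h y‖ₑ ^ 2 := hm.enorm.pow_const 2
  have m1 : Measurable fun z : Rn n × Rn n => ‖h z.1‖ₑ ^ 2 * w (z.1 - z.2) :=
    (hen.comp measurable_fst).mul hw1
  have m2 : Measurable fun z : Rn n × Rn n => ‖h z.2‖ₑ ^ 2 * w (z.1 - z.2) :=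
    (hen.comp measurable_snd).mul hw1
  have h3 : 2 * ∫⁻ z, (‖h z.1‖ₑ * ‖h z.2‖ₑ) * w (z.1 - z.2) ∂(μ.prod μ) ≤
      2 * ((∫⁻ z, w z) * sqn h) := by
    calc _ ≤ ∫⁻ z, (‖h z.1‖ₑ ^ 2 * w (z.1 - z.2) + ‖h z.2‖ₑ ^ 2 * w (z.1 - z.2)) ∂(μ.prod μ) := by
          rw [← lintegral_const_mul' _ _ (by simp)]
          refine lintegral_mono fun z => ?_
          rw [← add_mul, ← mul_assoc]
          exact mul_le_mul_left (two_mul_le_sq_add_sq _ _) _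
      _ = _ := by
          rw [lintegral_add_left m1, two_mul]
          congr 1
          · rw [lintegral_prod _ m1.aemeasurable]
            have : ∀ x, ∫⁻ y, ‖h x‖ₑ ^ 2 * w (x - y) ∂μ = ‖h x‖ₑ ^ 2 * ∫⁻ z, w z := fun x => by
              rw [lintegral_const_mul' _ _ (by simp), lintegral_sub_left_eq_self w x]
            simp only [this]
            rw [lintegral_mul_const _ hen, mul_comm]
            rfl
          · rw [lintegral_prod_symm _ m2.aemeasurable]
            have : ∀ y, ∫⁻ x, ‖h y‖ₑ ^ 2 * w (x - y) ∂μ = ‖h y‖ₑ ^ 2 * ∫⁻ z, w z := fun y => by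
              rw [lintegral_const_mul' _ _ (by simp), lintegral_sub_right_eq_self w y]
            simp only [this]
            rw [lintegral_mul_const _ hen, mul_comm]
            rfl
  exact (ENNReal.mul_le_mul_iff_right (by simp) (by simp)).1 h3

/-- A quadratic bound on compactly supported functions extends to bounded functions. -/
theorem sqn_opK_of_compact {kk : Rn n → Rn n → ℂ} (hk : Measurable (Function.uncurry kk)) {R : ℝ}
    (hR : ∀ x y, kk x y ≠ 0 → ‖x - y‖ ≤ R) {Q : ℝ≥0∞}
    (H : ∀ h : Rn n → ℂ, BM h → ∀ ρ : ℝ, (∀ y, h y ≠ 0 → ‖y‖ ≤ ρ) → sqn (opK kk h) ≤ Q * sqn h)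
    {h : Rn n → ℂ} (hh : BM h) : sqn (opK kk h) ≤ Q * sqn h := by
  set hm : ℕ → Rn n → ℂ := fun m => (Metric.closedBall (0 : Rn n) m).indicator h with hhm
  have hle : ∀ m y, ‖hm m y‖ ≤ ‖h y‖ := fun m y => norm_indicator_le_norm_self _ _
  have hmeas : ∀ m, Measurable (hm m) := fun m => hh.1.indicator measurableSet_closedBall
  have h1 : ∀ m, sqn (opK kk (hm m)) ≤ Q * sqn h := fun m => by
    refine (H (hm m) ⟨hmeas m, hh.2.imp fun B hB y => (hle m y).trans (hB y)⟩ m ?_).trans ?_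
    · intro y hy
      have : y ∈ Metric.closedBall (0 : Rn n) m := by
        by_contra hc; exact hy (indicator_of_notMem hc _)
      simpa using this
    · refine mul_le_mul_right (lintegral_mono fun y => ?_) _
      have := hle m y
      gcongr
      exact enorm_le_iff_norm_le.2 this
  have h2 : ∀ x, Tendsto (fun m => ‖opK kk (hm m) x‖ₑ ^ 2) atTop (𝓝 (‖opK kk h x‖ₑ ^ 2)) := by
    intro x
    refine tendsto_const_nhds.congr' ?_
    obtain ⟨m0, hm0⟩ := exists_nat_ge (‖x‖ + R)
    filter_upwards [eventually_ge_atTop m0] with m hmm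
    have : opK kk (hm m) x = opK kk h x := by
      unfold opK
      congr 1; ext y
      by_cases hy : kk x y = 0
      · simp [hy]
      · have : y ∈ Metric.closedBall (0 : Rn n) m := by
          rw [mem_closedBall_zero_iff]
          calc ‖y‖ = ‖x - (x - y)‖ := by simp
            _ ≤ ‖x‖ + ‖x - y‖ := norm_sub_le _ _
            _ ≤ ‖x‖ + R := by gcongr; exact hR _ _ hy
            _ ≤ m0 := hm0
            _ ≤ m := by exact_mod_cast hmm
        simp [hhm, indicator_of_mem this]
    rw [this]
  calc sqn (opK kk h) = ∫⁻ x, liminf (fun m => ‖opK kk (hm m) x‖ₑ ^ 2) atTop := by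
        unfold sqn; congr 1; ext x; exact (h2 x).liminf_eq.symm
    _ ≤ liminf (fun m => ∫⁻ x, ‖opK kk (hm m) x‖ₑ ^ 2) atTop :=
        lintegral_liminf_le fun m => (measurable_opK hk (hmeas m)).enorm.pow_const 2
    _ ≤ Q * sqn h := by
        refine liminf_le_of_le (by isBoundedDefault) fun b hb => ?_
        obtain ⟨m, hm'⟩ := hb.exists
        exact hm'.trans (h1 m)

theorem schur {kk : Rn n → Rn n → ℂ} (hk : Measurable (Function.uncurry kk)) {B R : ℝ}
    (hB : ∀ x y, ‖kk x y‖ ≤ B) (hR : ∀ x y, kk x y ≠ 0 → ‖x - y‖ ≤ R) {w : Rn n → ℝ≥0∞}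
    (hw : Measurable w)
    (hkw : ∀ y y', ‖∫ x, kk x y * (starRingEnd ℂ) (kk x y')‖ₑ ≤ w (y - y'))
    {h : Rn n → ℂ} (hh : BM h) : sqn (opK kk h) ≤ (∫⁻ z, w z) * sqn h :=
  sqn_opK_of_compact hk hR (fun _ hh' _ hρ => schur_compact hk hB hR hw hkw hh' hρ) hh

end ShortVariation

namespace ShortVariation

variable {n : ℕ}

theorem SB.diff {N : ℕ} {M : ℝ} {H : Rn n → ℝ} (hH : SB (N + 1) M H) (y y' : Rn n) :
    SB N (M * ‖y - y'‖) (fun x => H (x - y) - H (x - y')) := by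
  have h1 := (hH.comp_sub y).1
  have h2 := (hH.comp_sub y').1
  refine ⟨h1.sub h2, fun i hi x => ?_⟩
  have e : iteratedFDeriv ℝ i (fun x => H (x - y) - H (x - y')) x =
      iteratedFDeriv ℝ i H (x - y) - iteratedFDeriv ℝ i H (x - y') := by
    have := iteratedFDeriv_sub_apply (x := x) (i := i) (f := fun x => H (x - y))
      (g := fun x => H (x - y'))
      (h1.of_le (m := i) (by exact_mod_cast le_top)).contDiffAt
      (h2.of_le (m := i) (by exact_mod_cast le_top)).contDiffAt
    rw [← iteratedFDeriv_comp_sub, ← iteratedFDeriv_comp_sub]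
    exact this
  rw [e]
  have hd : ∀ x ∈ (univ : Set (Rn n)), DifferentiableAt ℝ (iteratedFDeriv ℝ i H) x := fun x _ =>
    (hH.1.differentiable_iteratedFDeriv (m := i) (by exact_mod_cast WithTop.coe_lt_top _)) x
  have := convex_univ.norm_image_sub_le_of_norm_fderiv_le (𝕜 := ℝ) hd (C := M)
    (fun x _ => by rw [norm_fderiv_iteratedFDeriv]; exact hH.2 _ (by lia) x)
    (mem_univ (x - y')) (mem_univ (x - y))
  refine this.trans (le_of_eq ?_)
  rw [← norm_neg (y - y')]
  congr 2
  abel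

/-- Phases and amplitudes admissible for the single-scale estimates. -/
structure Adm (M : ℝ) (G A : Rn n → ℝ) : Prop where
  phase : SB (n + 3) M G
  ampl : SB (n + 3) M A
  supp : ∀ x, A x ≠ 0 → ‖x‖ ≤ 2
  sep : ∀ x x', A x ≠ 0 → A x' ≠ 0 → ‖x - x'‖ ^ 2 ≤ M * ∑ q, (pd q G x - pd q G x') ^ 2

theorem pd_comp_sub (q : Fin n) (H : Rn n → ℝ) (y x : Rn n) :
    pd q (fun x => H (x - y)) x = pd q H (x - y) := by
  unfold pd
  rw [fderiv_comp_sub]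

theorem pd_phase_diff {M : ℝ} {G : Rn n → ℝ} {N : ℕ} (hG : SB N M G) (c : ℝ) (y y' : Rn n)
    (q : Fin n) : pd q (fun x => c * (G (x - y) - G (x - y'))) =
      fun x => c * (pd q G (x - y) - pd q G (x - y')) := by
  ext x
  have h1 : DifferentiableAt ℝ (fun x => G (x - y)) x := (hG.comp_sub y).1.differentiable (by simp) x
  have h2 : DifferentiableAt ℝ (fun x => G (x - y')) x :=
    (hG.comp_sub y').1.differentiable (by simp) x
  rw [← pd_comp_sub, ← pd_comp_sub]
  unfold pd
  have : fderiv ℝ (fun x => c * (G (x - y) - G (x - y'))) x =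
      c • (fderiv ℝ (fun x => G (x - y)) x - fderiv ℝ (fun x => G (x - y')) x) := by
    rw [← fderiv_fun_sub h1 h2]
    exact fderiv_const_mul (h1.sub h2) c
  rw [this]
  simp

theorem min_le_japanese {C t : ℝ} (hC : 0 ≤ C) (ht : 0 < t) {v : ℝ} (N : ℕ) (h1 : v ≤ C)
    (h2 : v ≤ C / t ^ N) : v ≤ C * 2 ^ N * (1 + t) ^ (-(N : ℝ)) := by
  rw [Real.rpow_neg (by positivity), Real.rpow_natCast, ← div_eq_mul_inv, le_div_iff₀ (by positivity)]
  rcases le_total t 1 with h | h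
  · calc v * (1 + t) ^ N ≤ C * (1 + t) ^ N := by gcongr
      _ ≤ C * 2 ^ N := by gcongr; linarith
  · rw [le_div_iff₀ (by positivity)] at h2
    rcases le_total v 0 with hv | hv
    · exact (mul_nonpos_of_nonpos_of_nonneg hv (by positivity)).trans (by positivity)
    calc v * (1 + t) ^ N ≤ v * (2 * t) ^ N := by gcongr; linarith
      _ = (v * t ^ N) * 2 ^ N := by rw [mul_pow]; ring
      _ ≤ C * 2 ^ N := by gcongr

theorem lintegral_japanese {lam : ℝ} (hl : 0 < lam) :
    ∫⁻ z : Rn n, ENNReal.ofReal ((1 + lam * ‖z‖) ^ (-((n + 1 : ℕ) : ℝ))) =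
      ENNReal.ofReal ((∫ z : Rn n, (1 + ‖z‖) ^ (-((n + 1 : ℕ) : ℝ))) / lam ^ n) := by
  have hi : Integrable fun z : Rn n => (1 + ‖z‖) ^ (-((n + 1 : ℕ) : ℝ)) := by
    refine integrable_one_add_norm ?_
    rw [finrank_euclideanSpace_fin]
    push_cast; linarith
  have e : ∀ z : Rn n, (1 + lam * ‖z‖) ^ (-((n + 1 : ℕ) : ℝ)) =
      (fun z : Rn n => (1 + ‖z‖) ^ (-((n + 1 : ℕ) : ℝ))) (lam • z) := fun z => by
    simp [norm_smul, abs_of_pos hl]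
  simp_rw [e]
  rw [← ofReal_integral_eq_lintegral_ofReal]
  · congr 1
    have := Measure.integral_comp_smul (volume : Measure (Rn n))
      (fun z : Rn n => (1 + ‖z‖) ^ (-((n + 1 : ℕ) : ℝ))) lam
    rw [this, finrank_euclideanSpace_fin, abs_of_pos (by positivity), smul_eq_mul]
    ring
  · exact (integrable_comp_smul_iff (volume : Measure (Rn n)) _ hl.ne').2 hi
  · exact ae_of_all _ fun z => by simp only [Pi.zero_apply]; positivity

theorem conj_osc (lam : ℝ) (Φ : Rn n → ℝ) (x : Rn n) :
    (starRingEnd ℂ) (osc lam Φ x) = osc lam (fun x => - Φ x) x := by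
  unfold osc
  rw [← Complex.exp_conj]
  simp

/-- Kernel with oscillation of a convolution phase and a general real amplitude. -/
def oscKer (lam : ℝ) (G : Rn n → ℝ) (b : Rn n → Rn n → ℝ) (x y : Rn n) : ℂ :=
  osc lam G (x - y) * (b x y : ℂ)

theorem measurable_oscKer (lam : ℝ) {G : Rn n → ℝ} (hG : ContDiff ℝ (⊤ : ℕ∞) G)
    {b : Rn n → Rn n → ℝ} (hb : Measurable (Function.uncurry b)) :
    Measurable (Function.uncurry (oscKer lam G b)) := by
  have h1 : Measurable fun q : Rn n × Rn n => osc lam G (q.1 - q.2) :=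
    (continuous_osc lam hG).measurable.comp (measurable_fst.sub measurable_snd)
  exact h1.mul (Complex.continuous_ofReal.measurable.comp hb)

theorem l2_bound (n : ℕ) (M : ℝ) : ∃ C : ℝ, 0 ≤ C ∧ ∀ (G A : Rn n → ℝ) (b : Rn n → Rn n → ℝ)
    (lam : ℝ), Adm M G A → 0 < lam → Measurable (Function.uncurry b) →
    (∀ y, SB (n + 1) M (fun x => b x y)) → (∀ x y, b x y ≠ 0 → A (x - y) ≠ 0) →
    ∀ h, BM h → sqn (opK (oscKer lam G b) h) ≤ ENNReal.ofReal (C / lam ^ n) * sqn h := by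
  set M1 : ℝ := max M (2 ^ (n + 1) * M * M) with hM1
  obtain ⟨C1, hC1, hC⟩ := nonstationary_phase n (n + 1) M1 2
  obtain ⟨C0, hC0, hC'⟩ := nonstationary_phase n 0 M1 2
  set C2 : ℝ := max C1 (M ^ 2 * volume.real (Metric.closedBall (0 : Rn n) 2)) with hC2
  have hC20 : 0 ≤ C2 := hC1.trans (le_max_left _ _)
  set J : ℝ := ∫ z : Rn n, (1 + ‖z‖) ^ (-((n + 1 : ℕ) : ℝ)) with hJ
  have hJ0 : 0 ≤ J := integral_nonneg fun z => by positivity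
  refine ⟨C2 * 2 ^ (n + 1) * J, by positivity, fun G A b lam hA hl hbm hb hbA h hh => ?_⟩
  have hM : 0 ≤ M := (hb 0).nonneg
  have hsupp : ∀ x y, b x y ≠ 0 → ‖x - y‖ ≤ 2 := fun x y h => hA.supp _ (hbA x y h)
  set w : Rn n → ℝ≥0∞ := fun z =>
    ENNReal.ofReal (C2 * 2 ^ (n + 1) * (1 + lam * ‖z‖) ^ (-((n + 1 : ℕ) : ℝ))) with hw
  have key := schur (kk := oscKer lam G b) (measurable_oscKer lam hA.phase.1 hbm) (B := M) (R := 2)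
    (fun x y => ?_) (fun x y hxy => hsupp x y fun h0 => hxy (by simp [oscKer, h0])) (w := w)
    (by fun_prop) (fun y y' => ?_) hh
  · refine key.trans (mul_le_mul_left (le_of_eq ?_) _)
    simp only [hw]
    have : ∀ z : Rn n, ENNReal.ofReal (C2 * 2 ^ (n + 1) * (1 + lam * ‖z‖) ^ (-((n + 1 : ℕ) : ℝ))) =
      ENNReal.ofReal (C2 * 2 ^ (n + 1)) * ENNReal.ofReal ((1 + lam * ‖z‖) ^ (-((n + 1 : ℕ) : ℝ))) :=
      fun z => ENNReal.ofReal_mul (by positivity)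
    simp_rw [this]
    rw [lintegral_const_mul' _ _ (by simp), lintegral_japanese hl, ← ENNReal.ofReal_mul (by positivity),
      mul_div_assoc]
  · rw [oscKer, norm_mul, norm_osc, one_mul, Complex.norm_real]
    exact (hb y).abs_le x
  · have e : ∀ x, oscKer lam G b x y * (starRingEnd ℂ) (oscKer lam G b x y') =
        osc lam (fun x => G (x - y) - G (x - y')) x * ((b x y * b x y' : ℝ) : ℂ) := fun x => by
      have : osc lam (fun x => G (x - y) - G (x - y')) x =
          osc lam G (x - y) * (starRingEnd ℂ) (osc lam G (x - y')) := by
        rw [conj_osc]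
        unfold osc
        rw [← Complex.exp_add]
        congr 1
        push_cast; ring
      rw [this]
      simp only [oscKer, map_mul, Complex.conj_ofReal]
      push_cast; ring
    simp_rw [e]
    rw [← ofReal_norm]
    refine ENNReal.ofReal_le_ofReal ?_
    have hbound : ‖∫ x, osc lam (fun x => G (x - y) - G (x - y')) x * ((b x y * b x y' : ℝ) : ℂ)‖ ≤
        C2 := by
      refine le_trans ?_ (le_max_right _ _)
      have hz : ∀ x, x ∉ Metric.closedBall y 2 →
          osc lam (fun x => G (x - y) - G (x - y')) x * ((b x y * b x y' : ℝ) : ℂ) = 0 := by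
        intro x hx
        have : b x y = 0 := by
          by_contra h0
          exact hx (mem_closedBall_iff_norm.2 (hsupp x y h0))
        simp [this]
      rw [← setIntegral_eq_integral_of_forall_compl_eq_zero hz]
      have hV' : volume.real (Metric.closedBall (0 : Rn n) 2) =
          volume.real (Metric.closedBall y 2) := by
        rw [Measure.real, Measure.real, ← Measure.addHaar_closedBall_center volume y]
      rw [hV']
      refine norm_setIntegral_le_of_norm_le_const measure_closedBall_lt_top fun x _ => ?_
      rw [norm_mul, norm_osc, one_mul, Complex.norm_real, norm_mul, pow_two]
      exact mul_le_mul ((hb y).abs_le x) ((hb y').abs_le x) (norm_nonneg _) hM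
    rcases eq_or_ne y y' with rfl | hyy
    · simp only [sub_self, norm_zero, mul_zero, add_zero, Real.one_rpow, mul_one]
      simp only [sub_self] at hbound
      refine hbound.trans (le_mul_of_one_le_right hC20 (one_le_pow₀ (by norm_num)))
    have hδ : 0 < ‖y - y'‖ := norm_pos_iff.2 (sub_ne_zero.2 hyy)
    set δ := ‖y - y'‖ with hδdef
    refine min_le_japanese hC20 (by positivity) (n + 1) hbound ?_
    have e2 : osc lam (fun x => G (x - y) - G (x - y')) =
        osc (lam * δ) (fun x => δ⁻¹ * (G (x - y) - G (x - y'))) := by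
      ext x
      unfold osc
      congr 3
      field_simp
    rw [e2]
    refine (hC _ _ y (lam * δ) (by positivity) ?_ (fun q => ?_) ?_ (fun x hx => ?_)
      fun x hx => ?_).trans ?_
    · exact contDiff_const.mul ((hA.phase.comp_sub y).1.sub (hA.phase.comp_sub y').1)
    · rw [pd_phase_diff hA.phase]
      refine (((hA.phase.pd q).diff y y').const_mul δ⁻¹).mono le_rfl ?_
      rw [abs_of_pos (by positivity), ← hδdef]
      refine le_trans (le_of_eq ?_) (le_max_left _ _)
      field_simp
    · exact ((hb y).mul (hb y')).mono le_rfl (le_max_right _ _)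
    · exact hsupp x y (left_ne_zero_of_mul hx)
    · have := hA.sep (x - y) (x - y') (hbA _ _ (left_ne_zero_of_mul hx))
        (hbA _ _ (right_ne_zero_of_mul hx))
      simp_rw [fun q => congrFun (pd_phase_diff hA.phase δ⁻¹ y y' q) x, mul_pow, ← Finset.mul_sum]
      set S := ∑ q, (pd q G (x - y) - pd q G (x - y')) ^ 2 with hS
      have hS0 : 0 ≤ S := Finset.sum_nonneg fun _ _ => sq_nonneg _
      have e3 : ‖x - y - (x - y')‖ = δ := by
        rw [hδdef, ← norm_neg]; congr 1; abel
      rw [e3] at this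
      have h4 : δ ^ 2 ≤ M1 * S := this.trans (mul_le_mul_of_nonneg_right (le_max_left _ _) hS0)
      rw [inv_pow, ← mul_assoc, mul_comm M1, mul_assoc, inv_mul_eq_div, le_div_iff₀ (by positivity)]
      linarith
    · gcongr
      exact le_max_left _ _

end ShortVariation

namespace ShortVariation

variable {n : ℕ}

/-- The index of the dyadic cell of side `2 ^ s` containing `x`. -/
def cell (s : ℤ) (x : Rn n) : Fin n → ℤ := fun a => ⌊x a / (2 : ℝ) ^ s⌋

/-- The lower corner of the dyadic cell of side `2 ^ s` and index `v`. -/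
def corner (s : ℤ) (v : Fin n → ℤ) : Rn n := WithLp.toLp 2 fun a => (2 : ℝ) ^ s * v a

/-- The dyadic cell of side `2 ^ s` and index `v`. -/
def cube (s : ℤ) (v : Fin n → ℤ) : Set (Rn n) := {y | cell s y = v}

theorem measurable_cell (s : ℤ) : Measurable (cell (n := n) s) := by
  refine measurable_pi_lambda _ fun a => ?_
  have : Measurable fun x : Rn n => x a := by fun_prop
  exact Int.measurable_floor.comp (this.div_const _)

theorem measurableSet_cube (s : ℤ) (v : Fin n → ℤ) : MeasurableSet (cube s v) :=
  measurable_cell s (measurableSet_singleton v)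

theorem mem_cube {s : ℤ} {v : Fin n → ℤ} {y : Rn n} : y ∈ cube s v ↔ cell s y = v := Iff.rfl

theorem cube_eq (s : ℤ) (v : Fin n → ℤ) : cube s v =
    (MeasurableEquiv.toLp 2 (Fin n → ℝ)).symm ⁻¹'
      Set.pi univ fun a => Ico ((2 : ℝ) ^ s * v a) ((2 : ℝ) ^ s * (v a + 1)) := by
  have h2 : (0 : ℝ) < (2 : ℝ) ^ s := by positivity
  ext y
  simp only [mem_cube, cell, funext_iff, Int.floor_eq_iff, mem_preimage, Set.mem_pi, mem_univ,
    true_implies, mem_Ico]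
  refine forall_congr' fun a => ?_
  have : (MeasurableEquiv.toLp 2 (Fin n → ℝ)).symm y a = y a := rfl
  rw [this, le_div_iff₀ h2, div_lt_iff₀ h2, mul_comm, mul_comm ((v a : ℝ) + 1)]

theorem volume_cube (s : ℤ) (v : Fin n → ℤ) :
    volume (cube s v) = ENNReal.ofReal ((2 : ℝ) ^ s) ^ n := by
  rw [cube_eq, (EuclideanSpace.volume_preserving_symm_measurableEquiv_toLp (Fin n)).measure_preimage
    (MeasurableSet.univ_pi fun a => measurableSet_Ico).nullMeasurableSet, Real.volume_pi_Ico]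
  have : ∀ a, (2 : ℝ) ^ s * (v a + 1) - 2 ^ s * v a = 2 ^ s := fun a => by ring
  simp [this]

theorem norm_sub_corner_le {s : ℤ} {v : Fin n → ℤ} {y : Rn n} (hy : y ∈ cube s v) :
    ‖y - corner s v‖ ≤ n * (2 : ℝ) ^ s := by
  have h2 : (0 : ℝ) < (2 : ℝ) ^ s := by positivity
  rw [EuclideanSpace.norm_eq]
  have h : ∀ a, ‖(y - corner s v) a‖ ^ 2 ≤ ((2 : ℝ) ^ s) ^ 2 := fun a => by
    have := congrFun hy a
    rw [cell, Int.floor_eq_iff, le_div_iff₀ h2, div_lt_iff₀ h2] at this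
    have e : (y - corner s v) a = y a - 2 ^ s * v a := rfl
    rw [e, Real.norm_eq_abs, sq_abs]
    nlinarith
  calc √(∑ a, ‖(y - corner s v) a‖ ^ 2) ≤ √(∑ _a : Fin n, ((2 : ℝ) ^ s) ^ 2) :=
        Real.sqrt_le_sqrt (Finset.sum_le_sum fun a _ => h a)
    _ ≤ n * (2 : ℝ) ^ s := by
        rw [Finset.sum_const, Finset.card_univ, Fintype.card_fin, nsmul_eq_mul]
        refine Real.sqrt_le_iff.2 ⟨by positivity, ?_⟩
        rw [mul_pow]
        gcongr
        exact_mod_cast Nat.le_self_pow two_ne_zero n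

theorem cell_eq_of_le {s s' : ℤ} (h : s ≤ s') {x y : Rn n} (hxy : cell s x = cell s y) :
    cell s' x = cell s' y := by
  obtain ⟨k, rfl⟩ := Int.le.dest h
  ext a
  have e : ∀ z : Rn n, cell (s + k) z a = ⌊z a / (2 : ℝ) ^ s⌋ / ((2 ^ k : ℕ) : ℤ) := fun z => by
    rw [← Int.floor_div_natCast, cell, zpow_add₀ (by norm_num), ← div_div]
    norm_cast
  rw [e, e]
  have := congrFun hxy a
  simp only [cell] at this
  rw [this]

theorem cell_smul (s k : ℤ) (y : Rn n) : cell s ((2 : ℝ) ^ k • y) = cell (s - k) y := by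
  ext a
  simp only [cell, PiLp.smul_apply, smul_eq_mul]
  congr 1
  rw [zpow_sub₀ (by norm_num)]
  field_simp

/-- `h` has vanishing mean on all dyadic cells of side `2 ^ s`. -/
def MZ (s : ℤ) (h : Rn n → ℂ) : Prop := ∀ v, ∫ y in cube s v, h y = 0

theorem iUnion_cube (s : ℤ) : ⋃ v, cube (n := n) s v = univ :=
  eq_univ_of_forall fun y => mem_iUnion.2 ⟨cell s y, rfl⟩

theorem pairwise_disjoint_cube (s : ℤ) : Pairwise (Function.onFun Disjoint (cube (n := n) s)) := by
  intro v w hvw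
  refine Set.disjoint_left.2 fun y hy hy' => hvw ?_
  exact hy.symm.trans hy'

theorem integral_eq_tsum_cube (s : ℤ) {F : Rn n → ℂ} (hF : Integrable F) :
    HasSum (fun v => ∫ y in cube s v, F y) (∫ y, F y) := by
  have := hasSum_integral_iUnion (f := F) (μ := volume) (measurableSet_cube (n := n) s)
    (pairwise_disjoint_cube s) (by rw [iUnion_cube]; exact hF.integrableOn)
  rwa [iUnion_cube, setIntegral_univ] at this

theorem lintegral_eq_tsum_cube (s : ℤ) (F : Rn n → ℝ≥0∞) :
    ∫⁻ y, F y = ∑' v, ∫⁻ y in cube s v, F y := by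
  rw [← lintegral_iUnion (measurableSet_cube s) (pairwise_disjoint_cube s), iUnion_cube,
    setLIntegral_univ]

theorem integral_cell_mul_eq_zero {s : ℤ} {h : Rn n → ℂ} (hz : MZ s h) (φ : (Fin n → ℤ) → ℂ)
    (hi : Integrable fun y => φ (cell s y) * h y) : ∫ y, φ (cell s y) * h y = 0 := by
  have := integral_eq_tsum_cube s hi
  have h0 : ∀ v, ∫ y in cube s v, φ (cell s y) * h y = 0 := fun v => by
    rw [setIntegral_congr_fun (g := fun y => φ v * h y) (measurableSet_cube s v)]
    · rw [integral_const_mul, hz v, mul_zero]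
    · intro y hy
      simp only [mem_cube.1 hy]
  simp_rw [h0] at this
  exact this.unique hasSum_zero

theorem sobolev_sup {g g' : ℝ → ℂ} (hg : ∀ u, HasDerivAt g (g' u) u) (hc : Continuous g')
    {B : ℝ} (hB : 1 ≤ B) {u : ℝ} (hu : u ∈ Icc (1 / 2 : ℝ) 4) :
    ‖g u‖ₑ ^ 2 ≤ 2 * (ENNReal.ofReal B * (∫⁻ v in Icc (1 / 2 : ℝ) 4, ‖g v‖ₑ ^ 2) +
      ENNReal.ofReal B⁻¹ * ∫⁻ v in Icc (1 / 2 : ℝ) 4, ‖g' v‖ₑ ^ 2) := by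
  have hgc : Continuous g := continuous_iff_continuousAt.2 fun v => (hg v).continuousAt
  set I := Icc (1 / 2 : ℝ) 4 with hI
  have hB0 : 0 < B := by linarith
  have conv : ∀ {φ : ℝ → ℂ}, Continuous φ →
      ∫⁻ v in I, ‖φ v‖ₑ ^ 2 = ENNReal.ofReal (∫ v in I, ‖φ v‖ ^ 2) := fun {φ} hφ => by
    rw [ofReal_integral_eq_lintegral_ofReal]
    · refine lintegral_congr fun v => ?_
      rw [ENNReal.ofReal_pow (norm_nonneg _), ofReal_norm]
    · exact (hφ.norm.pow 2).continuousOn.integrableOn_compact isCompact_Icc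
    · exact ae_of_all _ fun v => by simp only [Pi.zero_apply]; positivity
  have hInt : ∀ {φ : ℝ → ℂ}, Continuous φ → IntegrableOn (fun v => ‖φ v‖ ^ 2) I := fun hφ =>
    (hφ.norm.pow 2).continuousOn.integrableOn_compact isCompact_Icc
  obtain ⟨v, hv, hmin⟩ := isCompact_Icc.exists_isMinOn (s := I) ⟨u, hu⟩
    (hgc.norm.pow 2).continuousOn
  have hvol : volume.real I = 7 / 2 := by
    rw [hI, Real.volume_real_Icc_of_le (by norm_num)]; norm_num
  have h1 : ‖g v‖ ^ 2 * (7 / 2) ≤ ∫ w in I, ‖g w‖ ^ 2 := by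
    have : ∫ _w in I, ‖g v‖ ^ 2 = ‖g v‖ ^ 2 * (7 / 2) := by
      rw [setIntegral_const, hvol, smul_eq_mul, mul_comm]
    rw [← this]
    refine setIntegral_mono_on (by simp [hI]) (hInt hgc) measurableSet_Icc fun w hw => ?_
    exact hmin hw
  set k : ℝ → ℝ := fun w => 2 * (g w * (starRingEnd ℂ) (g' w)).re with hk
  have hkc : Continuous k := by fun_prop
  have hkd : ∀ w, HasDerivAt (fun w => ‖g w‖ ^ 2) (k w) w := fun w => by
    have := (hg w).norm_sq
    convert this using 1
    simp only [hk, Complex.inner]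
    simp; ring
  have hk2 : ∀ w, |k w| ≤ B * ‖g w‖ ^ 2 + B⁻¹ * ‖g' w‖ ^ 2 := fun w => by
    have : |k w| ≤ 2 * (‖g w‖ * ‖g' w‖) := by
      rw [hk, abs_mul, abs_two]
      have := Complex.abs_re_le_norm (g w * (starRingEnd ℂ) (g' w))
      rw [norm_mul, RCLike.norm_conj] at this
      linarith
    refine this.trans ?_
    have h3 : 0 ≤ B⁻¹ * (B * ‖g w‖ - ‖g' w‖) ^ 2 := by positivity
    have h4 : B⁻¹ * (B * ‖g w‖ - ‖g' w‖) ^ 2 =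
        B * ‖g w‖ ^ 2 + B⁻¹ * ‖g' w‖ ^ 2 - 2 * (‖g w‖ * ‖g' w‖) := by field_simp; ring
    linarith
  have h2 : ‖g u‖ ^ 2 - ‖g v‖ ^ 2 ≤ ∫ w in I, (B * ‖g w‖ ^ 2 + B⁻¹ * ‖g' w‖ ^ 2) := by
    rw [← intervalIntegral.integral_eq_sub_of_hasDerivAt (fun w _ => hkd w)
      (hkc.intervalIntegrable _ _)]
    refine (le_abs_self _).trans ?_
    rw [← Real.norm_eq_abs]
    refine intervalIntegral.norm_integral_le_integral_norm_uIoc.trans ?_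
    have hsub : uIoc v u ⊆ I := by
      refine uIoc_subset_uIcc.trans ?_
      exact uIcc_subset_Icc hv hu
    have hi2 : IntegrableOn (fun w => B * ‖g w‖ ^ 2 + B⁻¹ * ‖g' w‖ ^ 2) I :=
      ((hInt hgc).const_mul B).add ((hInt hc).const_mul B⁻¹)
    calc _ ≤ ∫ w in uIoc v u, (B * ‖g w‖ ^ 2 + B⁻¹ * ‖g' w‖ ^ 2) := by
          refine setIntegral_mono_on ?_ (hi2.mono_set hsub) measurableSet_uIoc fun w _ => hk2 w
          exact (hkc.norm.continuousOn.integrableOn_compact isCompact_Icc).mono_set hsub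
      _ ≤ _ := setIntegral_mono_set hi2 (ae_of_all _ fun w => by
          simp only [Pi.zero_apply]; positivity) hsub.eventuallyLE
  rw [integral_add ((hInt hgc).const_mul B) ((hInt hc).const_mul B⁻¹), integral_const_mul,
    integral_const_mul] at h2
  rw [conv hgc, conv hc, ← ENNReal.ofReal_mul hB0.le, ← ENNReal.ofReal_mul (by positivity),
    ← ENNReal.ofReal_add (by positivity) (by positivity), ← ofReal_norm,
    ← ENNReal.ofReal_pow (norm_nonneg _), ← ENNReal.ofReal_ofNat, ← ENNReal.ofReal_mul (by norm_num)]
  refine ENNReal.ofReal_le_ofReal ?_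
  set X := ∫ w in I, ‖g w‖ ^ 2
  set Y := ∫ w in I, ‖g' w‖ ^ 2 with hY
  have hX0 : 0 ≤ X := integral_nonneg fun w => by positivity
  have hY0 : 0 ≤ B⁻¹ * Y := mul_nonneg (by positivity) (integral_nonneg fun w => by positivity)
  have : X ≤ B * X := le_mul_of_one_le_left hX0 hB
  nlinarith

end ShortVariation

namespace ShortVariation

variable {n : ℕ}

/-- The convolution operator with kernel `osc lam G * A`. -/
def cv (lam : ℝ) (G A : Rn n → ℝ) (h : Rn n → ℂ) : Rn n → ℂ :=
  opK (oscKer lam G fun x y => A (x - y)) h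

theorem Adm.mono {M M' : ℝ} {G A : Rn n → ℝ} (h : Adm M G A) (hM : M ≤ M') : Adm M' G A where
  phase := h.phase.mono le_rfl hM
  ampl := h.ampl.mono le_rfl hM
  supp := h.supp
  sep x x' hx hx' := (h.sep x x' hx hx').trans
    (mul_le_mul_of_nonneg_right hM (Finset.sum_nonneg fun _ _ => sq_nonneg _))

theorem SB.sub_le {N : ℕ} {M : ℝ} {H : Rn n → ℝ} (hH : SB (N + 1) M H) (x y : Rn n) :
    |H x - H y| ≤ M * ‖x - y‖ := by
  have := (hH.diff 0 (x - y)).abs_le x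
  simpa [norm_sub_rev] using this

theorem osc_sub_le (lam : ℝ) {N : ℕ} {M : ℝ} {G : Rn n → ℝ} (hG : SB (N + 1) M G) (x y : Rn n) :
    ‖osc lam G x - osc lam G y‖ ≤ |lam| * M * ‖x - y‖ := by
  have e : osc lam G x - osc lam G y =
      osc lam G y * (Complex.exp (Complex.I * ((lam * (G x - G y) : ℝ) : ℂ)) - 1) := by
    rw [mul_sub, mul_one, osc, osc, ← Complex.exp_add]
    congr 2
    push_cast; ring
  rw [e, norm_mul, norm_osc, one_mul]
  refine (Real.norm_exp_I_mul_ofReal_sub_one_le).trans ?_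
  rw [norm_mul, Real.norm_eq_abs, Real.norm_eq_abs, mul_assoc]
  exact mul_le_mul_of_nonneg_left (hG.sub_le x y) (abs_nonneg _)

theorem ker_sub_le {M lam : ℝ} {G A : Rn n → ℝ} (h : Adm M G A) (hl : 1 ≤ 2 * lam) (x y : Rn n) :
    ‖osc lam G x * (A x : ℂ) - osc lam G y * (A y : ℂ)‖ ≤ (M ^ 2 + 2 * M) * lam * ‖x - y‖ := by
  have hM := h.phase.nonneg
  have hl0 : 0 < lam := by linarith
  have e : osc lam G x * (A x : ℂ) - osc lam G y * (A y : ℂ) =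
      (osc lam G x - osc lam G y) * (A x : ℂ) + osc lam G y * ((A x - A y : ℝ) : ℂ) := by
    push_cast; ring
  rw [e]
  refine (norm_add_le _ _).trans ?_
  rw [norm_mul, norm_mul, norm_osc, one_mul, Complex.norm_real, Complex.norm_real,
    Real.norm_eq_abs, Real.norm_eq_abs]
  have h1 := osc_sub_le lam h.phase x y
  have h2 := h.ampl.abs_le x
  have h3 := h.ampl.sub_le x y
  rw [abs_of_nonneg (by linarith : 0 ≤ lam)] at h1
  have h4 : ‖osc lam G x - osc lam G y‖ * |A x| ≤ lam * M * ‖x - y‖ * M :=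
    mul_le_mul h1 h2 (abs_nonneg _) (by positivity)
  have h5 : M * ‖x - y‖ ≤ M * ‖x - y‖ * (2 * lam) := le_mul_of_one_le_right (by positivity) hl
  nlinarith

theorem Adm.measurable_ampl {M : ℝ} {G A : Rn n → ℝ} (h : Adm M G A) :
    Measurable (Function.uncurry fun x y => A (x - y)) :=
  h.ampl.1.continuous.measurable.comp (measurable_fst.sub measurable_snd)

theorem measurable_cv {M lam : ℝ} {G A : Rn n → ℝ} (h : Adm M G A) {f : Rn n → ℂ}
    (hf : Measurable f) : Measurable (cv lam G A f) :=
  measurable_opK (measurable_oscKer lam h.phase.1 h.measurable_ampl) hf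

theorem integrable_oscKer_mul {lam B R : ℝ} {G : Rn n → ℝ} (hG : ContDiff ℝ (⊤ : ℕ∞) G)
    {b : Rn n → Rn n → ℝ} (hb : Measurable (Function.uncurry b)) (hB : ∀ x y, |b x y| ≤ B)
    (hR : ∀ x y, b x y ≠ 0 → ‖x - y‖ ≤ R) {h : Rn n → ℂ} (hh : BM h) (x : Rn n) :
    Integrable fun y => oscKer lam G b x y * h y := by
  obtain ⟨hm, B', hB'⟩ := hh
  refine integrable_of_bdd_support (B := B * B') (s := Metric.closedBall x R) ?_ ?_
    measure_closedBall_lt_top ?_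
  · exact ((measurable_oscKer lam hG hb).comp measurable_prodMk_left).mul hm
  · intro y
    rw [norm_mul, oscKer, norm_mul, norm_osc, one_mul, Complex.norm_real, Real.norm_eq_abs]
    exact mul_le_mul (hB x y) (hB' y) (norm_nonneg _) ((abs_nonneg _).trans (hB x y))
  · intro y hy
    rw [Metric.mem_closedBall, dist_comm, dist_eq_norm]
    refine hR x y fun h0 => hy ?_
    simp [oscKer, h0]

theorem Adm.integrable {M lam : ℝ} {G A : Rn n → ℝ} (h : Adm M G A) {f : Rn n → ℂ} (hf : BM f)
    (x : Rn n) : Integrable fun y => oscKer lam G (fun x y => A (x - y)) x y * f y :=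
  integrable_oscKer_mul h.phase.1 h.measurable_ampl (fun _ _ => h.ampl.abs_le _)
    (fun _ _ h0 => h.supp _ h0) hf x

theorem enorm_cv_le {M lam : ℝ} {G A : Rn n → ℝ} (h : Adm M G A) (f : Rn n → ℂ) (x : Rn n) :
    ‖cv lam G A f x‖ₑ ≤ ENNReal.ofReal M * ∫⁻ y in Metric.closedBall x 2, ‖f y‖ₑ := by
  rw [← lintegral_const_mul' _ _ ENNReal.ofReal_ne_top,
    ← lintegral_indicator Metric.isClosed_closedBall.measurableSet]
  refine (enorm_integral_le_lintegral_enorm _).trans (lintegral_mono fun y => ?_)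
  by_cases hy : A (x - y) = 0
  · simp [oscKer, hy]
  · have := h.supp _ hy
    rw [indicator_of_mem (by rwa [Metric.mem_closedBall, dist_comm, dist_eq_norm]), enorm_mul]
    refine mul_le_mul_left ?_ _
    rw [← ofReal_norm]
    refine ENNReal.ofReal_le_ofReal ?_
    rw [oscKer, norm_mul, norm_osc, one_mul, Complex.norm_real, Real.norm_eq_abs]
    exact h.ampl.abs_le _

/-- Cancellation on small cells. -/
theorem enorm_cv_le_of_MZ {M lam : ℝ} {G A : Rn n → ℝ} (h : Adm M G A) (hl : 1 ≤ 2 * lam) {s : ℤ}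
    (hs : s ≤ 0) {f : Rn n → ℂ} (hf : BM f) (hz : MZ s f) (x : Rn n) :
    ‖cv lam G A f x‖ₑ ≤ ENNReal.ofReal ((M ^ 2 + 2 * M) * n * lam * 2 ^ s) *
      ∫⁻ y in Metric.closedBall x (n + 2), ‖f y‖ₑ := by
  have hM := h.phase.nonneg
  have hl0 : 0 < lam := by linarith
  have h2s : (2 : ℝ) ^ s ≤ 1 := zpow_le_one_of_nonpos₀ (by norm_num) hs
  set kk : Rn n → ℂ := fun t => osc lam G t * (A t : ℂ) with hkk
  set cc : Rn n → Rn n := fun y => corner s (cell s y) with hcc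
  have hy : ∀ y, ‖y - cc y‖ ≤ n * (2 : ℝ) ^ s := fun y => norm_sub_corner_le rfl
  have hmc : Measurable cc := (measurable_of_countable (corner s)).comp (measurable_cell s)
  have hkc : Continuous kk := (continuous_osc lam h.phase.1).mul
    (Complex.continuous_ofReal.comp h.ampl.1.continuous)
  have hkM : ∀ t, ‖kk t‖ ≤ M := fun t => by
    rw [hkk, norm_mul, norm_osc, one_mul, Complex.norm_real]; exact h.ampl.abs_le _
  have hi : Integrable fun y => kk (x - cc y) * f y := by
    obtain ⟨hm, B', hB'⟩ := hf
    refine integrable_of_bdd_support (B := M * B') (s := Metric.closedBall x (n + 2)) ?_ ?_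
      measure_closedBall_lt_top ?_
    · exact (hkc.measurable.comp (measurable_const.sub hmc)).mul hm
    · intro y
      rw [norm_mul]
      exact mul_le_mul (hkM _) (hB' y) (norm_nonneg _) hM
    · intro y h0
      have h1 : ‖x - cc y‖ ≤ 2 := h.supp _ fun h0' => h0 (by simp [hkk, h0'])
      rw [Metric.mem_closedBall, dist_eq_norm]
      calc ‖y - x‖ = ‖(y - cc y) - (x - cc y)‖ := by congr 1; abel
        _ ≤ n * (2 : ℝ) ^ s + 2 := (norm_sub_le _ _).trans (add_le_add (hy y) h1)
        _ ≤ n + 2 := by nlinarith [(Nat.cast_nonneg n : (0 : ℝ) ≤ n)]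
  have h0 : ∫ y, kk (x - cc y) * f y = 0 :=
    integral_cell_mul_eq_zero hz (fun v => kk (x - corner s v)) hi
  have e : cv lam G A f x = ∫ y, (kk (x - y) - kk (x - cc y)) * f y := by
    have h1 : cv lam G A f x = (∫ y, kk (x - y) * f y) - ∫ y, kk (x - cc y) * f y := by
      rw [h0, sub_zero]; rfl
    have hI : Integrable fun y => kk (x - y) * f y := h.integrable hf x
    rw [h1, ← integral_sub hI hi]
    congr 1; ext y; ring
  rw [e, ← lintegral_const_mul' _ _ ENNReal.ofReal_ne_top,
    ← lintegral_indicator Metric.isClosed_closedBall.measurableSet]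
  refine (enorm_integral_le_lintegral_enorm _).trans (lintegral_mono fun y => ?_)
  by_cases hb : y ∈ Metric.closedBall x (n + 2)
  · rw [indicator_of_mem hb, enorm_mul]
    refine mul_le_mul_left ?_ _
    rw [← ofReal_norm]
    refine ENNReal.ofReal_le_ofReal ((ker_sub_le h hl _ _).trans ?_)
    have e2 : ‖x - y - (x - cc y)‖ = ‖y - cc y‖ := by rw [← norm_neg]; congr 1; abel
    rw [e2]
    calc _ ≤ (M ^ 2 + 2 * M) * lam * (n * (2 : ℝ) ^ s) :=
          mul_le_mul_of_nonneg_left (hy y) (by positivity)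
      _ = _ := by ring
  · rw [Metric.mem_closedBall, dist_eq_norm, not_le] at hb
    have hn0 : (0 : ℝ) ≤ n := Nat.cast_nonneg n
    have z1 : kk (x - y) = 0 := by
      by_contra h0
      have : ‖x - y‖ ≤ 2 := h.supp _ fun h0' => h0 (by simp [hkk, h0'])
      rw [norm_sub_rev] at this
      linarith
    have z2 : kk (x - cc y) = 0 := by
      by_contra h0
      have : ‖x - cc y‖ ≤ 2 := h.supp _ fun h0' => h0 (by simp [hkk, h0'])
      have h3 : ‖y - x‖ ≤ ‖y - cc y‖ + ‖x - cc y‖ := by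
        calc ‖y - x‖ = ‖(y - cc y) - (x - cc y)‖ := by congr 1; abel
          _ ≤ _ := norm_sub_le _ _
      nlinarith [hy y]
    simp [z1, z2]

theorem ball_average_eq (R : ℝ) (φ : Rn n → ℝ≥0∞) (x : Rn n) :
    ∫⁻ y in Metric.closedBall x R, φ y =
      ∫⁻ y, {q : Rn n × Rn n | dist q.2 q.1 ≤ R}.indicator (fun q => φ q.2) (x, y) := by
  rw [← lintegral_indicator Metric.isClosed_closedBall.measurableSet]
  rfl

theorem measurable_ball_average_aux (R : ℝ) {φ : Rn n → ℝ≥0∞} (hφ : Measurable φ) :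
    Measurable ({q : Rn n × Rn n | dist q.2 q.1 ≤ R}.indicator fun q => φ q.2) :=
  (hφ.comp measurable_snd).indicator (measurableSet_le (by fun_prop) (by fun_prop))

theorem measurable_ball_average (R : ℝ) {φ : Rn n → ℝ≥0∞} (hφ : Measurable φ) :
    Measurable fun x => ∫⁻ y in Metric.closedBall x R, φ y := by
  simp_rw [ball_average_eq]
  exact (measurable_ball_average_aux R hφ).lintegral_prod_right'

/-- Tonelli for averages over balls. -/
theorem lintegral_ball_average (R : ℝ) {φ : Rn n → ℝ≥0∞} (hφ : Measurable φ) :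
    ∫⁻ x, ∫⁻ y in Metric.closedBall x R, φ y =
      volume (Metric.closedBall (0 : Rn n) R) * ∫⁻ y, φ y := by
  have hm := measurable_ball_average_aux R hφ
  simp_rw [ball_average_eq]
  rw [lintegral_lintegral_swap (f := fun x y =>
    {q : Rn n × Rn n | dist q.2 q.1 ≤ R}.indicator (fun q => φ q.2) (x, y))
    (Measurable.aemeasurable (by exact hm)), ← lintegral_const_mul _ hφ]
  refine lintegral_congr fun y => ?_
  have e2 : ∀ x, {q : Rn n × Rn n | dist q.2 q.1 ≤ R}.indicator (fun q => φ q.2) (x, y) =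
      (Metric.closedBall y R).indicator (fun _ => φ y) x := fun x => by
    simp only [indicator, mem_ofPred_eq, Metric.mem_closedBall, dist_comm x y]
  simp_rw [e2]
  rw [lintegral_indicator Metric.isClosed_closedBall.measurableSet, setLIntegral_const, mul_comm,
    Measure.addHaar_closedBall_center]

theorem sq_setLIntegral_le {α : Type*} [MeasurableSpace α] (μ : Measure α) {φ : α → ℝ≥0∞}
    (hφ : AEMeasurable φ μ) : (∫⁻ y, φ y ∂μ) ^ 2 ≤ μ univ * ∫⁻ y, φ y ^ 2 ∂μ := by
  have := ENNReal.lintegral_mul_le_Lp_mul_Lq μ Real.HolderConjugate.two_two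
    (aemeasurable_const (b := (1 : ℝ≥0∞))) hφ
  have h2 : ∫⁻ y, φ y ∂μ ≤ (μ univ) ^ (1 / 2 : ℝ) * (∫⁻ y, φ y ^ 2 ∂μ) ^ (1 / 2 : ℝ) := by
    simpa using this
  calc _ ≤ ((μ univ) ^ (1 / 2 : ℝ) * (∫⁻ y, φ y ^ 2 ∂μ) ^ (1 / 2 : ℝ)) ^ 2 := by gcongr
    _ = _ := by
      rw [mul_pow, ← ENNReal.rpow_two, ← ENNReal.rpow_two, ← ENNReal.rpow_mul, ← ENNReal.rpow_mul]
      norm_num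

theorem sqn_le_of_ball_average {R : ℝ} {c : ℝ≥0∞} {F h : Rn n → ℂ} (hh : Measurable h)
    (H : ∀ x, ‖F x‖ₑ ≤ c * ∫⁻ y in Metric.closedBall x R, ‖h y‖ₑ) :
    sqn F ≤ (c * volume (Metric.closedBall (0 : Rn n) R)) ^ 2 * sqn h := by
  have hm : Measurable fun x => ∫⁻ y in Metric.closedBall x R, ‖h y‖ₑ ^ 2 :=
    measurable_ball_average R (by fun_prop)
  calc sqn F ≤ ∫⁻ x, c ^ 2 * (volume (Metric.closedBall (0 : Rn n) R) *
        ∫⁻ y in Metric.closedBall x R, ‖h y‖ₑ ^ 2) := by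
        refine lintegral_mono fun x => ?_
        calc ‖F x‖ₑ ^ 2 ≤ (c * ∫⁻ y in Metric.closedBall x R, ‖h y‖ₑ) ^ 2 := by gcongr; exact H x
          _ ≤ _ := by
            rw [mul_pow]
            refine mul_le_mul_right ((sq_setLIntegral_le _ hh.enorm.aemeasurable).trans ?_) _
            rw [Measure.restrict_apply_univ, Measure.addHaar_closedBall_center]
    _ = _ := by
        rw [lintegral_const_mul _ (hm.const_mul _), lintegral_const_mul _ hm,
          lintegral_ball_average _ (by fun_prop)]
        simp only [sqn]; ring

theorem sqn_cv_le (n : ℕ) (M : ℝ) : ∃ C : ℝ, 0 ≤ C ∧ ∀ (G A : Rn n → ℝ) (lam : ℝ),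
    Adm M G A → 0 < lam → ∀ h, BM h →
      sqn (cv lam G A h) ≤ ENNReal.ofReal (C / lam ^ n) * sqn h := by
  obtain ⟨C, hC, H⟩ := l2_bound n M
  refine ⟨C, hC, fun G A lam hA hl h hh => H G A _ lam hA hl hA.measurable_ampl (fun y => ?_)
    (fun _ _ h0 => h0) h hh⟩
  exact (hA.ampl.comp_sub y).mono (by lia) le_rfl

theorem sqn_cv_le_of_MZ (n : ℕ) (M : ℝ) : ∃ C : ℝ, 0 ≤ C ∧ ∀ (G A : Rn n → ℝ) (lam : ℝ),
    Adm M G A → 1 ≤ 2 * lam → ∀ s : ℤ, s ≤ 0 → ∀ h, BM h → MZ s h →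
      sqn (cv lam G A h) ≤ ENNReal.ofReal (C * (lam * 2 ^ s) ^ 2) * sqn h := by
  set V := volume.real (Metric.closedBall (0 : Rn n) (n + 2)) with hV
  refine ⟨((M ^ 2 + 2 * M) * n * V) ^ 2, sq_nonneg _, fun G A lam hA hl s hs h hh hz => ?_⟩
  have hM := hA.phase.nonneg
  have hl0 : 0 < lam := by linarith
  refine (sqn_le_of_ball_average hh.1 (enorm_cv_le_of_MZ hA hl hs hh hz)).trans (le_of_eq ?_)
  have : volume (Metric.closedBall (0 : Rn n) (n + 2)) = ENNReal.ofReal V :=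
    (ofReal_measureReal measure_closedBall_lt_top.ne).symm
  rw [this, ← ENNReal.ofReal_mul (by positivity), ← ENNReal.ofReal_pow (by positivity)]
  congr 2
  ring

end ShortVariation

namespace ShortVariation

variable {n : ℕ}

theorem hasDerivAt_osc (D : ℝ) (G : Rn n → ℝ) (t : Rn n) (u : ℝ) :
    HasDerivAt (fun u : ℝ => osc (u * D) G t) (Complex.I * D * G t * osc (u * D) G t) u := by
  have h1 : HasDerivAt (fun u : ℝ => Complex.I * (((u * D) * G t : ℝ) : ℂ))
      (Complex.I * ((1 * D * G t : ℝ) : ℂ)) u :=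
    (((hasDerivAt_id u).mul_const D).mul_const (G t)).ofReal_comp.const_mul Complex.I
  have h2 := h1.cexp
  unfold osc
  convert h2 using 1
  push_cast
  ring

theorem measurable_osc_param (D : ℝ) {G : Rn n → ℝ} (hG : ContDiff ℝ (⊤ : ℕ∞) G) :
    Measurable fun q : ℝ × Rn n => osc (q.1 * D) G q.2 := by
  have := hG.continuous
  unfold osc
  have h : Continuous fun q : ℝ × Rn n =>
      Complex.exp (Complex.I * (((q.1 * D) * G q.2 : ℝ) : ℂ)) := by fun_prop
  exact h.measurable

theorem measurable_opK_param (D : ℝ) {G : Rn n → ℝ} (hG : ContDiff ℝ (⊤ : ℕ∞) G)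
    {b : Rn n → Rn n → ℝ} (hb : Measurable (Function.uncurry b)) {h : Rn n → ℂ}
    (hh : Measurable h) :
    Measurable fun q : ℝ × Rn n => opK (oscKer (q.1 * D) G b) h q.2 := by
  have h1 : Measurable fun q : (ℝ × Rn n) × Rn n => osc (q.1.1 * D) G (q.1.2 - q.2) :=
    (measurable_osc_param D hG).comp (f := fun q : (ℝ × Rn n) × Rn n => (q.1.1, q.1.2 - q.2))
      (by fun_prop)
  have h2 : Measurable fun q : (ℝ × Rn n) × Rn n => (b q.1.2 q.2 : ℂ) :=
    Complex.continuous_ofReal.measurable.comp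
      (hb.comp (f := fun q : (ℝ × Rn n) × Rn n => (q.1.2, q.2)) (by fun_prop))
  have h3 : StronglyMeasurable fun q : (ℝ × Rn n) × Rn n =>
      oscKer (q.1.1 * D) G b q.1.2 q.2 * h q.2 :=
    ((h1.mul h2).mul (hh.comp measurable_snd)).stronglyMeasurable
  exact h3.integral_prod_right'.measurable

theorem hasDerivAt_opK {N : ℕ} {M B R D : ℝ} (hD : 0 ≤ D) {G : Rn n → ℝ} (hG : SB N M G)
    {b : Rn n → Rn n → ℝ} (hb : Measurable (Function.uncurry b)) (hB : ∀ x y, |b x y| ≤ B)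
    (hR : ∀ x y, b x y ≠ 0 → ‖x - y‖ ≤ R) {h : Rn n → ℂ} (hh : BM h) (x : Rn n) (u : ℝ) :
    HasDerivAt (fun u : ℝ => opK (oscKer (u * D) G b) h x)
      (Complex.I * D * opK (oscKer (u * D) G fun x y => G (x - y) * b x y) h x) u := by
  have hGc := hG.1.continuous
  have hGm : Measurable (Function.uncurry fun x y => G (x - y)) :=
    hGc.measurable.comp (measurable_fst.sub measurable_snd)
  have hM := hG.nonneg
  have hB0 : 0 ≤ B := (abs_nonneg _).trans (hB 0 0)
  have hB2 : ∀ x y, |G (x - y) * b x y| ≤ M * B := fun x y => by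
    rw [abs_mul]; exact mul_le_mul (hG.abs_le _) (hB x y) (abs_nonneg _) hM
  have hR2 : ∀ x y, G (x - y) * b x y ≠ 0 → ‖x - y‖ ≤ R := fun x y h0 =>
    hR x y (right_ne_zero_of_mul h0)
  have hi := fun v : ℝ => integrable_oscKer_mul (lam := v * D) hG.1 hb hB hR hh x
  have hGb : Measurable (Function.uncurry fun x y => G (x - y) * b x y) := hGm.mul hb
  have hi2 := fun v : ℝ => integrable_oscKer_mul (lam := v * D) hG.1 hGb hB2 hR2 hh x
  have key := hasDerivAt_integral_of_dominated_loc_of_deriv_le (μ := volume) (s := univ)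
    (F := fun v y => oscKer (v * D) G b x y * h y) (x₀ := u)
    (F' := fun v y => Complex.I * D *
      (oscKer (v * D) G (fun x y => G (x - y) * b x y) x y * h y))
    (bound := fun y => ‖oscKer (0 * D) G (fun x y => G (x - y) * b x y) x y * h y‖ * D)
    univ_mem (Eventually.of_forall fun v => (hi v).aestronglyMeasurable) (hi u)
    ((hi2 u).const_mul _).aestronglyMeasurable ?_ ((hi2 0).norm.mul_const D) ?_
  · rw [integral_const_mul] at key
    exact key.2
  · refine ae_of_all _ fun y v _ => le_of_eq ?_
    simp only [oscKer, norm_mul, norm_osc, Complex.norm_I, Complex.norm_real, Real.norm_eq_abs,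
      abs_of_nonneg hD]
    ring
  · refine ae_of_all _ fun y v _ => ?_
    have := ((hasDerivAt_osc D G (x - y) v).mul_const (b x y : ℂ)).mul_const (h y)
    unfold oscKer
    refine this.congr_deriv ?_
    push_cast
    ring

theorem Adm.abs_ampl {M : ℝ} {G A : Rn n → ℝ} (h : Adm M G A) (x y : Rn n) : |A (x - y)| ≤ M :=
  h.ampl.abs_le _

theorem hasDerivAt_cv {M D : ℝ} (hD : 0 ≤ D) {G A : Rn n → ℝ} (h : Adm M G A) {f : Rn n → ℂ}
    (hf : BM f) (x : Rn n) (u : ℝ) : HasDerivAt (fun u : ℝ => cv (u * D) G A f x)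
      (Complex.I * D * cv (u * D) G (fun t => G t * A t) f x) u :=
  hasDerivAt_opK hD h.phase h.measurable_ampl h.abs_ampl (fun _ _ h0 => h.supp _ h0) hf x u

theorem lintegral_sqn_le {D : ℝ} (hD : 1 ≤ D) {C : ℝ} (hC : 0 ≤ C) {F : ℝ → Rn n → ℂ}
    (hF : Measurable fun q : ℝ × Rn n => F q.1 q.2) {Q : ℝ≥0∞}
    (H : ∀ u ∈ Icc (1 / 2 : ℝ) 4, sqn (F u) ≤ ENNReal.ofReal (C / (u * D) ^ n) * Q) :
    ∫⁻ x, ∫⁻ u in Icc (1 / 2 : ℝ) 4, ‖F u x‖ₑ ^ 2 ≤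
      ENNReal.ofReal (2 ^ (n + 2) * C / D ^ n) * Q := by
  have hm : Measurable (Function.uncurry fun (x : Rn n) (u : ℝ) => ‖F u x‖ₑ ^ 2) :=
    ((hF.comp measurable_swap).enorm.pow_const 2)
  rw [lintegral_lintegral_swap hm.aemeasurable]
  have hb : ∀ u ∈ Icc (1 / 2 : ℝ) 4, ∫⁻ x, ‖F u x‖ₑ ^ 2 ≤
      ENNReal.ofReal (2 ^ n * C / D ^ n) * Q := fun u hu => by
    refine (H u hu).trans (mul_le_mul_left (ENNReal.ofReal_le_ofReal ?_) _)
    rw [div_le_div_iff₀ (by have := hu.1; positivity) (by positivity)]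
    have h1 : 1 ≤ (2 * u) ^ n := one_le_pow₀ (by linarith [hu.1])
    have h2 : 2 ^ n * C * (u * D) ^ n = C * D ^ n * (2 * u) ^ n := by
      rw [mul_pow, mul_pow]; ring
    rw [h2]
    exact le_mul_of_one_le_right (by positivity) h1
  refine (setLIntegral_mono measurable_const hb).trans ?_
  rw [setLIntegral_const, Real.volume_Icc, mul_comm, ← mul_assoc]
  rw [← ENNReal.ofReal_mul (by norm_num)]
  refine mul_le_mul_left (ENNReal.ofReal_le_ofReal ?_) _
  have : 0 ≤ 2 ^ n * C / D ^ n := by positivity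
  calc (4 - 1 / 2) * (2 ^ n * C / D ^ n) ≤ 4 * (2 ^ n * C / D ^ n) := by nlinarith
    _ = _ := by ring

/-- The difference amplitude. -/
def diffAmp (G A : Rn n → ℝ) (σ : ℝ) (x₀ x y : Rn n) : ℝ :=
  if ‖y - x₀‖ ≤ σ then σ⁻¹ * (A (x - y) * (G (x - y) - G (x - x₀))) else 0

theorem measurable_diffAmp {M : ℝ} {G A : Rn n → ℝ} (h : Adm M G A) (σ : ℝ) (x₀ : Rn n) :
    Measurable (Function.uncurry (diffAmp G A σ x₀)) := by
  have h1 := h.ampl.1.continuous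
  have h2 := h.phase.1.continuous
  refine Measurable.ite (measurableSet_le (by fun_prop) (by fun_prop)) ?_ measurable_const
  have h : Continuous fun q : Rn n × Rn n =>
    σ⁻¹ * (A (q.1 - q.2) * (G (q.1 - q.2) - G (q.1 - x₀))) := by fun_prop
  exact h.measurable

theorem sb_diffAmp {M : ℝ} {G A : Rn n → ℝ} (h : Adm M G A) {σ : ℝ} (hσ : 0 < σ) (x₀ y : Rn n) :
    SB (n + 1) (2 ^ (n + 1) * M * M) (fun x => diffAmp G A σ x₀ x y) := by
  have hM := h.phase.nonneg
  unfold diffAmp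
  split_ifs with hy
  · have hG := h.phase.mono (N' := n + 1 + 1) (by lia) le_rfl
    have h1 := (hG.diff y x₀)
    have h2 := ((h.ampl.comp_sub y).mono (N' := n + 1) (by lia) le_rfl).mul h1
    refine (h2.const_mul σ⁻¹).mono le_rfl ?_
    rw [abs_of_pos (by positivity)]
    calc σ⁻¹ * (2 ^ (n + 1) * M * (M * ‖y - x₀‖)) ≤ σ⁻¹ * (2 ^ (n + 1) * M * (M * σ)) := by gcongr
      _ = _ := by field_simp
  · exact (SB.const 0).mono le_rfl (by simp; positivity)

/-- A maximal function in the parameter, for functions supported in a small ball. -/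
theorem exists_majorant (n : ℕ) (M : ℝ) : ∃ C : ℝ, 0 ≤ C ∧ ∀ (G A : Rn n → ℝ) (D σ B : ℝ)
    (x₀ : Rn n), Adm M G A → 1 ≤ D → 0 < σ → 1 ≤ B → ∀ f, BM f → (∀ y, f y ≠ 0 → ‖y - x₀‖ ≤ σ) →
    ∃ β : Rn n → ℝ≥0∞, Measurable β ∧
      (∀ u ∈ Icc (1 / 2 : ℝ) 4, ∀ x, ‖cv (u * D) G A f x‖ₑ ≤ β x) ∧
      ∫⁻ x, β x ^ 2 ≤ ENNReal.ofReal (C * (B + B⁻¹ * (D * σ) ^ 2) / D ^ n) * sqn f ∧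
      ∀ x, β x ≠ 0 → ‖x - x₀‖ ≤ 2 + σ := by
  set M1 := max M (2 ^ (n + 1) * M * M) with hM1
  obtain ⟨C, hC, H⟩ := l2_bound n M1
  refine ⟨2 ^ (n + 3) * C, by positivity, fun G A D σ B x₀ hA hD hσ hB f hf hfs => ?_⟩
  have hM := hA.phase.nonneg
  have hA1 : Adm M1 G A := hA.mono (le_max_left _ _)
  have hD0 : 0 ≤ D := by linarith
  have hGc := hA.phase.1.continuous
  set b1 := diffAmp G A σ x₀ with hb1
  have hb1m : Measurable (Function.uncurry b1) := measurable_diffAmp hA σ x₀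
  have hb1s : ∀ x y, b1 x y ≠ 0 → A (x - y) ≠ 0 := fun x y h0 h1 => h0 (by
    simp [hb1, diffAmp, h1])
  set F0 : ℝ → Rn n → ℂ := fun u x => cv (u * D) G A f x with hF0
  set F1 : ℝ → Rn n → ℂ := fun u x => opK (oscKer (u * D) G b1) f x with hF1
  have hF0m : Measurable fun q : ℝ × Rn n => F0 q.1 q.2 :=
    measurable_opK_param D hA.phase.1 hA.measurable_ampl hf.1
  have hF1m : Measurable fun q : ℝ × Rn n => F1 q.1 q.2 :=
    measurable_opK_param D hA.phase.1 hb1m hf.1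
  have I0 : ∫⁻ x, ∫⁻ u in Icc (1 / 2 : ℝ) 4, ‖F0 u x‖ₑ ^ 2 ≤
      ENNReal.ofReal (2 ^ (n + 2) * C / D ^ n) * sqn f := by
    refine lintegral_sqn_le hD hC hF0m fun u hu => ?_
    refine H G A _ _ hA1 (by have := hu.1; positivity) hA.measurable_ampl (fun y => ?_)
      (fun _ _ h0 => h0) f hf
    exact (hA1.ampl.comp_sub y).mono (by lia) le_rfl
  have I1 : ∫⁻ x, ∫⁻ u in Icc (1 / 2 : ℝ) 4, ‖F1 u x‖ₑ ^ 2 ≤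
      ENNReal.ofReal (2 ^ (n + 2) * C / D ^ n) * sqn f := by
    refine lintegral_sqn_le hD hC hF1m fun u hu => ?_
    refine H G A _ _ hA1 (by have := hu.1; positivity) hb1m (fun y => ?_) hb1s f hf
    exact (sb_diffAmp hA hσ x₀ y).mono le_rfl (le_max_right _ _)
  have mI : ∀ {F : ℝ → Rn n → ℂ}, (Measurable fun q : ℝ × Rn n => F q.1 q.2) →
      Measurable fun x => ∫⁻ u in Icc (1 / 2 : ℝ) 4, ‖F u x‖ₑ ^ 2 := fun {F} hF => by
    have : Measurable fun q : Rn n × ℝ => ‖F q.2 q.1‖ₑ ^ 2 :=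
      ((hF.comp measurable_swap).enorm.pow_const 2)
    exact this.lintegral_prod_right'
  set γ : Rn n → ℝ≥0∞ := fun x =>
    2 * (ENNReal.ofReal B * (∫⁻ u in Icc (1 / 2 : ℝ) 4, ‖F0 u x‖ₑ ^ 2) +
      ENNReal.ofReal (B⁻¹ * (D * σ) ^ 2) * ∫⁻ u in Icc (1 / 2 : ℝ) 4, ‖F1 u x‖ₑ ^ 2) with hγ
  have hγm : Measurable γ :=
    (((mI hF0m).const_mul _).add ((mI hF1m).const_mul _)).const_mul 2
  set S := Metric.closedBall x₀ (2 + σ)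
  refine ⟨S.indicator fun x => γ x ^ (1 / 2 : ℝ), ?_, ?_, ?_, ?_⟩
  · exact (hγm.pow_const _).indicator Metric.isClosed_closedBall.measurableSet
  · intro u hu x
    by_cases hx : x ∈ S
    · rw [indicator_of_mem hx]
      have hd : ∀ v : ℝ, HasDerivAt (fun v : ℝ => osc (-v * D) G (x - x₀) * F0 v x)
          (osc (-v * D) G (x - x₀) * (Complex.I * (D * σ : ℝ) * F1 v x)) v := fun v => by
        have h1 : HasDerivAt (fun v : ℝ => osc (-v * D) G (x - x₀))
            (-(Complex.I * D * G (x - x₀) * osc (-v * D) G (x - x₀))) v := by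
          have := (hasDerivAt_osc D G (x - x₀) (-v)).scomp v (hasDerivAt_neg v)
          simpa [Function.comp_def] using this
        have h2 := h1.mul (hasDerivAt_cv hD0 hA hf x v)
        have e : (σ : ℂ) * F1 v x = cv (v * D) G (fun t => G t * A t) f x -
            G (x - x₀) * cv (v * D) G A f x := by
          have i1 : Integrable fun y => oscKer (v * D) G (fun x y => G (x - y) * A (x - y)) x y
              * f y := by
            have hm : Measurable (Function.uncurry fun x y => G (x - y) * A (x - y)) :=
              (hGc.measurable.comp (measurable_fst.sub measurable_snd)).mul hA.measurable_ampl
            refine integrable_oscKer_mul (B := M * M) (R := 2) hA.phase.1 hm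
              (fun x y => ?_) (fun x y h0 => hA.supp _ (right_ne_zero_of_mul h0)) hf x
            rw [abs_mul]
            exact mul_le_mul (hA.phase.abs_le _) (hA.ampl.abs_le _) (abs_nonneg _) hM
          have i2 := (hA.integrable (lam := v * D) hf x).const_mul (G (x - x₀) : ℂ)
          simp only [hF1, cv, opK]
          rw [← integral_const_mul, ← integral_const_mul, ← integral_sub i1 i2]
          congr 1; ext y
          by_cases hy : f y = 0
          · simp [hy]
          · have := hfs y hy
            have hσ' : (σ : ℂ) ≠ 0 := by exact_mod_cast hσ.ne'
            simp only [oscKer, hb1, diffAmp, if_pos this]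
            push_cast
            field_simp
        refine HasDerivAt.congr_deriv h2 ?_
        have e' : cv (v * D) G (fun t => G t * A t) f x =
          (σ : ℂ) * F1 v x + G (x - x₀) * cv (v * D) G A f x := by rw [e]; ring
        simp only [e']
        push_cast
        ring
      have hcont : Continuous fun v : ℝ =>
          osc (-v * D) G (x - x₀) * (Complex.I * (D * σ : ℝ) * F1 v x) := by
        have h1 : Continuous fun v : ℝ => osc (-v * D) G (x - x₀) := by
          unfold osc; fun_prop
        have h2 : Continuous fun v : ℝ => F1 v x :=
          continuous_iff_continuousAt.2 fun v =>
            (hasDerivAt_opK hD0 hA.phase hb1m (fun x y => (sb_diffAmp hA hσ x₀ y).abs_le x)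
              (fun x y h0 => hA.supp _ (hb1s x y h0)) hf x v).continuousAt
        exact h1.mul (continuous_const.mul h2)
      have key := sobolev_sup hd hcont hB hu
      have e1 : ∀ v : ℝ, ‖osc (-v * D) G (x - x₀) * F0 v x‖ₑ = ‖F0 v x‖ₑ := fun v => by
        rw [enorm_mul, ← ofReal_norm, norm_osc]; simp
      have e2 : ∀ v : ℝ, ‖osc (-v * D) G (x - x₀) * (Complex.I * (D * σ : ℝ) * F1 v x)‖ₑ =
          ENNReal.ofReal (D * σ) * ‖F1 v x‖ₑ := fun v => by
        rw [enorm_mul, ← ofReal_norm, norm_osc, enorm_mul, enorm_mul, ← ofReal_norm Complex.I,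
          Complex.norm_I, ← ofReal_norm ((D * σ : ℝ) : ℂ), Complex.norm_real, Real.norm_eq_abs,
          abs_of_nonneg (by positivity)]
        simp
      simp_rw [e1, e2, mul_pow] at key
      rw [lintegral_const_mul' _ _ (by simp), ← mul_assoc (ENNReal.ofReal B⁻¹),
        ← ENNReal.ofReal_pow (by positivity), ← ENNReal.ofReal_mul (by positivity)] at key
      have key2 : ‖F0 u x‖ₑ ^ 2 ≤ γ x := key
      calc ‖F0 u x‖ₑ = (‖F0 u x‖ₑ ^ 2) ^ (1 / 2 : ℝ) := by
            rw [← ENNReal.rpow_two, ← ENNReal.rpow_mul]; norm_num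
        _ ≤ _ := by gcongr
    · have : F0 u x = 0 := by
        refine integral_eq_zero_of_ae (ae_of_all _ fun y => ?_)
        by_contra h0
        have h1 : f y ≠ 0 := right_ne_zero_of_mul h0
        have h2 : A (x - y) ≠ 0 := fun h3 => h0 (by simp [oscKer, h3])
        refine hx ?_
        rw [Metric.mem_closedBall, dist_eq_norm]
        calc ‖x - x₀‖ = ‖(x - y) + (y - x₀)‖ := by congr 1; abel
          _ ≤ _ := (norm_add_le _ _).trans (add_le_add (hA.supp _ h2) (hfs y h1))
      have h' : cv (u * D) G A f x = 0 := this
      rw [h']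
      simp
  · calc ∫⁻ x, (S.indicator (fun x => γ x ^ (1 / 2 : ℝ)) x) ^ 2 ≤ ∫⁻ x, γ x := by
          refine lintegral_mono fun x => ?_
          by_cases hx : x ∈ S
          · rw [indicator_of_mem hx, ← ENNReal.rpow_two, ← ENNReal.rpow_mul]; norm_num
          · rw [indicator_of_notMem hx]; simp
      _ ≤ 2 * (ENNReal.ofReal B * (ENNReal.ofReal (2 ^ (n + 2) * C / D ^ n) * sqn f) +
          ENNReal.ofReal (B⁻¹ * (D * σ) ^ 2) *
            (ENNReal.ofReal (2 ^ (n + 2) * C / D ^ n) * sqn f)) := by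
          rw [hγ, lintegral_const_mul' _ _ (by simp), lintegral_add_left ((mI hF0m).const_mul _),
            lintegral_const_mul' _ _ (by simp), lintegral_const_mul' _ _ (by simp)]
          gcongr
      _ = _ := by
          rw [← ENNReal.ofReal_ofNat, ← mul_assoc, ← mul_assoc, ← add_mul, ← mul_assoc,
            ← ENNReal.ofReal_mul (by positivity), ← ENNReal.ofReal_mul (by positivity),
            ← ENNReal.ofReal_add (by positivity) (by positivity),
            ← ENNReal.ofReal_mul (by positivity)]
          congr 2
          ring
  · intro x hx
    have : x ∈ S := by
      by_contra h0
      exact hx (indicator_of_notMem h0 _)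
    rwa [Metric.mem_closedBall, dist_eq_norm] at this

end ShortVariation

namespace ShortVariation

variable {n : ℕ}

/-- The decay factor of the maximal `L¹` bound. -/
def dec (t : ℝ) : ℝ := min t (√t)⁻¹

theorem dec_nonneg {t : ℝ} (ht : 0 ≤ t) : 0 ≤ dec t := le_min ht (by positivity)

/-- `S` is a union of dyadic cells of side `2 ^ s`. -/
def Sat (s : ℤ) (S : Set (Rn n)) : Prop := ∀ y y', cell s y = cell s y' → y ∈ S → y' ∈ S

theorem Sat.inter_cube {s : ℤ} {S : Set (Rn n)} (hS : Sat s S) (v : Fin n → ℤ) :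
    S ∩ cube s v = ∅ ∨ S ∩ cube s v = cube s v := by
  rcases (S ∩ cube s v).eq_empty_or_nonempty with h | ⟨y, hy, hyv⟩
  · exact Or.inl h
  · refine Or.inr (inter_eq_right.2 fun z hz => hS y z ?_ hy)
    rw [mem_cube.1 hyv, mem_cube.1 hz]

theorem sqn_le_of_le_indicator {S : Set (Rn n)} (hS : MeasurableSet S) {Mx : ℝ} (hMx : 0 ≤ Mx)
    {a : Rn n → ℂ} (ha : ∀ x, ‖a x‖ ≤ Mx) (haS : ∀ x, a x ≠ 0 → x ∈ S) :
    sqn a ≤ ENNReal.ofReal (Mx ^ 2) * volume S := by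
  rw [← setLIntegral_const, ← lintegral_indicator hS]
  refine lintegral_mono fun x => ?_
  by_cases h : a x = 0
  · simp [h]
  · rw [indicator_of_mem (haS x h), ← ofReal_norm, ← ENNReal.ofReal_pow (norm_nonneg _)]
    exact ENNReal.ofReal_le_ofReal (pow_le_pow_left₀ (norm_nonneg _) (ha x) 2)

theorem lintegral_le_of_le_indicator {S : Set (Rn n)} (hS : MeasurableSet S) {Mx : ℝ}
    {a : Rn n → ℂ} (ha : ∀ x, ‖a x‖ ≤ Mx) (haS : ∀ x, a x ≠ 0 → x ∈ S) :
    ∫⁻ x, ‖a x‖ₑ ≤ ENNReal.ofReal Mx * volume S := by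
  rw [← setLIntegral_const, ← lintegral_indicator hS]
  refine lintegral_mono fun x => ?_
  by_cases h : a x = 0
  · simp [h]
  · rw [indicator_of_mem (haS x h), ← ofReal_norm]
    exact ENNReal.ofReal_le_ofReal (ha x)

theorem enorm_cv_le_tsum {M lam : ℝ} {G A : Rn n → ℝ} (h : Adm M G A) (s : ℤ) {a : Rn n → ℂ}
    (ha : BM a) (x : Rn n) :
    ‖cv lam G A a x‖ₑ ≤ ∑' v, ‖cv lam G A ((cube s v).indicator a) x‖ₑ := by
  have h1 := integral_eq_tsum_cube s (h.integrable (lam := lam) ha x)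
  have h2 : ∀ v, ∫ y in cube s v, oscKer lam G (fun x y => A (x - y)) x y * a y =
      cv lam G A ((cube s v).indicator a) x := fun v => by
    rw [← integral_indicator (measurableSet_cube s v), cv, opK]
    congr 1; ext y
    by_cases hy : y ∈ cube s v <;> simp [hy]
  simp_rw [h2] at h1
  have h3 : cv lam G A a x = ∑' v, cv lam G A ((cube s v).indicator a) x := h1.tsum_eq.symm
  rw [h3]
  exact enorm_tsum_le_tsum_enorm

theorem BM.indicator {a : Rn n → ℂ} (ha : BM a) {S : Set (Rn n)} (hS : MeasurableSet S) :
    BM (S.indicator a) :=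
  ⟨ha.1.indicator hS, ha.2.imp fun _ hB x => (norm_indicator_le_norm_self _ _).trans (hB x)⟩

theorem lintegral_le_of_sq {V Q : ℝ≥0∞} {β : Rn n → ℝ≥0∞} (hβ : Measurable β) {S : Set (Rn n)}
    (hβS : ∀ x, β x ≠ 0 → x ∈ S) (hV : volume S ≤ V) (hQ : V * ∫⁻ x, β x ^ 2 ≤ Q ^ 2) :
    ∫⁻ x, β x ≤ Q := by
  have h1 : ∫⁻ x, β x = ∫⁻ x in S, β x := (setLIntegral_eq_of_support_subset hβS).symm
  have h2 : (∫⁻ x, β x) ^ 2 ≤ Q ^ 2 := by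
    rw [h1]
    refine (sq_setLIntegral_le _ hβ.aemeasurable).trans (le_trans ?_ hQ)
    rw [Measure.restrict_apply_univ]
    exact mul_le_mul' hV (setLIntegral_le_lintegral _ _)
  exact (ENNReal.pow_le_pow_left_iff (by norm_num)).1 h2

theorem exists_majorant_unit (n : ℕ) (hn : 2 ≤ n) (M : ℝ) : ∃ C : ℝ, 0 ≤ C ∧
    ∀ (G A : Rn n → ℝ) (D Mx : ℝ) (s : ℤ) (S : Set (Rn n)), Adm M G A → 1 ≤ D → 0 ≤ Mx →
      s ≤ 0 → MeasurableSet S → Sat s S → ∀ a, BM a → (∀ x, ‖a x‖ ≤ Mx) →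
      (∀ x, a x ≠ 0 → x ∈ S) → MZ s a →
      ∃ α : Rn n → ℝ≥0∞, Measurable α ∧
        (∀ u ∈ Icc (1 / 2 : ℝ) 4, ∀ x, ‖cv (u * D) G A a x‖ₑ ≤ α x) ∧
        ∫⁻ x, α x ≤ ENNReal.ofReal (C * dec (D * 2 ^ s) * Mx) * volume S := by
  obtain ⟨C1, hC1, H⟩ := exists_majorant n M
  set V1 := volume.real (Metric.closedBall (0 : Rn n) (n + 2)) with hV1
  set C0 : ℝ := (M ^ 2 + 2 * |M|) * n * 4 * V1 with hC0
  set C2 : ℝ := V1 * (C1 * (1 + n ^ 2)) with hC2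
  refine ⟨max C0 (√C2), le_max_of_le_right (Real.sqrt_nonneg _),
    fun G A D Mx s S hA hD hMx hs hSm hS a ha haM haS hz => ?_⟩
  have hM := hA.phase.nonneg
  have h2s : (2 : ℝ) ^ s ≤ 1 := zpow_le_one_of_nonpos₀ (by norm_num) hs
  have h2s0 : (0 : ℝ) < 2 ^ s := by positivity
  have hn0 : (2 : ℝ) ≤ n := by exact_mod_cast hn
  have hVe : volume (Metric.closedBall (0 : Rn n) (n + 2)) = ENNReal.ofReal V1 :=
    (ofReal_measureReal measure_closedBall_lt_top.ne).symm
  set t := D * 2 ^ s with ht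
  have ht0 : 0 < t := by positivity
  rcases le_total t 1 with h1 | h1
  · have hd : dec t = t := min_eq_left (by
      rw [le_inv_comm₀ ht0 (by positivity)]
      refine (Real.sqrt_le_one.2 h1).trans ((one_le_inv₀ ht0).2 h1))
    refine ⟨fun x => ENNReal.ofReal ((M ^ 2 + 2 * M) * n * 4 * t) *
      ∫⁻ y in Metric.closedBall x (n + 2), ‖a y‖ₑ,
      (measurable_ball_average _ ha.1.enorm).const_mul _, fun u hu x => ?_, ?_⟩
    · refine (enorm_cv_le_of_MZ hA (by have := hu.1; nlinarith) hs ha hz x).trans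
        (mul_le_mul_left (ENNReal.ofReal_le_ofReal ?_) _)
      have : u * D * 2 ^ s ≤ 4 * t := by
        rw [ht, mul_assoc]; exact mul_le_mul_of_nonneg_right hu.2 ht0.le
      calc (M ^ 2 + 2 * M) * n * (u * D) * 2 ^ s = (M ^ 2 + 2 * M) * n * (u * D * 2 ^ s) := by ring
        _ ≤ (M ^ 2 + 2 * M) * n * (4 * t) := by gcongr
        _ = _ := by ring
    · rw [lintegral_const_mul' _ _ ENNReal.ofReal_ne_top, lintegral_ball_average _ ha.1.enorm, hVe,
        ← mul_assoc, ← ENNReal.ofReal_mul (by positivity)]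
      refine (mul_le_mul_right (lintegral_le_of_le_indicator hSm haM haS) _).trans ?_
      rw [← mul_assoc, ← ENNReal.ofReal_mul (by positivity)]
      refine mul_le_mul_left (ENNReal.ofReal_le_ofReal ?_) _
      rw [hd]
      have : C0 = (M ^ 2 + 2 * M) * n * 4 * V1 := by rw [hC0, abs_of_nonneg hM]
      calc (M ^ 2 + 2 * M) * n * 4 * t * V1 * Mx = C0 * t * Mx := by rw [this]; ring
        _ ≤ _ := by gcongr; exact le_max_left _ _
  · have hd : dec t = (√t)⁻¹ := min_eq_right (by
      refine (inv_le_one₀ (by positivity)).2 (Real.one_le_sqrt.2 h1) |>.trans h1)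
    have hσ : (0 : ℝ) < n * 2 ^ s := by positivity
    choose β hβm hβ hβ2 hβs using fun v => H G A D (n * 2 ^ s) t (corner s v) hA hD hσ h1
      ((cube s v).indicator a) (ha.indicator (measurableSet_cube s v))
      (fun y hy => norm_sub_corner_le (by
        by_contra h0
        exact hy (indicator_of_notMem h0 _)))
    refine ⟨fun x => ∑' v, β v x, Measurable.tsum hβm, fun u hu x => ?_, ?_⟩
    · exact (enorm_cv_le_tsum hA s ha x).trans (ENNReal.tsum_le_tsum fun v => hβ v u hu x)
    · rw [lintegral_tsum fun v => (hβm v).aemeasurable]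
      have hvol : volume S = ∑' v, volume (S ∩ cube s v) := by
        rw [← measure_iUnion (fun v w hvw => (pairwise_disjoint_cube s hvw).mono
          inter_subset_right inter_subset_right) fun v => hSm.inter (measurableSet_cube s v),
          ← inter_iUnion, iUnion_cube, inter_univ]
      rw [hvol, ← ENNReal.tsum_mul_left]
      refine ENNReal.tsum_le_tsum fun v => ?_
      have hsq : sqn ((cube s v).indicator a) ≤ ENNReal.ofReal (Mx ^ 2) * volume (S ∩ cube s v) := by
        refine sqn_le_of_le_indicator (hSm.inter (measurableSet_cube s v)) hMx
          (fun x => (norm_indicator_le_norm_self _ _).trans (haM x)) fun x hx => ?_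
        by_cases hxv : x ∈ cube s v
        · rw [indicator_of_mem hxv] at hx
          exact ⟨haS x hx, hxv⟩
        · exact absurd (indicator_of_notMem hxv _) hx
      refine lintegral_le_of_sq (V := ENNReal.ofReal V1) (hβm v)
        (S := Metric.closedBall (corner s v) (n + 2)) (fun x hx => ?_) ?_ ?_
      · rw [Metric.mem_closedBall, dist_eq_norm]
        refine (hβs v x hx).trans ?_
        nlinarith
      · rw [Measure.addHaar_closedBall_center, hVe]
      · refine (mul_le_mul_right ((hβ2 v).trans (mul_le_mul_right hsq _)) _).trans ?_
        rcases hS.inter_cube v with h0 | h0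
        · rw [h0]; simp
        · rw [h0, volume_cube, ← ENNReal.ofReal_pow h2s0.le, ← ENNReal.ofReal_mul (by positivity),
            ← ENNReal.ofReal_mul (by positivity), ← ENNReal.ofReal_mul (by positivity),
            ← ENNReal.ofReal_mul (mul_nonneg (mul_nonneg (le_max_of_le_right (Real.sqrt_nonneg _))
              (dec_nonneg ht0.le)) hMx),
            ← ENNReal.ofReal_pow (mul_nonneg (mul_nonneg (mul_nonneg
              (le_max_of_le_right (Real.sqrt_nonneg _)) (dec_nonneg ht0.le)) hMx) (by positivity))]
          refine ENNReal.ofReal_le_ofReal ?_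
          have hC20 : 0 ≤ C2 := by positivity
          have e1 : (√C2) ^ 2 = C2 := Real.sq_sqrt hC20
          have e2 : (√t)⁻¹ ^ 2 = t⁻¹ := by rw [inv_pow, Real.sq_sqrt ht0.le]
          calc _ = C2 * Mx ^ 2 * ((2 : ℝ) ^ s) ^ n * (t / D ^ n) := by
                rw [hC2, show D * (n * (2 : ℝ) ^ s) = n * t by rw [ht]; ring]
                field_simp
            _ ≤ C2 * Mx ^ 2 * ((2 : ℝ) ^ s) ^ n * (t⁻¹ * ((2 : ℝ) ^ s) ^ n) := by
                refine mul_le_mul_of_nonneg_left ?_ (by positivity)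
                rw [div_le_iff₀ (by positivity), mul_assoc, ← mul_pow, mul_comm _ D, ← ht,
                  le_inv_mul_iff₀ ht0, ← sq]
                exact pow_le_pow_right₀ h1 hn
            _ = (√C2 * dec t * Mx * ((2 : ℝ) ^ s) ^ n) ^ 2 := by
                rw [hd, mul_pow, mul_pow, mul_pow, e1, e2]; ring
            _ ≤ _ := by
                have := dec_nonneg ht0.le
                gcongr
                exact le_max_right _ _

/-- The rescaled convolution operator. -/
def TT (k : ℤ) (lam : ℝ) (G A : Rn n → ℝ) (h : Rn n → ℂ) (x : Rn n) : ℂ :=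
  cv lam G A (fun y => h ((2 : ℝ) ^ k • y)) ((2 : ℝ) ^ (-k) • x)

theorem lintegral_comp_zpow_smul (k : ℤ) (F : Rn n → ℝ≥0∞) :
    ∫⁻ x, F ((2 : ℝ) ^ k • x) = ENNReal.ofReal (((2 : ℝ) ^ (-k)) ^ n) * ∫⁻ x, F x := by
  have h2 : (2 : ℝ) ^ k ≠ 0 := by positivity
  have h1 := lintegral_map_equiv (μ := (volume : Measure (Rn n))) F
    (Homeomorph.smulOfNeZero ((2 : ℝ) ^ k) h2 : Rn n ≃ₜ Rn n).toMeasurableEquiv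
  have h3 : Measure.map (fun x : Rn n => (2 : ℝ) ^ k • x) volume =
      ENNReal.ofReal |(((2 : ℝ) ^ k) ^ n)⁻¹| • volume := by
    have := Measure.map_addHaar_smul (volume : Measure (Rn n)) h2
    rwa [finrank_euclideanSpace_fin] at this
  have e : ⇑((Homeomorph.smulOfNeZero ((2 : ℝ) ^ k) h2 : Rn n ≃ₜ Rn n).toMeasurableEquiv) =
      fun x : Rn n => (2 : ℝ) ^ k • x := rfl
  rw [e, h3, lintegral_smul_measure] at h1
  rw [← h1, abs_of_pos (by positivity), zpow_neg, inv_pow, smul_eq_mul]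

theorem BM.comp_smul {h : Rn n → ℂ} (hh : BM h) (k : ℤ) : BM fun y => h ((2 : ℝ) ^ k • y) :=
  ⟨hh.1.comp (measurable_const_smul _), hh.2.imp fun _ hB _ => hB _⟩

theorem MZ.comp_smul {s : ℤ} {h : Rn n → ℂ} (hh : MZ s h) (k : ℤ) :
    MZ (s - k) fun y => h ((2 : ℝ) ^ k • y) := fun v => by
  have e : cube (s - k) v = (fun y : Rn n => (2 : ℝ) ^ k • y) ⁻¹' cube s v := by
    ext y
    simp only [mem_cube, mem_preimage, cell_smul]
  have h2 : ∫ y in cube (s - k) v, h ((2 : ℝ) ^ k • y) =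
      ∫ y, (cube s v).indicator h ((2 : ℝ) ^ k • y) := by
    rw [← integral_indicator (measurableSet_cube _ v)]
    congr 1; ext y
    by_cases hy : (2 : ℝ) ^ k • y ∈ cube s v
    · rw [indicator_of_mem hy, indicator_of_mem (by rw [e]; exact hy)]
    · rw [indicator_of_notMem hy, indicator_of_notMem (by rw [e]; exact hy)]
  rw [h2, Measure.integral_comp_smul, integral_indicator (measurableSet_cube s v), hh v, smul_zero]

theorem Sat.preimage_smul {s : ℤ} {S : Set (Rn n)} (hS : Sat s S) (k : ℤ) :
    Sat (s - k) ((fun y : Rn n => (2 : ℝ) ^ k • y) ⁻¹' S) := fun y y' hyy hy =>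
  hS _ _ (by rw [cell_smul, cell_smul, hyy]) hy

theorem zpow_neg_smul (k : ℤ) (x : Rn n) : (2 : ℝ) ^ (-k) • (2 : ℝ) ^ k • x = x := by
  rw [smul_smul, ← zpow_add₀ (by norm_num), neg_add_cancel, zpow_zero, one_smul]

theorem measurable_TT {M lam : ℝ} {G A : Rn n → ℝ} (h : Adm M G A) (k : ℤ) {f : Rn n → ℂ}
    (hf : Measurable f) : Measurable (TT k lam G A f) :=
  (measurable_cv h (hf.comp (measurable_const_smul _))).comp (measurable_const_smul _)

theorem sqn_comp_smul (k : ℤ) (h : Rn n → ℂ) :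
    sqn (fun y => h ((2 : ℝ) ^ k • y)) = ENNReal.ofReal (((2 : ℝ) ^ (-k)) ^ n) * sqn h :=
  lintegral_comp_zpow_smul k fun x => ‖h x‖ₑ ^ 2

theorem sqn_TT_le_of {k : ℤ} {lam : ℝ} {G A : Rn n → ℝ} {h : Rn n → ℂ} {Q : ℝ≥0∞}
    (H : sqn (cv lam G A fun y => h ((2 : ℝ) ^ k • y)) ≤ Q * sqn fun y => h ((2 : ℝ) ^ k • y)) :
    sqn (TT k lam G A h) ≤ Q * sqn h := by
  have e : sqn (TT k lam G A h) = ENNReal.ofReal (((2 : ℝ) ^ (- -k)) ^ n) *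
      sqn (cv lam G A fun y => h ((2 : ℝ) ^ k • y)) := sqn_comp_smul (-k) _
  rw [e]
  refine (mul_le_mul_right H _).trans (le_of_eq ?_)
  rw [sqn_comp_smul, mul_left_comm, ← mul_assoc (ENNReal.ofReal _),
    ← ENNReal.ofReal_mul (by positivity), ← mul_pow, ← zpow_add₀ (by norm_num)]
  simp

theorem sqn_TT_le (n : ℕ) (M : ℝ) : ∃ C : ℝ, 0 ≤ C ∧ ∀ (k : ℤ) (G A : Rn n → ℝ) (lam : ℝ),
    Adm M G A → 0 < lam → ∀ h, BM h →
      sqn (TT k lam G A h) ≤ ENNReal.ofReal (C / lam ^ n) * sqn h := by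
  obtain ⟨C, hC, H⟩ := sqn_cv_le n M
  exact ⟨C, hC, fun k G A lam hA hl h hh => sqn_TT_le_of (H G A lam hA hl _ (hh.comp_smul k))⟩

theorem sqn_TT_le_of_MZ (n : ℕ) (M : ℝ) : ∃ C : ℝ, 0 ≤ C ∧ ∀ (k : ℤ) (G A : Rn n → ℝ) (lam : ℝ),
    Adm M G A → 1 ≤ 2 * lam → ∀ s : ℤ, s ≤ k → ∀ h, BM h → MZ s h →
      sqn (TT k lam G A h) ≤ ENNReal.ofReal (C * (lam * 2 ^ (s - k)) ^ 2) * sqn h := by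
  obtain ⟨C, hC, H⟩ := sqn_cv_le_of_MZ n M
  exact ⟨C, hC, fun k G A lam hA hl s hs h hh hz =>
    sqn_TT_le_of (H G A lam hA hl (s - k) (by lia) _ (hh.comp_smul k) (hz.comp_smul k))⟩

theorem exists_majorant_TT (n : ℕ) (hn : 2 ≤ n) (M : ℝ) : ∃ C : ℝ, 0 ≤ C ∧
    ∀ (k : ℤ) (G A : Rn n → ℝ) (D Mx : ℝ) (s : ℤ) (S : Set (Rn n)), Adm M G A → 1 ≤ D → 0 ≤ Mx →
      s ≤ k → MeasurableSet S → Sat s S → ∀ a, BM a → (∀ x, ‖a x‖ ≤ Mx) →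
      (∀ x, a x ≠ 0 → x ∈ S) → MZ s a →
      ∃ α : Rn n → ℝ≥0∞, Measurable α ∧
        (∀ u ∈ Icc (1 / 2 : ℝ) 4, ∀ x, ‖TT k (u * D) G A a x‖ₑ ≤ α x) ∧
        ∫⁻ x, α x ≤ ENNReal.ofReal (C * dec (D * 2 ^ (s - k)) * Mx) * volume S := by
  obtain ⟨C, hC, H⟩ := exists_majorant_unit n hn M
  refine ⟨C, hC, fun k G A D Mx s S hA hD hMx hs hSm hS a ha haM haS hz => ?_⟩
  obtain ⟨α, hαm, hα, hαi⟩ := H G A D Mx (s - k) _ hA hD hMx (by lia)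
    ((measurable_const_smul ((2 : ℝ) ^ k)) hSm) (hS.preimage_smul k) _ (ha.comp_smul k)
    (fun x => haM _) (fun x hx => haS _ hx) (hz.comp_smul k)
  refine ⟨fun x => α ((2 : ℝ) ^ (-k) • x), hαm.comp (measurable_const_smul _),
    fun u hu x => hα u hu _, ?_⟩
  rw [lintegral_comp_zpow_smul]
  refine (mul_le_mul_right hαi _).trans (le_of_eq ?_)
  have hv : volume ((fun y : Rn n => (2 : ℝ) ^ k • y) ⁻¹' S) =
      ENNReal.ofReal (((2 : ℝ) ^ (-k)) ^ n) * volume S := by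
    have := lintegral_comp_zpow_smul k (S.indicator (1 : Rn n → ℝ≥0∞))
    rw [lintegral_indicator_one hSm] at this
    rw [← this, ← lintegral_indicator_one ((measurable_const_smul ((2 : ℝ) ^ k)) hSm)]
    rfl
  rw [hv, mul_left_comm, ← mul_assoc (ENNReal.ofReal (((2 : ℝ) ^ (- -k)) ^ n)),
    ← ENNReal.ofReal_mul (by positivity), ← mul_pow, ← zpow_add₀ (by norm_num)]
  simp

end ShortVariation

namespace ShortVariation

variable {n : ℕ}

/-- The convolution kernel `e^{iλG} A`. -/
def kap (lam : ℝ) (G A : Rn n → ℝ) (x : Rn n) : ℂ := osc lam G x * (A x : ℂ)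

theorem contDiff_osc (lam : ℝ) {G : Rn n → ℝ} (hG : ContDiff ℝ (⊤ : ℕ∞) G) :
    ContDiff ℝ (⊤ : ℕ∞) (osc lam G) := by
  unfold osc
  exact (contDiff_const.mul (Complex.ofRealCLM.contDiff.comp (contDiff_const.mul hG))).cexp

theorem Adm.contDiff_kap {M : ℝ} {G A : Rn n → ℝ} (h : Adm M G A) (lam : ℝ) :
    ContDiff ℝ (⊤ : ℕ∞) (kap lam G A) :=
  (contDiff_osc lam h.phase.1).mul (Complex.ofRealCLM.contDiff.comp h.ampl.1)

theorem Adm.kap_supp {M : ℝ} {G A : Rn n → ℝ} (h : Adm M G A) (lam : ℝ) (x : Rn n)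
    (hx : kap lam G A x ≠ 0) : x ∈ Metric.closedBall (0 : Rn n) 2 := by
  rw [mem_closedBall_zero_iff]
  exact h.supp x fun h0 => hx (by simp [kap, h0])

theorem Adm.hasCompactSupport_kap {M : ℝ} {G A : Rn n → ℝ} (h : Adm M G A) (lam : ℝ) :
    HasCompactSupport (kap lam G A) :=
  hasCompactSupport_of_ball (x0 := 0) (R := 2) fun x hx => by
    simpa using h.kap_supp lam x hx

theorem Adm.norm_kap_le {M : ℝ} {G A : Rn n → ℝ} (h : Adm M G A) (lam : ℝ) (x : Rn n) :
    ‖kap lam G A x‖ ≤ M := by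
  rw [kap, norm_mul, norm_osc, one_mul, Complex.norm_real]
  exact h.ampl.abs_le x

theorem Adm.integrable_kap {M : ℝ} {G A : Rn n → ℝ} (h : Adm M G A) (lam : ℝ) :
    Integrable (kap lam G A) :=
  (h.contDiff_kap lam).continuous.integrable_of_hasCompactSupport (h.hasCompactSupport_kap lam)

theorem norm_integral_le_of_ball {F : Type*} [NormedAddCommGroup F] [NormedSpace ℝ F]
    {f : Rn n → F} {B R : ℝ} (hB : ∀ x, ‖f x‖ ≤ B)
    (hs : ∀ x, f x ≠ 0 → x ∈ Metric.closedBall (0 : Rn n) R) :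
    ‖∫ x, f x‖ ≤ B * volume.real (Metric.closedBall (0 : Rn n) R) := by
  rw [← setIntegral_eq_integral_of_forall_compl_eq_zero (s := Metric.closedBall (0 : Rn n) R)
    fun x hx => by by_contra h0; exact hx (hs x h0)]
  exact norm_setIntegral_le_of_norm_le_const measure_closedBall_lt_top fun x _ => hB x

theorem norm_fourier_kap_le {M lam : ℝ} {G A : Rn n → ℝ} (h : Adm M G A)
    (h0 : ∫ x, kap lam G A x = 0) (ξ : Rn n) :
    ‖𝓕 (kap lam G A) ξ‖ ≤
      4 * Real.pi * M * volume.real (Metric.closedBall (0 : Rn n) 2) * ‖ξ‖ := by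
  have hi := (Real.fourierIntegral_convergent_iff ξ).2 (h.integrable_kap lam)
  have h1 : 𝓕 (kap lam G A) ξ =
      ∫ v, (Real.fourierChar (-inner ℝ v ξ) • kap lam G A v - kap lam G A v) := by
    rw [integral_sub hi (h.integrable_kap lam), h0, sub_zero, Real.fourier_eq]
  rw [h1]
  have hM := h.ampl.nonneg
  refine (norm_integral_le_of_ball (R := 2) (B := 4 * Real.pi * M * ‖ξ‖) (fun v => ?_)
    fun v hv => ?_).trans (le_of_eq (by ring))
  · by_cases hv : kap lam G A v = 0
    · rw [hv]; simp; positivity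
    have hv2 := h.kap_supp lam v hv
    rw [mem_closedBall_zero_iff] at hv2
    have e : Real.fourierChar (-inner ℝ v ξ) • kap lam G A v - kap lam G A v =
        (Complex.exp (Complex.I * (2 * Real.pi * -inner ℝ v ξ : ℝ)) - 1) * kap lam G A v := by
      rw [Circle.smul_def, Real.fourierChar_apply, smul_eq_mul, sub_mul, one_mul, mul_comm Complex.I]
    rw [e, norm_mul]
    have h2 := Real.norm_exp_I_mul_ofReal_sub_one_le (x := 2 * Real.pi * -inner ℝ v ξ)
    have h3 : ‖2 * Real.pi * -inner ℝ v ξ‖ ≤ 2 * Real.pi * (2 * ‖ξ‖) := by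
      rw [norm_mul, norm_neg, Real.norm_of_nonneg (by positivity)]
      gcongr
      exact (norm_inner_le_norm v ξ).trans (by gcongr)
    calc _ ≤ (2 * Real.pi * (2 * ‖ξ‖)) * M :=
          mul_le_mul (h2.trans h3) (h.norm_kap_le lam v) (norm_nonneg _) (by positivity)
      _ = _ := by ring
  · refine h.kap_supp lam v fun h4 => hv (by simp [h4])

theorem SB.norm_fderiv_le {N : ℕ} {M : ℝ} {f : Rn n → ℝ} (hf : SB N M f) (hN : 1 ≤ N) (x : Rn n) :
    ‖fderiv ℝ f x‖ ≤ M := by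
  have := hf.2 1 hN x
  rwa [norm_iteratedFDeriv_one] at this

theorem Adm.norm_fderiv_kap_le {M lam : ℝ} {G A : Rn n → ℝ} (h : Adm M G A) (hl : 0 ≤ lam)
    (x : Rn n) : ‖fderiv ℝ (kap lam G A) x‖ ≤ M + lam * M ^ 2 := by
  have h1 := hasFDerivAt_osc lam h.phase.1 x
  have h2 : HasFDerivAt (fun y => (A y : ℂ)) (Complex.ofRealCLM.comp (fderiv ℝ A x)) x :=
    Complex.ofRealCLM.hasFDerivAt.comp x (h.ampl.1.differentiable (by simp) x).hasFDerivAt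
  have h3 : HasFDerivAt (kap lam G A) _ x := h1.mul h2
  have hM := h.ampl.nonneg
  rw [h3.fderiv]
  have hc : ∀ L : Rn n →L[ℝ] ℝ, ‖Complex.ofRealCLM.comp L‖ ≤ ‖L‖ := fun L =>
    (ContinuousLinearMap.opNorm_comp_le _ _).trans (by rw [Complex.ofRealCLM_norm, one_mul])
  refine (norm_add_le _ _).trans (add_le_add ?_ ?_)
  · rw [norm_smul, norm_osc, one_mul]
    exact (hc _).trans (h.ampl.norm_fderiv_le (by lia) x)
  · rw [norm_smul, norm_smul, norm_smul, norm_osc, one_mul, Complex.norm_real, norm_mul,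
      Complex.norm_I, one_mul, Complex.norm_real, Real.norm_of_nonneg hl]
    have := (hc (fderiv ℝ G x)).trans (h.phase.norm_fderiv_le (by lia) x)
    calc _ ≤ M * (lam * M) := by
          gcongr
          exact h.ampl.abs_le x
      _ = _ := by ring

theorem norm_mul_norm_fourier_kap_le {M lam : ℝ} {G A : Rn n → ℝ} (h : Adm M G A) (hl : 0 ≤ lam)
    (ξ : Rn n) : ‖ξ‖ * ‖𝓕 (kap lam G A) ξ‖ ≤
      (M + lam * M ^ 2) * volume.real (Metric.closedBall (0 : Rn n) 2) := by
  have hcd := h.contDiff_kap lam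
  have hf' : Continuous (fderiv ℝ (kap lam G A)) := hcd.continuous_fderiv (by simp)
  have hs' := (h.hasCompactSupport_kap lam).fderiv (𝕜 := ℝ)
  have key := congrFun (Real.fourier_fderiv (h.integrable_kap lam) (hcd.differentiable (by simp))
    (hf'.integrable_of_hasCompactSupport hs')) ξ
  have h2 := congrArg norm key
  rw [VectorFourier.norm_fourierSMulRight] at h2
  have h3 : ‖(-innerSL ℝ : Rn n →L[ℝ] Rn n →L[ℝ] ℝ) ξ‖ = ‖ξ‖ := by
    rw [_root_.neg_apply, norm_neg, innerSL_apply_norm]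
  rw [h3] at h2
  have h4 : ‖𝓕 (fderiv ℝ (kap lam G A)) ξ‖ ≤
      (M + lam * M ^ 2) * volume.real (Metric.closedBall (0 : Rn n) 2) := by
    rw [Real.fourier_eq]
    refine norm_integral_le_of_ball (fun v => ?_) fun v hv => ?_
    · rw [Circle.norm_smul]
      exact h.norm_fderiv_kap_le hl v
    · have h5 : v ∈ tsupport (kap lam G A) :=
        support_fderiv_subset ℝ fun h6 => hv (by rw [h6, Circle.smul_def, smul_zero])
      exact closure_minimal (fun x hx => h.kap_supp lam x hx) Metric.isClosed_closedBall h5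
  have hp : 1 ≤ 2 * Real.pi := by linarith [Real.pi_gt_three]
  have h6 : 0 ≤ ‖ξ‖ * ‖𝓕 (kap lam G A) ξ‖ := by positivity
  nlinarith

theorem cv_eq (lam : ℝ) (G A : Rn n → ℝ) (f : Rn n → ℂ) (x : Rn n) :
    cv lam G A f x = ∫ y, kap lam G A (x - y) * f y := rfl

theorem enorm_sq_fourier_kap_le (n : ℕ) (M : ℝ) : ∃ C : ℝ, 0 ≤ C ∧
    ∀ (G A : Rn n → ℝ) (lam : ℝ), Adm M G A → 0 < lam → ∀ ξ,
      ‖𝓕 (kap lam G A) ξ‖ ^ 2 ≤ C / lam ^ n := by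
  obtain ⟨C, hC, H⟩ := sqn_cv_le n M
  set V3 := volume.real (Metric.closedBall (0 : Rn n) 3) with hV3
  set V1 := volume.real (Metric.closedBall (0 : Rn n) 1) with hV1
  have hV1p : 0 < V1 := by
    rw [hV1, measureReal_def]
    exact ENNReal.toReal_pos (Metric.measure_closedBall_pos _ _ one_pos).ne'
      measure_closedBall_lt_top.ne
  refine ⟨C * V3 / V1, by positivity, fun G A lam hA hl ξ => ?_⟩
  set e : Rn n → ℂ := fun y => (Real.fourierChar (inner ℝ y ξ) : ℂ) with he
  have hec : Continuous e := by
    rw [he]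
    have := Real.continuous_fourierChar
    fun_prop
  set h : Rn n → ℂ := (Metric.closedBall (0 : Rn n) 3).indicator e with hh
  have hen : ∀ y, ‖e y‖ = 1 := fun y => Circle.norm_coe _
  have hbm : BM h := ⟨hec.measurable.indicator measurableSet_closedBall, 1, fun x =>
    (norm_indicator_le_norm_self _ _).trans (hen x).le⟩
  have h1 := H G A lam hA hl h hbm
  have h2 : sqn h ≤ ENNReal.ofReal V3 := by
    have := sqn_le_of_le_indicator (S := Metric.closedBall (0 : Rn n) 3) measurableSet_closedBall
      zero_le_one (a := h) (fun x => (norm_indicator_le_norm_self _ _).trans (hen x).le)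
      (fun x hx => by by_contra h0; exact hx (indicator_of_notMem h0 _))
    simpa [hV3, ofReal_measureReal measure_closedBall_lt_top.ne] using this
  have h3 : ∀ x ∈ Metric.closedBall (0 : Rn n) 1, ‖cv lam G A h x‖ = ‖𝓕 (kap lam G A) ξ‖ := by
    intro x hx
    have h4 : cv lam G A h x = e x * 𝓕 (kap lam G A) ξ := by
      rw [cv_eq, Real.fourier_eq, ← integral_const_mul,
        ← integral_sub_left_eq_self (fun v => e x *
          Real.fourierChar (-inner ℝ v ξ) • kap lam G A v) volume x]
      congr 1; ext y
      by_cases hk : kap lam G A (x - y) = 0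
      · rw [hk]; simp
      have hy : y ∈ Metric.closedBall (0 : Rn n) 3 := by
        have h5 := hA.kap_supp lam _ hk
        rw [mem_closedBall_zero_iff] at *
        calc ‖y‖ = ‖x - (x - y)‖ := by congr 1; abel
          _ ≤ ‖x‖ + ‖x - y‖ := norm_sub_le _ _
          _ ≤ 3 := by linarith
      rw [hh, indicator_of_mem hy, Circle.smul_def, smul_eq_mul, ← mul_assoc, mul_comm]
      congr 1
      rw [he]
      simp only
      rw [← Circle.coe_mul, ← AddChar.map_add_eq_mul, inner_sub_left]
      congr 2; ring
    rw [h4, norm_mul, hen, one_mul]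
  have h5 : ENNReal.ofReal (‖𝓕 (kap lam G A) ξ‖ ^ 2 * V1) ≤ ENNReal.ofReal (C / lam ^ n * V3) := by
    calc ENNReal.ofReal (‖𝓕 (kap lam G A) ξ‖ ^ 2 * V1)
        = ∫⁻ x in Metric.closedBall (0 : Rn n) 1, ENNReal.ofReal (‖𝓕 (kap lam G A) ξ‖ ^ 2) := by
          rw [setLIntegral_const, ENNReal.ofReal_mul (by positivity), hV1,
            ofReal_measureReal measure_closedBall_lt_top.ne]
      _ ≤ ∫⁻ x in Metric.closedBall (0 : Rn n) 1, ‖cv lam G A h x‖ₑ ^ 2 := by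
          refine setLIntegral_mono' measurableSet_closedBall fun x hx => ?_
          rw [← ofReal_norm, h3 x hx, ENNReal.ofReal_pow (norm_nonneg _)]
      _ ≤ sqn (cv lam G A h) := setLIntegral_le_lintegral _ _
      _ ≤ _ := h1
      _ ≤ _ := by
        rw [ENNReal.ofReal_mul (by positivity)]
        exact mul_le_mul_right h2 _
  have h6 := (ENNReal.ofReal_le_ofReal_iff (by positivity)).1 h5
  rw [← le_div_iff₀ hV1p] at h6
  exact h6.trans (le_of_eq (by ring))

theorem sqn_schwartz_eq (g : SchwartzMap (Rn n) ℂ) :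
    sqn g = ENNReal.ofReal (∫ x, ‖g x‖ ^ 2) := by
  rw [ofReal_integral_eq_lintegral_ofReal ((g.memLp 2 volume).integrable_norm_pow (by norm_num))
    (Eventually.of_forall fun x => by positivity)]
  refine lintegral_congr fun x => ?_
  rw [ENNReal.ofReal_pow (norm_nonneg _), ofReal_norm]

theorem sqn_fourier (f : SchwartzMap (Rn n) ℂ) : sqn (𝓕 f : SchwartzMap (Rn n) ℂ) = sqn f := by
  rw [sqn_schwartz_eq, sqn_schwartz_eq, SchwartzMap.integral_norm_sq_fourier]

theorem sqn_cv_schwartz {M : ℝ} {G A : Rn n → ℝ} (h : Adm M G A) (lam : ℝ)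
    (f : SchwartzMap (Rn n) ℂ) :
    sqn (cv lam G A f) = ∫⁻ ξ, ‖𝓕 (kap lam G A) ξ‖ₑ ^ 2 * ‖𝓕 (⇑f) ξ‖ₑ ^ 2 := by
  set κ : SchwartzMap (Rn n) ℂ :=
    (h.hasCompactSupport_kap lam).toSchwartzMap (h.contDiff_kap lam) with hκ
  have e1 : cv lam G A f = SchwartzMap.convolution (ContinuousLinearMap.mul ℂ ℂ) κ f := by
    ext x
    rw [SchwartzMap.convolution_apply, convolution_eq_swap]
    rfl
  rw [e1, ← sqn_fourier]
  refine lintegral_congr fun ξ => ?_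
  have e2 := SchwartzMap.fourier_convolution_apply (ContinuousLinearMap.mul ℂ ℂ) κ f ξ
  rw [e2, Real.fourier_mul_convolution_eq κ.integrable f.integrable, enorm_mul, mul_pow]
  rfl

theorem fourier_comp_zpow_smul (k : ℤ) (f : Rn n → ℂ) (ξ : Rn n) :
    𝓕 (fun y => f ((2 : ℝ) ^ k • y)) ξ = (((2 : ℝ) ^ (-k)) ^ n : ℝ) • 𝓕 f ((2 : ℝ) ^ (-k) • ξ) := by
  have h := Measure.integral_comp_smul (volume : Measure (Rn n))
    (fun v => Real.fourierChar (-inner ℝ v ((2 : ℝ) ^ (-k) • ξ)) • f v) ((2 : ℝ) ^ k)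
  rw [Real.fourier_eq, Real.fourier_eq]
  rw [finrank_euclideanSpace_fin, abs_of_pos (by positivity)] at h
  rw [zpow_neg, inv_pow, ← zpow_neg, ← h]
  congr 1; ext y
  rw [real_inner_smul_left, real_inner_smul_right, ← mul_assoc, ← zpow_add₀ (by norm_num),
    add_neg_cancel, zpow_zero, one_mul]

theorem sqn_TT_schwartz {M : ℝ} {G A : Rn n → ℝ} (h : Adm M G A) (lam : ℝ) (k : ℤ)
    (f : SchwartzMap (Rn n) ℂ) :
    sqn (TT k lam G A f) =
      ∫⁻ ξ, ‖𝓕 (kap lam G A) ((2 : ℝ) ^ k • ξ)‖ₑ ^ 2 * ‖𝓕 (⇑f) ξ‖ₑ ^ 2 := by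
  have h2 : (2 : ℝ) ^ k ≠ 0 := by positivity
  set fk : SchwartzMap (Rn n) ℂ := SchwartzMap.compCLMOfContinuousLinearEquiv ℂ
    (ContinuousLinearEquiv.smulLeft (Units.mk0 _ h2)) f with hfk
  have e0 : (fun y => f ((2 : ℝ) ^ k • y)) = fk := rfl
  have e1 : sqn (TT k lam G A f) = ENNReal.ofReal (((2 : ℝ) ^ (- -k)) ^ n) *
      sqn (cv lam G A fk) := sqn_comp_smul (-k) _
  rw [e1, sqn_cv_schwartz h, ← e0]
  have e2 := lintegral_comp_zpow_smul k fun ξ : Rn n =>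
    ‖𝓕 (kap lam G A) ξ‖ₑ ^ 2 * ‖𝓕 (⇑f) ((2 : ℝ) ^ (-k) • ξ)‖ₑ ^ 2
  simp only [zpow_neg_smul] at e2
  rw [e2, ← lintegral_const_mul' _ _ ENNReal.ofReal_ne_top,
    ← lintegral_const_mul' _ _ ENNReal.ofReal_ne_top]
  refine lintegral_congr fun ξ => ?_
  have h3 : ENNReal.ofReal (((2 : ℝ) ^ (- -k)) ^ n) * ENNReal.ofReal (((2 : ℝ) ^ (-k)) ^ n) = 1 := by
    rw [← ENNReal.ofReal_mul (by positivity), ← mul_pow, ← zpow_add₀ (by norm_num)]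
    simp
  rw [fourier_comp_zpow_smul, enorm_smul, Real.enorm_of_nonneg (by positivity)]
  calc _ = (ENNReal.ofReal (((2 : ℝ) ^ (- -k)) ^ n) * ENNReal.ofReal (((2 : ℝ) ^ (-k)) ^ n)) *
        ENNReal.ofReal (((2 : ℝ) ^ (-k)) ^ n) *
        (‖𝓕 (kap lam G A) ξ‖ₑ ^ 2 * ‖𝓕 (⇑f) ((2 : ℝ) ^ (-k) • ξ)‖ₑ ^ 2) := by ring
    _ = _ := by rw [h3, one_mul]

theorem summable_pow_natAbs {q : ℝ} (h0 : 0 ≤ q) (h1 : q < 1) :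
    Summable fun c : ℤ => q ^ c.natAbs := by
  rw [summable_int_iff_summable_nat_and_neg]
  simpa using summable_geometric_of_lt_one h0 h1

theorem tsum_comp_le {ι : Type*} {k : ι → ℤ} {Mu : ℕ} (hk : ∀ c, (k ⁻¹' {c}).encard ≤ Mu)
    (w : ℤ → ℝ≥0∞) : ∑' j, w (k j) ≤ Mu * ∑' c, w c := by
  rw [← (Equiv.sigmaFiberEquiv k).tsum_eq, ENNReal.tsum_sigma', ← ENNReal.tsum_mul_left]
  refine ENNReal.tsum_le_tsum fun c => ?_
  have e : ∀ j : {j // k j = c}, w (k ((Equiv.sigmaFiberEquiv k) ⟨c, j⟩)) = w c := fun j => by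
    rw [Equiv.sigmaFiberEquiv_apply, j.2]
  simp_rw [e]
  rw [ENNReal.tsum_const]
  refine mul_le_mul_left ?_ _
  have : ENat.card {j // k j = c} ≤ Mu := hk c
  exact_mod_cast this

theorem norm_fourier_kap_sq_le (n : ℕ) (M : ℝ) : ∃ C : ℝ, 0 ≤ C ∧
    ∀ (G A : Rn n → ℝ) (lam η : ℝ), Adm M G A → 1 ≤ 2 * lam → 0 ≤ η → η ≤ 1 →
      ∫ x, kap lam G A x = 0 → ∀ ξ, ξ ≠ 0 →
      ‖𝓕 (kap lam G A) ξ‖ ^ 2 ≤ C * lam ^ (-(n : ℝ) + (n + 2) * η) *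
        (min (‖ξ‖ ^ 2) (‖ξ‖ ^ 2)⁻¹) ^ η := by
  obtain ⟨C1, hC1, H1⟩ := enorm_sq_fourier_kap_le n M
  set V2 := volume.real (Metric.closedBall (0 : Rn n) 2) with hV2
  set C2 := 4 * Real.pi * |M| * V2 with hC2
  set C3 := (2 * |M| + M ^ 2) * V2 with hC3
  set C := C1 + 4 * C2 ^ 2 + C3 ^ 2 with hC
  have hC20 : 0 ≤ C2 := by positivity
  have hC30 : 0 ≤ C3 := by positivity
  have hC0 : 0 ≤ C := by positivity
  refine ⟨C, hC0, fun G A lam η hA hl hη hη1 hz ξ hξ => ?_⟩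
  have hM : |M| = M := abs_of_nonneg hA.phase.nonneg
  have hl0 : 0 < lam := by linarith
  have hX : 0 < ‖ξ‖ := norm_pos_iff.2 hξ
  set a := ‖𝓕 (kap lam G A) ξ‖ with ha
  have ha0 : 0 ≤ a := norm_nonneg _
  have b1 : a ^ 2 ≤ C * lam ^ (-(n : ℝ)) := by
    refine (H1 G A lam hA hl0 ξ).trans ?_
    rw [Real.rpow_neg hl0.le, Real.rpow_natCast, div_eq_mul_inv]
    refine mul_le_mul_of_nonneg_right ?_ (by positivity)
    rw [hC]; nlinarith [sq_nonneg C2, sq_nonneg C3]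
  set m := min (‖ξ‖ ^ 2) (‖ξ‖ ^ 2)⁻¹ with hm
  have hm0 : 0 ≤ m := by positivity
  have b2 : a ^ 2 ≤ C * (lam ^ 2 * m) := by
    rw [hm, mul_min_of_nonneg _ _ (by positivity), mul_min_of_nonneg _ _ hC0]
    refine le_min ?_ ?_
    · have := norm_fourier_kap_le hA hz ξ
      rw [← hV2, ← hM, ← hC2] at this
      calc a ^ 2 ≤ (C2 * ‖ξ‖) ^ 2 := by gcongr
        _ ≤ (2 * lam) ^ 2 * (C2 * ‖ξ‖) ^ 2 :=
          le_mul_of_one_le_left (by positivity) (one_le_pow₀ hl)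
        _ = 4 * C2 ^ 2 * (lam ^ 2 * ‖ξ‖ ^ 2) := by ring
        _ ≤ _ := by gcongr; rw [hC]; nlinarith [sq_nonneg C2, sq_nonneg C3]
    · have := norm_mul_norm_fourier_kap_le hA hl0.le ξ
      have h2 : ‖ξ‖ * a ≤ lam * C3 := by
        refine this.trans ?_
        rw [hC3, ← hV2, hM, ← mul_assoc]
        refine mul_le_mul_of_nonneg_right ?_ (by positivity)
        nlinarith [hA.phase.nonneg]
      have h3 : a ≤ lam * C3 * ‖ξ‖⁻¹ := by
        rw [← div_eq_mul_inv, le_div_iff₀ hX]; linarith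
      calc a ^ 2 ≤ (lam * C3 * ‖ξ‖⁻¹) ^ 2 := by gcongr
        _ = C3 ^ 2 * (lam ^ 2 * (‖ξ‖ ^ 2)⁻¹) := by rw [mul_pow, mul_pow, inv_pow]; ring
        _ ≤ _ := by gcongr; rw [hC]; nlinarith [sq_nonneg C2, sq_nonneg C3]
  have e1 : a ^ 2 = (a ^ 2) ^ (1 - η) * (a ^ 2) ^ η := by
    rcases ha0.eq_or_lt with h | h
    · rw [← h]
      rcases hη.eq_or_lt with h' | h'
      · rw [← h']; simp
      · rw [zero_pow (by norm_num), Real.zero_rpow h'.ne', mul_zero]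
    · rw [← Real.rpow_add (by positivity)]; simp
  rw [e1]
  calc (a ^ 2) ^ (1 - η) * (a ^ 2) ^ η
      ≤ (C * lam ^ (-(n : ℝ))) ^ (1 - η) * (C * (lam ^ 2 * m)) ^ η := by
        gcongr
    _ = (C ^ (1 - η) * C ^ η) * ((lam ^ (-(n : ℝ))) ^ (1 - η) * (lam ^ 2) ^ η) * m ^ η := by
        rw [Real.mul_rpow hC0 (by positivity), Real.mul_rpow hC0 (by positivity),
          Real.mul_rpow (by positivity) hm0]; ring
    _ ≤ _ := by
        refine mul_le_mul_of_nonneg_right ?_ (by positivity)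
        refine mul_le_mul (le_of_eq ?_) (le_of_eq ?_) (by positivity) hC0
        · rw [← Real.rpow_add_of_nonneg hC0 (by linarith) hη]; simp
        · rw [← Real.rpow_mul hl0.le, ← Real.rpow_natCast, ← Real.rpow_mul hl0.le,
            ← Real.rpow_add hl0]
          congr 1; push_cast; ring

theorem min_sq_inv_le {x : ℝ} (hx : 0 < x) : ∃ e : ℤ, ∀ k : ℤ,
    min (((2 : ℝ) ^ k * x) ^ 2) (((2 : ℝ) ^ k * x) ^ 2)⁻¹ ≤ 4 * (1 / 4 : ℝ) ^ (k + e).natAbs := by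
  obtain ⟨e, he1, he2⟩ := exists_mem_Ico_zpow hx (show (1 : ℝ) < 2 by norm_num)
  refine ⟨e, fun k => ?_⟩
  have h1 : (2 : ℝ) ^ (k + e) ≤ 2 ^ k * x := by
    rw [zpow_add₀ (by norm_num)]; gcongr
  have h2 : 2 ^ k * x ≤ 2 * (2 : ℝ) ^ (k + e) := by
    have : (2 : ℝ) ^ (k + e) = 2 ^ k * 2 ^ e := zpow_add₀ (by norm_num) _ _
    rw [this]
    rw [zpow_add_one₀ (by norm_num)] at he2
    have h3 : (0 : ℝ) < 2 ^ k := by positivity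
    nlinarith
  have hq : (1 / 4 : ℝ) = (2 ^ 2)⁻¹ := by norm_num
  rcases le_total 0 (k + e) with h | h
  · refine (min_le_right _ _).trans ?_
    obtain ⟨c, hc⟩ := Int.eq_ofNat_of_zero_le h
    rw [hc] at h1 ⊢
    rw [Int.natAbs_natCast, hq, inv_pow, ← pow_mul, mul_comm 2 c, pow_mul]
    rw [zpow_natCast] at h1
    calc _ ≤ ((2 ^ c : ℝ) ^ 2)⁻¹ := by gcongr
      _ ≤ _ := le_mul_of_one_le_left (by positivity) (by norm_num)
  · refine (min_le_left _ _).trans ?_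
    obtain ⟨c, hc⟩ := Int.eq_ofNat_of_zero_le (neg_nonneg.2 h)
    rw [← Int.natAbs_neg, hc, Int.natAbs_natCast, hq, inv_pow, ← pow_mul, mul_comm 2 c, pow_mul]
    have hc' : k + e = -(c : ℤ) := by lia
    rw [hc', zpow_neg, zpow_natCast] at h2
    calc _ ≤ (2 * (2 ^ c : ℝ)⁻¹) ^ 2 := by gcongr
      _ = _ := by rw [mul_pow, inv_pow]; norm_num

/-- Square function bound for the rescaled operators. -/
theorem tsum_sqn_TT_schwartz (n : ℕ) (hn : 0 < n) (M η : ℝ) (hη : 0 < η) (hη1 : η ≤ 1) (Mu : ℕ) :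
    ∃ C : ℝ, 0 ≤ C ∧ ∀ (ι : Type) [Countable ι] (k : ι → ℤ) (G A : ι → Rn n → ℝ) (lam : ℝ),
      (∀ j, Adm M (G j) (A j)) → 1 ≤ 2 * lam → (∀ c, (k ⁻¹' {c}).encard ≤ Mu) →
      (∀ j, ∫ x, kap lam (G j) (A j) x = 0) → ∀ f : SchwartzMap (Rn n) ℂ,
      ∑' j, sqn (TT (k j) lam (G j) (A j) f) ≤
        ENNReal.ofReal (C * lam ^ (-(n : ℝ) + (n + 2) * η)) * sqn f := by
  obtain ⟨C, hC, H⟩ := norm_fourier_kap_sq_le n M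
  set q : ℝ := (1 / 4 : ℝ) ^ η with hq
  have hq0 : 0 ≤ q := by positivity
  have hq1 : q < 1 := Real.rpow_lt_one (by norm_num) (by norm_num) hη
  have hs := summable_pow_natAbs hq0 hq1
  set W := ∑' c : ℤ, q ^ c.natAbs with hW
  have hW0 : 0 ≤ W := tsum_nonneg fun c => by positivity
  refine ⟨C * 4 ^ η * (Mu * W), by positivity, fun ι _ k G A lam hA hl hk hz f => ?_⟩
  have hl0 : 0 < lam := by linarith
  set L := lam ^ (-(n : ℝ) + (n + 2) * η) with hL
  have hL0 : 0 < L := by positivity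
  have hm : ∀ j, AEMeasurable (fun ξ : Rn n =>
      ‖𝓕 (kap lam (G j) (A j)) ((2 : ℝ) ^ k j • ξ)‖ₑ ^ 2 * ‖𝓕 (⇑f) ξ‖ₑ ^ 2) := fun j => by
    have c1 : Continuous (𝓕 (kap lam (G j) (A j))) := by
      set κ : SchwartzMap (Rn n) ℂ :=
        ((hA j).hasCompactSupport_kap lam).toSchwartzMap ((hA j).contDiff_kap lam)
      exact (𝓕 κ : SchwartzMap (Rn n) ℂ).continuous
    have c2 : Continuous (𝓕 (⇑f)) := (𝓕 f : SchwartzMap (Rn n) ℂ).continuous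
    have c3 := c1.comp (continuous_const_smul ((2 : ℝ) ^ k j))
    exact ((c3.measurable.enorm.pow_const 2).mul (c2.measurable.enorm.pow_const 2)).aemeasurable
  simp_rw [fun j => sqn_TT_schwartz (hA j) lam (k j) f]
  rw [← lintegral_tsum hm, ← sqn_fourier f, sqn, ← lintegral_const_mul' _ _ ENNReal.ofReal_ne_top]
  refine lintegral_mono_ae ?_
  have hne : ∀ᵐ ξ : Rn n, ξ ≠ 0 := by
    have : Nonempty (Fin n) := ⟨⟨0, hn⟩⟩
    have : Nontrivial (Rn n) := inferInstance
    exact Measure.ae_ne volume 0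
  filter_upwards [hne] with ξ hξ
  rw [ENNReal.tsum_mul_right]
  refine mul_le_mul_left ?_ _
  obtain ⟨e, he⟩ := min_sq_inv_le (norm_pos_iff.2 hξ)
  calc ∑' j, ‖𝓕 (kap lam (G j) (A j)) ((2 : ℝ) ^ k j • ξ)‖ₑ ^ 2
      ≤ ∑' j, ENNReal.ofReal (C * L * 4 ^ η) * ENNReal.ofReal (q ^ (k j + e).natAbs) := by
        refine ENNReal.tsum_le_tsum fun j => ?_
        have h2 : (2 : ℝ) ^ k j • ξ ≠ 0 := smul_ne_zero (by positivity) hξ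
        have h3 := H (G j) (A j) lam η (hA j) hl hη.le hη1 (hz j) _ h2
        rw [← ofReal_norm, ← ENNReal.ofReal_pow (norm_nonneg _), ← ENNReal.ofReal_mul (by positivity)]
        refine ENNReal.ofReal_le_ofReal (h3.trans ?_)
        rw [norm_smul, Real.norm_of_nonneg (by positivity), mul_assoc (C * L)]
        refine mul_le_mul_of_nonneg_left ?_ (by positivity)
        calc _ ≤ (4 * (1 / 4 : ℝ) ^ (k j + e).natAbs) ^ η := by gcongr; exact he _
          _ = _ := by
            rw [Real.mul_rpow (by norm_num) (by positivity), hq, ← Real.rpow_natCast,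
              ← Real.rpow_natCast, ← Real.rpow_mul (by norm_num), ← Real.rpow_mul (by norm_num),
              mul_comm η]
    _ = ENNReal.ofReal (C * L * 4 ^ η) * ∑' j, ENNReal.ofReal (q ^ (k j + e).natAbs) :=
        ENNReal.tsum_mul_left
    _ ≤ ENNReal.ofReal (C * L * 4 ^ η) * (Mu * ∑' c : ℤ, ENNReal.ofReal (q ^ (c + e).natAbs)) :=
        mul_le_mul_right (tsum_comp_le hk fun c => ENNReal.ofReal (q ^ (c + e).natAbs)) _
    _ = _ := by
        have h4 := (Equiv.addRight e).tsum_eq fun c : ℤ => ENNReal.ofReal (q ^ c.natAbs)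
        simp only [Equiv.coe_addRight] at h4
        rw [h4, ← ENNReal.ofReal_tsum_of_nonneg (fun c => by positivity) hs, ← hW,
          ← ENNReal.ofReal_natCast, ← ENNReal.ofReal_mul (by positivity),
          ← ENNReal.ofReal_mul (by positivity)]
        congr 1; ring

theorem TT_sub {M lam : ℝ} {G A : Rn n → ℝ} (h : Adm M G A) (k : ℤ) {f g : Rn n → ℂ} (hf : BM f)
    (hg : BM g) (x : Rn n) :
    TT k lam G A (fun y => f y - g y) x = TT k lam G A f x - TT k lam G A g x := by
  unfold TT cv opK
  rw [← integral_sub (h.integrable (hf.comp_smul k) _) (h.integrable (hg.comp_smul k) _)]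
  congr 1; ext y; ring

theorem TT_add {M lam : ℝ} {G A : Rn n → ℝ} (h : Adm M G A) (k : ℤ) {f g : Rn n → ℂ} (hf : BM f)
    (hg : BM g) (x : Rn n) :
    TT k lam G A (fun y => f y + g y) x = TT k lam G A f x + TT k lam G A g x := by
  unfold TT cv opK
  rw [← integral_add (h.integrable (hf.comp_smul k) _) (h.integrable (hg.comp_smul k) _)]
  congr 1; ext y; ring

theorem enorm_add_sq_le (a b : ℂ) : ‖a + b‖ₑ ^ 2 ≤ 2 * (‖a‖ₑ ^ 2 + ‖b‖ₑ ^ 2) := by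
  have h : ‖a + b‖ ^ 2 ≤ 2 * (‖a‖ ^ 2 + ‖b‖ ^ 2) := by
    have := norm_add_le a b
    have h0 := norm_nonneg (a + b)
    nlinarith [sq_nonneg (‖a‖ - ‖b‖)]
  rw [← ofReal_norm, ← ofReal_norm, ← ofReal_norm, ← ENNReal.ofReal_pow (norm_nonneg _),
    ← ENNReal.ofReal_pow (norm_nonneg _), ← ENNReal.ofReal_pow (norm_nonneg _),
    ← ENNReal.ofReal_add (by positivity) (by positivity), ← ENNReal.ofReal_ofNat,
    ← ENNReal.ofReal_mul (by norm_num)]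
  exact ENNReal.ofReal_le_ofReal h

theorem sqn_le_add {F a b : Rn n → ℂ} (ha : Measurable a) (h : ∀ x, F x = a x + b x) :
    sqn F ≤ 2 * (sqn a + sqn b) := by
  unfold sqn
  rw [← lintegral_add_left (ha.enorm.pow_const 2), ← lintegral_const_mul' _ _ (by norm_num)]
  exact lintegral_mono fun x => by rw [h]; exact enorm_add_sq_le _ _

theorem sqn_eq_eLpNorm (h : Rn n → ℂ) : sqn h = eLpNorm h 2 volume ^ 2 := by
  rw [eLpNorm_eq_lintegral_rpow_enorm_toReal (by norm_num) (by norm_num), ENNReal.toReal_ofNat,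
    ← ENNReal.rpow_natCast, ← ENNReal.rpow_mul]
  simp [sqn]

theorem tsum_sqn_TT_le (n : ℕ) (hn : 0 < n) (M η : ℝ) (hη : 0 < η) (hη1 : η ≤ 1) (Mu : ℕ) :
    ∃ C : ℝ, 0 ≤ C ∧ ∀ (ι : Type) [Countable ι] (k : ι → ℤ) (G A : ι → Rn n → ℝ) (lam : ℝ),
      (∀ j, Adm M (G j) (A j)) → 1 ≤ 2 * lam → (∀ c, (k ⁻¹' {c}).encard ≤ Mu) →
      (∀ j, ∫ x, kap lam (G j) (A j) x = 0) → ∀ f, BM f → sqn f < ∞ →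
      ∑' j, sqn (TT (k j) lam (G j) (A j) f) ≤
        ENNReal.ofReal (C * lam ^ (-(n : ℝ) + (n + 2) * η)) * sqn f := by
  obtain ⟨C, hC, H⟩ := tsum_sqn_TT_schwartz n hn M η hη hη1 Mu
  obtain ⟨C1, hC1, H1⟩ := sqn_TT_le n M
  refine ⟨4 * C, by positivity, fun ι _ k G A lam hA hl hk hz f hf hfin => ?_⟩
  have hl0 : 0 < lam := by linarith
  set Z := ENNReal.ofReal (C * lam ^ (-(n : ℝ) + (n + 2) * η)) with hZ
  set Y := ENNReal.ofReal (C1 / lam ^ n) with hY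
  have hf2 : MemLp f 2 volume := by
    refine ⟨hf.1.aestronglyMeasurable, ?_⟩
    rw [sqn_eq_eLpNorm] at hfin
    exact lt_of_not_ge fun h => absurd hfin (by rw [top_le_iff.1 h]; simp)
  have e4 : ENNReal.ofReal (4 * C * lam ^ (-(n : ℝ) + (n + 2) * η)) = 4 * Z := by
    rw [hZ, mul_assoc, ENNReal.ofReal_mul (by norm_num), ENNReal.ofReal_ofNat]
  rw [e4]
  rw [ENNReal.tsum_eq_iSup_sum]
  refine iSup_le fun J => ?_
  set N : ℝ≥0∞ := (J.card : ℝ≥0∞) with hN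
  have key : ∀ ε : ℝ≥0, 0 < ε → ∑ j ∈ J, sqn (TT (k j) lam (G j) (A j) f) ≤
      4 * Z * sqn f + (4 * Z + 2 * N * Y) * (ε : ℝ≥0∞) ^ 2 := by
    intro ε hε
    obtain ⟨g, hg1, hg2, hg3⟩ := hf2.exist_eLpNorm_sub_le (by norm_num) (by norm_num) (ε := ε)
      (by exact_mod_cast hε)
    set gs : SchwartzMap (Rn n) ℂ := hg1.toSchwartzMap hg2 with hgs
    have hgb : BM g := ⟨gs.continuous.measurable, by
      obtain ⟨B, hB⟩ := hg1.exists_bound_of_continuous hg2.continuous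
      exact ⟨B, hB⟩⟩
    have hd : sqn (fun y => f y - g y) ≤ (ε : ℝ≥0∞) ^ 2 := by
      rw [sqn_eq_eLpNorm]
      refine pow_le_pow_left' (hg3.trans (le_of_eq ?_)) 2
      simp
    have hdb : BM fun y => f y - g y := by
      obtain ⟨hm, B, hB⟩ := hf
      obtain ⟨hm', B', hB'⟩ := hgb
      exact ⟨hm.sub hm', B + B', fun x => (norm_sub_le _ _).trans (add_le_add (hB x) (hB' x))⟩
    have hg' : sqn g ≤ 2 * (sqn f + (ε : ℝ≥0∞) ^ 2) := by
      refine (sqn_le_add (a := f) (b := fun y => g y - f y) hf.1 fun x => by ring).trans ?_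
      gcongr
      refine le_trans (le_of_eq ?_) hd
      exact lintegral_congr fun x => by rw [← enorm_neg, neg_sub]
    have h1 : ∀ j ∈ J, sqn (TT (k j) lam (G j) (A j) f) ≤
        2 * sqn (TT (k j) lam (G j) (A j) g) + 2 * (Y * (ε : ℝ≥0∞) ^ 2) := fun j _ => by
      refine (sqn_le_add (a := TT (k j) lam (G j) (A j) g)
        (b := TT (k j) lam (G j) (A j) fun y => f y - g y) (measurable_TT (hA j) _ hgb.1)
        fun x => by rw [TT_sub (hA j) _ hf hgb]; ring).trans ?_
      rw [mul_add]
      gcongr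
      exact (H1 (k j) (G j) (A j) lam (hA j) hl0 _ hdb).trans (mul_le_mul_right hd _)
    calc _ ≤ ∑ j ∈ J, (2 * sqn (TT (k j) lam (G j) (A j) g) + 2 * (Y * (ε : ℝ≥0∞) ^ 2)) :=
          Finset.sum_le_sum h1
      _ = 2 * ∑ j ∈ J, sqn (TT (k j) lam (G j) (A j) g) + N * (2 * (Y * (ε : ℝ≥0∞) ^ 2)) := by
          rw [Finset.sum_add_distrib, Finset.sum_const, Finset.mul_sum, nsmul_eq_mul]
      _ ≤ 2 * (Z * (2 * (sqn f + (ε : ℝ≥0∞) ^ 2))) + N * (2 * (Y * (ε : ℝ≥0∞) ^ 2)) := by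
          gcongr
          refine (ENNReal.sum_le_tsum J).trans ((H ι k G A lam hA hl hk hz gs).trans ?_)
          exact mul_le_mul_right hg' _
      _ = _ := by ring
  have hcoef : 4 * Z + 2 * N * Y ≠ ∞ := by
    rw [hZ, hY, hN]
    finiteness
  have hlim : Tendsto (fun ε : ℝ≥0 => 4 * Z * sqn f + (4 * Z + 2 * N * Y) * (ε : ℝ≥0∞) ^ 2)
      (𝓝[>] 0) (𝓝 (4 * Z * sqn f + (4 * Z + 2 * N * Y) * 0)) := by
    refine tendsto_const_nhds.add (ENNReal.Tendsto.const_mul ?_ (Or.inr hcoef))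
    have : Tendsto (fun ε : ℝ≥0 => (ε : ℝ≥0∞) ^ 2) (𝓝 0) (𝓝 (((0 : ℝ≥0) : ℝ≥0∞) ^ 2)) :=
      ((ENNReal.continuous_pow 2).comp ENNReal.continuous_coe).tendsto 0
    simpa using this.mono_left nhdsWithin_le_nhds
  rw [mul_zero, add_zero] at hlim
  exact ge_of_tendsto hlim (eventually_mem_nhdsWithin.mono fun ε hε => key ε hε)

end ShortVariation

namespace ShortVariation
variable {n : ℕ}

/-- The average of `‖f‖` over the dyadic cell of side `2 ^ s` containing `x`. -/
def nav (f : Rn n → ℂ) (s : ℤ) (x : Rn n) : ℝ :=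
  (((2 : ℝ) ^ s) ^ n)⁻¹ * ∫ y in cube s (cell s x), ‖f y‖

/-- The average of `f` over the dyadic cell of side `2 ^ s` containing `x`. -/
def cav (f : Rn n → ℂ) (s : ℤ) (x : Rn n) : ℂ :=
  ((((2 : ℝ) ^ s) ^ n)⁻¹ : ℝ) * ∫ y in cube s (cell s x), f y

/-- The points whose maximal dyadic cell with average above `2 ^ i` has side `2 ^ s`. -/
def stopCells (f : Rn n → ℂ) (i s : ℤ) : Set (Rn n) :=
  {x | (2 : ℝ) ^ i < nav f s x ∧ ∀ s' > s, nav f s' x ≤ (2 : ℝ) ^ i}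

theorem norm_cav_le (f : Rn n → ℂ) (s : ℤ) (x : Rn n) : ‖cav f s x‖ ≤ nav f s x := by
  rw [cav, nav, norm_mul, Complex.norm_real, Real.norm_of_nonneg (by positivity)]
  gcongr
  exact norm_integral_le_integral_norm _

theorem measurable_nav (f : Rn n → ℂ) (s : ℤ) : Measurable (nav f s) := by
  have : Measurable fun v : Fin n → ℤ => (((2 : ℝ) ^ s) ^ n)⁻¹ * ∫ y in cube s v, ‖f y‖ :=
    measurable_of_countable _
  exact this.comp (measurable_cell s)

theorem measurable_cav (f : Rn n → ℂ) (s : ℤ) : Measurable (cav f s) := by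
  have : Measurable fun v : Fin n → ℤ =>
      ((((2 : ℝ) ^ s) ^ n)⁻¹ : ℝ) * ∫ y in cube s v, f y := measurable_of_countable _
  exact this.comp (measurable_cell s)

theorem nav_congr (f : Rn n → ℂ) {s : ℤ} {x y : Rn n} (h : cell s x = cell s y) :
    nav f s x = nav f s y := by rw [nav, nav, h]

theorem measurableSet_stop (f : Rn n → ℂ) (i s : ℤ) : MeasurableSet (stopCells f i s) := by
  have : stopCells f i s = {x | (2 : ℝ) ^ i < nav f s x} ∩
      ⋂ s', ⋂ (_ : s' > s), {x | nav f s' x ≤ (2 : ℝ) ^ i} := by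
    ext x; simp [stopCells]
  rw [this]
  refine (measurableSet_lt measurable_const (measurable_nav f s)).inter ?_
  exact MeasurableSet.iInter fun s' => MeasurableSet.iInter fun _ =>
    measurableSet_le (measurable_nav f s') measurable_const

theorem sat_stop (f : Rn n → ℂ) (i s : ℤ) : Sat s (stopCells f i s) := by
  intro y y' h hy
  refine ⟨by rw [← nav_congr f h]; exact hy.1, fun s' hs' => ?_⟩
  rw [← nav_congr f (cell_eq_of_le hs'.le h)]
  exact hy.2 s' hs'

theorem stop_unique {f : Rn n → ℂ} {i s s' : ℤ} {x : Rn n} (h : x ∈ stopCells f i s)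
    (h' : x ∈ stopCells f i s') : s = s' := by
  rcases lt_trichotomy s s' with hl | hl | hl
  · exact absurd h'.1 (not_lt.2 (h.2 _ hl))
  · exact hl
  · exact absurd h.1 (not_lt.2 (h'.2 _ hl))

theorem nav_le (hn : 0 < n) {f : Rn n → ℂ} (hf : Integrable f) (s : ℤ) (x : Rn n) :
    nav f s x ≤ (((2 : ℝ) ^ s) ^ n)⁻¹ * ∫ y, ‖f y‖ := by
  rw [nav]
  exact mul_le_mul_of_nonneg_left
    (setIntegral_le_integral hf.norm (ae_of_all _ fun y => norm_nonneg _)) (by positivity)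

theorem exists_stop (hn : 0 < n) {f : Rn n → ℂ} (hf : Integrable f) {i s : ℤ} {x : Rn n}
    (h : (2 : ℝ) ^ i < nav f s x) : ∃ s' ≥ s, x ∈ stopCells f i s' := by
  have hb : ∃ b : ℤ, ∀ z : ℤ, (2 : ℝ) ^ i < nav f z x → z ≤ b := by
    obtain ⟨N, hN⟩ := pow_unbounded_of_one_lt (((2 : ℝ) ^ i)⁻¹ * ∫ y, ‖f y‖) (one_lt_two)
    refine ⟨N, fun z hz => ?_⟩
    by_contra hlt
    push Not at hlt
    have h1 := hz.trans_le (nav_le hn hf z x)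
    have h2 : (2 : ℝ) ^ N ≤ ((2 : ℝ) ^ z) ^ n := by
      have e1 : (2 : ℝ) ^ N ≤ (2 : ℝ) ^ z := by
        rw [← zpow_natCast]
        exact zpow_le_zpow_right₀ one_le_two hlt.le
      have e2 : (1 : ℝ) ≤ 2 ^ z := le_trans (one_le_pow₀ one_le_two) e1
      exact e1.trans (le_self_pow₀ e2 hn.ne')
    have hp : (0 : ℝ) < ((2 : ℝ) ^ z) ^ n := by positivity
    have hi : (0 : ℝ) < (2 : ℝ) ^ i := by positivity
    rw [inv_mul_eq_div, lt_div_iff₀ hp] at h1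
    rw [inv_mul_eq_div, div_lt_iff₀ hi] at hN
    nlinarith
  obtain ⟨s', h1, h2⟩ := Int.exists_greatest_of_bdd hb ⟨s, h⟩
  exact ⟨s', h2 s h, h1, fun z hz => not_lt.1 fun hc => absurd (h2 z hc) (not_le.2 hz)⟩

theorem nav_le_succ {f : Rn n → ℂ} (hf : Integrable f) (s : ℤ) (x : Rn n) :
    nav f s x ≤ 2 ^ n * nav f (s + 1) x := by
  have h : ∫ y in cube s (cell s x), ‖f y‖ ≤ ∫ y in cube (s + 1) (cell (s + 1) x), ‖f y‖ := by
    refine setIntegral_mono_set hf.norm.integrableOn (ae_of_all _ fun y => norm_nonneg _) ?_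
    refine LE.le.eventuallyLE fun y hy => ?_
    exact cell_eq_of_le (by omega) hy
  rw [nav, nav, zpow_add_one₀ (by norm_num), mul_pow, mul_inv]
  have : (0 : ℝ) < 2 ^ n := by positivity
  calc _ ≤ (((2 : ℝ) ^ s) ^ n)⁻¹ * ∫ y in cube (s + 1) (cell (s + 1) x), ‖f y‖ := by gcongr
    _ = _ := by field_simp

theorem nav_le_of_mem_stop {f : Rn n → ℂ} (hf : Integrable f) {i s : ℤ} {x : Rn n}
    (h : x ∈ stopCells f i s) : nav f s x ≤ 2 ^ n * 2 ^ i :=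
  (nav_le_succ hf s x).trans (by gcongr; exact h.2 _ (by omega))

theorem volume_real_cube (s : ℤ) (v : Fin n → ℤ) :
    volume.real (cube s v) = ((2 : ℝ) ^ s) ^ n := by
  rw [measureReal_def, volume_cube, ENNReal.toReal_pow, ENNReal.toReal_ofReal (by positivity)]

theorem volume_cube_lt_top (s : ℤ) (v : Fin n → ℤ) : volume (cube s v) < ∞ := by
  rw [volume_cube]; exact ENNReal.pow_lt_top ENNReal.ofReal_lt_top

theorem nav_le_of_le {f : Rn n → ℂ} (hf : Integrable f) {B : ℝ} (hB : ∀ x, ‖f x‖ ≤ B) (s : ℤ)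
    (x : Rn n) : nav f s x ≤ B := by
  have hp : (0 : ℝ) < ((2 : ℝ) ^ s) ^ n := by positivity
  have : ∫ y in cube s (cell s x), ‖f y‖ ≤ ∫ _y in cube s (cell s x), B :=
    setIntegral_mono hf.norm.integrableOn (integrableOn_const (volume_cube_lt_top _ _).ne)
      fun y => hB y
  rw [setIntegral_const, volume_real_cube, smul_eq_mul] at this
  rw [nav, inv_mul_eq_div, div_le_iff₀ hp]
  linarith

theorem le_nav_of_ge {f : Rn n → ℂ} (hf : Integrable f) {B : ℝ} {s : ℤ}
    {x : Rn n} (hB : ∀ y ∈ cube s (cell s x), B ≤ ‖f y‖) : B ≤ nav f s x := by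
  have hp : (0 : ℝ) < ((2 : ℝ) ^ s) ^ n := by positivity
  have : ∫ _y in cube s (cell s x), B ≤ ∫ y in cube s (cell s x), ‖f y‖ :=
    setIntegral_mono_on (integrableOn_const (volume_cube_lt_top _ _).ne) hf.norm.integrableOn
      (measurableSet_cube _ _) hB
  rw [setIntegral_const, volume_real_cube, smul_eq_mul] at this
  rw [nav, inv_mul_eq_div, le_div_iff₀ hp]
  linarith

theorem norm_le_of_notMem_stop (hn : 0 < n) {f : Rn n → ℂ} (hf : Integrable f)
    (hc : Continuous f) {i : ℤ} {x : Rn n} (h : ∀ s, x ∉ stopCells f i s) : ‖f x‖ ≤ 2 ^ i := by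
  by_contra hlt
  push Not at hlt
  obtain ⟨B, hB1, hB2⟩ := exists_between hlt
  have := (hc.norm.tendsto x).eventually (lt_mem_nhds hB2)
  obtain ⟨δ, hδ, hball⟩ := Metric.eventually_nhds_iff.1 this
  have hn' : (0 : ℝ) < n := by exact_mod_cast hn
  obtain ⟨N, hN⟩ := exists_pow_lt_of_lt_one (show 0 < δ / (2 * n) by positivity)
    (show (2 : ℝ)⁻¹ < 1 by norm_num)
  have hs : (2 : ℝ) ^ (-(N : ℤ)) < δ / (2 * n) := by
    rwa [zpow_neg, zpow_natCast, ← inv_pow]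
  refine absurd (exists_stop hn hf (i := i) (s := -N) (x := x) (hB1.trans_le ?_))
    (by rintro ⟨s', -, h'⟩; exact h s' h')
  refine le_nav_of_ge hf fun y hy => (hball ?_).le
  have h1 := norm_sub_corner_le hy
  have h2 := norm_sub_corner_le (y := x) (s := -N) (v := cell (-N) x) rfl
  rw [dist_eq_norm]
  calc ‖y - x‖ = ‖(y - corner (-N) (cell (-N) x)) - (x - corner (-N) (cell (-N) x))‖ := by
        congr 1; abel
    _ ≤ n * 2 ^ (-(N : ℤ)) + n * 2 ^ (-(N : ℤ)) := (norm_sub_le _ _).trans (add_le_add h1 h2)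
    _ < δ := by
        rw [lt_div_iff₀ (by positivity)] at hs
        linarith

theorem setIntegral_cav_sub {f : Rn n → ℂ} (hf : Integrable f) {s : ℤ} {S : Set (Rn n)}
    (hS : MeasurableSet S) (hsat : Sat s S) (hi : IntegrableOn (cav f s) S) :
    ∫ x in S, (cav f s x - f x) = 0 := by
  have hI : Integrable (S.indicator fun x => cav f s x - f x) :=
    (hi.sub hf.integrableOn).integrable_indicator hS
  rw [← integral_indicator hS]
  have := integral_eq_tsum_cube s hI
  have h0 : ∀ v, ∫ y in cube s v, S.indicator (fun x => cav f s x - f x) y = 0 := fun v => by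
    by_cases hv : ∃ z ∈ cube s v, z ∈ S
    · obtain ⟨z, hz, hzS⟩ := hv
      rw [setIntegral_congr_fun (g := fun y => cav f s z - f y) (measurableSet_cube s v)]
      · have hk : IntegrableOn (fun _ : Rn n => cav f s z) (cube s v) :=
          integrableOn_const (volume_cube_lt_top _ _).ne
        rw [integral_sub hk hf.integrableOn,
          setIntegral_const, volume_real_cube, cav, mem_cube.1 hz]
        have hp : (((2 : ℝ) ^ s) ^ n) ≠ 0 := by positivity
        rw [Complex.real_smul, ← mul_assoc, ← Complex.ofReal_mul, mul_inv_cancel₀ hp,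
          Complex.ofReal_one, one_mul, sub_self]
      · intro y hy
        have hyz : cell s z = cell s y := (mem_cube.1 hz).trans (mem_cube.1 hy).symm
        simp only [indicator_of_mem (hsat z y hyz hzS), cav, hyz]
    · push Not at hv
      rw [setIntegral_congr_fun (g := fun _ => 0) (measurableSet_cube s v)]
      · simp
      · intro y hy
        simp only [indicator_of_notMem (hv y hy)]
  simp_rw [h0] at this
  exact this.unique hasSum_zero

open Classical in
/-- The good part of `f` at height `2 ^ i`. -/
def good (f : Rn n → ℂ) (i : ℤ) (x : Rn n) : ℂ :=
  if h : ∃ s, x ∈ stopCells f i s then cav f h.choose x else f x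

theorem good_of_mem {f : Rn n → ℂ} {i s : ℤ} {x : Rn n} (h : x ∈ stopCells f i s) :
    good f i x = cav f s x := by
  have h' : ∃ s, x ∈ stopCells f i s := ⟨s, h⟩
  rw [good, dif_pos h', stop_unique h'.choose_spec h]

theorem good_of_notMem {f : Rn n → ℂ} {i : ℤ} {x : Rn n} (h : ∀ s, x ∉ stopCells f i s) :
    good f i x = f x := by
  rw [good, dif_neg (by rintro ⟨s, hs⟩; exact h s hs)]

theorem measurable_good {f : Rn n → ℂ} (hf : Measurable f) (i : ℤ) : Measurable (good f i) := by
  intro t ht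
  have : good f i ⁻¹' t = ((⋃ s, stopCells f i s)ᶜ ∩ f ⁻¹' t) ∪
      ⋃ s, (stopCells f i s ∩ cav f s ⁻¹' t) := by
    ext x
    by_cases h : ∃ s, x ∈ stopCells f i s
    · obtain ⟨s, hs⟩ := h
      simp only [mem_preimage, good_of_mem hs, mem_union, mem_inter_iff, mem_compl_iff,
        mem_iUnion]
      constructor
      · exact fun hx => Or.inr ⟨s, hs, hx⟩
      · rintro (⟨h1, -⟩ | ⟨s', h1, h2⟩)
        · exact absurd ⟨s, hs⟩ h1
        · rwa [stop_unique hs h1]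
    · push Not at h
      simp [good_of_notMem h, h]
  rw [this]
  exact ((MeasurableSet.iUnion fun s => measurableSet_stop f i s).compl.inter (hf ht)).union
    (MeasurableSet.iUnion fun s => (measurableSet_stop f i s).inter (measurable_cav f s ht))

theorem norm_good_le (hn : 0 < n) {f : Rn n → ℂ} (hf : Integrable f) (hc : Continuous f) (i : ℤ)
    (x : Rn n) : ‖good f i x‖ ≤ 2 ^ n * 2 ^ i := by
  by_cases h : ∃ s, x ∈ stopCells f i s
  · obtain ⟨s, hs⟩ := h
    rw [good_of_mem hs]
    exact (norm_cav_le f s x).trans (nav_le_of_mem_stop hf hs)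
  · push Not at h
    rw [good_of_notMem h]
    refine (norm_le_of_notMem_stop hn hf hc h).trans ?_
    exact le_mul_of_one_le_left (by positivity) (one_le_pow₀ one_le_two)

theorem stop_nest (hn : 0 < n) {f : Rn n → ℂ} (hf : Integrable f) {i i' s : ℤ} (hi : i' ≤ i)
    {x : Rn n} (h : x ∈ stopCells f i s) : ∃ s' ≥ s, x ∈ stopCells f i' s' :=
  exists_stop hn hf ((zpow_le_zpow_right₀ one_le_two hi).trans_lt h.1)

theorem mz_good (hn : 0 < n) {f : Rn n → ℂ} (hf : Integrable f) (hc : Continuous f) (i s : ℤ) :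
    MZ s ((stopCells f i s).indicator fun x => good f (i + 1) x - good f i x) := by
  intro v
  by_cases hv : ∃ z ∈ cube s v, z ∈ stopCells f i s
  swap
  · push Not at hv
    rw [setIntegral_congr_fun (g := fun _ => 0) (measurableSet_cube s v)]
    · simp
    · intro y hy
      simp only [indicator_of_notMem (hv y hy)]
  obtain ⟨z, hz, hzS⟩ := hv
  have hmem : ∀ y ∈ cube s v, y ∈ stopCells f i s := fun y hy =>
    sat_stop f i s z y ((mem_cube.1 hz).trans (mem_cube.1 hy).symm) hzS
  have hfin := (volume_cube_lt_top (n := n) s v)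
  have hbi : ∀ {F : Rn n → ℂ} {A : Set (Rn n)} (B : ℝ), A ⊆ cube s v → MeasurableSet A →
      Measurable F → (∀ x ∈ A, ‖F x‖ ≤ B) → IntegrableOn F A :=
    fun {F A} B hA hAm hF hB => by
      refine Measure.integrableOn_of_bounded ((measure_mono hA).trans_lt hfin).ne
        hF.aestronglyMeasurable (M := B) ?_
      exact (ae_restrict_iff' hAm).2 (ae_of_all _ hB)
  have hig : ∀ j, IntegrableOn (good f j) (cube s v) := fun j =>
    hbi _ subset_rfl (measurableSet_cube s v) (measurable_good hc.measurable j)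
      fun x _ => norm_good_le hn hf hc j x
  have e1 : ∫ y in cube s v, (good f i y - f y) = 0 := by
    have hic : IntegrableOn (cav f s) (cube s v) :=
      hbi (2 ^ n * 2 ^ i) subset_rfl (measurableSet_cube s v) (measurable_cav f s) fun x hx =>
        (norm_cav_le f s x).trans (nav_le_of_mem_stop hf (hmem x hx))
    rw [setIntegral_congr_fun (g := fun y => cav f s y - f y) (measurableSet_cube s v)]
    · exact setIntegral_cav_sub hf (measurableSet_cube s v) (fun y y' h hy => h.symm.trans hy) hic
    · intro y hy
      simp only [good_of_mem (hmem y hy)]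
  have e2 : ∫ y in cube s v, (good f (i + 1) y - f y) = 0 := by
    have hsub : ∀ s', cube s v ∩ stopCells f (i + 1) s' ⊆ cube s v := fun _ => inter_subset_left
    have hInt : IntegrableOn (fun y => good f (i + 1) y - f y) (cube s v) :=
      (hig _).sub hf.integrableOn
    have hU : (cube s v ∩ ⋃ s', stopCells f (i + 1) s') = ⋃ s', cube s v ∩ stopCells f (i + 1) s' :=
      inter_iUnion _ _
    rw [setIntegral_eq_of_subset_of_forall_sdiff_eq_zero (measurableSet_cube s v)
      (s := cube s v ∩ ⋃ s', stopCells f (i + 1) s') inter_subset_left, hU, integral_iUnion]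
    · refine (tsum_congr fun s' => ?_).trans tsum_zero
      have hm := (measurableSet_cube s v).inter (measurableSet_stop f (i + 1) s')
      by_cases hne : (cube s v ∩ stopCells f (i + 1) s').Nonempty
      swap
      · rw [not_nonempty_iff_eq_empty.1 hne]; simp
      obtain ⟨w, hw, hw'⟩ := hne
      have hss : s' ≤ s := by
        obtain ⟨s'', h1, h2⟩ := stop_nest hn hf (show i ≤ i + 1 by omega) hw'
        rwa [stop_unique h2 (hmem w hw)] at h1
      have hic : IntegrableOn (cav f s') (cube s v ∩ stopCells f (i + 1) s') :=
        hbi (2 ^ n * 2 ^ (i + 1)) inter_subset_left hm (measurable_cav f s') fun x hx =>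
          (norm_cav_le f s' x).trans (nav_le_of_mem_stop hf hx.2)
      rw [setIntegral_congr_fun (g := fun y => cav f s' y - f y) hm]
      · refine setIntegral_cav_sub hf hm (fun y y' h hy => ⟨?_, ?_⟩) hic
        · exact (cell_eq_of_le hss h).symm.trans hy.1
        · exact sat_stop f (i + 1) s' y y' h hy.2
      · intro y hy
        simp only [good_of_mem hy.2]
    · exact fun s' => (measurableSet_cube s v).inter (measurableSet_stop f (i + 1) s')
    · intro s₁ s₂ hs
      refine Set.disjoint_left.2 fun y hy hy' => hs (stop_unique hy.2 hy'.2)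
    · exact hInt.mono_set (by rw [← hU]; exact inter_subset_left)
    · intro y hy
      have : ∀ s', y ∉ stopCells f (i + 1) s' := fun s' hs' =>
        hy.2 ⟨hy.1, mem_iUnion.2 ⟨s', hs'⟩⟩
      simp only [good_of_notMem this, sub_self]
  rw [setIntegral_congr_fun (g := fun y => (good f (i + 1) y - f y) - (good f i y - f y))
    (measurableSet_cube s v)]
  · have hd : ∀ j, IntegrableOn (fun y => good f j y - f y) (cube s v) := fun j =>
      (hig j).sub hf.integrableOn
    rw [integral_sub (hd _) (hd _), e1, e2, sub_zero]
  · intro y hy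
    simp only [indicator_of_mem (hmem y hy)]
    ring

theorem volume_stop_le {f : Rn n → ℂ} (hf : Integrable f) (hc : Continuous f) (i s : ℤ) :
    volume (stopCells f i s) ≤ ENNReal.ofReal (2 * (2 : ℝ) ^ (-i)) *
      ∫⁻ x in stopCells f i s, {x | (2 : ℝ) ^ (i - 1) < ‖f x‖}.indicator (fun x => ‖f x‖ₑ) x := by
  set L : Set (Rn n) := {x | (2 : ℝ) ^ (i - 1) < ‖f x‖} with hL
  have hLm : MeasurableSet L := measurableSet_lt measurable_const hc.norm.measurable
  set F : Rn n → ℝ≥0∞ := L.indicator fun x => ‖f x‖ₑ with hF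
  have hSm := measurableSet_stop f i s
  have h1 : volume (stopCells f i s) = ∫⁻ x, (stopCells f i s).indicator (fun _ => 1) x := by
    rw [lintegral_indicator_const hSm, one_mul]
  rw [h1, ← lintegral_indicator hSm, lintegral_eq_tsum_cube s, lintegral_eq_tsum_cube s,
    ← ENNReal.tsum_mul_left]
  refine ENNReal.tsum_le_tsum fun v => ?_
  by_cases hv : ∃ z ∈ cube s v, z ∈ stopCells f i s
  swap
  · push Not at hv
    rw [setLIntegral_congr_fun (g := fun _ => 0) (measurableSet_cube s v)]
    · simp
    · intro y hy
      simp only [indicator_of_notMem (hv y hy)]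
  obtain ⟨z, hz, hzS⟩ := hv
  have hmem : ∀ y ∈ cube s v, y ∈ stopCells f i s := fun y hy =>
    sat_stop f i s z y ((mem_cube.1 hz).trans (mem_cube.1 hy).symm) hzS
  have c1 : ∫⁻ x in cube s v, (stopCells f i s).indicator (fun _ => (1 : ℝ≥0∞)) x =
      volume (cube s v) := by
    rw [← setLIntegral_one]
    exact setLIntegral_congr_fun (measurableSet_cube s v) fun y hy => by
      simp only [indicator_of_mem (hmem y hy)]
  have c2 : ∫⁻ x in cube s v, (stopCells f i s).indicator F x = ∫⁻ x in cube s v, F x :=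
    setLIntegral_congr_fun (measurableSet_cube s v) fun y hy => by
      simp only [indicator_of_mem (hmem y hy)]
  rw [c1, c2]
  have hp : (0 : ℝ) < ((2 : ℝ) ^ s) ^ n := by positivity
  have hlt : (2 : ℝ) ^ i * ((2 : ℝ) ^ s) ^ n ≤ ∫ y in cube s v, ‖f y‖ := by
    have := hzS.1
    rw [nav, mem_cube.1 hz, inv_mul_eq_div, lt_div_iff₀ hp] at this
    exact this.le
  have hFr : F = fun y => ENNReal.ofReal (L.indicator (fun x => ‖f x‖) y) := by
    ext y
    by_cases hy : y ∈ L
    · simp only [hF, indicator_of_mem hy, ofReal_norm]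
    · simp only [hF, indicator_of_notMem hy, ENNReal.ofReal_zero]
  have hiL : Integrable (L.indicator fun x => ‖f x‖) := hf.norm.indicator hLm
  rw [hFr, ← ofReal_integral_eq_lintegral_ofReal hiL.integrableOn
    (ae_of_all _ fun y => indicator_nonneg (fun _ _ => norm_nonneg _) _), volume_cube,
    ← ENNReal.ofReal_pow (by positivity), ← ENNReal.ofReal_mul (by positivity)]
  refine ENNReal.ofReal_le_ofReal ?_
  have h2 : ∫ y in cube s v, ‖f y‖ ≤
      ∫ y in cube s v, (L.indicator (fun x => ‖f x‖) y + (2 : ℝ) ^ (i - 1)) := by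
    refine setIntegral_mono hf.norm.integrableOn
      (hiL.integrableOn.add (integrableOn_const (volume_cube_lt_top _ _).ne)) fun y => ?_
    by_cases hy : y ∈ L
    · simp only [indicator_of_mem hy]
      have : (0 : ℝ) < (2 : ℝ) ^ (i - 1) := by positivity
      linarith
    · simp only [indicator_of_notMem hy, zero_add]
      exact not_lt.1 hy
  rw [integral_add hiL.integrableOn (integrableOn_const (volume_cube_lt_top _ _).ne),
    setIntegral_const, volume_real_cube, smul_eq_mul] at h2
  have hi : (2 : ℝ) ^ (i - 1) = 2 ^ i / 2 := by rw [zpow_sub_one₀ (by norm_num)]; ring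
  have hi0 : (0 : ℝ) < (2 : ℝ) ^ i := by positivity
  rw [hi] at h2
  rw [zpow_neg]
  set T := ∫ y in cube s v, L.indicator (fun x => ‖f x‖) y
  have h3 : ((2 : ℝ) ^ s) ^ n * 2 ^ i ≤ 2 * T := by nlinarith
  rw [mul_assoc, inv_mul_eq_div, ← mul_div_assoc, le_div_iff₀ hi0]
  exact h3

end ShortVariation

namespace ShortVariation
variable {n : ℕ}

/-- The extended nonnegative real `2 ^ t`. -/
def e2 (t : ℝ) : ℝ≥0∞ := ENNReal.ofReal ((2 : ℝ) ^ t)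

theorem e2_add (a b : ℝ) : e2 (a + b) = e2 a * e2 b := by
  rw [e2, e2, e2, ← ENNReal.ofReal_mul (by positivity), Real.rpow_add two_pos]

theorem e2_zero : e2 0 = 1 := by simp [e2]

theorem e2_rpow (a b : ℝ) : e2 a ^ b = e2 (a * b) := by
  rw [e2, e2, ENNReal.ofReal_rpow_of_pos (by positivity), ← Real.rpow_mul two_pos.le]

theorem e2_le {a b : ℝ} (h : a ≤ b) : e2 a ≤ e2 b :=
  ENNReal.ofReal_le_ofReal (Real.rpow_le_rpow_of_exponent_le one_le_two h)

theorem e2_ne_top (a : ℝ) : e2 a ≠ ∞ := ENNReal.ofReal_ne_top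

theorem ofReal_zpow (i : ℤ) : ENNReal.ofReal ((2 : ℝ) ^ i) = e2 i := by
  rw [e2, Real.rpow_intCast]

/-- The two-sided geometric series. -/
def gs (q : ℝ) : ℝ := ∑' c : ℤ, q ^ c.natAbs

theorem tsum_geom {q : ℝ} (h0 : 0 ≤ q) (h1 : q < 1) (K : ℤ) :
    ∑' i : ℤ, ENNReal.ofReal (q ^ (i - K).natAbs) = ENNReal.ofReal (gs q) := by
  rw [gs, ENNReal.ofReal_tsum_of_nonneg (fun c => pow_nonneg h0 _) (summable_pow_natAbs h0 h1)]
  exact (Equiv.subRight K).tsum_eq fun c : ℤ => ENNReal.ofReal (q ^ c.natAbs)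

theorem tsum_le_of_geom {q : ℝ} (h0 : 0 ≤ q) (h1 : q < 1) {X : ℝ≥0∞} (K : ℤ) {w : ℤ → ℝ≥0∞}
    (h : ∀ i, w i ≤ X * ENNReal.ofReal (q ^ (i - K).natAbs)) :
    ∑' i, w i ≤ X * ENNReal.ofReal (gs q) := by
  rw [← tsum_geom h0 h1 K, ← ENNReal.tsum_mul_left]
  exact ENNReal.tsum_le_tsum h

theorem two_rpow_natAbs {β : ℝ} (m : ℤ) :
    ENNReal.ofReal (((2 : ℝ) ^ (-β)) ^ m.natAbs) = e2 (-β * |(m : ℝ)|) := by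
  rw [e2, ← Real.rpow_natCast, ← Real.rpow_mul two_pos.le, Nat.cast_natAbs, Int.cast_abs]

theorem two_rpow_neg_lt_one {β : ℝ} (hβ : 0 < β) : (2 : ℝ) ^ (-β) < 1 :=
  Real.rpow_lt_one_of_one_lt_of_neg one_lt_two (by linarith)

/-- A sum over the integers dominated by two-sided geometric decay. -/
theorem tsum_le_of_e2 {β : ℝ} (hβ : 0 < β) {X : ℝ≥0∞} (K : ℤ) {w : ℤ → ℝ≥0∞}
    (h : ∀ i : ℤ, w i ≤ X * e2 (-β * |(i : ℝ) - K|)) :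
    ∑' i, w i ≤ X * ENNReal.ofReal (gs ((2 : ℝ) ^ (-β))) := by
  refine tsum_le_of_geom (by positivity) (two_rpow_neg_lt_one hβ) K fun i => ?_
  rw [two_rpow_natAbs]
  push_cast
  exact h i

theorem rpow_tsum_le {ι : Type*} (f : ι → ℝ≥0∞) {θ : ℝ} (h0 : 0 < θ) (h1 : θ ≤ 1) :
    (∑' i, f i) ^ θ ≤ ∑' i, f i ^ θ := by
  have hfin : ∀ s : Finset ι, (∑ i ∈ s, f i) ^ θ ≤ ∑ i ∈ s, f i ^ θ := by
    classical
    intro s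
    induction s using Finset.induction with
    | empty => simp [h0]
    | insert a s ha ih =>
      rw [Finset.sum_insert ha, Finset.sum_insert ha]
      exact (ENNReal.rpow_add_le_add_rpow _ _ h0.le h1).trans (add_le_add le_rfl ih)
  rw [ENNReal.tsum_eq_iSup_sum]
  have := (ENNReal.orderIsoRpow θ h0).map_iSup fun s : Finset ι => ∑ i ∈ s, f i
  simp only [ENNReal.orderIsoRpow_apply] at this
  rw [this]
  exact iSup_le fun s => (hfin s).trans (ENNReal.sum_le_tsum s)

theorem rpow_sum_le {ι : Type*} (s : Finset ι) (f : ι → ℝ≥0∞) {θ : ℝ} (h0 : 0 < θ) (h1 : θ ≤ 1) :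
    (∑ i ∈ s, f i) ^ θ ≤ ∑ i ∈ s, f i ^ θ := by
  rw [← Finset.tsum_subtype, ← Finset.tsum_subtype s fun i => f i ^ θ]
  exact rpow_tsum_le _ h0 h1

/-- A weighted comparison of the power of a series with the series of powers. -/
theorem rpow_tsum_le_weighted {β P : ℝ} (hβ : 0 < β) (hP : 0 < P) (v : ℤ → ℝ≥0∞) :
    (∑' c, v c) ^ P ≤ ENNReal.ofReal (gs ((2 : ℝ) ^ (-β))) ^ P *
      ∑' c : ℤ, e2 (P * (β * |(c : ℝ)|)) * v c ^ P := by
  set S : ℝ≥0∞ := ⨆ c : ℤ, e2 (β * |(c : ℝ)|) * v c with hS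
  have h1 : ∑' c, v c ≤ S * ENNReal.ofReal (gs ((2 : ℝ) ^ (-β))) := by
    refine tsum_le_of_e2 hβ 0 fun c => ?_
    have : v c = e2 (β * |(c : ℝ)|) * v c * e2 (-β * |(c : ℝ)|) := by
      rw [mul_comm (e2 _) (v c), mul_assoc, ← e2_add]
      simp [e2_zero]
    rw [Int.cast_zero, sub_zero, this]
    gcongr
    exact le_iSup (fun c : ℤ => e2 (β * |(c : ℝ)|) * v c) c
  have h2 : S ^ P ≤ ∑' c : ℤ, e2 (P * (β * |(c : ℝ)|)) * v c ^ P := by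
    have := (ENNReal.orderIsoRpow P hP).map_iSup fun c : ℤ => e2 (β * |(c : ℝ)|) * v c
    simp only [ENNReal.orderIsoRpow_apply] at this
    rw [hS, this]
    refine iSup_le fun c => ?_
    rw [ENNReal.mul_rpow_of_nonneg _ _ hP.le, e2_rpow, mul_comm _ P]
    exact ENNReal.le_tsum (f := fun c : ℤ => e2 (P * (β * |(c : ℝ)|)) * v c ^ P) c
  calc (∑' c, v c) ^ P ≤ (S * ENNReal.ofReal (gs ((2 : ℝ) ^ (-β)))) ^ P := by gcongr
    _ = ENNReal.ofReal (gs ((2 : ℝ) ^ (-β))) ^ P * S ^ P := by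
        rw [ENNReal.mul_rpow_of_nonneg _ _ hP.le, mul_comm]
    _ ≤ _ := by gcongr

theorem rpow_mul_rpow_le_add (a b : ℝ≥0∞) {θ τ : ℝ} (h0 : 0 ≤ θ) (h1 : 0 ≤ τ) (h : θ + τ = 1) :
    a ^ θ * b ^ τ ≤ a + b := by
  calc a ^ θ * b ^ τ ≤ max a b ^ θ * max a b ^ τ := by
        gcongr
        · exact le_max_left _ _
        · exact le_max_right _ _
    _ = max a b := by rw [← ENNReal.rpow_add_of_nonneg _ _ h0 h1, h, ENNReal.rpow_one]
    _ ≤ a + b := max_le le_self_add le_add_self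

/-- Weighted arithmetic–geometric inequality with cancelling powers of two. -/
theorem rpow_mul_rpow_le_weighted (X Y : ℝ≥0∞) {θ τ s t : ℝ} (h0 : 0 ≤ θ) (h1 : 0 ≤ τ)
    (h : θ + τ = 1) (hst : s * θ + t * τ = 0) : X ^ θ * Y ^ τ ≤ e2 s * X + e2 t * Y := by
  have : X ^ θ * Y ^ τ = (e2 s * X) ^ θ * (e2 t * Y) ^ τ := by
    rw [ENNReal.mul_rpow_of_nonneg _ _ h0, ENNReal.mul_rpow_of_nonneg _ _ h1, e2_rpow, e2_rpow]
    rw [show e2 (s * θ) * X ^ θ * (e2 (t * τ) * Y ^ τ) = (e2 (s * θ) * e2 (t * τ)) *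
      (X ^ θ * Y ^ τ) by ring, ← e2_add, hst, e2_zero, one_mul]
  rw [this]
  exact rpow_mul_rpow_le_add _ _ h0 h1 h

theorem sum_e2_mul_sum_lt {p : ℝ} (hp : p < 2) (μ : ℤ → ℝ≥0∞) (b I0 : ℤ) :
    ∑ I ∈ Finset.Ioc b I0, e2 (I * (p - 2)) * ∑ i ∈ Finset.Ico b I, e2 (2 * i) * μ i ≤
      ENNReal.ofReal (gs ((2 : ℝ) ^ (-(2 - p)))) * ∑' i : ℤ, e2 (i * p) * μ i := by
  calc ∑ I ∈ Finset.Ioc b I0, e2 (I * (p - 2)) * ∑ i ∈ Finset.Ico b I, e2 (2 * i) * μ i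
      ≤ ∑ I ∈ Finset.Ioc b I0, ∑' i : ℤ, e2 (i * p) * μ i * e2 (-(2 - p) * |(I : ℝ) - i|) := by
        refine Finset.sum_le_sum fun I _ => ?_
        rw [Finset.mul_sum]
        refine le_trans (Finset.sum_le_sum fun i hi => ?_) (ENNReal.sum_le_tsum (Finset.Ico b I))
        have hi' : (i : ℝ) < I := by exact_mod_cast (Finset.mem_Ico.1 hi).2
        rw [abs_of_pos (by linarith), ← mul_assoc, ← e2_add, mul_right_comm, ← e2_add]
        gcongr
        exact e2_le (by nlinarith)
    _ ≤ ∑' I : ℤ, ∑' i : ℤ, e2 (i * p) * μ i * e2 (-(2 - p) * |(I : ℝ) - i|) :=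
        ENNReal.sum_le_tsum _
    _ = ∑' i : ℤ, ∑' I : ℤ, e2 (i * p) * μ i * e2 (-(2 - p) * |(I : ℝ) - i|) :=
        ENNReal.tsum_comm
    _ ≤ ∑' i : ℤ, e2 (i * p) * μ i * ENNReal.ofReal (gs ((2 : ℝ) ^ (-(2 - p)))) :=
        ENNReal.tsum_le_tsum fun i => tsum_le_of_e2 (by linarith) i fun I => le_rfl
    _ = _ := by rw [ENNReal.tsum_mul_right, mul_comm]

theorem sum_e2_mul_sum_ge {p : ℝ} (hp : 1 < p) (μ : ℤ → ℝ≥0∞) (b I0 : ℤ) :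
    ∑ I ∈ Finset.Ioc b I0, e2 (I * (p - 1)) * ∑ i ∈ Finset.Ico (I - 1) I0, e2 i * μ i ≤
      e2 (2 * (p - 1)) * ENNReal.ofReal (gs ((2 : ℝ) ^ (-(p - 1)))) *
        ∑' i : ℤ, e2 (i * p) * μ i := by
  calc ∑ I ∈ Finset.Ioc b I0, e2 (I * (p - 1)) * ∑ i ∈ Finset.Ico (I - 1) I0, e2 i * μ i
      ≤ ∑ I ∈ Finset.Ioc b I0, ∑' i : ℤ, e2 (2 * (p - 1)) * (e2 (i * p) * μ i) *
          e2 (-(p - 1) * |(I : ℝ) - i|) := by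
        refine Finset.sum_le_sum fun I _ => ?_
        rw [Finset.mul_sum]
        refine le_trans (Finset.sum_le_sum fun i hi => ?_)
          (ENNReal.sum_le_tsum (Finset.Ico (I - 1) I0))
        have hi' : (I : ℝ) - 1 ≤ i := by exact_mod_cast (Finset.mem_Ico.1 hi).1
        have hab : |(I : ℝ) - i| ≤ i - I + 2 := by
          rw [_root_.abs_le]; constructor <;> linarith
        rw [← mul_assoc, ← e2_add, ← mul_assoc, mul_right_comm, ← e2_add, ← e2_add]
        gcongr
        exact e2_le (by nlinarith)
    _ ≤ ∑' I : ℤ, ∑' i : ℤ, e2 (2 * (p - 1)) * (e2 (i * p) * μ i) *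
          e2 (-(p - 1) * |(I : ℝ) - i|) := ENNReal.sum_le_tsum _
    _ = ∑' i : ℤ, ∑' I : ℤ, e2 (2 * (p - 1)) * (e2 (i * p) * μ i) *
          e2 (-(p - 1) * |(I : ℝ) - i|) := ENNReal.tsum_comm
    _ ≤ ∑' i : ℤ, e2 (2 * (p - 1)) * (e2 (i * p) * μ i) *
          ENNReal.ofReal (gs ((2 : ℝ) ^ (-(p - 1)))) :=
        ENNReal.tsum_le_tsum fun i => tsum_le_of_e2 (by linarith) i fun I => le_rfl
    _ = _ := by rw [ENNReal.tsum_mul_right, ENNReal.tsum_mul_left]; ring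

/-- The sequence inequality for the near part. -/
theorem sum_rpow_mul_rpow_le {p : ℝ} (hp1 : 1 < p) (hp2 : p < 2) : ∃ C : ℝ, 0 ≤ C ∧
    ∀ (μ : ℤ → ℝ≥0∞) (b I0 : ℤ), ∑ I ∈ Finset.Ioc b I0,
      (∑ i ∈ Finset.Ico b I, e2 (2 * i) * μ i) ^ (p - 1) *
        (∑ i ∈ Finset.Ico (I - 1) I0, e2 i * μ i) ^ (2 - p) ≤
      ENNReal.ofReal C * ∑' i : ℤ, e2 (i * p) * μ i := by
  set C : ℝ≥0∞ := ENNReal.ofReal (gs ((2 : ℝ) ^ (-(2 - p)))) +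
    e2 (2 * (p - 1)) * ENNReal.ofReal (gs ((2 : ℝ) ^ (-(p - 1)))) with hC
  have hCt : C ≠ ∞ := by simp [hC, ENNReal.mul_eq_top, e2_ne_top]
  refine ⟨C.toReal, ENNReal.toReal_nonneg, fun μ b I0 => ?_⟩
  rw [ENNReal.ofReal_toReal hCt, hC, add_mul]
  refine le_trans (Finset.sum_le_sum fun I _ => rpow_mul_rpow_le_weighted _ _ (s := I * (p - 2))
    (t := I * (p - 1)) (by linarith) (by linarith) (by ring) (by ring)) ?_
  rw [Finset.sum_add_distrib]
  exact add_le_add (sum_e2_mul_sum_lt hp2 μ b I0) (sum_e2_mul_sum_ge hp1 μ b I0)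

/-- The sequence inequality for the far part. -/
theorem sum_rpow_mul_rpow_le' {p : ℝ} (hp1 : 1 < p) (hp2 : p < 2) : ∃ C : ℝ, 0 ≤ C ∧
    ∀ (μ : ℤ → ℝ≥0∞) (b I0 : ℤ), ∑ I ∈ Finset.Ioc b I0,
      (∑ i ∈ Finset.Ico b I, e2 (2 * i) * μ i) ^ (p / 2) * μ (I - 1) ^ (1 - p / 2) ≤
      ENNReal.ofReal C * ∑' i : ℤ, e2 (i * p) * μ i := by
  set C : ℝ≥0∞ := ENNReal.ofReal (gs ((2 : ℝ) ^ (-(2 - p)))) + e2 p with hC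
  have hCt : C ≠ ∞ := by simp [hC, e2_ne_top]
  refine ⟨C.toReal, ENNReal.toReal_nonneg, fun μ b I0 => ?_⟩
  rw [ENNReal.ofReal_toReal hCt, hC, add_mul]
  refine le_trans (Finset.sum_le_sum fun I _ => rpow_mul_rpow_le_weighted _ _ (s := I * (p - 2))
    (t := I * p) (by linarith) (by linarith) (by ring) (by ring)) ?_
  rw [Finset.sum_add_distrib]
  refine add_le_add (sum_e2_mul_sum_lt hp2 μ b I0) ?_
  rw [← ENNReal.tsum_mul_left, ← (Equiv.subRight (1 : ℤ)).tsum_eq]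
  refine le_trans (Finset.sum_le_sum fun I _ => ?_) (ENNReal.sum_le_tsum (Finset.Ioc b I0))
  simp only [Equiv.subRight_apply]
  rw [← mul_assoc, ← e2_add]
  push_cast
  exact le_of_eq (by ring_nf)

theorem sq_sum_e2_le (F : Finset ℤ) : (∑ i ∈ F, e2 i) ^ 2 ≤
    ENNReal.ofReal (gs ((2 : ℝ) ^ (-1 : ℝ))) ^ 2 * ∑ i ∈ F, e2 (2 * i) := by
  rcases F.eq_empty_or_nonempty with rfl | hF
  · simp
  have h1 : ∑ i ∈ F, e2 i ≤ e2 (F.max' hF) * ENNReal.ofReal (gs ((2 : ℝ) ^ (-1 : ℝ))) := by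
    refine le_trans ?_ (tsum_le_of_e2 (w := fun i => (F : Set ℤ).indicator (fun i : ℤ => e2 i) i)
      one_pos (F.max' hF) fun i => ?_)
    · refine le_trans (Finset.sum_le_sum fun i hi => ?_) (ENNReal.sum_le_tsum F)
      rw [indicator_of_mem (Finset.mem_coe.2 hi)]
    · by_cases hi : i ∈ F
      · rw [indicator_of_mem (Finset.mem_coe.2 hi), ← e2_add]
        have : (i : ℝ) ≤ F.max' hF := by exact_mod_cast F.le_max' i hi
        rw [abs_of_nonpos (by linarith)]
        exact e2_le (by linarith)
      · rw [indicator_of_notMem (by simpa using hi)]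
        exact zero_le
  calc (∑ i ∈ F, e2 i) ^ 2 ≤ (e2 (F.max' hF) * ENNReal.ofReal (gs ((2 : ℝ) ^ (-1 : ℝ)))) ^ 2 := by
        gcongr
    _ = ENNReal.ofReal (gs ((2 : ℝ) ^ (-1 : ℝ))) ^ 2 * e2 (2 * F.max' hF) := by
        rw [mul_pow, ← ENNReal.rpow_natCast (e2 _), e2_rpow, mul_comm]
        congr 2
        push_cast; ring
    _ ≤ _ := by
        gcongr
        exact Finset.single_le_sum (f := fun i : ℤ => e2 (2 * i)) (fun _ _ => zero_le)
          (F.max'_mem hF)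

/-- The total measure of the stopping cells at height `2 ^ i`. -/
def om (f : Rn n → ℂ) (i : ℤ) : ℝ≥0∞ := ∑' s, volume (stopCells f i s)

theorem om_le {f : Rn n → ℂ} (hf : Integrable f) (hc : Continuous f) (i : ℤ) :
    om f i ≤ e2 (1 - i) *
      ∫⁻ x, {x | (2 : ℝ) ^ (i - 1) < ‖f x‖}.indicator (fun x => ‖f x‖ₑ) x := by
  have h2 : ENNReal.ofReal (2 * (2 : ℝ) ^ (-i)) = e2 (1 - i) := by
    rw [e2, Real.rpow_sub two_pos, Real.rpow_one, Real.rpow_intCast, zpow_neg, div_eq_mul_inv]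
  calc om f i ≤ ∑' s, e2 (1 - i) * ∫⁻ x in stopCells f i s,
        {x | (2 : ℝ) ^ (i - 1) < ‖f x‖}.indicator (fun x => ‖f x‖ₑ) x :=
        ENNReal.tsum_le_tsum fun s => by rw [← h2]; exact volume_stop_le hf hc i s
    _ = e2 (1 - i) * ∫⁻ x in ⋃ s, stopCells f i s,
        {x | (2 : ℝ) ^ (i - 1) < ‖f x‖}.indicator (fun x => ‖f x‖ₑ) x := by
        rw [ENNReal.tsum_mul_left, lintegral_iUnion (measurableSet_stop f i)]
        intro s s' hs
        exact Set.disjoint_left.2 fun y hy hy' => hs (stop_unique hy hy')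
    _ ≤ _ := mul_le_mul_right (setLIntegral_le_lintegral _ _) _

theorem om_lt_top {f : Rn n → ℂ} (hf : Integrable f) (hc : Continuous f) (i : ℤ) :
    om f i < ∞ := by
  refine (om_le hf hc i).trans_lt (ENNReal.mul_lt_top (e2_ne_top _).lt_top ?_)
  refine lt_of_le_of_lt (lintegral_mono fun x => ?_) hf.2
  exact indicator_le_self _ _ _

theorem tsum_om_le {p : ℝ} (hp : 1 < p) : ∃ C : ℝ, 0 ≤ C ∧ ∀ (f : Rn n → ℂ), Integrable f →
    Continuous f → ∑' i : ℤ, e2 (i * p) * om f i ≤ ENNReal.ofReal C * ∫⁻ x, ‖f x‖ₑ ^ p := by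
  set C : ℝ≥0∞ := e2 (2 * p) * ENNReal.ofReal (gs ((2 : ℝ) ^ (-(p - 1)))) with hC
  have hCt : C ≠ ∞ := by simp [hC, ENNReal.mul_eq_top, e2_ne_top]
  refine ⟨C.toReal, ENNReal.toReal_nonneg, fun f hf hc => ?_⟩
  rw [ENNReal.ofReal_toReal hCt]
  set F : ℤ → Rn n → ℝ≥0∞ := fun i =>
    {x | (2 : ℝ) ^ (i - 1) < ‖f x‖}.indicator (fun x => ‖f x‖ₑ) with hF
  have hFm : ∀ i, Measurable (F i) := fun i =>
    hc.measurable.enorm.indicator (measurableSet_lt measurable_const hc.norm.measurable)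
  have hpt : ∀ x, ∑' i : ℤ, e2 (i * p) * (e2 (1 - i) * F i x) ≤ C * ‖f x‖ₑ ^ p := fun x => by
    rcases (norm_nonneg (f x)).eq_or_lt with h0 | h0
    · have : ‖f x‖ₑ = 0 := by rw [← ofReal_norm, ← h0, ENNReal.ofReal_zero]
      have hz : ∀ i, F i x = 0 := fun i => by
        refine (le_antisymm (le_trans (indicator_le_self _ _ _) this.le) zero_le)
      simp [hz]
    obtain ⟨k, hk1, hk2⟩ := exists_mem_Ioc_zpow h0 (one_lt_two (α := ℝ))
    have hle : ‖f x‖ₑ ≤ e2 (k + 1) := by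
      rw [← ofReal_norm, e2]
      refine ENNReal.ofReal_le_ofReal (hk2.trans (le_of_eq ?_))
      rw [← Real.rpow_intCast]; push_cast; rfl
    have hge : e2 k ≤ ‖f x‖ₑ := by
      rw [← ofReal_norm, e2, Real.rpow_intCast]
      exact ENNReal.ofReal_le_ofReal hk1.le
    have hge' : e2 (k * p) ≤ ‖f x‖ₑ ^ p := by
      rw [← e2_rpow]
      gcongr
    refine (tsum_le_of_e2 (X := e2 (2 * p) * e2 (k * p)) (by linarith : 0 < p - 1) (k + 1)
      fun i => ?_).trans ?_
    · by_cases hi : x ∈ {x | (2 : ℝ) ^ (i - 1) < ‖f x‖}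
      · have hik : i ≤ k + 1 := by
          have : (2 : ℝ) ^ (i - 1) < 2 ^ (k + 1) := lt_of_lt_of_le hi hk2
          have := (zpow_lt_zpow_iff_right₀ one_lt_two).1 this
          omega
        have hik' : (i : ℝ) ≤ k + 1 := by exact_mod_cast hik
        simp only [hF, indicator_of_mem hi]
        push_cast
        rw [abs_of_nonpos (by linarith)]
        calc e2 (i * p) * (e2 (1 - i) * ‖f x‖ₑ) ≤ e2 (i * p) * (e2 (1 - i) * e2 (k + 1)) := by
              gcongr
          _ = e2 (i * p + (1 - i + (k + 1))) := by simp only [e2_add]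
          _ ≤ _ := by
              rw [← e2_add, ← e2_add]
              exact e2_le (by nlinarith)
      · simp only [hF, indicator_of_notMem hi, mul_zero]
        exact zero_le
    · rw [hC, mul_right_comm]
      gcongr
  calc ∑' i : ℤ, e2 (i * p) * om f i
      ≤ ∑' i : ℤ, ∫⁻ x, e2 (i * p) * (e2 (1 - i) * F i x) := by
        refine ENNReal.tsum_le_tsum fun i => ?_
        rw [lintegral_const_mul _ ((hFm i).const_mul _), lintegral_const_mul _ (hFm i)]
        gcongr
        exact om_le hf hc i
    _ = ∫⁻ x, ∑' i : ℤ, e2 (i * p) * (e2 (1 - i) * F i x) :=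
        (lintegral_tsum fun i => (((hFm i).const_mul _).const_mul _).aemeasurable).symm
    _ ≤ ∫⁻ x, C * ‖f x‖ₑ ^ p := lintegral_mono hpt
    _ = _ := lintegral_const_mul _ (hc.measurable.enorm.pow_const p)

end ShortVariation

namespace ShortVariation
variable {n : ℕ}

/-- The increment of the good parts between two consecutive heights. -/
def incr (f : Rn n → ℂ) (i : ℤ) (x : Rn n) : ℂ := good f (i + 1) x - good f i x

/-- The increment restricted to the stopping cells of side `2 ^ s`. -/
def atom (f : Rn n → ℂ) (i s : ℤ) : Rn n → ℂ := (stopCells f i s).indicator (incr f i)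

/-- The sum of the atoms of side `2 ^ s` over the heights `b ≤ i < I`. -/
def atoms (f : Rn n → ℂ) (b I s : ℤ) (x : Rn n) : ℂ := ∑ i ∈ Finset.Ico b I, atom f i s x

theorem BM.zero : BM (fun _ : Rn n => (0 : ℂ)) := ⟨measurable_const, 0, fun _ => by simp⟩

theorem BM.add {f g : Rn n → ℂ} (hf : BM f) (hg : BM g) : BM fun x => f x + g x := by
  obtain ⟨hf, B, hB⟩ := hf
  obtain ⟨hg, B', hB'⟩ := hg
  exact ⟨hf.add hg, B + B', fun x => (norm_add_le _ _).trans (add_le_add (hB x) (hB' x))⟩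

theorem BM.sub {f g : Rn n → ℂ} (hf : BM f) (hg : BM g) : BM fun x => f x - g x := by
  obtain ⟨hf, B, hB⟩ := hf
  obtain ⟨hg, B', hB'⟩ := hg
  exact ⟨hf.sub hg, B + B', fun x => (norm_sub_le _ _).trans (add_le_add (hB x) (hB' x))⟩

theorem BM.sum {ι : Type*} (s : Finset ι) {f : ι → Rn n → ℂ} (hf : ∀ i, BM (f i)) :
    BM fun x => ∑ i ∈ s, f i x := by
  classical
  induction s using Finset.induction with
  | empty => simpa using BM.zero
  | insert a s ha ih =>
    simp only [Finset.sum_insert ha]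
    exact (hf a).add ih

theorem TT_zero (k : ℤ) (lam : ℝ) (G A : Rn n → ℝ) (x : Rn n) :
    TT k lam G A (fun _ => 0) x = 0 := by simp [TT, cv, opK]

theorem TT_sum {ι : Type*} {M lam : ℝ} {G A : Rn n → ℝ} (h : Adm M G A) (k : ℤ) (s : Finset ι)
    {f : ι → Rn n → ℂ} (hf : ∀ i, BM (f i)) (x : Rn n) :
    TT k lam G A (fun y => ∑ i ∈ s, f i y) x = ∑ i ∈ s, TT k lam G A (f i) x := by
  classical
  induction s using Finset.induction with
  | empty => simpa using TT_zero k lam G A x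
  | insert a s ha ih =>
    simp only [Finset.sum_insert ha]
    rw [TT_add h k (hf a) (BM.sum s hf), ih]

theorem measurable_TT_param {M : ℝ} (D : ℝ) {G A : Rn n → ℝ} (h : Adm M G A) (k : ℤ)
    {f : Rn n → ℂ} (hf : Measurable f) :
    Measurable fun q : ℝ × Rn n => TT k (q.1 * D) G A f q.2 := by
  have hb : Measurable (Function.uncurry fun x y : Rn n => A (x - y)) :=
    h.measurable_ampl
  have hs : Measurable fun y : Rn n => f ((2 : ℝ) ^ k • y) := hf.comp (measurable_const_smul _)
  have := measurable_opK_param D h.phase.1 hb hs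
  exact this.comp (f := fun q : ℝ × Rn n => (q.1, (2 : ℝ) ^ (-k) • q.2))
    (measurable_fst.prodMk ((measurable_const_smul _).comp measurable_snd))

section
variable {f : Rn n → ℂ} (hn : 0 < n) (hf : Integrable f) (hc : Continuous f)
include hn hf hc

theorem bm_good (i : ℤ) : BM (good f i) :=
  ⟨measurable_good hc.measurable i, _, norm_good_le hn hf hc i⟩

theorem bm_incr (i : ℤ) : BM (incr f i) := (bm_good hn hf hc _).sub (bm_good hn hf hc _)

theorem norm_incr_le (i : ℤ) (x : Rn n) : ‖incr f i x‖ ≤ 3 * 2 ^ n * 2 ^ i := by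
  refine (norm_sub_le _ _).trans ((add_le_add (norm_good_le hn hf hc _ x)
    (norm_good_le hn hf hc _ x)).trans (le_of_eq ?_))
  rw [zpow_add_one₀ (by norm_num)]; ring

theorem bm_atom (i s : ℤ) : BM (atom f i s) :=
  (bm_incr hn hf hc i).indicator (measurableSet_stop f i s)

theorem norm_atom_le (i s : ℤ) (x : Rn n) : ‖atom f i s x‖ ≤ 3 * 2 ^ n * 2 ^ i :=
  (norm_indicator_le_norm_self _ _).trans (norm_incr_le hn hf hc i x)

theorem bm_atoms (b I s : ℤ) : BM (atoms f b I s) :=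
  BM.sum _ fun i => bm_atom hn hf hc i s

theorem mz_atoms (b I s : ℤ) : MZ s (atoms f b I s) := by
  intro v
  have : ∀ i, IntegrableOn (atom f i s) (cube s v) := fun i => by
    obtain ⟨h1, B, hB⟩ := bm_atom hn hf hc i s
    exact Measure.integrableOn_of_bounded (volume_cube_lt_top s v).ne
      h1.aestronglyMeasurable (M := B) (ae_of_all _ hB)
  rw [show atoms f b I s = fun x => ∑ i ∈ Finset.Ico b I, atom f i s x from rfl,
    integral_finsetSum _ fun i _ => this i]
  exact Finset.sum_eq_zero fun i _ => mz_good hn hf hc i s v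

end

theorem enorm_incr_le {f : Rn n → ℂ} (hn : 0 < n) (hf : Integrable f) (hc : Continuous f)
    (i : ℤ) (x : Rn n) : ‖incr f i x‖ₑ ≤ ENNReal.ofReal (3 * 2 ^ n) * e2 i := by
  rw [← ofReal_norm, ← ofReal_zpow, ← ENNReal.ofReal_mul (by positivity)]
  exact ENNReal.ofReal_le_ofReal (norm_incr_le hn hf hc i x)

/-- The constant in the quadratic estimates for sums of atoms. -/
def ca (n : ℕ) : ℝ := (3 * 2 ^ n * gs ((2 : ℝ) ^ (-1 : ℝ))) ^ 2

theorem enorm_sum_incr_sq_le {f : Rn n → ℂ} (hn : 0 < n) (hf : Integrable f) (hc : Continuous f)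
    (T : ℤ → Set (Rn n)) (F : Finset ℤ) (x : Rn n) :
    ‖∑ i ∈ F, (T i).indicator (incr f i) x‖ₑ ^ 2 ≤
      ENNReal.ofReal (ca n) * ∑ i ∈ F, e2 (2 * i) * (T i).indicator 1 x := by
  classical
  set F' := F.filter fun i => x ∈ T i with hF'
  have h1 : ∑ i ∈ F, (T i).indicator (incr f i) x = ∑ i ∈ F', incr f i x := by
    rw [hF', Finset.sum_filter]
    exact Finset.sum_congr rfl fun i _ => by simp only [indicator_apply]
  have h2 : ∑ i ∈ F, e2 (2 * i) * (T i).indicator (1 : Rn n → ℝ≥0∞) x =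
      ∑ i ∈ F', e2 (2 * i) := by
    rw [hF', Finset.sum_filter]
    exact Finset.sum_congr rfl fun i _ => by simp [indicator_apply]
  have hg : 0 ≤ gs ((2 : ℝ) ^ (-1 : ℝ)) := tsum_nonneg fun c => by positivity
  rw [h1, h2]
  calc ‖∑ i ∈ F', incr f i x‖ₑ ^ 2 ≤ (∑ i ∈ F', ‖incr f i x‖ₑ) ^ 2 := by
        gcongr; exact enorm_sum_le _ _
    _ ≤ (∑ i ∈ F', ENNReal.ofReal (3 * 2 ^ n) * e2 i) ^ 2 := by
        gcongr with i; exact enorm_incr_le hn hf hc i x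
    _ = ENNReal.ofReal (3 * 2 ^ n) ^ 2 * (∑ i ∈ F', e2 i) ^ 2 := by
        rw [← Finset.mul_sum, mul_pow]
    _ ≤ ENNReal.ofReal (3 * 2 ^ n) ^ 2 * (ENNReal.ofReal (gs ((2 : ℝ) ^ (-1 : ℝ))) ^ 2 *
          ∑ i ∈ F', e2 (2 * i)) := by gcongr; exact sq_sum_e2_le F'
    _ = _ := by
        rw [ca, ENNReal.ofReal_pow (by positivity), ENNReal.ofReal_mul (p := 3 * 2 ^ n) (by positivity),
          mul_pow, mul_assoc]

theorem sqn_sum_incr_le {f : Rn n → ℂ} (hn : 0 < n) (hf : Integrable f) (hc : Continuous f)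
    {T : ℤ → Set (Rn n)} (hT : ∀ i, MeasurableSet (T i)) (F : Finset ℤ) :
    sqn (fun x => ∑ i ∈ F, (T i).indicator (incr f i) x) ≤
      ENNReal.ofReal (ca n) * ∑ i ∈ F, e2 (2 * i) * volume (T i) := by
  have hm : ∀ i, Measurable ((T i).indicator (1 : Rn n → ℝ≥0∞)) := fun i =>
    measurable_one.indicator (hT i)
  calc sqn (fun x => ∑ i ∈ F, (T i).indicator (incr f i) x)
      ≤ ∫⁻ x, ENNReal.ofReal (ca n) * ∑ i ∈ F, e2 (2 * i) * (T i).indicator 1 x :=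
        lintegral_mono fun x => enorm_sum_incr_sq_le hn hf hc T F x
    _ = _ := by
        rw [lintegral_const_mul _ (Finset.measurable_fun_sum _ fun i _ => (hm i).const_mul _),
          lintegral_finsetSum _ fun i _ => (hm i).const_mul _]
        congr 1
        refine Finset.sum_congr rfl fun i _ => ?_
        rw [lintegral_const_mul _ (hm i), lintegral_indicator_one (hT i)]

/-- Pointwise bound by the consecutive levels of a decreasing majorant. -/
theorem rpow_le_sum_layers {P : ℝ} (hP : 2 ≤ P) {b I0 : ℤ} (hb : b ≤ I0) {g B : ℤ → ℝ≥0∞}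
    {v : ℝ≥0∞} (hv : v ≠ ∞) (h : ∀ I, b ≤ I → I ≤ I0 → v ≤ g I + B I) (hg : g b = 0)
    (hB : B I0 = 0) :
    v ^ P ≤ 2 ^ P * ∑ I ∈ Finset.Ioc b I0, B (I - 1) ^ (P - 2) * g I ^ 2 := by
  rcases eq_or_ne v 0 with rfl | hv0
  · rw [ENNReal.zero_rpow_of_pos (by linarith)]; exact zero_le
  have hv2 : v / 2 < v := ENNReal.half_lt_self hv0 hv
  have hv20 : 0 < v / 2 := ENNReal.half_pos hv0
  obtain ⟨I, ⟨hbI, hI⟩, hmin⟩ := Int.exists_least_of_bdd (P := fun I => b ≤ I ∧ B I < v / 2)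
    ⟨b, fun z hz => hz.1⟩ ⟨I0, hb, by rw [hB]; exact hv20⟩
  have hII0 : I ≤ I0 := hmin I0 ⟨hb, by rw [hB]; exact hv20⟩
  have hne : I ≠ b := by
    rintro rfl
    have := h I le_rfl hb
    rw [hg, zero_add] at this
    exact absurd (hv2.trans_le this) hI.not_gt
  have hbI' : b < I := lt_of_le_of_ne hbI (Ne.symm hne)
  have hB1 : v ≤ 2 * B (I - 1) := by
    have : ¬ B (I - 1) < v / 2 := fun hlt => by
      have := hmin (I - 1) ⟨by omega, hlt⟩
      omega
    rw [← ENNReal.div_le_iff' two_ne_zero ENNReal.ofNat_ne_top]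
    exact not_lt.1 this
  have hg1 : v ≤ 2 * g I := by
    rw [← ENNReal.div_le_iff' two_ne_zero ENNReal.ofNat_ne_top]
    by_contra hlt
    push Not at hlt
    have := (h I hbI hII0).trans_lt (ENNReal.add_lt_add hlt hI)
    rw [ENNReal.add_halves] at this
    exact lt_irrefl _ this
  calc v ^ P = v ^ (P - 2) * v ^ 2 := by
        rw [← ENNReal.rpow_natCast v 2, ← ENNReal.rpow_add_of_nonneg _ _ (by linarith) (by simp)]
        congr 1; push_cast; ring
    _ ≤ (2 * B (I - 1)) ^ (P - 2) * (2 * g I) ^ 2 := by gcongr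
    _ = 2 ^ P * (B (I - 1) ^ (P - 2) * g I ^ 2) := by
        rw [ENNReal.mul_rpow_of_nonneg _ _ (by linarith), mul_pow,
          show (2 : ℝ≥0∞) ^ P = 2 ^ (P - 2) * 2 ^ 2 by
            rw [← ENNReal.rpow_natCast 2 2, ← ENNReal.rpow_add_of_nonneg _ _ (by linarith)
              (by simp)]
            congr 1; push_cast; ring]
        ring
    _ ≤ _ := by
        gcongr
        exact Finset.single_le_sum (f := fun I => B (I - 1) ^ (P - 2) * g I ^ 2)
          (fun _ _ => zero_le) (Finset.mem_Ioc.2 ⟨hbI', hII0⟩)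

theorem lintegral_sqn_TT_le (n : ℕ) (M : ℝ) : ∃ C : ℝ, 0 ≤ C ∧ ∀ (k : ℤ) (G A : Rn n → ℝ) (D : ℝ),
    Adm M G A → 0 < D → ∀ h, BM h →
      ∫⁻ x, ∫⁻ u in Icc (1 / 2 : ℝ) 4, ‖TT k (u * D) G A h x‖ₑ ^ 2 ≤
        ENNReal.ofReal (C * (D ^ n)⁻¹) * sqn h := by
  obtain ⟨C, hC, hT⟩ := sqn_TT_le n M
  refine ⟨4 * (C * 2 ^ n), by positivity, fun k G A D hA hD h hh => ?_⟩
  have hm := measurable_TT_param D hA k hh.1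
  rw [lintegral_lintegral_swap]
  · calc ∫⁻ u in Icc (1 / 2 : ℝ) 4, ∫⁻ x, ‖TT k (u * D) G A h x‖ₑ ^ 2
        ≤ ∫⁻ _u in Icc (1 / 2 : ℝ) 4, ENNReal.ofReal (C * 2 ^ n * (D ^ n)⁻¹) * sqn h := by
          refine setLIntegral_mono' measurableSet_Icc fun u hu => ?_
          have hu0 : 0 < u := by linarith [hu.1]
          refine (hT k G A (u * D) hA (by positivity) h hh).trans ?_
          gcongr
          rw [mul_pow, div_eq_mul_inv, mul_inv, ← mul_assoc]
          gcongr
          rw [← inv_pow]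
          gcongr
          rw [inv_le_comm₀ hu0 two_pos]
          linarith [hu.1]
      _ ≤ ENNReal.ofReal 4 * (ENNReal.ofReal (C * 2 ^ n * (D ^ n)⁻¹) * sqn h) := by
          rw [setLIntegral_const, mul_comm]
          gcongr
          rw [Real.volume_Icc]
          exact ENNReal.ofReal_le_ofReal (by norm_num)
      _ = _ := by
          rw [← mul_assoc, ← ENNReal.ofReal_mul (by norm_num)]
          congr 2; ring
  · exact (hm.comp (measurable_snd.prodMk measurable_fst)).enorm.pow_const 2 |>.aemeasurable

theorem sum_Ico_add_sum_Ico {β : Type*} [AddCommMonoid β] (φ : ℤ → β) {b I I0 : ℤ} (h : b ≤ I)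
    (h' : I ≤ I0) : ∑ i ∈ Finset.Ico b I0, φ i =
      ∑ i ∈ Finset.Ico b I, φ i + ∑ i ∈ Finset.Ico I I0, φ i := by
  rw [← Finset.sum_union (Finset.Ico_disjoint_Ico_consecutive b I I0),
    Finset.Ico_union_Ico_eq_Ico h h']

theorem near_single (n : ℕ) (hn : 2 ≤ n) (M : ℝ) {p : ℝ} (hp1 : 1 < p) (hp2 : p < 2) :
    ∃ C : ℝ, 0 ≤ C ∧ ∀ (k : ℤ) (G A : Rn n → ℝ) (D : ℝ) (s : ℤ), Adm M G A → 1 ≤ D → s ≤ k →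
      ∀ f : Rn n → ℂ, Integrable f → Continuous f → ∀ b I0 : ℤ, b ≤ I0 →
      ∫⁻ x, (∫⁻ u in Icc (1 / 2 : ℝ) 4,
        ‖TT k (u * D) G A (atoms f b I0 s) x‖ₑ ^ (p / (p - 1))) ^ (p - 1) ≤
      ENNReal.ofReal C * ENNReal.ofReal ((D ^ n)⁻¹) ^ (p - 1) *
        ENNReal.ofReal (dec (D * 2 ^ (s - k))) ^ (2 - p) *
        ∑' i : ℤ, e2 (i * p) * volume (stopCells f i s) := by
  obtain ⟨C1, hC1, hmaj⟩ := exists_majorant_TT n hn M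
  obtain ⟨C2, hC2, hL2⟩ := lintegral_sqn_TT_le n M
  obtain ⟨C3, hC3, hseq⟩ := sum_rpow_mul_rpow_le hp1 hp2
  have hn0 : 0 < n := by omega
  set P := p / (p - 1) with hP
  have hp0 : 0 < p - 1 := by linarith
  have hP2 : 2 ≤ P := by rw [hP, le_div_iff₀ hp0]; linarith
  have hPp : (P - 2) * (p - 1) = 2 - p := by rw [hP]; field_simp; ring
  set K : ℝ≥0∞ := (2 ^ P) ^ (p - 1) * (ENNReal.ofReal (C1 * (3 * 2 ^ n)) ^ (2 - p) *
    ENNReal.ofReal (C2 * ca n) ^ (p - 1)) * ENNReal.ofReal C3 with hK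
  have hKt : K ≠ ∞ := by
    refine ENNReal.mul_ne_top (ENNReal.mul_ne_top ?_ (ENNReal.mul_ne_top ?_ ?_))
      ENNReal.ofReal_ne_top
    · exact ENNReal.rpow_ne_top_of_nonneg hp0.le
        (ENNReal.rpow_ne_top_of_nonneg (by linarith) ENNReal.ofNat_ne_top)
    · exact ENNReal.rpow_ne_top_of_nonneg (by linarith) ENNReal.ofReal_ne_top
    · exact ENNReal.rpow_ne_top_of_nonneg hp0.le ENNReal.ofReal_ne_top
  refine ⟨K.toReal, ENNReal.toReal_nonneg, fun k G A D s hA hD hsk f hf hc b I0 hb => ?_⟩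
  rw [ENNReal.ofReal_toReal hKt]
  set δ := dec (D * 2 ^ (s - k)) with hδ
  set μ : ℤ → ℝ≥0∞ := fun i => volume (stopCells f i s) with hμ
  have hbm := fun i => bm_atom hn0 hf hc i s
  choose α hαm hα hαi using fun i => hmaj k G A D (3 * 2 ^ n * 2 ^ i) s (stopCells f i s) hA hD
    (by positivity) hsk (measurableSet_stop f i s) (sat_stop f i s) (atom f i s) (hbm i)
    (norm_atom_le hn0 hf hc i s) (fun x hx => by_contra fun h => hx (indicator_of_notMem h _))
    (mz_good hn0 hf hc i s)
  set B : ℤ → Rn n → ℝ≥0∞ := fun I x => ∑ i ∈ Finset.Ico I I0, α i x with hB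
  have hBm : ∀ I, Measurable (B I) := fun I => Finset.measurable_fun_sum _ fun i _ => hαm i
  set T : ℤ → ℝ → Rn n → ℂ := fun I u x => TT k (u * D) G A (atoms f b I s) x with hT
  have hTm : ∀ I, Measurable fun q : ℝ × Rn n => T I q.1 q.2 := fun I =>
    measurable_TT_param D hA k (bm_atoms hn0 hf hc b I s).1
  set Γ : ℤ → Rn n → ℝ≥0∞ := fun I x => ∫⁻ u in Icc (1 / 2 : ℝ) 4, ‖T I u x‖ₑ ^ 2 with hΓ
  have hΓm : ∀ I, Measurable (Γ I) := fun I => by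
    have : Measurable (Function.uncurry fun (x : Rn n) (u : ℝ) => ‖T I u x‖ₑ ^ 2) :=
      ((hTm I).comp (measurable_snd.prodMk measurable_fst)).enorm.pow_const 2
    exact this.lintegral_prod_right'
  have hpt : ∀ x, ∀ u ∈ Icc (1 / 2 : ℝ) 4, ‖T I0 u x‖ₑ ^ P ≤
      2 ^ P * ∑ I ∈ Finset.Ioc b I0, B (I - 1) x ^ (P - 2) * ‖T I u x‖ₑ ^ 2 := by
    intro x u hu
    refine rpow_le_sum_layers hP2 hb enorm_ne_top (g := fun I => ‖T I u x‖ₑ)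
      (B := fun I => B I x) (fun I hbI hI => ?_) ?_ ?_
    · have hsplit : atoms f b I0 s =
          fun y => atoms f b I s y + ∑ i ∈ Finset.Ico I I0, atom f i s y := by
        ext y
        exact sum_Ico_add_sum_Ico (fun i => atom f i s y) hbI hI
      simp only [hT, hB]
      rw [hsplit, TT_add hA k (bm_atoms hn0 hf hc b I s) (BM.sum _ hbm),
        TT_sum hA k _ hbm]
      refine (enorm_add_le _ _).trans (add_le_add le_rfl ((enorm_sum_le _ _).trans ?_))
      exact Finset.sum_le_sum fun i _ => hα i u hu x
    · have : atoms f b b s = fun _ => 0 := by ext y; simp [atoms]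
      simp only [hT, this, TT_zero, enorm_zero]
    · simp [hB]
  have hx : ∀ x, (∫⁻ u in Icc (1 / 2 : ℝ) 4, ‖T I0 u x‖ₑ ^ P) ^ (p - 1) ≤
      (2 ^ P) ^ (p - 1) * ∑ I ∈ Finset.Ioc b I0, B (I - 1) x ^ (2 - p) * Γ I x ^ (p - 1) := by
    intro x
    have hm1 : ∀ I, Measurable fun u => ‖T I u x‖ₑ ^ 2 := fun I =>
      ((hTm I).comp (measurable_id.prodMk measurable_const)).enorm.pow_const 2
    have h1 : ∫⁻ u in Icc (1 / 2 : ℝ) 4, ‖T I0 u x‖ₑ ^ P ≤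
        2 ^ P * ∑ I ∈ Finset.Ioc b I0, B (I - 1) x ^ (P - 2) * Γ I x := by
      refine (setLIntegral_mono' measurableSet_Icc (hpt x)).trans (le_of_eq ?_)
      rw [lintegral_const_mul _ (Finset.measurable_fun_sum _ fun I _ => (hm1 I).const_mul _),
        lintegral_finsetSum _ fun I _ => (hm1 I).const_mul _]
      congr 1
      exact Finset.sum_congr rfl fun I _ => lintegral_const_mul _ (hm1 I)
    calc _ ≤ (2 ^ P * ∑ I ∈ Finset.Ioc b I0, B (I - 1) x ^ (P - 2) * Γ I x) ^ (p - 1) := by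
          gcongr
      _ = (2 ^ P) ^ (p - 1) *
          (∑ I ∈ Finset.Ioc b I0, B (I - 1) x ^ (P - 2) * Γ I x) ^ (p - 1) :=
          ENNReal.mul_rpow_of_nonneg _ _ hp0.le
      _ ≤ _ := by
          gcongr
          refine (rpow_sum_le _ _ hp0 (by linarith)).trans (le_of_eq ?_)
          refine Finset.sum_congr rfl fun I _ => ?_
          rw [ENNReal.mul_rpow_of_nonneg _ _ hp0.le, ← ENNReal.rpow_mul, hPp]
  have hBi : ∀ I, ∫⁻ x, B I x ≤ ENNReal.ofReal (C1 * (3 * 2 ^ n)) * ENNReal.ofReal δ *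
      ∑ i ∈ Finset.Ico I I0, e2 i * μ i := fun I => by
    rw [lintegral_finsetSum _ fun i _ => hαm i, Finset.mul_sum]
    refine Finset.sum_le_sum fun i _ => (hαi i).trans (le_of_eq ?_)
    rw [← ofReal_zpow, ← ENNReal.ofReal_mul (by positivity), ← mul_assoc (ENNReal.ofReal _),
      ← ENNReal.ofReal_mul' (by positivity)]
    congr 2
    ring
  have hΓi : ∀ I, ∫⁻ x, Γ I x ≤ ENNReal.ofReal (C2 * ca n) * ENNReal.ofReal ((D ^ n)⁻¹) *
      ∑ i ∈ Finset.Ico b I, e2 (2 * i) * μ i := fun I => by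
    refine (hL2 k G A D hA (by linarith) _ (bm_atoms hn0 hf hc b I s)).trans ?_
    have := sqn_sum_incr_le hn0 hf hc (fun i => measurableSet_stop f i s) (Finset.Ico b I)
    refine (mul_le_mul_right this _).trans (le_of_eq ?_)
    rw [← mul_assoc, ← ENNReal.ofReal_mul (by positivity), ← ENNReal.ofReal_mul' (by positivity)]
    congr 2; ring
  calc ∫⁻ x, (∫⁻ u in Icc (1 / 2 : ℝ) 4, ‖T I0 u x‖ₑ ^ P) ^ (p - 1)
      ≤ ∫⁻ x, (2 ^ P) ^ (p - 1) *
          ∑ I ∈ Finset.Ioc b I0, B (I - 1) x ^ (2 - p) * Γ I x ^ (p - 1) := lintegral_mono hx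
    _ = (2 ^ P) ^ (p - 1) *
          ∑ I ∈ Finset.Ioc b I0, ∫⁻ x, B (I - 1) x ^ (2 - p) * Γ I x ^ (p - 1) := by
        have : ∀ I, Measurable fun x => B (I - 1) x ^ (2 - p) * Γ I x ^ (p - 1) := fun I =>
          ((hBm _).pow_const _).mul ((hΓm I).pow_const _)
        rw [lintegral_const_mul _ (Finset.measurable_fun_sum _ fun I _ => this I),
          lintegral_finsetSum _ fun I _ => this I]
    _ ≤ (2 ^ P) ^ (p - 1) * ∑ I ∈ Finset.Ioc b I0,
          (ENNReal.ofReal (C1 * (3 * 2 ^ n)) ^ (2 - p) * ENNReal.ofReal δ ^ (2 - p) *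
            (ENNReal.ofReal (C2 * ca n) ^ (p - 1) * ENNReal.ofReal ((D ^ n)⁻¹) ^ (p - 1))) *
          ((∑ i ∈ Finset.Ico b I, e2 (2 * i) * μ i) ^ (p - 1) *
            (∑ i ∈ Finset.Ico (I - 1) I0, e2 i * μ i) ^ (2 - p)) := by
        gcongr with I
        refine (ENNReal.lintegral_mul_norm_pow_le (hBm _).aemeasurable (hΓm I).aemeasurable
          (by linarith) hp0.le (by ring)).trans ?_
        refine (mul_le_mul' (ENNReal.rpow_le_rpow (hBi (I - 1)) (by linarith))
          (ENNReal.rpow_le_rpow (hΓi I) hp0.le)).trans (le_of_eq ?_)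
        simp only [ENNReal.mul_rpow_of_nonneg _ _ hp0.le,
          ENNReal.mul_rpow_of_nonneg _ _ (show 0 ≤ 2 - p by linarith)]
        ring
    _ ≤ (2 ^ P) ^ (p - 1) *
          ((ENNReal.ofReal (C1 * (3 * 2 ^ n)) ^ (2 - p) * ENNReal.ofReal δ ^ (2 - p) *
            (ENNReal.ofReal (C2 * ca n) ^ (p - 1) * ENNReal.ofReal ((D ^ n)⁻¹) ^ (p - 1))) *
          (ENNReal.ofReal C3 * ∑' i : ℤ, e2 (i * p) * μ i)) := by
        rw [← Finset.mul_sum]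
        gcongr
        exact hseq μ b I0
    _ = _ := by rw [hK]; ring

end ShortVariation

namespace ShortVariation
variable {n : ℕ}

/-- The union of the stopping cells at height `2 ^ i` of side at most `2 ^ k`. -/
def smallStop (f : Rn n → ℂ) (i k : ℤ) : Set (Rn n) := ⋃ s ≤ k, stopCells f i s

/-- The part of `good f I - good f b` carried by the stopping cells of side at most `2 ^ k`. -/
def lowPart (f : Rn n → ℂ) (b I k : ℤ) (x : Rn n) : ℂ :=
  ∑ i ∈ Finset.Ico b I, (smallStop f i k).indicator (incr f i) x

theorem measurableSet_smallStop (f : Rn n → ℂ) (i k : ℤ) : MeasurableSet (smallStop f i k) :=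
  MeasurableSet.iUnion fun s => MeasurableSet.iUnion fun _ => measurableSet_stop f i s

theorem bm_lowPart {f : Rn n → ℂ} (hn : 0 < n) (hf : Integrable f) (hc : Continuous f)
    (b I k : ℤ) : BM (lowPart f b I k) :=
  BM.sum _ fun i => (bm_incr hn hf hc i).indicator (measurableSet_smallStop f i k)

/-- The atoms of side `2 ^ s`, discarded when `s > k`. -/
def cutAtoms (f : Rn n → ℂ) (b I k s : ℤ) : Rn n → ℂ :=
  if s ≤ k then atoms f b I s else fun _ => 0

theorem bm_cutAtoms {f : Rn n → ℂ} (hn : 0 < n) (hf : Integrable f) (hc : Continuous f)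
    (b I k s : ℤ) : BM (cutAtoms f b I k s) := by
  unfold cutAtoms
  split_ifs
  · exact bm_atoms hn hf hc b I s
  · exact BM.zero

theorem hasSum_cutAtoms (f : Rn n → ℂ) (b I k : ℤ) (x : Rn n) :
    HasSum (fun s => cutAtoms f b I k s x) (lowPart f b I k x) := by
  have h : (fun s => cutAtoms f b I k s x) =
      fun s => ∑ i ∈ Finset.Ico b I, if s ≤ k then atom f i s x else 0 := by
    ext s
    unfold cutAtoms atoms
    split_ifs <;> simp
  rw [h]
  refine hasSum_sum fun i _ => ?_
  by_cases hx : x ∈ smallStop f i k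
  · obtain ⟨s, hs, hxs⟩ : ∃ s ≤ k, x ∈ stopCells f i s := by simpa [smallStop] using hx
    have h2 : (smallStop f i k).indicator (incr f i) x = if s ≤ k then atom f i s x else 0 := by
      rw [if_pos hs, atom, indicator_of_mem hx, indicator_of_mem hxs]
    rw [h2]
    refine hasSum_single s fun s' hs' => ?_
    rw [atom, indicator_of_notMem fun h' => hs' (stop_unique h' hxs), ite_self]
  · have h0 : ∀ s ≤ k, x ∉ stopCells f i s := by simpa [smallStop] using hx
    have h2 : (fun s => if s ≤ k then atom f i s x else 0) = fun _ => 0 := by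
      ext s
      split_ifs with hs
      · rw [atom, indicator_of_notMem (h0 s hs)]
      · rfl
    rw [h2, indicator_of_notMem hx]
    exact hasSum_zero

theorem tsum_enorm_cutAtoms_le {f : Rn n → ℂ} (hn : 0 < n) (hf : Integrable f)
    (hc : Continuous f) (b I k : ℤ) (x : Rn n) : ∑' s, ‖cutAtoms f b I k s x‖ₑ ≤
      ∑ i ∈ Finset.Ico b I, ENNReal.ofReal (3 * 2 ^ n) * e2 i := by
  have h : ∀ s, ‖cutAtoms f b I k s x‖ₑ ≤ ∑ i ∈ Finset.Ico b I, ‖atom f i s x‖ₑ := fun s => by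
    unfold cutAtoms atoms
    split_ifs
    · exact enorm_sum_le _ _
    · simp
  refine (ENNReal.tsum_le_tsum h).trans ?_
  rw [Summable.tsum_finsetSum fun _ _ => ENNReal.summable]
  refine Finset.sum_le_sum fun i _ => ?_
  by_cases hx : ∃ s, x ∈ stopCells f i s
  · obtain ⟨s, hs⟩ := hx
    rw [tsum_eq_single s fun s' hs' => by
      rw [atom, indicator_of_notMem fun h' => hs' (stop_unique h' hs), enorm_zero]]
    rw [atom, indicator_of_mem hs]
    exact enorm_incr_le hn hf hc i x
  · push Not at hx
    have : ∀ s, ‖atom f i s x‖ₑ = 0 := fun s => by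
      rw [atom, indicator_of_notMem (hx s), enorm_zero]
    simp [this]

theorem enorm_TT_le_tsum {ι : Type*} [Countable ι] {M lam : ℝ} {G A : Rn n → ℝ} (h : Adm M G A)
    (k : ℤ) {H : Rn n → ℂ} {a : ι → Rn n → ℂ} (ha : ∀ s, BM (a s)) {B : ℝ≥0∞} (hB : B ≠ ∞)
    (hs : ∀ x, HasSum (fun s => a s x) (H x)) (hb : ∀ x, ∑' s, ‖a s x‖ₑ ≤ B) (x : Rn n) :
    ‖TT k lam G A H x‖ₑ ≤ ∑' s, ‖TT k lam G A (a s) x‖ₑ := by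
  have h1 : ∀ s, Integrable fun y => oscKer lam G (fun x y => A (x - y)) ((2 : ℝ) ^ (-k) • x) y *
      a s ((2 : ℝ) ^ k • y) := fun s => h.integrable ((ha s).comp_smul k) _
  have hone : Integrable fun y => oscKer lam G (fun x y => A (x - y)) ((2 : ℝ) ^ (-k) • x) y *
      (1 : ℂ) := h.integrable ⟨measurable_const, 1, fun _ => by simp⟩ _
  have h2 : ∑' s, ∫⁻ y, ‖oscKer lam G (fun x y => A (x - y)) ((2 : ℝ) ^ (-k) • x) y *
      a s ((2 : ℝ) ^ k • y)‖ₑ ≠ ∞ := by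
    rw [← lintegral_tsum fun s => (h1 s).1.enorm]
    refine ne_top_of_le_ne_top (ENNReal.mul_ne_top hone.2.ne hB) ?_
    rw [← lintegral_mul_const' _ _ hB]
    refine lintegral_mono fun y => ?_
    simp only [enorm_mul, ENNReal.tsum_mul_left, mul_one]
    gcongr
    exact hb _
  have h3 : TT k lam G A H x = ∑' s, TT k lam G A (a s) x := by
    unfold TT cv opK
    rw [← integral_tsum (fun s => (h1 s).1) h2]
    congr 1; ext y
    rw [tsum_mul_left, (hs _).tsum_eq]
  rw [h3]
  exact enorm_tsum_le_tsum_enorm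

theorem enorm_TT_lowPart_le {f : Rn n → ℂ} (hn : 0 < n) (hf : Integrable f) (hc : Continuous f)
    {M lam : ℝ} {G A : Rn n → ℝ} (h : Adm M G A) (b I k k' : ℤ) (d : ℤ) (x : Rn n) :
    ‖TT k' lam G A (lowPart f b I k) x‖ₑ ≤
      ∑' c : ℤ, ‖TT k' lam G A (cutAtoms f b I k (k - d + c)) x‖ₑ := by
  refine (enorm_TT_le_tsum h k' (bm_cutAtoms hn hf hc b I k)
    (ENNReal.sum_ne_top.2 fun i _ => ENNReal.mul_ne_top ENNReal.ofReal_ne_top (e2_ne_top _))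
    (hasSum_cutAtoms f b I k) (tsum_enorm_cutAtoms_le hn hf hc b I k) x).trans (le_of_eq ?_)
  exact ((Equiv.addLeft (k - d)).tsum_eq fun s => ‖TT k' lam G A (cutAtoms f b I k s) x‖ₑ).symm

theorem ofReal_dec_zpow_le (c : ℤ) : ENNReal.ofReal (dec ((2 : ℝ) ^ c)) ≤ e2 (-|(c : ℝ)| / 2) := by
  rw [e2]
  refine ENNReal.ofReal_le_ofReal ?_
  rcases le_total (c : ℝ) 0 with h | h
  · refine (min_le_left _ _).trans ?_
    rw [← Real.rpow_intCast, abs_of_nonpos h]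
    exact Real.rpow_le_rpow_of_exponent_le one_le_two (by linarith)
  · refine (min_le_right _ _).trans (le_of_eq ?_)
    rw [← Real.rpow_intCast, Real.sqrt_eq_rpow, ← Real.rpow_mul two_pos.le,
      ← Real.rpow_neg two_pos.le, abs_of_nonneg h]
    congr 1; ring

theorem near_sum (n : ℕ) (hn : 2 ≤ n) (M : ℝ) (Mu : ℕ) {p : ℝ} (hp1 : 1 < p) (hp2 : p < 2) :
    ∃ C : ℝ, 0 ≤ C ∧ ∀ (ι : Type) [Countable ι] (k : ι → ℤ) (G A : ι → Rn n → ℝ) (d : ℤ),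
      (∀ j, Adm M (G j) (A j)) → 0 ≤ d → (∀ c, (k ⁻¹' {c}).encard ≤ Mu) →
      ∀ f : Rn n → ℂ, Integrable f → Continuous f → ∀ b I0 : ℤ, b ≤ I0 →
      ∑' j, ∫⁻ x, (∫⁻ u in Icc (1 / 2 : ℝ) 4,
        ‖TT (k j) (u * 2 ^ d) (G j) (A j) (lowPart f b I0 (k j)) x‖ₑ ^ (p / (p - 1))) ^ (p - 1) ≤
      ENNReal.ofReal C * e2 (-(n * d * (p - 1))) * ∫⁻ x, ‖f x‖ₑ ^ p := by
  obtain ⟨C1, hC1, hsing⟩ := near_single n hn M hp1 hp2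
  obtain ⟨C2, hC2, hom⟩ := tsum_om_le (n := n) hp1
  set P := p / (p - 1) with hP
  have hp0 : 0 < p - 1 := by linarith
  have hP0 : 0 < P := by positivity
  have hPp : P * (p - 1) = p := by rw [hP]; field_simp
  set β : ℝ := (2 - p) / (4 * p) with hβ
  have hβ0 : 0 < β := div_pos (by linarith) (by linarith)
  set L : ℝ≥0∞ := (ENNReal.ofReal (gs ((2 : ℝ) ^ (-β))) ^ P) ^ (p - 1) with hL
  set C : ℝ≥0∞ := L * ENNReal.ofReal C1 * (Mu * ENNReal.ofReal C2) *
    ENNReal.ofReal (gs ((2 : ℝ) ^ (-((2 - p) / 4)))) with hC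
  have hLt : L ≠ ∞ := by
    refine ENNReal.rpow_ne_top_of_nonneg hp0.le (ENNReal.rpow_ne_top_of_nonneg hP0.le ?_)
    exact ENNReal.ofReal_ne_top
  have hCt : C ≠ ∞ := by
    simp [hC, ENNReal.mul_eq_top, hLt]
  refine ⟨C.toReal, ENNReal.toReal_nonneg, fun ι _ k G A d hA hd hk f hf hc b I0 hb => ?_⟩
  rw [ENNReal.ofReal_toReal hCt]
  have hn0 : 0 < n := by omega
  set V : ι → ℤ → ℝ → Rn n → ℂ := fun j c u x =>
    TT (k j) (u * 2 ^ d) (G j) (A j) (cutAtoms f b I0 (k j) (k j - d + c)) x with hV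
  have hVm : ∀ j c, Measurable fun q : ℝ × Rn n => V j c q.1 q.2 := fun j c =>
    measurable_TT_param _ (hA j) _ (bm_cutAtoms hn0 hf hc _ _ _ _).1
  have hVu : ∀ j c x, Measurable fun u : ℝ => ‖V j c u x‖ₑ ^ P := fun j c x =>
    (((hVm j c).comp measurable_prodMk_right).enorm).pow_const P
  have hVx : ∀ j c, Measurable fun x => (∫⁻ u in Icc (1 / 2 : ℝ) 4, ‖V j c u x‖ₑ ^ P) ^ (p - 1) :=
    fun j c => (Measurable.lintegral_prod_left' ((hVm j c).enorm.pow_const P)).pow_const _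
  have hpt : ∀ j x, (∫⁻ u in Icc (1 / 2 : ℝ) 4,
      ‖TT (k j) (u * 2 ^ d) (G j) (A j) (lowPart f b I0 (k j)) x‖ₑ ^ P) ^ (p - 1) ≤
      L * ∑' c : ℤ, e2 (p * (β * |(c : ℝ)|)) *
        (∫⁻ u in Icc (1 / 2 : ℝ) 4, ‖V j c u x‖ₑ ^ P) ^ (p - 1) := fun j x => by
    calc _ ≤ (∫⁻ u in Icc (1 / 2 : ℝ) 4, ENNReal.ofReal (gs ((2 : ℝ) ^ (-β))) ^ P *
          ∑' c : ℤ, e2 (P * (β * |(c : ℝ)|)) * ‖V j c u x‖ₑ ^ P) ^ (p - 1) := by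
          gcongr with u
          refine le_trans ?_ (rpow_tsum_le_weighted hβ0 hP0 fun c => ‖V j c u x‖ₑ)
          gcongr
          exact enorm_TT_lowPart_le hn0 hf hc (hA j) _ _ _ _ _ _
      _ = L * (∑' c : ℤ, e2 (P * (β * |(c : ℝ)|)) *
          ∫⁻ u in Icc (1 / 2 : ℝ) 4, ‖V j c u x‖ₑ ^ P) ^ (p - 1) := by
          rw [lintegral_const_mul' _ _ (ENNReal.rpow_ne_top_of_nonneg hP0.le ENNReal.ofReal_ne_top),
            ENNReal.mul_rpow_of_nonneg _ _ hp0.le,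
            lintegral_tsum fun c => ((hVu j c x).const_mul _).aemeasurable]
          simp_rw [lintegral_const_mul' _ _ (e2_ne_top _)]
          rfl
      _ ≤ _ := by
          gcongr
          refine (rpow_tsum_le _ hp0 (by linarith)).trans (le_of_eq ?_)
          refine tsum_congr fun c => ?_
          rw [ENNReal.mul_rpow_of_nonneg _ _ hp0.le, e2_rpow]
          congr 2
          rw [mul_right_comm, hPp]
  have hDn : ENNReal.ofReal (((2 : ℝ) ^ d) ^ n)⁻¹ ^ (p - 1) = e2 (-(n * d * (p - 1))) := by
    have : (((2 : ℝ) ^ d) ^ n)⁻¹ = (2 : ℝ) ^ (-(n * d) : ℝ) := by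
      rw [Real.rpow_neg two_pos.le, mul_comm, Real.rpow_mul two_pos.le, Real.rpow_intCast,
        Real.rpow_natCast]
    rw [this, ← e2, e2_rpow]
    congr 1; ring
  have hInt : ∀ (j : ι) (c : ℤ), e2 (p * (β * |(c : ℝ)|)) *
      ∫⁻ x, (∫⁻ u in Icc (1 / 2 : ℝ) 4, ‖V j c u x‖ₑ ^ P) ^ (p - 1) ≤
      ENNReal.ofReal C1 * e2 (-(n * d * (p - 1))) * e2 (-((2 - p) / 4) * |(c : ℝ)|) *
        ∑' i : ℤ, e2 (i * p) * volume (stopCells f i (k j - d + c)) := fun j c => by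
    by_cases hcd : c ≤ d
    · have hle : k j - d + c ≤ k j := by omega
      have h1 := hsing (k j) (G j) (A j) (2 ^ d) (k j - d + c) (hA j)
        (one_le_zpow₀ one_le_two hd) hle f hf hc b I0 hb
      have h2 : (2 : ℝ) ^ d * 2 ^ (k j - d + c - k j) = 2 ^ c := by
        rw [← zpow_add₀ two_ne_zero]; congr 1; ring
      rw [hDn, h2] at h1
      have h3 : ENNReal.ofReal (dec ((2 : ℝ) ^ c)) ^ (2 - p) ≤ e2 (-|(c : ℝ)| / 2 * (2 - p)) := by
        rw [← e2_rpow]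
        exact ENNReal.rpow_le_rpow (ofReal_dec_zpow_le c) (by linarith)
      have h4 : e2 (p * (β * |(c : ℝ)|)) * e2 (-|(c : ℝ)| / 2 * (2 - p)) =
          e2 (-((2 - p) / 4) * |(c : ℝ)|) := by
        rw [← e2_add, hβ]; congr 1; field_simp; ring
      simp only [hV, cutAtoms, if_pos hle]
      calc _ ≤ e2 (p * (β * |(c : ℝ)|)) * (ENNReal.ofReal C1 * e2 (-(n * d * (p - 1))) *
            e2 (-|(c : ℝ)| / 2 * (2 - p)) *
            ∑' i : ℤ, e2 (i * p) * volume (stopCells f i (k j - d + c))) := by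
            gcongr
            exact h1.trans (by gcongr)
        _ = _ := by rw [← h4]; ring
    · have hle : ¬ k j - d + c ≤ k j := by omega
      simp only [hV, cutAtoms, if_neg hle, TT_zero, enorm_zero, ENNReal.zero_rpow_of_pos hP0,
        lintegral_zero, ENNReal.zero_rpow_of_pos hp0, mul_zero, zero_le]
  have hshift : ∀ c, ∑' j, ∑' i : ℤ, e2 (i * p) * volume (stopCells f i (k j - d + c)) ≤
      Mu * ENNReal.ofReal C2 * ∫⁻ x, ‖f x‖ₑ ^ p := fun c => by
    rw [ENNReal.tsum_comm]
    calc _ ≤ ∑' i : ℤ, Mu * (e2 (i * p) * om f i) := by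
          refine ENNReal.tsum_le_tsum fun i => ?_
          rw [ENNReal.tsum_mul_left, mul_left_comm]
          gcongr
          refine (tsum_comp_le hk fun s => volume (stopCells f i (s - d + c))).trans (le_of_eq ?_)
          congr 1
          exact ((Equiv.addRight (c - d)).tsum_eq fun s => volume (stopCells f i s)).symm.trans
            (tsum_congr fun s => by congr 2; simp; ring) |>.symm
      _ ≤ _ := by
          rw [ENNReal.tsum_mul_left, mul_assoc]
          gcongr
          exact hom f hf hc
  calc _ ≤ ∑' j, ∫⁻ x, L * ∑' c : ℤ, e2 (p * (β * |(c : ℝ)|)) *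
        (∫⁻ u in Icc (1 / 2 : ℝ) 4, ‖V j c u x‖ₑ ^ P) ^ (p - 1) :=
        ENNReal.tsum_le_tsum fun j => lintegral_mono (hpt j)
    _ = ∑' j, L * ∑' c : ℤ, e2 (p * (β * |(c : ℝ)|)) *
        ∫⁻ x, (∫⁻ u in Icc (1 / 2 : ℝ) 4, ‖V j c u x‖ₑ ^ P) ^ (p - 1) := by
        refine tsum_congr fun j => ?_
        rw [lintegral_const_mul' _ _ hLt,
          lintegral_tsum fun c => ((hVx j c).const_mul _).aemeasurable]
        simp_rw [lintegral_const_mul' _ _ (e2_ne_top _)]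
    _ ≤ ∑' j, L * ∑' c : ℤ, ENNReal.ofReal C1 * e2 (-(n * d * (p - 1))) *
        e2 (-((2 - p) / 4) * |(c : ℝ)|) *
        ∑' i : ℤ, e2 (i * p) * volume (stopCells f i (k j - d + c)) := by
        exact ENNReal.tsum_le_tsum fun j =>
          mul_le_mul_right (ENNReal.tsum_le_tsum fun c => hInt j c) _
    _ = L * ∑' c : ℤ, ENNReal.ofReal C1 * e2 (-(n * d * (p - 1))) *
        e2 (-((2 - p) / 4) * |(c : ℝ)|) *
        ∑' j, ∑' i : ℤ, e2 (i * p) * volume (stopCells f i (k j - d + c)) := by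
        rw [ENNReal.tsum_mul_left, ENNReal.tsum_comm]
        simp_rw [ENNReal.tsum_mul_left]
    _ ≤ L * ∑' c : ℤ, ENNReal.ofReal C1 * e2 (-(n * d * (p - 1))) *
        e2 (-((2 - p) / 4) * |(c : ℝ)|) * (Mu * ENNReal.ofReal C2 * ∫⁻ x, ‖f x‖ₑ ^ p) := by
        gcongr with c
        exact hshift c
    _ = L * (ENNReal.ofReal C1 * e2 (-(n * d * (p - 1))) *
        (Mu * ENNReal.ofReal C2 * ∫⁻ x, ‖f x‖ₑ ^ p)) *
        ∑' c : ℤ, e2 (-((2 - p) / 4) * |(c : ℝ)|) := by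
        rw [mul_assoc L]
        congr 1
        rw [← ENNReal.tsum_mul_left]
        exact tsum_congr fun c => by ring
    _ ≤ L * (ENNReal.ofReal C1 * e2 (-(n * d * (p - 1))) *
        (Mu * ENNReal.ofReal C2 * ∫⁻ x, ‖f x‖ₑ ^ p)) *
        (1 * ENNReal.ofReal (gs ((2 : ℝ) ^ (-((2 - p) / 4))))) := by
        gcongr
        refine tsum_le_of_e2 (by linarith : 0 < (2 - p) / 4) 0 fun i => ?_
        simp
    _ = _ := by rw [hC]; ring

end ShortVariation

namespace ShortVariation
variable {n : ℕ}

/-- The union of all stopping cells at height `2 ^ i`. -/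
def allStop (f : Rn n → ℂ) (i : ℤ) : Set (Rn n) := ⋃ s, stopCells f i s

theorem measurableSet_allStop (f : Rn n → ℂ) (i : ℤ) : MeasurableSet (allStop f i) :=
  MeasurableSet.iUnion fun s => measurableSet_stop f i s

theorem volume_allStop_le (f : Rn n → ℂ) (i : ℤ) : volume (allStop f i) ≤ om f i :=
  measure_iUnion_le _

theorem incr_eq_zero {f : Rn n → ℂ} (hn : 0 < n) (hf : Integrable f) {i : ℤ} {x : Rn n}
    (hx : x ∉ allStop f i) : incr f i x = 0 := by
  have h : ∀ s, x ∉ stopCells f i s := by simpa [allStop] using hx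
  rw [incr, good_of_notMem h, good_of_notMem, sub_self]
  intro s hs
  obtain ⟨s', -, hs'⟩ := stop_nest hn hf (by omega : i ≤ i + 1) hs
  exact h s' hs'

theorem sum_incr (f : Rn n → ℂ) {b I : ℤ} (hb : b ≤ I) (x : Rn n) :
    ∑ i ∈ Finset.Ico b I, incr f i x = good f I x - good f b x := by
  induction I, hb using Int.leInduction with
  | base => simp
  | succ I hI ih =>
    rw [← Finset.insert_Ico_right_eq_Ico_add_one hI, Finset.sum_insert (by simp), ih, incr]
    ring

theorem good_sub_good {f : Rn n → ℂ} (hn : 0 < n) (hf : Integrable f) {b I : ℤ} (hb : b ≤ I)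
    (x : Rn n) : good f I x - good f b x =
      ∑ i ∈ Finset.Ico b I, (allStop f i).indicator (incr f i) x := by
  rw [← sum_incr f hb]
  refine Finset.sum_congr rfl fun i _ => ?_
  by_cases hx : x ∈ allStop f i
  · rw [indicator_of_mem hx]
  · rw [indicator_of_notMem hx, incr_eq_zero hn hf hx]

/-- The part of `good f I - good f b` carried by the stopping cells of side more than `2 ^ k`. -/
def highPart (f : Rn n → ℂ) (b I k : ℤ) (x : Rn n) : ℂ :=
  good f I x - good f b x - lowPart f b I k x

/-- The energy of the stopping cells at the heights between `2 ^ b` and `2 ^ I`. -/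
def energy (f : Rn n → ℂ) (b I : ℤ) : ℝ≥0∞ := ∑ i ∈ Finset.Ico b I, e2 (2 * i) * om f i

section
variable {f : Rn n → ℂ} (hn : 0 < n) (hf : Integrable f) (hc : Continuous f)
include hn hf hc

theorem bm_highPart (b I k : ℤ) : BM (highPart f b I k) :=
  ((bm_good hn hf hc I).sub (bm_good hn hf hc b)).sub (bm_lowPart hn hf hc b I k)

theorem sqn_good_sub_good_le {b I : ℤ} (hb : b ≤ I) :
    sqn (fun x => good f I x - good f b x) ≤ ENNReal.ofReal (ca n) * energy f b I := by
  simp_rw [good_sub_good hn hf hb]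
  refine (sqn_sum_incr_le hn hf hc (fun i => measurableSet_allStop f i) _).trans ?_
  unfold energy
  gcongr
  exact volume_allStop_le f _

theorem energy_lt_top (b I : ℤ) : energy f b I < ∞ :=
  ENNReal.sum_lt_top.2 fun i _ => ENNReal.mul_lt_top (e2_ne_top _).lt_top (om_lt_top hf hc i)

end

theorem tsum_sqn_TT_lowPart_le (n : ℕ) (hn : 0 < n) (M η : ℝ) (hη : 0 < η) (hη1 : η ≤ 1)
    (Mu : ℕ) : ∃ C : ℝ, 0 ≤ C ∧ ∀ (ι : Type) [Countable ι] (k : ι → ℤ) (G A : ι → Rn n → ℝ)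
      (lam : ℝ), (∀ j, Adm M (G j) (A j)) → 1 ≤ 2 * lam → (∀ c, (k ⁻¹' {c}).encard ≤ Mu) →
      ∀ f : Rn n → ℂ, Integrable f → Continuous f → ∀ b I : ℤ,
      ∑' j, sqn (TT (k j) lam (G j) (A j) (lowPart f b I (k j))) ≤
        ENNReal.ofReal (C * lam ^ (-(n : ℝ) + (n + 2) * η)) * energy f b I := by
  obtain ⟨C1, hC1, h1⟩ := sqn_TT_le n M
  obtain ⟨C2, hC2, h2⟩ := sqn_TT_le_of_MZ n M
  set Cm := max C1 C2
  have hCm : 0 ≤ Cm := le_max_of_le_left hC1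
  set g : ℝ := gs ((2 : ℝ) ^ (-(η / 2))) with hg
  set g' : ℝ := gs ((2 : ℝ) ^ (-η)) with hg'
  have hg0 : 0 ≤ g := tsum_nonneg fun c => by positivity
  have hg0' : 0 ≤ g' := tsum_nonneg fun c => by positivity
  have hca : 0 ≤ ca n := sq_nonneg _
  refine ⟨g ^ 2 * (Cm * ca n * Mu * g'), by positivity,
    fun ι _ k G A lam hA hlam hk f hf hc b I => ?_⟩
  have hl0 : 0 < lam := by linarith
  set V : ι → ℤ → Rn n → ℂ := fun j c => TT (k j) lam (G j) (A j)
    (cutAtoms f b I (k j) (k j + c)) with hV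
  have hVm : ∀ j c, Measurable (V j c) := fun j c =>
    measurable_TT (hA j) _ (bm_cutAtoms hn hf hc _ _ _ _).1
  have hW : ∀ j, sqn (TT (k j) lam (G j) (A j) (lowPart f b I (k j))) ≤
      ENNReal.ofReal (g ^ 2) * ∑' c : ℤ, e2 (η * |(c : ℝ)|) * sqn (V j c) := fun j => by
    unfold sqn
    simp_rw [← lintegral_const_mul' _ _ (e2_ne_top _)]
    rw [← lintegral_tsum fun c => (((hVm j c).enorm.pow_const 2).const_mul _).aemeasurable,
      ← lintegral_const_mul' _ _ ENNReal.ofReal_ne_top]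
    refine lintegral_mono fun x => ?_
    have h3 := enorm_TT_lowPart_le hn hf hc (hA j) (lam := lam) b I (k j) (k j) 0 x
    simp only [sub_zero] at h3
    have h4 := rpow_tsum_le_weighted (half_pos hη) two_pos fun c => ‖V j c x‖ₑ
    simp only [ENNReal.rpow_two] at h4
    refine (pow_le_pow_left₀ zero_le h3 2).trans (h4.trans (le_of_eq ?_))
    rw [ENNReal.ofReal_pow hg0]
    congr 1
    exact tsum_congr fun c => by congr 2; ring
  have hVs : ∀ (j : ι) (c : ℤ), e2 (η * |(c : ℝ)|) * sqn (V j c) ≤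
      ENNReal.ofReal (Cm * ca n * lam ^ (-(n : ℝ) + (n + 2) * η)) * e2 (-η * |(c : ℝ)|) *
        ∑ i ∈ Finset.Ico b I, e2 (2 * i) * volume (stopCells f i (k j + c)) := fun j c => by
    by_cases hc0 : c ≤ 0
    · have hle : k j + c ≤ k j := by omega
      have hc0' : (c : ℝ) ≤ 0 := by exact_mod_cast hc0
      simp only [hV, cutAtoms, if_pos hle]
      have h3 := h1 (k j) (G j) (A j) lam (hA j) hl0 _ (bm_atoms hn hf hc b I (k j + c))
      have h4 := h2 (k j) (G j) (A j) lam (hA j) hlam _ hle _ (bm_atoms hn hf hc b I (k j + c))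
        (mz_atoms hn hf hc b I (k j + c))
      have h5 := sqn_sum_incr_le hn hf hc (fun i => measurableSet_stop f i (k j + c))
        (Finset.Ico b I)
      set σ := sqn (atoms f b I (k j + c)) with hσ
      have h6 : sqn (TT (k j) lam (G j) (A j) (atoms f b I (k j + c))) ≤
          ENNReal.ofReal (Cm * (lam ^ (-(n : ℝ) + (n + 2) * η) * 2 ^ (2 * η * c))) * σ := by
        have e3 : C1 / lam ^ n ≤ Cm * lam ^ (-(n : ℝ)) := by
          rw [Real.rpow_neg hl0.le, Real.rpow_natCast, div_eq_mul_inv]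
          gcongr; exact le_max_left _ _
        have e4 : C2 * (lam * 2 ^ (k j + c - k j)) ^ 2 ≤ Cm * (lam * 2 ^ (c : ℝ)) ^ (2 : ℝ) := by
          rw [add_sub_cancel_left, Real.rpow_intCast, Real.rpow_two]
          gcongr; exact le_max_right _ _
        have e5 : min (lam ^ (-(n : ℝ))) ((lam * 2 ^ (c : ℝ)) ^ (2 : ℝ)) ≤
            lam ^ (-(n : ℝ) + (n + 2) * η) * 2 ^ (2 * η * c) := by
          set a := lam ^ (-(n : ℝ))
          set b' := (lam * 2 ^ (c : ℝ)) ^ (2 : ℝ)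
          have ha : 0 < a := by positivity
          have hb : 0 < b' := by positivity
          have hm : 0 < min a b' := lt_min ha hb
          calc min a b' = min a b' ^ (1 - η) * min a b' ^ η := by
                rw [← Real.rpow_add hm]; simp
            _ ≤ a ^ (1 - η) * b' ^ η := by
                exact mul_le_mul (Real.rpow_le_rpow hm.le (min_le_left _ _) (by linarith))
                  (Real.rpow_le_rpow hm.le (min_le_right _ _) hη.le) (by positivity)
                  (by positivity)
            _ = _ := by
                simp only [a, b']
                rw [← Real.rpow_mul hl0.le, ← Real.rpow_mul (by positivity),
                  Real.mul_rpow hl0.le (by positivity), ← Real.rpow_mul two_pos.le, ← mul_assoc,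
                  ← Real.rpow_add hl0]
                congr 2 <;> ring
        rcases min_le_iff.1 e5 with h | h
        · refine h3.trans ?_
          exact mul_le_mul_left (ENNReal.ofReal_le_ofReal
            (e3.trans (mul_le_mul_of_nonneg_left h hCm))) _
        · refine h4.trans ?_
          exact mul_le_mul_left (ENNReal.ofReal_le_ofReal
            (e4.trans (mul_le_mul_of_nonneg_left h hCm))) _
      calc _ ≤ e2 (η * |(c : ℝ)|) *
            (ENNReal.ofReal (Cm * (lam ^ (-(n : ℝ) + (n + 2) * η) * 2 ^ (2 * η * c))) *
            (ENNReal.ofReal (ca n) * ∑ i ∈ Finset.Ico b I, e2 (2 * i) *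
              volume (stopCells f i (k j + c)))) := by
            gcongr
            exact h6.trans (by gcongr; exact h5)
        _ = _ := by
            have e6 : e2 (-η * |(c : ℝ)|) = e2 (η * |(c : ℝ)|) * e2 (2 * η * c) := by
              rw [← e2_add, abs_of_nonpos hc0']; congr 1; ring
            rw [e6, e2, e2, mul_assoc Cm, mul_comm (ca n), ← mul_assoc Cm, ← mul_assoc Cm,
              ENNReal.ofReal_mul (by positivity), ENNReal.ofReal_mul' hca]
            ring
    · have hle : ¬ k j + c ≤ k j := by omega
      simp only [hV, cutAtoms, if_neg hle, TT_zero, sqn]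
      simp
  have hsum : ∀ c, ∑' j, ∑ i ∈ Finset.Ico b I, e2 (2 * i) * volume (stopCells f i (k j + c)) ≤
      Mu * energy f b I := fun c => by
    rw [Summable.tsum_finsetSum fun _ _ => ENNReal.summable, energy, Finset.mul_sum]
    refine Finset.sum_le_sum fun i _ => ?_
    rw [ENNReal.tsum_mul_left, mul_left_comm]
    gcongr
    refine (tsum_comp_le hk fun s => volume (stopCells f i (s + c))).trans (le_of_eq ?_)
    congr 1
    exact (Equiv.addRight c).tsum_eq fun s => volume (stopCells f i s)
  set Z := ENNReal.ofReal (Cm * ca n * lam ^ (-(n : ℝ) + (n + 2) * η)) with hZ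
  calc _ ≤ ∑' j, ENNReal.ofReal (g ^ 2) * ∑' c : ℤ, Z * e2 (-η * |(c : ℝ)|) *
        ∑ i ∈ Finset.Ico b I, e2 (2 * i) * volume (stopCells f i (k j + c)) :=
        ENNReal.tsum_le_tsum fun j => (hW j).trans
          (mul_le_mul_right (ENNReal.tsum_le_tsum fun c => hVs j c) _)
    _ = ENNReal.ofReal (g ^ 2) * ∑' c : ℤ, Z * e2 (-η * |(c : ℝ)|) *
        ∑' j, ∑ i ∈ Finset.Ico b I, e2 (2 * i) * volume (stopCells f i (k j + c)) := by
        rw [ENNReal.tsum_mul_left, ENNReal.tsum_comm]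
        simp_rw [ENNReal.tsum_mul_left]
    _ ≤ ENNReal.ofReal (g ^ 2) * ∑' c : ℤ, Z * e2 (-η * |(c : ℝ)|) * (Mu * energy f b I) :=
        mul_le_mul_right (ENNReal.tsum_le_tsum fun c => mul_le_mul_right (hsum c) _) _
    _ ≤ ENNReal.ofReal (g ^ 2) * ((Z * (Mu * energy f b I)) * ENNReal.ofReal g') := by
        gcongr
        refine tsum_le_of_e2 hη 0 fun c => le_of_eq ?_
        simp; ring
    _ = _ := by
        rw [hZ, show g ^ 2 * (Cm * ca n * Mu * g') * lam ^ (-(n : ℝ) + (n + 2) * η) =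
          g ^ 2 * ((Cm * ca n * lam ^ (-(n : ℝ) + (n + 2) * η)) * (Mu * g')) by ring,
          ENNReal.ofReal_mul (by positivity) (p := g ^ 2), ENNReal.ofReal_mul (by positivity)
          (p := _ * lam ^ _), ENNReal.ofReal_mul (by positivity) (p := (Mu : ℝ)),
          ENNReal.ofReal_natCast]
        ring

end ShortVariation

namespace ShortVariation
variable {n : ℕ}

theorem sqn_neg (h : Rn n → ℂ) : sqn (fun x => -h x) = sqn h := by simp [sqn]

theorem rpow_le_e2 {u : ℝ} (hu : 1 / 2 ≤ u) (d : ℤ) {E : ℝ} (hE : E ≤ 0) :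
    ENNReal.ofReal ((u * 2 ^ d) ^ E) ≤ e2 (-E) * e2 (d * E) := by
  rw [← e2_add, e2]
  refine ENNReal.ofReal_le_ofReal ?_
  have h : (2 : ℝ) ^ ((d : ℝ) - 1) ≤ u * 2 ^ d := by
    rw [Real.rpow_sub two_pos, Real.rpow_intCast, Real.rpow_one]
    have : (0 : ℝ) < 2 ^ d := by positivity
    nlinarith
  refine (Real.rpow_le_rpow_of_nonpos (by positivity) h hE).trans (le_of_eq ?_)
  rw [← Real.rpow_mul two_pos.le]; congr 1; ring

theorem tsum_sqn_TT_highPart_le (n : ℕ) (hn : 0 < n) (M η : ℝ) (hη : 0 < η) (hη1 : η ≤ 1)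
    (hηn : (n + 2) * η ≤ n) (Mu : ℕ) :
    ∃ C : ℝ, 0 ≤ C ∧ ∀ (ι : Type) [Countable ι] (k : ι → ℤ) (G A : ι → Rn n → ℝ) (d : ℤ),
      (∀ j, Adm M (G j) (A j)) → 0 ≤ d → (∀ c, (k ⁻¹' {c}).encard ≤ Mu) →
      (∀ j lam, ∫ x, kap lam (G j) (A j) x = 0) →
      ∀ f : Rn n → ℂ, Integrable f → Continuous f → ∀ b I : ℤ, b ≤ I →
      ∀ u ∈ Icc (1 / 2 : ℝ) 4,
      ∑' j, sqn (TT (k j) (u * 2 ^ d) (G j) (A j) (highPart f b I (k j))) ≤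
        ENNReal.ofReal C * e2 (d * (-(n : ℝ) + (n + 2) * η)) * energy f b I := by
  obtain ⟨C1, hC1, h1⟩ := tsum_sqn_TT_le n hn M η hη hη1 Mu
  obtain ⟨C2, hC2, h2⟩ := tsum_sqn_TT_lowPart_le n hn M η hη hη1 Mu
  set E : ℝ := -(n : ℝ) + (n + 2) * η with hE
  have hE0 : E ≤ 0 := by rw [hE]; linarith
  have hca : 0 ≤ ca n := sq_nonneg _
  refine ⟨2 * (C1 * ca n + C2) * 2 ^ (-E), by positivity,
    fun ι _ k G A d hA hd hk hz f hf hc b I hb u hu => ?_⟩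
  have hD : (1 : ℝ) ≤ 2 ^ d := one_le_zpow₀ one_le_two hd
  have hlam : 1 ≤ 2 * (u * 2 ^ d) := by nlinarith [hu.1]
  have hl0 : 0 < u * (2 : ℝ) ^ d := by linarith
  have hgd : BM fun x => good f I x - good f b x :=
    (bm_good hn hf hc I).sub (bm_good hn hf hc b)
  have hsq := sqn_good_sub_good_le hn hf hc hb
  have hfin : sqn (fun x => good f I x - good f b x) < ∞ :=
    hsq.trans_lt (ENNReal.mul_lt_top ENNReal.ofReal_lt_top (energy_lt_top hn hf hc b I))
  have h3 := h1 ι k G A (u * 2 ^ d) hA hlam hk (fun j => hz j _) _ hgd hfin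
  have h4 := h2 ι k G A (u * 2 ^ d) hA hlam hk f hf hc b I
  have h5 : ∀ j, sqn (TT (k j) (u * 2 ^ d) (G j) (A j) (highPart f b I (k j))) ≤
      2 * (sqn (TT (k j) (u * 2 ^ d) (G j) (A j) fun x => good f I x - good f b x) +
        sqn (TT (k j) (u * 2 ^ d) (G j) (A j) (lowPart f b I (k j)))) := fun j => by
    rw [← sqn_neg (TT (k j) (u * 2 ^ d) (G j) (A j) (lowPart f b I (k j)))]
    refine sqn_le_add (measurable_TT (hA j) _ hgd.1) fun x => ?_
    rw [← sub_eq_add_neg]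
    exact TT_sub (hA j) _ hgd (bm_lowPart hn hf hc b I (k j)) x
  have h6 := rpow_le_e2 hu.1 d hE0
  calc _ ≤ 2 * (ENNReal.ofReal (C1 * (u * 2 ^ d) ^ E) * (ENNReal.ofReal (ca n) * energy f b I) +
        ENNReal.ofReal (C2 * (u * 2 ^ d) ^ E) * energy f b I) := by
        refine (ENNReal.tsum_le_tsum h5).trans ?_
        rw [ENNReal.tsum_mul_left, ENNReal.tsum_add]
        gcongr
        exact h3.trans (by gcongr)
    _ = 2 * (ENNReal.ofReal C1 * ENNReal.ofReal (ca n) + ENNReal.ofReal C2) *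
        ENNReal.ofReal ((u * 2 ^ d) ^ E) * energy f b I := by
        rw [ENNReal.ofReal_mul hC1, ENNReal.ofReal_mul hC2]; ring
    _ ≤ 2 * (ENNReal.ofReal C1 * ENNReal.ofReal (ca n) + ENNReal.ofReal C2) *
        (e2 (-E) * e2 (d * E)) * energy f b I := by gcongr
    _ = _ := by
        rw [ENNReal.ofReal_mul (by positivity), ENNReal.ofReal_mul (by positivity),
          ENNReal.ofReal_add (by positivity) hC2, ENNReal.ofReal_mul hC1, e2, e2]
        simp only [ENNReal.ofReal_ofNat]
        ring

theorem enorm_TT_sq_le {M : ℝ} {G A : Rn n → ℝ} (hA : Adm M G A)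
    (hA' : Adm M G fun t => G t * A t) (k d : ℤ) (hd : 0 ≤ d) {f : Rn n → ℂ} (hf : BM f)
    (x : Rn n) {u : ℝ} (hu : u ∈ Icc (1 / 2 : ℝ) 4) : ‖TT k (u * 2 ^ d) G A f x‖ₑ ^ 2 ≤
      2 * e2 d * ((∫⁻ v in Icc (1 / 2 : ℝ) 4, ‖TT k (v * 2 ^ d) G A f x‖ₑ ^ 2) +
        ∫⁻ v in Icc (1 / 2 : ℝ) 4, ‖TT k (v * 2 ^ d) G (fun t => G t * A t) f x‖ₑ ^ 2) := by
  have hD : (1 : ℝ) ≤ 2 ^ d := one_le_zpow₀ one_le_two hd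
  have hD0 : (0 : ℝ) < 2 ^ d := by positivity
  have hg := fun v => hasDerivAt_cv hD0.le hA (hf.comp_smul k) ((2 : ℝ) ^ (-k) • x) v
  have hg' := fun v => hasDerivAt_cv hD0.le hA' (hf.comp_smul k) ((2 : ℝ) ^ (-k) • x) v
  have hcont : Continuous fun v : ℝ => cv (v * 2 ^ d) G (fun t => G t * A t)
      (fun y => f ((2 : ℝ) ^ k • y)) ((2 : ℝ) ^ (-k) • x) :=
    continuous_iff_continuousAt.2 fun v => (hg' v).continuousAt
  have h := sobolev_sup hg (continuous_const.mul hcont) hD hu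
  refine h.trans (le_of_eq ?_)
  have e1 : ENNReal.ofReal ((2 : ℝ) ^ d)⁻¹ * (e2 d) ^ 2 = e2 d := by
    rw [← ofReal_zpow, ← ENNReal.ofReal_pow (by positivity), ← ENNReal.ofReal_mul (by positivity)]
    congr 1; field_simp
  have e3 : ‖Complex.I * (((2 : ℝ) ^ d : ℝ) : ℂ)‖ₑ = e2 d := by
    rw [enorm_mul, ← ofReal_norm, ← ofReal_norm, Complex.norm_I, Complex.norm_real,
      Real.norm_of_nonneg hD0.le, ofReal_zpow]
    simp
  simp_rw [enorm_mul (Complex.I * _), e3, mul_pow]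
  rw [lintegral_const_mul' _ _ (ENNReal.pow_ne_top (e2_ne_top _)), ← mul_assoc, e1, ofReal_zpow,
    ← mul_add, mul_assoc]
  rfl

/-- The `ℓ²`-valued size of the far parts. -/
def farSize {ι : Type} (P : ℝ) (k : ι → ℤ) (G A : ι → Rn n → ℝ) (d : ℤ) (f : Rn n → ℂ) (b I : ℤ)
    (x : Rn n) : ℝ≥0∞ :=
  ∑' j, (∫⁻ u in Icc (1 / 2 : ℝ) 4,
    ‖TT (k j) (u * 2 ^ d) (G j) (A j) (highPart f b I (k j)) x‖ₑ ^ P) ^ (2 / P)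

theorem measurable_farSize {ι : Type} [Countable ι] {M P : ℝ} {k : ι → ℤ} {G A : ι → Rn n → ℝ}
    {d : ℤ} {f : Rn n → ℂ} {b I : ℤ} (hn : 0 < n) (hf : Integrable f) (hc : Continuous f)
    (hA : ∀ j, Adm M (G j) (A j)) : Measurable (farSize P k G A d f b I) := by
  refine Measurable.tsum fun j => ?_
  exact (Measurable.lintegral_prod_left' ((measurable_TT_param _ (hA j) _
    (bm_highPart hn hf hc b I (k j)).1).enorm.pow_const P)).pow_const _

theorem lintegral_farSize_le (n : ℕ) (hn : 0 < n) (M η P : ℝ) (hP : 0 < P) (hη : 0 < η)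
    (hη1 : η ≤ 1) (hηn : (n + 2) * η ≤ n) (Mu : ℕ) :
    ∃ C : ℝ, 0 ≤ C ∧ ∀ (ι : Type) [Countable ι] (k : ι → ℤ) (G A : ι → Rn n → ℝ) (d : ℤ),
      (∀ j, Adm M (G j) (A j)) → (∀ j, Adm M (G j) fun t => G j t * A j t) → 0 ≤ d →
      (∀ c, (k ⁻¹' {c}).encard ≤ Mu) → (∀ j lam, ∫ x, kap lam (G j) (A j) x = 0) →
      (∀ j lam, ∫ x, kap lam (G j) (fun t => G j t * A j t) x = 0) →
      ∀ f : Rn n → ℂ, Integrable f → Continuous f → ∀ b I : ℤ, b ≤ I →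
      ∫⁻ x, farSize P k G A d f b I x ≤
        ENNReal.ofReal C * e2 (d * (1 - n + (n + 2) * η)) * energy f b I := by
  obtain ⟨C, hC, H⟩ := tsum_sqn_TT_highPart_le n hn M η hη hη1 hηn Mu
  set V : ℝ≥0∞ := volume (Icc (1 / 2 : ℝ) 4) with hV
  have hVt : V ≠ ∞ := measure_Icc_lt_top.ne
  set W : ℝ≥0∞ := V ^ (2 / P) * (2 * (2 * (ENNReal.ofReal C * V))) with hW
  have hVPt : V ^ (2 / P) ≠ ∞ := ENNReal.rpow_ne_top_of_nonneg (by positivity) hVt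
  have hWt : W ≠ ∞ := by simp [hW, ENNReal.mul_eq_top, hVPt, hVt]
  refine ⟨W.toReal, ENNReal.toReal_nonneg,
    fun ι _ k G A d hA hA' hd hk hz hz' f hf hc b I hb => ?_⟩
  rw [ENNReal.ofReal_toReal hWt]
  set Q : (ι → Rn n → ℝ) → ι → Rn n → ℝ≥0∞ := fun A j x => ∫⁻ v in Icc (1 / 2 : ℝ) 4,
    ‖TT (k j) (v * 2 ^ d) (G j) (A j) (highPart f b I (k j)) x‖ₑ ^ 2 with hQ
  have hbm := fun j => bm_highPart hn hf hc b I (k j)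
  have hpm : ∀ A : ι → Rn n → ℝ, (∀ j, Adm M (G j) (A j)) → ∀ j, Measurable fun q : ℝ × Rn n =>
      ‖TT (k j) (q.1 * 2 ^ d) (G j) (A j) (highPart f b I (k j)) q.2‖ₑ ^ 2 := fun A hA j =>
    (measurable_TT_param _ (hA j) _ (hbm j).1).enorm.pow_const 2
  have hQm : ∀ A : ι → Rn n → ℝ, (∀ j, Adm M (G j) (A j)) → ∀ j, Measurable (Q A j) :=
    fun A hA j => Measurable.lintegral_prod_left' (hpm A hA j)
  have hpt : ∀ j x, (∫⁻ u in Icc (1 / 2 : ℝ) 4,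
      ‖TT (k j) (u * 2 ^ d) (G j) (A j) (highPart f b I (k j)) x‖ₑ ^ P) ^ (2 / P) ≤
      V ^ (2 / P) * (2 * e2 d * (Q A j x + Q (fun j t => G j t * A j t) j x)) := fun j x => by
    set Sx := 2 * e2 d * (Q A j x + Q (fun j t => G j t * A j t) j x) with hSx
    have h1 : ∫⁻ u in Icc (1 / 2 : ℝ) 4,
        ‖TT (k j) (u * 2 ^ d) (G j) (A j) (highPart f b I (k j)) x‖ₑ ^ P ≤ Sx ^ (P / 2) * V := by
      rw [hV, ← setLIntegral_const]
      refine setLIntegral_mono measurable_const fun u hu => ?_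
      have := enorm_TT_sq_le (hA j) (hA' j) (k j) d hd (hbm j) x hu
      rw [← ENNReal.rpow_two] at this
      have h2 := ENNReal.rpow_le_rpow this (by positivity : 0 ≤ P / 2)
      rwa [← ENNReal.rpow_mul, mul_div_cancel₀ _ two_ne_zero] at h2
    refine (ENNReal.rpow_le_rpow h1 (by positivity)).trans (le_of_eq ?_)
    rw [ENNReal.mul_rpow_of_nonneg _ _ (by positivity), ← ENNReal.rpow_mul,
      show P / 2 * (2 / P) = 1 by field_simp, ENNReal.rpow_one, mul_comm]
  have hInt : ∀ A : ι → Rn n → ℝ, (∀ j, Adm M (G j) (A j)) →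
      (∀ j lam, ∫ x, kap lam (G j) (A j) x = 0) → ∑' j, ∫⁻ x, Q A j x ≤
      ENNReal.ofReal C * e2 (d * (-(n : ℝ) + (n + 2) * η)) * energy f b I * V := by
    intro A hA hz
    have h1 : ∀ j, ∫⁻ x, Q A j x = ∫⁻ u in Icc (1 / 2 : ℝ) 4,
        sqn (TT (k j) (u * 2 ^ d) (G j) (A j) (highPart f b I (k j))) := fun j => by
      simp only [hQ, sqn]
      exact lintegral_lintegral_swap (((hpm A hA j).comp measurable_swap).aemeasurable)
    simp_rw [h1]
    have h2 : ∀ j, Measurable fun u : ℝ =>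
        sqn (TT (k j) (u * 2 ^ d) (G j) (A j) (highPart f b I (k j))) := fun j =>
      Measurable.lintegral_prod_right' (hpm A hA j)
    rw [← lintegral_tsum fun j => (h2 j).aemeasurable,
      hV, ← setLIntegral_const]
    exact setLIntegral_mono measurable_const fun u hu => H ι k G A d hA hd hk hz f hf hc b I hb u hu
  calc _ ≤ ∫⁻ x, V ^ (2 / P) * (2 * e2 d * ∑' j, (Q A j x + Q (fun j t => G j t * A j t) j x)) := by
        refine lintegral_mono fun x => ?_
        rw [← ENNReal.tsum_mul_left, ← ENNReal.tsum_mul_left]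
        exact ENNReal.tsum_le_tsum fun j => hpt j x
    _ = V ^ (2 / P) * (2 * e2 d * ((∑' j, ∫⁻ x, Q A j x) +
        ∑' j, ∫⁻ x, Q (fun j t => G j t * A j t) j x)) := by
        have hQ2 : ∀ j, Measurable fun x => Q A j x + Q (fun j t => G j t * A j t) j x :=
          fun j => (hQm A hA j).add (hQm _ hA' j)
        rw [lintegral_const_mul' _ _ hVPt, lintegral_const_mul' _ _
          (ENNReal.mul_ne_top (by norm_num) (e2_ne_top _)),
          lintegral_tsum fun j => (hQ2 j).aemeasurable, ← ENNReal.tsum_add]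
        congr 2
        exact tsum_congr fun j => lintegral_add_left (hQm A hA j) _
    _ ≤ V ^ (2 / P) * (2 * e2 d *
        (ENNReal.ofReal C * e2 (d * (-(n : ℝ) + (n + 2) * η)) * energy f b I * V +
        ENNReal.ofReal C * e2 (d * (-(n : ℝ) + (n + 2) * η)) * energy f b I * V)) := by
        gcongr
        · exact hInt A hA hz
        · exact hInt _ hA' hz'
    _ = _ := by
        rw [show (d : ℝ) * (1 - n + (n + 2) * η) = d + d * (-(n : ℝ) + (n + 2) * η) by ring,
          e2_add, hW]
        ring

end ShortVariation

namespace ShortVariation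
variable {n : ℕ}

/-- The union of the enlarged stopping cells at height `2 ^ i`. -/
def enlarged (f : Rn n → ℂ) (i : ℤ) : Set (Rn n) :=
  ⋃ (s : ℤ) (v : Fin n → ℤ) (_ : (stopCells f i s ∩ cube s v).Nonempty),
    Metric.closedBall (corner s v) ((2 : ℝ) ^ s * (n + 2))

theorem measurableSet_enlarged (f : Rn n → ℂ) (i : ℤ) : MeasurableSet (enlarged f i) :=
  MeasurableSet.iUnion fun _ => MeasurableSet.iUnion fun _ => MeasurableSet.iUnion fun _ =>
    Metric.isClosed_closedBall.measurableSet

theorem volume_enlarged_le (f : Rn n → ℂ) (i : ℤ) : volume (enlarged f i) ≤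
    volume (Metric.closedBall (0 : Rn n) (n + 2)) * om f i := by
  set c := volume (Metric.closedBall (0 : Rn n) (n + 2)) with hc
  unfold enlarged om
  rw [← ENNReal.tsum_mul_left]
  refine (measure_iUnion_le _).trans (ENNReal.tsum_le_tsum fun s => ?_)
  have h : volume (stopCells f i s) = ∑' v, volume (stopCells f i s ∩ cube s v) := by
    rw [← measure_iUnion (fun v w hvw => ((pairwise_disjoint_cube s hvw).mono
      inter_subset_right inter_subset_right))
      fun v => (measurableSet_stop f i s).inter (measurableSet_cube s v),
      ← inter_iUnion, iUnion_cube, inter_univ]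
  rw [h, ← ENNReal.tsum_mul_left]
  refine (measure_iUnion_le _).trans (ENNReal.tsum_le_tsum fun v => ?_)
  rcases (sat_stop f i s).inter_cube v with h0 | h0
  · simp [h0]
  · refine (measure_mono (iUnion_subset fun _ => Subset.rfl)).trans (le_of_eq ?_)
    rw [h0, Measure.addHaar_closedBall_mul _ _ (by positivity) (by positivity), volume_cube,
      finrank_euclideanSpace_fin, ENNReal.ofReal_pow (by positivity), mul_comm]

theorem mem_enlarged {f : Rn n → ℂ} {i k s : ℤ} {x y : Rn n} (hy : y ∈ stopCells f i s) (hk : k < s)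
    (hxy : ‖x - y‖ ≤ 2 * 2 ^ k) : x ∈ enlarged f i := by
  simp only [enlarged, mem_iUnion]
  refine ⟨s, cell s y, ⟨y, hy, rfl⟩, ?_⟩
  have h1 := norm_sub_corner_le (y := y) (v := cell s y) (s := s) rfl
  have h2 : (2 : ℝ) * 2 ^ k ≤ 2 ^ s := by
    rw [mul_comm, ← zpow_add_one₀ two_ne_zero]
    exact zpow_le_zpow_right₀ one_le_two hk
  have h3 : (0 : ℝ) < 2 ^ s := by positivity
  rw [Metric.mem_closedBall, dist_eq_norm]
  have := norm_add_le (x - y) (y - corner s (cell s y))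
  rw [sub_add_sub_cancel] at this
  nlinarith

theorem TT_eq_of_eqOn {M lam : ℝ} {G A : Rn n → ℝ} (h : Adm M G A) (k : ℤ) {f g : Rn n → ℂ}
    {x : Rn n} (hfg : ∀ y, ‖x - y‖ ≤ 2 * 2 ^ k → f y = g y) :
    TT k lam G A f x = TT k lam G A g x := by
  unfold TT cv opK
  congr 1; ext y
  by_cases hA : A ((2 : ℝ) ^ (-k) • x - y) = 0
  · simp only [oscKer, hA, Complex.ofReal_zero, mul_zero, zero_mul]
  · have h1 := h.supp _ hA
    refine congrArg _ (hfg _ ?_)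
    have h2 : x - (2 : ℝ) ^ k • y = (2 : ℝ) ^ k • ((2 : ℝ) ^ (-k) • x - y) := by
      rw [smul_sub, smul_smul, ← zpow_add₀ two_ne_zero]; simp
    rw [h2, norm_smul, Real.norm_of_nonneg (by positivity), mul_comm]
    gcongr

theorem highPart_eq_of_notMem {f : Rn n → ℂ} (hn : 0 < n) (hf : Integrable f) {b I I0 k : ℤ}
    (hb : b ≤ I) (hI : I ≤ I0) {x : Rn n} (hx : x ∉ enlarged f I) {y : Rn n}
    (hxy : ‖x - y‖ ≤ 2 * 2 ^ k) : highPart f b I0 k y = highPart f b I k y := by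
  have h : ∀ J, b ≤ J → highPart f b J k y = ∑ i ∈ Finset.Ico b J,
      (incr f i y - (smallStop f i k).indicator (incr f i) y) := fun J hJ => by
    rw [highPart, ← sum_incr f hJ, lowPart, Finset.sum_sub_distrib]
  rw [h I hb, h I0 (hb.trans hI), sum_Ico_add_sum_Ico _ hb hI, add_eq_left]
  refine Finset.sum_eq_zero fun i hi => ?_
  by_cases h0 : y ∈ allStop f i
  · obtain ⟨s, hs⟩ : ∃ s, y ∈ stopCells f i s := by simpa [allStop] using h0
    have hsk : s ≤ k := by
      by_contra! hsk
      obtain ⟨s', hs', hys'⟩ := stop_nest hn hf (Finset.mem_Ico.1 hi).1 hs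
      exact hx (mem_enlarged hys' (by omega) hxy)
    rw [indicator_of_mem, sub_self]
    exact mem_iUnion₂.2 ⟨s, hsk, hs⟩
  · rw [incr_eq_zero hn hf h0]
    simp [incr_eq_zero hn hf h0]

theorem exists_layer {S : ℤ → Set (Rn n)} {b I0 : ℤ} (hb : b ≤ I0) {x : Rn n} (hx : x ∈ S b)
    (hx0 : x ∉ S I0) : ∃ I ∈ Finset.Ioc b I0, x ∈ S (I - 1) ∧ x ∉ S I := by
  by_contra! h
  have : ∀ I, b ≤ I → I ≤ I0 → x ∈ S I := fun I hI => by
    induction I, hI using Int.leInduction with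
    | base => exact fun _ => hx
    | succ I hI ih =>
      intro h'
      exact h (I + 1) (Finset.mem_Ioc.2 ⟨by omega, h'⟩) (by simpa using ih (by omega))
  exact hx0 (this I0 hb le_rfl)

theorem far_sum (n : ℕ) (hn : 2 ≤ n) (M : ℝ) (Mu : ℕ) {p : ℝ} (hp1 : 1 < p)
    (hp2 : p * (n + 1) < 2 * n) :
    ∃ C : ℝ, 0 ≤ C ∧ ∀ (ι : Type) [Countable ι] (k : ι → ℤ) (G A : ι → Rn n → ℝ) (d : ℤ),
      (∀ j, Adm M (G j) (A j)) → (∀ j, Adm M (G j) fun t => G j t * A j t) → 0 ≤ d →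
      (∀ c, (k ⁻¹' {c}).encard ≤ Mu) → (∀ j lam, ∫ x, kap lam (G j) (A j) x = 0) →
      (∀ j lam, ∫ x, kap lam (G j) (fun t => G j t * A j t) x = 0) →
      ∀ f : Rn n → ℂ, Integrable f → Continuous f → ∀ b I0 : ℤ, b ≤ I0 →
      (∀ s, stopCells f I0 s = ∅) →
      ∫⁻ x, farSize (p / (p - 1)) k G A d f b I0 x ^ (p / 2) ≤
        ENNReal.ofReal C * e2 (-(n * d * (p - 1))) * ∫⁻ x, ‖f x‖ₑ ^ p := by
  have hn0 : 0 < n := by omega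
  have hn1 : (2 : ℝ) ≤ n := by exact_mod_cast hn
  have hp22 : p < 2 := by
    by_contra! h
    nlinarith
  set P := p / (p - 1) with hP
  have hpp : 0 < p - 1 := by linarith
  have hP0 : 0 < P := by positivity
  set w : ℝ := (n - 1) - 2 * n * (p - 1) / p with hw
  have hwp : w * p = (n - 1) * p - 2 * n * (p - 1) := by rw [hw]; field_simp
  have hw0 : 0 < w := by
    by_contra! h
    nlinarith
  set η : ℝ := min 1 (w / (n + 2)) with hη
  have hη0 : 0 < η := lt_min one_pos (by positivity)
  have hηw : (n + 2) * η ≤ w := by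
    calc ((n : ℝ) + 2) * η ≤ (n + 2) * (w / (n + 2)) := by gcongr; exact min_le_right _ _
      _ = w := by field_simp
  have hwn : w ≤ n - 1 := by
    have : 0 ≤ 2 * (n : ℝ) * (p - 1) / p := by positivity
    rw [hw]; linarith
  obtain ⟨C1, hC1, H⟩ := lintegral_farSize_le n hn0 M η P hP0 hη0 (min_le_left _ _)
    (by linarith) Mu
  obtain ⟨C2, hC2, hseq⟩ := sum_rpow_mul_rpow_le' hp1 hp22
  obtain ⟨C3, hC3, hom⟩ := tsum_om_le (n := n) hp1
  set c0 := volume (Metric.closedBall (0 : Rn n) (n + 2)) with hc0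
  have hc0t : c0 ≠ ∞ := measure_closedBall_lt_top.ne
  set W : ℝ≥0∞ := ENNReal.ofReal C1 ^ (p / 2) * c0 ^ (1 - p / 2) *
    (ENNReal.ofReal C2 * ENNReal.ofReal C3) with hW
  have hW1 : ENNReal.ofReal C1 ^ (p / 2) ≠ ∞ :=
    ENNReal.rpow_ne_top_of_nonneg (by positivity) ENNReal.ofReal_ne_top
  have hW2 : c0 ^ (1 - p / 2) ≠ ∞ := ENNReal.rpow_ne_top_of_nonneg (by linarith) hc0t
  have hWt : W ≠ ∞ := by simp [hW, ENNReal.mul_eq_top, hW1, hW2]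
  refine ⟨W.toReal, ENNReal.toReal_nonneg,
    fun ι _ k G A d hA hA' hd hk hz hz' f hf hc b I0 hb hemp => ?_⟩
  rw [ENNReal.ofReal_toReal hWt]
  set Φ : ℤ → Rn n → ℝ≥0∞ := fun I => farSize P k G A d f b I with hΦ
  have hΦm : ∀ I, Measurable (Φ I) := fun I => measurable_farSize hn0 hf hc hA
  have hloc : ∀ I, b ≤ I → I ≤ I0 → ∀ x ∉ enlarged f I, Φ I0 x = Φ I x := by
    intro I h1 h2 x hx
    simp only [hΦ, farSize]
    refine tsum_congr fun j => ?_
    congr 1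
    refine lintegral_congr fun u => ?_
    rw [TT_eq_of_eqOn (hA j) (k j) fun y hy => highPart_eq_of_notMem hn0 hf h1 h2 hx hy]
  have hΦb : ∀ x, Φ b x = 0 := fun x => by
    have h0 : ∀ j, highPart f b b (k j) = fun _ => 0 := fun j => by
      ext y; simp [highPart, lowPart]
    simp only [hΦ, farSize, h0, TT_zero, enorm_zero, ENNReal.zero_rpow_of_pos hP0, lintegral_zero]
    rw [ENNReal.zero_rpow_of_pos (by positivity), tsum_zero]
  have hempty : enlarged f I0 = ∅ := by simp [enlarged, hemp]
  have hpt : ∀ x, Φ I0 x ^ (p / 2) ≤ ∑ I ∈ Finset.Ioc b I0, Φ I x ^ (p / 2) *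
      (enlarged f (I - 1)).indicator 1 x ^ (1 - p / 2) := fun x => by
    by_cases hx : x ∈ enlarged f b
    · obtain ⟨I, hI, h1, h2⟩ := exists_layer hb hx (by rw [hempty]; exact notMem_empty x)
      have hI' := Finset.mem_Ioc.1 hI
      rw [hloc I (by omega) hI'.2 x h2]
      refine le_trans (le_of_eq ?_) (Finset.single_le_sum (f := fun I => Φ I x ^ (p / 2) *
        (enlarged f (I - 1)).indicator 1 x ^ (1 - p / 2)) (fun _ _ => zero_le) hI)
      simp [indicator_of_mem h1]
    · rw [hloc b le_rfl hb x hx, hΦb, ENNReal.zero_rpow_of_pos (by positivity)]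
      exact zero_le
  set Z : ℝ≥0∞ := ENNReal.ofReal C1 * e2 (d * (1 - n + (n + 2) * η)) with hZ
  have hlay : ∀ I ∈ Finset.Ioc b I0, ∫⁻ x, Φ I x ^ (p / 2) *
      (enlarged f (I - 1)).indicator 1 x ^ (1 - p / 2) ≤
      Z ^ (p / 2) * c0 ^ (1 - p / 2) * (energy f b I ^ (p / 2) * om f (I - 1) ^ (1 - p / 2)) := by
    intro I hI
    have hI' := Finset.mem_Ioc.1 hI
    have hm : Measurable ((enlarged f (I - 1)).indicator (1 : Rn n → ℝ≥0∞)) :=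
      measurable_one.indicator (measurableSet_enlarged f _)
    refine (ENNReal.lintegral_mul_norm_pow_le (hΦm I).aemeasurable hm.aemeasurable
      (by positivity) (by linarith) (by ring)).trans ?_
    rw [lintegral_indicator_one (measurableSet_enlarged f _)]
    calc _ ≤ (Z * energy f b I) ^ (p / 2) * (c0 * om f (I - 1)) ^ (1 - p / 2) := by
          refine mul_le_mul' (ENNReal.rpow_le_rpow ?_ (by positivity))
            (ENNReal.rpow_le_rpow (volume_enlarged_le f _) (by linarith))
          exact H ι k G A d hA hA' hd hk hz hz' f hf hc b I (by omega)
      _ = _ := by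
          rw [ENNReal.mul_rpow_of_nonneg Z _ (by positivity),
            ENNReal.mul_rpow_of_nonneg c0 _ (by linarith)]
          ring
  have hZp : Z ^ (p / 2) ≤ ENNReal.ofReal C1 ^ (p / 2) * e2 (-(n * d * (p - 1))) := by
    rw [hZ, ENNReal.mul_rpow_of_nonneg _ _ (by positivity), e2_rpow]
    gcongr
    refine e2_le ?_
    have hd' : (0 : ℝ) ≤ d := by exact_mod_cast hd
    have : (1 - n + (n + 2) * η) * p ≤ -(2 * n * (p - 1)) := by nlinarith
    nlinarith
  calc ∫⁻ x, Φ I0 x ^ (p / 2) ≤ ∫⁻ x, ∑ I ∈ Finset.Ioc b I0, Φ I x ^ (p / 2) *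
        (enlarged f (I - 1)).indicator 1 x ^ (1 - p / 2) := lintegral_mono hpt
    _ = ∑ I ∈ Finset.Ioc b I0, ∫⁻ x, Φ I x ^ (p / 2) *
        (enlarged f (I - 1)).indicator 1 x ^ (1 - p / 2) :=
        lintegral_finsetSum _ fun I _ => ((hΦm I).pow_const _).mul
          ((measurable_one.indicator (measurableSet_enlarged f _)).pow_const _)
    _ ≤ ∑ I ∈ Finset.Ioc b I0, Z ^ (p / 2) * c0 ^ (1 - p / 2) *
        (energy f b I ^ (p / 2) * om f (I - 1) ^ (1 - p / 2)) := Finset.sum_le_sum hlay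
    _ ≤ Z ^ (p / 2) * c0 ^ (1 - p / 2) *
        (ENNReal.ofReal C2 * ∑' i : ℤ, e2 (i * p) * om f i) := by
        rw [← Finset.mul_sum]
        gcongr
        exact hseq (om f) b I0
    _ ≤ (ENNReal.ofReal C1 ^ (p / 2) * e2 (-(n * d * (p - 1)))) * c0 ^ (1 - p / 2) *
        (ENNReal.ofReal C2 * (ENNReal.ofReal C3 * ∫⁻ x, ‖f x‖ₑ ^ p)) := by
        gcongr
        exact hom f hf hc
    _ = _ := by rw [hW]; ring

end ShortVariation

namespace ShortVariation
variable {n : ℕ}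

/-- The `L ^ P` norm over the compact range of parameters of an oscillatory integral. -/
def uN (P : ℝ) (k : ℤ) (G A : Rn n → ℝ) (D : ℝ) (h : Rn n → ℂ) (x : Rn n) : ℝ≥0∞ :=
  (∫⁻ u in Icc (1 / 2 : ℝ) 4, ‖TT k (u * D) G A h x‖ₑ ^ P) ^ (1 / P)

theorem measurable_uN {M P D : ℝ} {k : ℤ} {G A : Rn n → ℝ} (hA : Adm M G A) {h : Rn n → ℂ}
    (hh : Measurable h) : Measurable (uN P k G A D h) := by
  have := ((measurable_TT_param D hA k hh).enorm.pow_const P)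
  exact (Measurable.lintegral_prod_left' this).pow_const _

theorem measurable_TT_left {M D : ℝ} {k : ℤ} {G A : Rn n → ℝ} (hA : Adm M G A) {h : Rn n → ℂ}
    (hh : Measurable h) (x : Rn n) : Measurable fun u : ℝ => TT k (u * D) G A h x :=
  Measurable.of_uncurry_right (f := fun u x => TT k (u * D) G A h x) (measurable_TT_param D hA k hh)

theorem uN_add_le {M P D : ℝ} (hP : 1 ≤ P) {k : ℤ} {G A : Rn n → ℝ} (hA : Adm M G A)
    {g h : Rn n → ℂ} (hg : BM g) (hh : BM h) (x : Rn n) :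
    uN P k G A D (fun y => g y + h y) x ≤ uN P k G A D g x + uN P k G A D h x := by
  have hmg := (measurable_TT_left (D := D) (k := k) hA hg.1 x).enorm
  have hmh := (measurable_TT_left (D := D) (k := k) hA hh.1 x).enorm
  refine le_trans ?_ (ENNReal.lintegral_Lp_add_le hmg.aemeasurable hmh.aemeasurable hP)
  refine ENNReal.rpow_le_rpow (lintegral_mono fun u => ?_) (by positivity)
  rw [TT_add hA k hg hh]
  exact ENNReal.rpow_le_rpow (enorm_add_le _ _) (by positivity)

theorem uN_le_of_bound {M P D B : ℝ} (hP : 1 ≤ P) {k : ℤ} {G A : Rn n → ℝ} (hA : Adm M G A)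
    {g : Rn n → ℂ} (hB : ∀ y, ‖g y‖ ≤ B) (x : Rn n) :
    uN P k G A D g x ≤ (ENNReal.ofReal M * volume (Metric.closedBall (0 : Rn n) 2) *
      volume (Icc (1 / 2 : ℝ) 4) ^ (1 / P)) * ENNReal.ofReal B := by
  have hP0 : 0 < P := by linarith
  have h1 : ∀ u, ‖TT k (u * D) G A g x‖ₑ ≤ ENNReal.ofReal M *
      (volume (Metric.closedBall (0 : Rn n) 2) * ENNReal.ofReal B) := fun u => by
    refine (enorm_cv_le hA _ _).trans ?_
    gcongr
    calc _ ≤ ∫⁻ _y in Metric.closedBall ((2 : ℝ) ^ (-k) • x) 2, ENNReal.ofReal B :=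
          lintegral_mono fun y => by
            rw [← ofReal_norm]; exact ENNReal.ofReal_le_ofReal (hB _)
      _ = _ := by
          rw [lintegral_const, Measure.restrict_apply_univ, mul_comm,
            Measure.addHaar_closedBall_center]
  calc uN P k G A D g x ≤ (∫⁻ _u in Icc (1 / 2 : ℝ) 4, (ENNReal.ofReal M *
      (volume (Metric.closedBall (0 : Rn n) 2) * ENNReal.ofReal B)) ^ P) ^ (1 / P) := by
        refine ENNReal.rpow_le_rpow (lintegral_mono fun u => ?_) (by positivity)
        exact ENNReal.rpow_le_rpow (h1 u) hP0.le
    _ = _ := by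
        rw [lintegral_const, Measure.restrict_apply_univ, ENNReal.mul_rpow_of_nonneg _ _
          (by positivity), ← ENNReal.rpow_mul, mul_one_div_cancel hP0.ne', ENNReal.rpow_one]
        ring

theorem rpow_add_le_two_mul (a b : ℝ≥0∞) {r : ℝ} (hr : 0 ≤ r) :
    (a + b) ^ r ≤ 2 ^ r * (a ^ r + b ^ r) := by
  rcases le_total a b with h | h
  · calc (a + b) ^ r ≤ (2 * b) ^ r := by gcongr; rw [two_mul]; gcongr
      _ = 2 ^ r * b ^ r := ENNReal.mul_rpow_of_nonneg _ _ hr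
      _ ≤ _ := by gcongr; exact le_add_self
  · calc (a + b) ^ r ≤ (2 * a) ^ r := by gcongr; rw [two_mul]; gcongr
      _ = 2 ^ r * a ^ r := ENNReal.mul_rpow_of_nonneg _ _ hr
      _ ≤ _ := by gcongr; exact le_self_add

theorem tsum_rpow_le_of_le {ι : Type*} (g L H : ι → ℝ≥0∞) {p r : ℝ} (hp : 0 < p) (hpr : p ≤ r)
    (hr : 2 ≤ r) (h : ∀ j, g j ≤ L j + H j) :
    (∑' j, g j ^ r) ^ (p / r) ≤ 2 ^ p * (∑' j, L j ^ p + (∑' j, H j ^ (2 : ℝ)) ^ (p / 2)) := by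
  have hr0 : 0 < r := by linarith
  have h1 : (∑' j, L j ^ r) ^ (p / r) ≤ ∑' j, L j ^ p := by
    refine (rpow_tsum_le _ (by positivity) ((div_le_one hr0).2 hpr)).trans (le_of_eq ?_)
    refine tsum_congr fun j => ?_
    rw [← ENNReal.rpow_mul, mul_div_cancel₀ _ hr0.ne']
  have h2 : (∑' j, H j ^ r) ^ (p / r) ≤ (∑' j, H j ^ (2 : ℝ)) ^ (p / 2) := by
    have : (∑' j, H j ^ r) ^ (2 / r) ≤ ∑' j, H j ^ (2 : ℝ) := by
      refine (rpow_tsum_le _ (by positivity) ((div_le_one hr0).2 hr)).trans (le_of_eq ?_)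
      refine tsum_congr fun j => ?_
      rw [← ENNReal.rpow_mul, mul_div_cancel₀ _ hr0.ne']
    calc _ = ((∑' j, H j ^ r) ^ (2 / r)) ^ (p / 2) := by
          rw [← ENNReal.rpow_mul]; congr 1; field_simp
      _ ≤ _ := ENNReal.rpow_le_rpow this (by positivity)
  calc (∑' j, g j ^ r) ^ (p / r) ≤ (∑' j, 2 ^ r * (L j ^ r + H j ^ r)) ^ (p / r) := by
        refine ENNReal.rpow_le_rpow (ENNReal.tsum_le_tsum fun j => ?_) (by positivity)
        exact (ENNReal.rpow_le_rpow (h j) hr0.le).trans (rpow_add_le_two_mul _ _ hr0.le)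
    _ = 2 ^ p * (∑' j, L j ^ r + ∑' j, H j ^ r) ^ (p / r) := by
        rw [ENNReal.tsum_mul_left, ENNReal.tsum_add, ENNReal.mul_rpow_of_nonneg _ _ (by positivity),
          ← ENNReal.rpow_mul, mul_div_cancel₀ _ hr0.ne']
    _ ≤ 2 ^ p * ((∑' j, L j ^ r) ^ (p / r) + (∑' j, H j ^ r) ^ (p / r)) := by
        gcongr
        exact ENNReal.rpow_add_le_add_rpow _ _ (by positivity) ((div_le_one hr0).2 hpr)
    _ ≤ _ := by gcongr

theorem tsum_rpow_le_liminf {ι : Type*} (g : ι → ℝ≥0∞) (F : ℕ → ι → ℝ≥0∞) (ε : ℕ → ℝ≥0∞)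
    {a c : ℝ} (ha : 0 < a) (hc : 0 < c) (hε : Tendsto ε atTop (𝓝 0))
    (h : ∀ N j, g j ≤ F N j + ε N) :
    (∑' j, g j ^ a) ^ c ≤ liminf (fun N => (∑' j, F N j ^ a) ^ c) atTop := by
  set L := liminf (fun N => (∑' j, F N j ^ a) ^ c) atTop with hL
  have key : ∀ s : Finset ι, (∑ j ∈ s, g j ^ a) ^ c ≤ L := by
    intro s
    have h1 : Tendsto (fun N => (∑ j ∈ s, (g j - ε N) ^ a) ^ c) atTop
        (𝓝 ((∑ j ∈ s, g j ^ a) ^ c)) := by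
      refine (ENNReal.continuous_rpow_const.tendsto _).comp (tendsto_finsetSum _ fun j _ => ?_)
      refine (ENNReal.continuous_rpow_const.tendsto _).comp ?_
      simpa using ENNReal.Tendsto.sub (tendsto_const_nhds (x := g j)) hε (Or.inr ENNReal.zero_ne_top)
    rw [← h1.liminf_eq]
    refine liminf_le_liminf (Eventually.of_forall fun N => ?_)
    refine ENNReal.rpow_le_rpow (le_trans (Finset.sum_le_sum fun j _ => ?_)
      (ENNReal.sum_le_tsum s)) hc.le
    exact ENNReal.rpow_le_rpow (tsub_le_iff_right.2 (h N j)) ha.le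
  have : ∑' j, g j ^ a ≤ L ^ (1 / c) := by
    rw [ENNReal.tsum_eq_iSup_sum]
    exact iSup_le fun s => by
      rw [one_div]; exact (ENNReal.le_rpow_inv_iff hc).2 (key s)
  calc _ ≤ (L ^ (1 / c)) ^ c := ENNReal.rpow_le_rpow this hc.le
    _ = L := by rw [← ENNReal.rpow_mul, one_div_mul_cancel hc.ne', ENNReal.rpow_one]

theorem exists_stop_empty {f : Rn n → ℂ} (hf : Integrable f) {B : ℝ} (hB : ∀ x, ‖f x‖ ≤ B) :
    ∃ I0 : ℤ, ∀ s, stopCells f I0 s = ∅ := by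
  obtain ⟨N, hN⟩ := pow_unbounded_of_one_lt B (one_lt_two)
  refine ⟨N, fun s => eq_empty_of_forall_notMem fun x hx => ?_⟩
  have h1 := nav_le_of_le hf hB s x
  have h2 := hx.1
  have h3 : ((2 : ℝ) ^ (N : ℤ)) = 2 ^ N := zpow_natCast _ _
  linarith

theorem full_sum (n : ℕ) (hn : 2 ≤ n) (M : ℝ) (Mu : ℕ) {p r : ℝ} (hp1 : 1 < p)
    (hp2 : p * (n + 1) < 2 * n) (hr : 2 ≤ r) :
    ∃ C : ℝ, 0 ≤ C ∧ ∀ (ι : Type) [Countable ι] (k : ι → ℤ) (G A : ι → Rn n → ℝ) (d : ℤ),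
      (∀ j, Adm M (G j) (A j)) → (∀ j, Adm M (G j) fun t => G j t * A j t) → 0 ≤ d →
      (∀ c, (k ⁻¹' {c}).encard ≤ Mu) → (∀ j lam, ∫ x, kap lam (G j) (A j) x = 0) →
      (∀ j lam, ∫ x, kap lam (G j) (fun t => G j t * A j t) x = 0) →
      ∀ f : Rn n → ℂ, Integrable f → Continuous f → (∃ B : ℝ, ∀ x, ‖f x‖ ≤ B) →
      ∫⁻ x, (∑' j, uN (p / (p - 1)) (k j) (G j) (A j) (2 ^ d) f x ^ r) ^ (p / r) ≤
        ENNReal.ofReal C * e2 (-(n * d * (p - 1))) * ∫⁻ x, ‖f x‖ₑ ^ p := by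
  have hn0 : 0 < n := by omega
  have hn1 : (2 : ℝ) ≤ n := by exact_mod_cast hn
  have hp22 : p < 2 := by
    by_contra! h
    nlinarith
  have hpp : 0 < p - 1 := by linarith
  obtain ⟨C1, hC1, Hn⟩ := near_sum n hn M Mu hp1 hp22
  obtain ⟨C2, hC2, Hf⟩ := far_sum n hn M Mu hp1 hp2
  refine ⟨(2 : ℝ) ^ p * (C1 + C2), by positivity,
    fun ι _ k G A d hA hA' hd hk hz hz' f hf hc hB => ?_⟩
  obtain ⟨B, hB⟩ := hB
  obtain ⟨I0, hI0⟩ := exists_stop_empty hf hB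
  set P := p / (p - 1) with hPdef
  have hP1 : 1 ≤ P := by rw [hPdef, le_div_iff₀ hpp]; linarith
  have hP0 : 0 < P := by linarith
  have hgood : ∀ x, good f I0 x = f x := fun x => good_of_notMem fun s => by simp [hI0]
  have hdec : ∀ b K, (fun y => lowPart f b I0 K y + highPart f b I0 K y) =
      fun y => f y - good f b y := fun b K => by
    ext y; rw [highPart, hgood]; ring
  have hbm : ∀ b, BM fun y => f y - good f b y := fun b => by
    rw [← hdec b 0]
    exact (bm_lowPart hn0 hf hc b I0 0).add (bm_highPart hn0 hf hc b I0 0)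
  have hcut : ∀ b ≤ I0, ∫⁻ x, (∑' j, uN P (k j) (G j) (A j) (2 ^ d)
      (fun y => f y - good f b y) x ^ r) ^ (p / r) ≤
      ENNReal.ofReal ((2 : ℝ) ^ p * (C1 + C2)) * e2 (-(n * d * (p - 1))) * ∫⁻ x, ‖f x‖ₑ ^ p := by
    intro b hb
    have hm : ∀ j, Measurable fun x => uN P (k j) (G j) (A j) (2 ^ d) (lowPart f b I0 (k j)) x ^ p :=
      fun j => (measurable_uN (hA j) (bm_lowPart hn0 hf hc b I0 (k j)).1).pow_const _
    have hm1 : Measurable fun x => ∑' j, uN P (k j) (G j) (A j) (2 ^ d)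
        (lowPart f b I0 (k j)) x ^ p := Measurable.tsum hm
    have hm2 : Measurable fun x => farSize P k G A d f b I0 x ^ (p / 2) :=
      (measurable_farSize hn0 hf hc hA).pow_const _
    have hm3 : Measurable fun x => ∑' j, uN P (k j) (G j) (A j) (2 ^ d)
        (lowPart f b I0 (k j)) x ^ p + farSize P k G A d f b I0 x ^ (p / 2) := hm1.add hm2
    calc _ ≤ ∫⁻ x, 2 ^ p * (∑' j, uN P (k j) (G j) (A j) (2 ^ d) (lowPart f b I0 (k j)) x ^ p +
          farSize P k G A d f b I0 x ^ (p / 2)) := by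
          refine lintegral_mono fun x => ?_
          refine (tsum_rpow_le_of_le _
            (fun j => uN P (k j) (G j) (A j) (2 ^ d) (lowPart f b I0 (k j)) x)
            (fun j => uN P (k j) (G j) (A j) (2 ^ d) (highPart f b I0 (k j)) x)
            (by linarith) (by linarith) hr fun j => ?_).trans (le_of_eq ?_)
          · have := uN_add_le (D := 2 ^ d) (k := k j) hP1 (hA j) (bm_lowPart hn0 hf hc b I0 (k j))
              (bm_highPart hn0 hf hc b I0 (k j)) x
            rwa [hdec] at this
          · congr 3
            refine tsum_congr fun j => ?_
            rw [uN, ← ENNReal.rpow_mul]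
            congr 1; ring
      _ = 2 ^ p * ((∑' j, ∫⁻ x, uN P (k j) (G j) (A j) (2 ^ d) (lowPart f b I0 (k j)) x ^ p) +
          ∫⁻ x, farSize P k G A d f b I0 x ^ (p / 2)) := by
          rw [lintegral_const_mul _ hm3, lintegral_add_left hm1,
            lintegral_tsum fun j => (hm j).aemeasurable]
      _ ≤ 2 ^ p * (ENNReal.ofReal C1 * e2 (-(n * d * (p - 1))) * (∫⁻ x, ‖f x‖ₑ ^ p) +
          ENNReal.ofReal C2 * e2 (-(n * d * (p - 1))) * ∫⁻ x, ‖f x‖ₑ ^ p) := by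
          refine mul_le_mul_right (add_le_add ?_
            (Hf ι k G A d hA hA' hd hk hz hz' f hf hc b I0 hb hI0)) (2 ^ p)
          refine le_trans (le_of_eq ?_) (Hn ι k G A d hA hd hk f hf hc b I0 hb)
          refine tsum_congr fun j => lintegral_congr fun x => ?_
          rw [uN, ← ENNReal.rpow_mul]
          congr 1; rw [hPdef]; field_simp
      _ = _ := by
          rw [ENNReal.ofReal_mul (by positivity), ENNReal.ofReal_add hC1 hC2,
            ← ENNReal.ofReal_rpow_of_pos two_pos, ENNReal.ofReal_ofNat]
          ring
  set κ : ℝ≥0∞ := ENNReal.ofReal M * volume (Metric.closedBall (0 : Rn n) 2) *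
      volume (Icc (1 / 2 : ℝ) 4) ^ (1 / P) with hκ
  have hκt : κ ≠ ∞ := by
    refine ENNReal.mul_ne_top (ENNReal.mul_ne_top ENNReal.ofReal_ne_top
      measure_closedBall_lt_top.ne) (ENNReal.rpow_ne_top_of_nonneg (by positivity) ?_)
    exact isCompact_Icc.measure_lt_top.ne
  have hε : Tendsto (fun N : ℕ => κ * ENNReal.ofReal (2 ^ n * (2 : ℝ) ^ (I0 - N))) atTop (𝓝 0) := by
    have h1 : Tendsto (fun N : ℕ => 2 ^ n * (2 : ℝ) ^ (I0 - N)) atTop (𝓝 0) := by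
      have h2 : Tendsto (fun N : ℕ => 2 ^ n * (2 : ℝ) ^ I0 * (1 / 2 : ℝ) ^ N) atTop (𝓝 0) := by
        simpa using (tendsto_pow_atTop_nhds_zero_of_lt_one (by norm_num : (0 : ℝ) ≤ 1 / 2)
          (by norm_num)).const_mul (2 ^ n * (2 : ℝ) ^ I0)
      refine h2.congr fun N => ?_
      rw [zpow_sub₀ two_ne_zero, zpow_natCast, one_div, inv_pow]
      ring
    have h2 := ENNReal.tendsto_ofReal h1
    simpa using ENNReal.Tendsto.const_mul h2 (Or.inr hκt)
  calc _ ≤ ∫⁻ x, liminf (fun N : ℕ => (∑' j, uN P (k j) (G j) (A j) (2 ^ d)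
        (fun y => f y - good f (I0 - N) y) x ^ r) ^ (p / r)) atTop := by
        refine lintegral_mono fun x => ?_
        refine tsum_rpow_le_liminf _ _ _ (by linarith) (by positivity) hε fun N j => ?_
        have h1 := uN_add_le (D := 2 ^ d) (k := k j) hP1 (hA j) (hbm (I0 - N))
          (bm_good hn0 hf hc (I0 - N)) x
        simp only [sub_add_cancel] at h1
        refine h1.trans (add_le_add le_rfl ?_)
        exact uN_le_of_bound hP1 (hA j) (norm_good_le hn0 hf hc (I0 - N)) x
    _ ≤ liminf (fun N : ℕ => ∫⁻ x, (∑' j, uN P (k j) (G j) (A j) (2 ^ d)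
        (fun y => f y - good f (I0 - N) y) x ^ r) ^ (p / r)) atTop :=
        lintegral_liminf_le fun N => (Measurable.tsum fun j =>
          (measurable_uN (hA j) (hbm (I0 - N)).1).pow_const _).pow_const _
    _ ≤ _ := by
        refine liminf_le_of_le (by isBoundedDefault) fun b hb => ?_
        obtain ⟨N, hN⟩ := hb.exists
        exact hN.trans (hcut _ (by omega))

end ShortVariation

namespace ShortVariation

theorem fourierInv_mul_fourier (m : SchwartzMap ℝ ℂ) {a : ℝ} (ha : 0 < a) {g : ℝ → ℂ}
    (hg : Integrable g) (x : ℝ) :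
    𝓕⁻ (fun τ => m (a * τ) * 𝓕 g τ) x = ∫ z, 𝓕⁻ (m : ℝ → ℂ) z * g (x - a * z) := by
  set E : ℝ → ℂ := fun s => Complex.exp ((2 * Real.pi * s : ℝ) * Complex.I) with hE
  have hEadd : ∀ s t, E (s + t) = E s * E t := fun s t => by
    simp only [hE]; rw [← Complex.exp_add]; push_cast; ring_nf
  have hEn : ∀ s, ‖E s‖ = 1 := fun s => Complex.norm_exp_ofReal_mul_I _
  have hEc : Continuous E := by fun_prop
  have hinv : ∀ (h : ℝ → ℂ) w, 𝓕⁻ h w = ∫ v, E (w * v) * h v := fun h w => by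
    rw [Real.fourierInv_eq']
    simp [hE, mul_comm]
  have hfwd : ∀ (h : ℝ → ℂ) w, 𝓕 h w = ∫ v, E (-(w * v)) * h v := fun h w => by
    rw [Real.fourier_eq']
    simp [hE, mul_comm]
  have hma : Integrable fun τ => m (a * τ) := m.integrable.comp_mul_left' ha.ne'
  have hInt : Integrable (Function.uncurry fun τ y : ℝ => E (τ * (x - y)) * (m (a * τ) * g y))
      (volume.prod volume) := by
    refine (hma.mul_prod hg).bdd_mul (c := 1) ?_ (Eventually.of_forall fun q => (hEn _).le)
    exact (hEc.comp (by fun_prop)).aestronglyMeasurable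
  calc 𝓕⁻ (fun τ => m (a * τ) * 𝓕 g τ) x
      = ∫ τ, ∫ y, E (τ * (x - y)) * (m (a * τ) * g y) := by
        rw [hinv]
        refine integral_congr_ae (Eventually.of_forall fun τ => ?_)
        simp only [hfwd]
        rw [← mul_assoc, ← integral_const_mul]
        refine integral_congr_ae (Eventually.of_forall fun y => ?_)
        have : E (τ * (x - y)) = E (x * τ) * E (-(τ * y)) := by rw [← hEadd]; congr 1; ring
        simp only [this]; ring
    _ = ∫ y, ∫ τ, E (τ * (x - y)) * (m (a * τ) * g y) := integral_integral_swap hInt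
    _ = ∫ y, ((a : ℂ)⁻¹ * 𝓕⁻ (m : ℝ → ℂ) ((x - y) / a)) * g y := by
        refine integral_congr_ae (Eventually.of_forall fun y => ?_)
        simp only [← mul_assoc]
        rw [integral_mul_const, hinv]
        congr 1
        have := Measure.integral_comp_mul_left (fun σ => E ((x - y) / a * σ) * m σ) a
        rw [abs_of_pos (inv_pos.2 ha)] at this
        rw [← Complex.ofReal_inv, ← Complex.real_smul, ← this]
        refine integral_congr_ae (Eventually.of_forall fun τ => ?_)
        simp only
        congr 2
        field_simp
    _ = ∫ z, 𝓕⁻ (m : ℝ → ℂ) z * g (x - a * z) := by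
        have h1 := integral_sub_left_eq_self
          (fun y => ((a : ℂ)⁻¹ * 𝓕⁻ (m : ℝ → ℂ) ((x - y) / a)) * g y) volume x
        have h2 := Measure.integral_comp_mul_left (fun y =>
          ((a : ℂ)⁻¹ * 𝓕⁻ (m : ℝ → ℂ) ((x - (x - y)) / a)) * g (x - y)) a
        rw [h1, abs_of_pos (inv_pos.2 ha), eq_comm, inv_smul_eq_iff₀ ha.ne'] at h2
        rw [h2, ← integral_smul]
        refine integral_congr_ae (Eventually.of_forall fun z => ?_)
        have ha' : (a : ℂ) ≠ 0 := by exact_mod_cast ha.ne'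
        simp only [sub_sub_cancel, Complex.real_smul]
        rw [mul_div_cancel_left₀ _ ha.ne']
        field_simp

theorem eLpNorm_fourierInv_mul_le (m : SchwartzMap ℝ ℂ) {r : ℝ} (hr : 1 < r) :
    ∃ C : ℝ, 0 ≤ C ∧ ∀ a : ℝ, 0 < a → ∀ g : ℝ → ℂ, Integrable g →
      eLpNorm (𝓕⁻ fun τ => m (a * τ) * 𝓕 g τ) (ENNReal.ofReal r) volume ≤
        ENNReal.ofReal C * eLpNorm g (ENNReal.ofReal r) volume := by
  have hr0 : 0 < r := by linarith
  set κ : ℝ → ℂ := 𝓕⁻ (m : ℝ → ℂ) with hκ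
  have hκi : Integrable κ := by
    rw [hκ, ← SchwartzMap.fourierInv_coe]; exact (𝓕⁻ m).integrable
  set c : ℝ≥0∞ := ∫⁻ z, ‖κ z‖ₑ with hc
  have hct : c ≠ ∞ := hκi.2.ne
  refine ⟨c.toReal, ENNReal.toReal_nonneg, fun a ha g hg => ?_⟩
  rw [ENNReal.ofReal_toReal hct]
  have hr0' : ENNReal.ofReal r ≠ 0 := by simpa using hr0
  rw [eLpNorm_eq_lintegral_rpow_enorm_toReal hr0' ENNReal.ofReal_ne_top,
    eLpNorm_eq_lintegral_rpow_enorm_toReal hr0' ENNReal.ofReal_ne_top, ENNReal.toReal_ofReal hr0.le]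
  have hκm : AEMeasurable (fun z => ‖κ z‖ₑ) := hκi.1.enorm
  have hgm : ∀ x, AEMeasurable (fun z => ‖g (x - a * z)‖ₑ) := fun x => by
    have := (hg.comp_sub_left x).comp_mul_left' ha.ne'
    exact this.1.enorm
  have hpt : ∀ x, ‖(𝓕⁻ fun τ => m (a * τ) * 𝓕 g τ) x‖ₑ ^ r ≤
      c ^ (r - 1) * ∫⁻ z, ‖g (x - a * z)‖ₑ ^ r * ‖κ z‖ₑ := fun x => by
    have h1 : ‖(𝓕⁻ fun τ => m (a * τ) * 𝓕 g τ) x‖ₑ ≤ ∫⁻ z, ‖g (x - a * z)‖ₑ * ‖κ z‖ₑ := by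
      rw [fourierInv_mul_fourier m ha hg]
      refine (enorm_integral_le_lintegral_enorm _).trans (le_of_eq ?_)
      refine lintegral_congr fun z => ?_
      rw [enorm_mul, mul_comm]
    have h2 := ENNReal.lintegral_mul_norm_pow_le (μ := volume) (((hgm x).pow_const r).mul hκm) hκm
      (p := 1 / r) (q := 1 - 1 / r) (by positivity)
      (by rw [sub_nonneg, div_le_one hr0]; exact hr.le) (by ring)
    have h3 : ∫⁻ z, ‖g (x - a * z)‖ₑ * ‖κ z‖ₑ ≤
        (∫⁻ z, ‖g (x - a * z)‖ₑ ^ r * ‖κ z‖ₑ) ^ (1 / r) * c ^ (1 - 1 / r) := by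
      refine le_trans (le_of_eq (lintegral_congr fun z => ?_)) h2
      simp only [Pi.mul_apply]
      rw [ENNReal.mul_rpow_of_nonneg _ _ (by positivity), ← ENNReal.rpow_mul,
        mul_one_div_cancel hr0.ne', ENNReal.rpow_one, mul_assoc]
      congr 1
      rw [← ENNReal.rpow_add_of_nonneg _ _ (by positivity)
        (by rw [sub_nonneg, div_le_one hr0]; exact hr.le)]
      simp
    calc _ ≤ ((∫⁻ z, ‖g (x - a * z)‖ₑ ^ r * ‖κ z‖ₑ) ^ (1 / r) * c ^ (1 - 1 / r)) ^ r :=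
          ENNReal.rpow_le_rpow (h1.trans h3) hr0.le
      _ = _ := by
          rw [ENNReal.mul_rpow_of_nonneg _ _ hr0.le, ← ENNReal.rpow_mul, ← ENNReal.rpow_mul,
            one_div_mul_cancel hr0.ne', ENNReal.rpow_one, mul_comm]
          congr 2
          field_simp
  set g' := hg.1.mk g with hg'
  have hgm' : Measurable g' := hg.1.stronglyMeasurable_mk.measurable
  have hswap : ∫⁻ x, ∫⁻ z, ‖g (x - a * z)‖ₑ ^ r * ‖κ z‖ₑ = c * ∫⁻ x, ‖g x‖ₑ ^ r := by
    have h0 : ∀ x, ∫⁻ z, ‖g (x - a * z)‖ₑ ^ r * ‖κ z‖ₑ =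
        ∫⁻ z, ‖g' (x - a * z)‖ₑ ^ r * ‖κ z‖ₑ := fun x => by
      refine lintegral_congr_ae ?_
      have hq : Measure.QuasiMeasurePreserving (fun z : ℝ => x - a * z) volume volume :=
        (quasiMeasurePreserving_sub_left volume x).comp
          ⟨by fun_prop, by
            rw [Real.map_volume_mul_left ha.ne']
            exact Measure.smul_absolutelyContinuous⟩
      filter_upwards [hq.ae hg.1.ae_eq_mk] with z hz
      rw [hz]
    simp only [h0]
    rw [lintegral_lintegral_swap]
    · calc ∫⁻ z, ∫⁻ x, ‖g' (x - a * z)‖ₑ ^ r * ‖κ z‖ₑ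
          = ∫⁻ z, (∫⁻ x, ‖g x‖ₑ ^ r) * ‖κ z‖ₑ := by
            refine lintegral_congr fun z => ?_
            have hm : Measurable fun x => ‖g' (x - a * z)‖ₑ ^ r :=
              (hgm'.comp (measurable_id.sub_const (a * z))).enorm.pow_const _
            rw [lintegral_mul_const _ hm,
              lintegral_sub_right_eq_self (fun x => ‖g' x‖ₑ ^ r)]
            congr 1
            refine lintegral_congr_ae ?_
            filter_upwards [hg.1.ae_eq_mk] with z hz
            rw [hz]
        _ = _ := by rw [lintegral_const_mul'' _ hκm, mul_comm]
    · refine AEMeasurable.mul ?_ (hκm.comp_snd)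
      exact (((hgm'.comp (measurable_fst.sub (measurable_snd.const_mul a))).enorm).pow_const
        r).aemeasurable
  calc _ ≤ (∫⁻ x, c ^ (r - 1) * ∫⁻ z, ‖g (x - a * z)‖ₑ ^ r * ‖κ z‖ₑ) ^ (1 / r) :=
        ENNReal.rpow_le_rpow (lintegral_mono hpt) (by positivity)
    _ = (c ^ r * ∫⁻ x, ‖g x‖ₑ ^ r) ^ (1 / r) := by
        rw [lintegral_const_mul' _ _ (ENNReal.rpow_ne_top_of_nonneg (by linarith) hct), hswap,
          ← mul_assoc]
        congr 2
        nth_rw 2 [← ENNReal.rpow_one c]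
        rw [← ENNReal.rpow_add_of_nonneg _ _ (by linarith) zero_le_one, sub_add_cancel]
    _ = _ := by
        rw [ENNReal.mul_rpow_of_nonneg _ _ (by positivity), ← ENNReal.rpow_mul,
          mul_one_div_cancel hr0.ne', ENNReal.rpow_one]

end ShortVariation

namespace ShortVariation

/-- A smooth function vanishing near the origin, composed with the absolute value. -/
theorem contDiff_cutoff_abs {ψ : ℝ → ℝ} (hψ : IsLPCutoff ψ) :
    ContDiff ℝ (⊤ : ℕ∞) fun s : ℝ => ψ |s| := by
  rw [contDiff_iff_contDiffAt]
  intro s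
  by_cases hs : s = 0
  · refine (contDiffAt_const (c := (0 : ℝ))).congr_of_eventuallyEq ?_
    filter_upwards [Metric.ball_mem_nhds s (by norm_num : (0 : ℝ) < 1 / 2)] with t ht
    by_contra h
    have := (hψ.2.2.1 _ h).1
    rw [abs_abs] at this
    rw [hs, mem_ball_zero_iff, Real.norm_eq_abs] at ht
    linarith
  · exact hψ.1.contDiffAt.comp s (contDiffAt_abs hs)

theorem cutoff_eq_zero {ψ : ℝ → ℝ} (hψ : IsLPCutoff ψ) {s : ℝ} (h : |s| < 1 / 2 ∨ 2 < |s|) :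
    ψ s = 0 := by
  by_contra h0
  have := hψ.2.2.1 _ h0
  rw [mem_Icc] at this
  rcases h with h | h <;> linarith

theorem contDiff_low {ψ : ℝ → ℝ} (hψ : IsLPCutoff ψ) :
    ContDiff ℝ (⊤ : ℕ∞) fun τ : ℝ => 1 - ∑' i : ℕ, ψ ((2 : ℝ) ^ (-(i : ℤ)) * |τ|) := by
  rw [contDiff_iff_contDiffAt]
  intro s
  have hterm : ∀ i : ℕ, ContDiff ℝ (⊤ : ℕ∞) fun τ : ℝ => ψ ((2 : ℝ) ^ (-(i : ℤ)) * |τ|) := by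
    intro i
    have := (contDiff_cutoff_abs hψ).comp (contDiff_const.mul contDiff_id :
      ContDiff ℝ (⊤ : ℕ∞) fun τ : ℝ => (2 : ℝ) ^ (-(i : ℤ)) * τ)
    refine (congrArg (ContDiff ℝ _) (funext fun τ => ?_)).mp this
    simp only [Function.comp, abs_mul]
    rw [abs_of_pos (by positivity : (0 : ℝ) < 2 ^ (-(i : ℤ)))]
  obtain ⟨N, hN⟩ := pow_unbounded_of_one_lt (2 * (|s| + 1)) (one_lt_two)
  have hsm : ContDiff ℝ (⊤ : ℕ∞) fun τ : ℝ =>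
      1 - ∑ i ∈ Finset.range N, ψ ((2 : ℝ) ^ (-(i : ℤ)) * |τ|) :=
    contDiff_const.sub (ContDiff.sum fun i _ => hterm i)
  refine hsm.contDiffAt.congr_of_eventuallyEq ?_
  filter_upwards [Metric.ball_mem_nhds s one_pos] with t ht
  congr 1
  refine tsum_eq_sum fun i hi => cutoff_eq_zero hψ (Or.inl ?_)
  rw [abs_mul, abs_abs, abs_of_pos (by positivity : (0 : ℝ) < 2 ^ (-(i : ℤ))), zpow_neg,
    zpow_natCast, inv_mul_lt_iff₀ (by positivity)]
  have h1 : |t| < |s| + 1 := by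
    rw [mem_ball_iff_norm, Real.norm_eq_abs] at ht
    have := abs_sub_abs_le_abs_sub t s
    linarith
  have h2 : (2 : ℝ) ^ N ≤ 2 ^ i := pow_le_pow_right₀ one_le_two (by simpa using hi)
  linarith

theorem low_eq_zero {ψ : ℝ → ℝ} (hψ : IsLPCutoff ψ) {τ : ℝ} (h : 1 < |τ|) :
    1 - ∑' i : ℕ, ψ ((2 : ℝ) ^ (-(i : ℤ)) * |τ|) = 0 := by
  have h1 := hψ.2.2.2 |τ| (by linarith)
  have h2 : HasSum (fun i : ℕ => ψ ((2 : ℝ) ^ (-(i : ℤ)) * |τ|)) 1 := by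
    refine ((Nat.cast_injective (R := ℤ)).hasSum_iff fun l hl => ?_).2 h1
    have hl : l < 0 := by
      by_contra! h0
      exact hl ⟨l.toNat, Int.toNat_of_nonneg h0⟩
    refine cutoff_eq_zero hψ (Or.inr ?_)
    rw [abs_mul, abs_abs, abs_of_pos (by positivity : (0 : ℝ) < 2 ^ (-l))]
    have : (2 : ℝ) ^ (1 : ℤ) ≤ 2 ^ (-l) := zpow_le_zpow_right₀ one_le_two (by omega)
    rw [zpow_one] at this
    nlinarith
  rw [h2.tsum_eq, sub_self]

theorem hasCompactSupport_of_abs_le {m : ℝ → ℂ} (R : ℝ) (h : ∀ s, R < |s| → m s = 0) :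
    HasCompactSupport m :=
  HasCompactSupport.intro (isCompact_closedBall (0 : ℝ) R) fun s hs => h s (by
    simpa using hs)

theorem fourier_const_mul (c : ℂ) (g : ℝ → ℂ) (τ : ℝ) :
    𝓕 (fun u => c * g u) τ = c * 𝓕 g τ := by
  rw [Real.fourier_eq', Real.fourier_eq', ← integral_const_mul]
  refine integral_congr_ae (Eventually.of_forall fun v => ?_)
  simp only [smul_eq_mul]
  ring

theorem eLpNorm_deltaLow_le {ψ : ℝ → ℝ} (hψ : IsLPCutoff ψ) {r : ℝ} (hr : 1 < r) :
    ∃ C : ℝ, 0 ≤ C ∧ ∀ g : ℝ → ℂ, Integrable g →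
      eLpNorm (deltaLow ψ g) (ENNReal.ofReal r) volume ≤
        ENNReal.ofReal C * eLpNorm g (ENNReal.ofReal r) volume := by
  have h1 : ContDiff ℝ (⊤ : ℕ∞) fun τ : ℝ =>
      Complex.ofReal (1 - ∑' i : ℕ, ψ ((2 : ℝ) ^ (-(i : ℤ)) * |τ|)) :=
    Complex.ofRealCLM.contDiff.comp (contDiff_low hψ)
  have h2 : HasCompactSupport fun τ : ℝ =>
      Complex.ofReal (1 - ∑' i : ℕ, ψ ((2 : ℝ) ^ (-(i : ℤ)) * |τ|)) :=
    hasCompactSupport_of_abs_le 1 fun s hs => by rw [low_eq_zero hψ hs, Complex.ofReal_zero]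
  obtain ⟨C, hC, H⟩ := eLpNorm_fourierInv_mul_le (h2.toSchwartzMap h1) hr
  refine ⟨C, hC, fun g hg => ?_⟩
  have := H 1 one_pos g hg
  simp only [one_mul] at this
  exact this

theorem eLpNorm_deltaHigh_le {ψ : ℝ → ℝ} (hψ : IsLPCutoff ψ) {r : ℝ} (hr : 1 < r) :
    ∃ C : ℝ, 0 ≤ C ∧ ∀ (i : ℕ) (g : ℝ → ℂ), Integrable g →
      eLpNorm (deltaHigh ψ i g) (ENNReal.ofReal r) volume ≤
        ENNReal.ofReal C * eLpNorm g (ENNReal.ofReal r) volume := by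
  have h1 : ContDiff ℝ (⊤ : ℕ∞) fun τ : ℝ => Complex.ofReal (ψ |τ|) :=
    Complex.ofRealCLM.contDiff.comp (contDiff_cutoff_abs hψ)
  have h2 : HasCompactSupport fun τ : ℝ => Complex.ofReal (ψ |τ|) :=
    hasCompactSupport_of_abs_le 2 fun s hs => by
      rw [cutoff_eq_zero hψ (Or.inr (by rwa [abs_abs])), Complex.ofReal_zero]
  obtain ⟨C, hC, H⟩ := eLpNorm_fourierInv_mul_le (h2.toSchwartzMap h1) hr
  refine ⟨C, hC, fun i g hg => ?_⟩
  have h3 := H (2 ^ (-(i : ℤ))) (by positivity) g hg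
  refine le_trans (le_of_eq ?_) h3
  congr 1
  unfold deltaHigh
  congr 1; ext τ
  simp [abs_mul]

theorem eLpNorm_deltaHigh_le_deriv {ψ : ℝ → ℝ} (hψ : IsLPCutoff ψ) {r : ℝ} (hr : 1 < r) :
    ∃ C : ℝ, 0 ≤ C ∧ ∀ (i : ℕ) (g : ℝ → ℂ), Integrable g → Differentiable ℝ g →
      Integrable (deriv g) →
      eLpNorm (deltaHigh ψ i g) (ENNReal.ofReal r) volume ≤
        ENNReal.ofReal C * (e2 (-i) * eLpNorm (deriv g) (ENNReal.ofReal r) volume) := by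
  set m : ℝ → ℂ := fun τ => Complex.ofReal (ψ |τ|) * (2 * Real.pi * Complex.I * τ)⁻¹ with hm
  have h1 : ContDiff ℝ (⊤ : ℕ∞) m := by
    rw [contDiff_iff_contDiffAt]
    intro s
    by_cases hs : s = 0
    · refine (contDiffAt_const (c := (0 : ℂ))).congr_of_eventuallyEq ?_
      filter_upwards [Metric.ball_mem_nhds s (by norm_num : (0 : ℝ) < 1 / 2)] with t ht
      rw [hs, mem_ball_zero_iff, Real.norm_eq_abs] at ht
      simp only [hm]
      rw [cutoff_eq_zero hψ (Or.inl (by rwa [abs_abs])), Complex.ofReal_zero, zero_mul]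
    · refine ContDiffAt.mul (Complex.ofRealCLM.contDiff.comp
        (contDiff_cutoff_abs hψ)).contDiffAt (ContDiffAt.inv ?_ ?_)
      · exact contDiffAt_const.mul Complex.ofRealCLM.contDiff.contDiffAt
      · simp [hs, Real.pi_ne_zero]
  have h2 : HasCompactSupport m :=
    hasCompactSupport_of_abs_le 2 fun s hs => by
      simp only [hm]
      rw [cutoff_eq_zero hψ (Or.inr (by rwa [abs_abs])), Complex.ofReal_zero, zero_mul]
  obtain ⟨C, hC, H⟩ := eLpNorm_fourierInv_mul_le (h2.toSchwartzMap h1) hr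
  refine ⟨C, hC, fun i g hg hd hg' => ?_⟩
  set a : ℝ := 2 ^ (-(i : ℤ)) with ha
  have ha0 : 0 < a := by positivity
  have h3 := H a ha0 (fun u => (a : ℂ) * deriv g u) (hg'.const_mul _)
  have h4 : eLpNorm (fun u => (a : ℂ) * deriv g u) (ENNReal.ofReal r) volume =
      e2 (-i) * eLpNorm (deriv g) (ENNReal.ofReal r) volume := by
    have := eLpNorm_const_smul (a : ℂ) (deriv g) (ENNReal.ofReal r) volume
    rw [← ofReal_norm, Complex.norm_real, Real.norm_of_nonneg ha0.le, ha, ofReal_zpow] at this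
    rw [Int.cast_neg, Int.cast_natCast] at this
    exact this
  rw [h4] at h3
  refine le_trans (le_of_eq ?_) h3
  congr 1
  unfold deltaHigh
  congr 1; ext τ
  rw [fourier_const_mul, Real.fourier_deriv hg hd hg']
  rw [HasCompactSupport.toSchwartzMap_toFun]
  simp only [hm, smul_eq_mul]
  rw [← ha, abs_mul, abs_of_pos ha0]
  by_cases hτ : τ = 0
  · rw [hτ, abs_zero, mul_zero, cutoff_eq_zero hψ (Or.inl (by norm_num))]
    simp
  · have h5 : (τ : ℂ) ≠ 0 := by exact_mod_cast hτ
    have h6 : (a : ℂ) ≠ 0 := by exact_mod_cast ha0.ne'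
    have h7 : (Real.pi : ℂ) ≠ 0 := by exact_mod_cast Real.pi_ne_zero
    push_cast
    field_simp

theorem besovNorm_le {ψ : ℝ → ℝ} (hψ : IsLPCutoff ψ) {r : ℝ} (hr : 2 ≤ r) :
    ∃ C : ℝ, 0 ≤ C ∧ ∀ d : ℤ, 0 ≤ d → ∀ g : ℝ → ℂ, Integrable g → Differentiable ℝ g →
      Integrable (deriv g) →
      besovNorm ψ r g ≤ ENNReal.ofReal C * e2 (d / r) *
        (eLpNorm g (ENNReal.ofReal r) volume +
          e2 (-d) * eLpNorm (deriv g) (ENNReal.ofReal r) volume) := by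
  have hr0 : 0 < r := by linarith
  obtain ⟨C1, hC1, H1⟩ := eLpNorm_deltaLow_le hψ (r := r) (by linarith)
  obtain ⟨C2, hC2, H2⟩ := eLpNorm_deltaHigh_le hψ (r := r) (by linarith)
  obtain ⟨C3, hC3, H3⟩ := eLpNorm_deltaHigh_le_deriv hψ (r := r) (by linarith)
  have hgs : 0 ≤ gs ((2 : ℝ) ^ (-(1 / r))) := tsum_nonneg fun _ => by positivity
  refine ⟨C1 + (C2 + C3) * gs ((2 : ℝ) ^ (-(1 / r))), by positivity, fun d hd g hg hdf hg' => ?_⟩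
  set A := eLpNorm g (ENNReal.ofReal r) volume
  set B := eLpNorm (deriv g) (ENNReal.ofReal r) volume
  have hd' : (0 : ℝ) ≤ d := by exact_mod_cast hd
  set X : ℝ≥0∞ := ENNReal.ofReal (C2 + C3) * e2 (d / r) * (A + e2 (-d) * B) with hX
  have hterm : ∀ i : ℕ, ENNReal.ofReal ((2 : ℝ) ^ ((i : ℝ) / r)) *
      eLpNorm (deltaHigh ψ i g) (ENNReal.ofReal r) volume ≤
      X * e2 (-(1 / r) * |((i : ℤ) : ℝ) - d|) := by
    intro i
    change e2 (i / r) * _ ≤ _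
    rcases le_total (i : ℝ) d with h | h
    · calc _ ≤ e2 (i / r) * (ENNReal.ofReal C2 * A) := mul_le_mul_right (H2 i g hg) _
        _ = ENNReal.ofReal C2 * (e2 (d / r) * e2 (-(1 / r) * |((i : ℤ) : ℝ) - d|)) * A := by
          rw [← e2_add, abs_of_nonpos (by push_cast; linarith)]
          push_cast
          rw [show (d : ℝ) / r + -(1 / r) * -((i : ℝ) - d) = i / r by ring]
          ring
        _ ≤ ENNReal.ofReal (C2 + C3) * (e2 (d / r) * e2 (-(1 / r) * |((i : ℤ) : ℝ) - d|)) *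
            (A + e2 (-d) * B) := by
          gcongr
          · linarith
          · exact le_self_add
        _ = _ := by rw [hX]; ring
    · calc _ ≤ e2 (i / r) * (ENNReal.ofReal C3 * (e2 (-i) * B)) :=
            mul_le_mul_right (H3 i g hg hdf hg') _
        _ = ENNReal.ofReal C3 * (e2 (i / r) * e2 (-i)) * B := by ring
        _ ≤ ENNReal.ofReal C3 * (e2 (d / r) * e2 (-(1 / r) * |((i : ℤ) : ℝ) - d|) *
            e2 (-d)) * B := by
          refine mul_le_mul_left (mul_le_mul_right ?_ _) _
          rw [← e2_add, ← e2_add, ← e2_add, abs_of_nonneg (by push_cast; linarith)]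
          refine e2_le ?_
          push_cast
          have h3 : ((i : ℝ) - d) * (2 / r) ≤ ((i : ℝ) - d) * 1 :=
            mul_le_mul_of_nonneg_left ((div_le_one hr0).2 hr) (by linarith)
          have h4 : (i : ℝ) / r - d / r + (1 / r) * (i - d) = (i - d) * (2 / r) := by ring
          linarith
        _ = ENNReal.ofReal C3 * (e2 (d / r) * e2 (-(1 / r) * |((i : ℤ) : ℝ) - d|)) *
            (e2 (-d) * B) := by ring
        _ ≤ ENNReal.ofReal (C2 + C3) * (e2 (d / r) * e2 (-(1 / r) * |((i : ℤ) : ℝ) - d|)) *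
            (A + e2 (-d) * B) := by
          gcongr
          · linarith
          · exact le_add_self
        _ = _ := by rw [hX]; ring
  have hsum : ∑' i : ℕ, ENNReal.ofReal ((2 : ℝ) ^ ((i : ℝ) / r)) *
      eLpNorm (deltaHigh ψ i g) (ENNReal.ofReal r) volume ≤
      X * ENNReal.ofReal (gs ((2 : ℝ) ^ (-(1 / r)))) := by
    refine (ENNReal.tsum_le_tsum hterm).trans ?_
    refine (ENNReal.tsum_comp_le_tsum_of_injective (Nat.cast_injective (R := ℤ))
      fun i : ℤ => X * e2 (-(1 / r) * |(i : ℝ) - d|)).trans ?_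
    exact tsum_le_of_e2 (by positivity) d fun i => le_rfl
  have hlow : eLpNorm (deltaLow ψ g) (ENNReal.ofReal r) volume ≤
      ENNReal.ofReal C1 * e2 (d / r) * (A + e2 (-d) * B) := by
    refine (H1 g hg).trans ?_
    have h1 : (1 : ℝ≥0∞) ≤ e2 (d / r) := by rw [← e2_zero]; exact e2_le (by positivity)
    calc ENNReal.ofReal C1 * A = ENNReal.ofReal C1 * 1 * A := by rw [mul_one]
      _ ≤ _ := by gcongr; exact le_self_add
  calc besovNorm ψ r g ≤ ENNReal.ofReal C1 * e2 (d / r) * (A + e2 (-d) * B) +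
        X * ENNReal.ofReal (gs ((2 : ℝ) ^ (-(1 / r)))) := add_le_add hlow hsum
    _ = _ := by
        rw [ENNReal.ofReal_add hC1 (by positivity), ENNReal.ofReal_mul (by positivity), hX]
        ring

end ShortVariation

namespace ShortVariation
variable {n : ℕ}

theorem hasDerivAt_TT {M D : ℝ} (hD : 0 ≤ D) {G A : Rn n → ℝ} (h : Adm M G A) (k : ℤ)
    {f : Rn n → ℂ} (hf : BM f) (x : Rn n) (u : ℝ) : HasDerivAt (fun u : ℝ => TT k (u * D) G A f x)
      (Complex.I * D * TT k (u * D) G (fun t => G t * A t) f x) u :=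
  hasDerivAt_cv hD h (hf.comp_smul k) _ u

theorem uN_eq_eLpNorm {P D : ℝ} (hP : 0 < P) (k : ℤ) (G A : Rn n → ℝ) (f : Rn n → ℂ) (x : Rn n) :
    eLpNorm (fun u : ℝ => TT k (u * D) G A f x) (ENNReal.ofReal P)
      (volume.restrict (Icc (1 / 2 : ℝ) 4)) = uN P k G A D f x := by
  rw [eLpNorm_eq_lintegral_rpow_enorm_toReal (by simpa using hP) ENNReal.ofReal_ne_top,
    ENNReal.toReal_ofReal hP.le]
  rfl

theorem eLpNorm_le_uN {r P : ℝ} (hr : 0 < r) (hrP : r ≤ P) :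
    ∃ C : ℝ, 0 ≤ C ∧ ∀ (M D : ℝ) (n : ℕ) (k : ℤ) (G A : Rn n → ℝ) (f : Rn n → ℂ) (x : Rn n),
      Adm M G A → BM f →
      eLpNorm (fun u : ℝ => TT k (u * D) G A f x) (ENNReal.ofReal r)
        (volume.restrict (Icc (1 / 2 : ℝ) 4)) ≤ ENNReal.ofReal C * uN P k G A D f x := by
  have hP : 0 < P := by linarith
  set c : ℝ≥0∞ := (volume.restrict (Icc (1 / 2 : ℝ) 4)) univ ^ (1 / r - 1 / P)
  have hc : c ≠ ∞ := by
    refine ENNReal.rpow_ne_top_of_nonneg ?_ ?_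
    · rw [sub_nonneg]; exact one_div_le_one_div_of_le hr hrP
    · rw [Measure.restrict_apply_univ]; exact isCompact_Icc.measure_lt_top.ne
  refine ⟨c.toReal, ENNReal.toReal_nonneg, fun M D n k G A f x hA hf => ?_⟩
  have h := eLpNorm_le_eLpNorm_mul_rpow_measure_univ (μ := volume.restrict (Icc (1 / 2 : ℝ) 4))
    (ENNReal.ofReal_le_ofReal hrP)
    (measurable_TT_left (D := D) (k := k) hA hf.1 x).aestronglyMeasurable
  rw [uN_eq_eLpNorm hP, ENNReal.toReal_ofReal hr.le, ENNReal.toReal_ofReal hP.le] at h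
  rwa [ENNReal.ofReal_toReal hc, mul_comm]

theorem besovNorm_TT_le {ψ χ : ℝ → ℝ} (hψ : IsLPCutoff ψ) (hχ : IsChiCutoff χ) {r P : ℝ}
    (hr : 2 ≤ r) (hrP : r ≤ P) :
    ∃ C : ℝ, 0 ≤ C ∧ ∀ (M : ℝ) (d : ℤ) (n : ℕ) (k : ℤ) (G A : Rn n → ℝ) (f : Rn n → ℂ) (x : Rn n),
      0 ≤ d → Adm M G A → Adm M G (fun t => G t * A t) → BM f →
      besovNorm ψ r (fun u => Complex.ofReal (χ u) * TT k (u * 2 ^ d) G A f x) ≤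
        ENNReal.ofReal C * e2 (d / r) *
          (uN P k G A (2 ^ d) f x + uN P k G (fun t => G t * A t) (2 ^ d) f x) := by
  obtain ⟨C1, hC1, H1⟩ := besovNorm_le hψ hr
  obtain ⟨C2, hC2, H2⟩ := eLpNorm_le_uN (r := r) (by linarith) hrP
  have hχs : Function.support χ ⊆ Icc (1 / 2) 4 := fun u hu => hχ.2.2.1 u hu
  have hχt : tsupport χ ⊆ Icc (1 / 2) 4 := closure_minimal hχs isClosed_Icc
  have hχc : HasCompactSupport χ := HasCompactSupport.of_support_subset_isCompact isCompact_Icc hχs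
  have hχ' : Continuous (deriv χ) := hχ.1.continuous_deriv (by simp)
  obtain ⟨B, hB⟩ := hχc.deriv.exists_bound_of_continuous hχ'
  have hB0 : 0 ≤ B := (norm_nonneg _).trans (hB 0)
  have hχ's : ∀ u, u ∉ Icc (1 / 2 : ℝ) 4 → deriv χ u = 0 := fun u hu => by
    by_contra h
    exact hu (hχt (support_deriv_subset (f := χ) h))
  refine ⟨C1 * (C2 * (B + 1)), by positivity, fun M d n k G A f x hd hA hA' hf => ?_⟩
  set D : ℝ := 2 ^ d with hD
  have hD0 : 0 < D := by positivity
  set I : Set ℝ := Icc (1 / 2 : ℝ) 4 with hI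
  set F0 : ℝ → ℂ := fun u => TT k (u * D) G A f x with hF0
  set F1 : ℝ → ℂ := fun u => TT k (u * D) G (fun t => G t * A t) f x with hF1
  have hd0 : ∀ u, HasDerivAt F0 (Complex.I * D * F1 u) u := hasDerivAt_TT hD0.le hA k hf x
  have hc0 : Continuous F0 := continuous_iff_continuousAt.2 fun u => (hd0 u).continuousAt
  have hc1 : Continuous F1 := continuous_iff_continuousAt.2 fun u =>
    (hasDerivAt_TT hD0.le hA' k hf x u).continuousAt
  set g : ℝ → ℂ := fun u => Complex.ofReal (χ u) * F0 u with hg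
  have hgd : ∀ u, HasDerivAt g (Complex.ofReal (deriv χ u) * F0 u +
      Complex.ofReal (χ u) * (Complex.I * D * F1 u)) u := fun u =>
    ((hχ.1.differentiable (by simp) u).hasDerivAt.ofReal_comp).mul (hd0 u)
  have hderiv : deriv g = (fun u => Complex.ofReal (deriv χ u) * F0 u) +
      fun u => Complex.ofReal (χ u) * (Complex.I * D * F1 u) := funext fun u => (hgd u).deriv
  have hχcont : Continuous χ := hχ.1.continuous
  have hgc : Continuous g := (Complex.continuous_ofReal.comp hχcont).mul hc0
  have hg'c1 : Continuous fun u => Complex.ofReal (deriv χ u) * F0 u :=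
    (Complex.continuous_ofReal.comp hχ').mul hc0
  have hg'c2 : Continuous fun u => Complex.ofReal (χ u) * (Complex.I * D * F1 u) :=
    (Complex.continuous_ofReal.comp hχcont).mul (continuous_const.mul hc1)
  have hχ0 : ∀ u, u ∉ I → χ u = 0 := fun u hu => by
    by_contra h
    exact hu (hχs h)
  have hz : ∀ u, u ∉ I → g u = 0 := fun u hu => by simp [hg, hχ0 u hu]
  have hz' : ∀ u, u ∉ I → deriv g u = 0 := fun u hu => by
    rw [hderiv]; simp [hχ0 u hu, hχ's u hu]
  have hgi : Integrable g :=
    hgc.integrable_of_hasCompactSupport (HasCompactSupport.intro isCompact_Icc hz)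
  have hgi' : Integrable (deriv g) := by
    refine Continuous.integrable_of_hasCompactSupport ?_ (HasCompactSupport.intro isCompact_Icc hz')
    rw [hderiv]; exact hg'c1.add hg'c2
  have hres : ∀ h : ℝ → ℂ, (∀ u, u ∉ I → h u = 0) → eLpNorm h (ENNReal.ofReal r) volume =
      eLpNorm h (ENNReal.ofReal r) (volume.restrict I) := fun h hh => by
    rw [← eLpNorm_indicator_eq_eLpNorm_restrict measurableSet_Icc]
    congr 1; ext u
    by_cases hu : u ∈ I
    · rw [indicator_of_mem hu]
    · rw [indicator_of_notMem hu, hh u hu]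
  have hχ1 : ∀ u, ‖(χ u : ℂ)‖ ≤ 1 := fun u => by
    rw [Complex.norm_real, Real.norm_of_nonneg (hχ.2.1 u).1]
    exact (hχ.2.1 u).2
  have hn0 : eLpNorm g (ENNReal.ofReal r) volume ≤ ENNReal.ofReal C2 * uN P k G A D f x := by
    rw [hres g hz]
    refine le_trans (eLpNorm_mono fun u => ?_) (H2 M D n k G A f x hA hf)
    rw [norm_mul]
    exact mul_le_of_le_one_left (norm_nonneg _) (hχ1 u)
  have hn1 : eLpNorm (deriv g) (ENNReal.ofReal r) volume ≤
      ENNReal.ofReal B * (ENNReal.ofReal C2 * uN P k G A D f x) + ENNReal.ofReal D *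
        (ENNReal.ofReal C2 * uN P k G (fun t => G t * A t) D f x) := by
    rw [hres _ hz', hderiv]
    refine (eLpNorm_add_le hg'c1.aestronglyMeasurable hg'c2.aestronglyMeasurable
      (by rw [ENNReal.one_le_ofReal]; linarith)).trans (add_le_add ?_ ?_)
    · refine (eLpNorm_le_mul_eLpNorm_of_ae_le_mul (g := F0) (c := B)
        (Eventually.of_forall fun u => ?_) _).trans
        (mul_le_mul_right (H2 M D n k G A f x hA hf) _)
      rw [norm_mul, Complex.norm_real]
      exact mul_le_mul_of_nonneg_right (hB u) (norm_nonneg _)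
    · refine (eLpNorm_le_mul_eLpNorm_of_ae_le_mul (g := F1) (c := D)
        (Eventually.of_forall fun u => ?_) _).trans
        (mul_le_mul_right (H2 M D n k G _ f x hA' hf) _)
      rw [norm_mul, norm_mul, norm_mul, Complex.norm_I, Complex.norm_real D,
        Real.norm_of_nonneg hD0.le, one_mul]
      exact mul_le_of_le_one_left (by positivity) (hχ1 u)
  have hDe : e2 (-d) * ENNReal.ofReal D = 1 := by
    rw [hD, ofReal_zpow, ← e2_add, neg_add_cancel, e2_zero]
  have hd1 : e2 (-d) ≤ 1 := by
    rw [← e2_zero]; exact e2_le (by simpa using (by exact_mod_cast hd : (0 : ℝ) ≤ d))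
  set a := uN P k G A D f x
  set b := uN P k G (fun t => G t * A t) D f x
  calc _ ≤ ENNReal.ofReal C1 * e2 (d / r) * (eLpNorm g (ENNReal.ofReal r) volume +
        e2 (-d) * eLpNorm (deriv g) (ENNReal.ofReal r) volume) :=
        H1 d hd g hgi (fun u => (hgd u).differentiableAt) hgi'
    _ ≤ ENNReal.ofReal C1 * e2 (d / r) * (ENNReal.ofReal C2 * a + e2 (-d) *
        (ENNReal.ofReal B * (ENNReal.ofReal C2 * a) + ENNReal.ofReal D *
        (ENNReal.ofReal C2 * b))) := by gcongr
    _ = ENNReal.ofReal C1 * e2 (d / r) * (ENNReal.ofReal C2 * a + (e2 (-d) *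
        (ENNReal.ofReal B * (ENNReal.ofReal C2 * a)) + (e2 (-d) * ENNReal.ofReal D) *
        (ENNReal.ofReal C2 * b))) := by ring
    _ ≤ ENNReal.ofReal C1 * e2 (d / r) * (ENNReal.ofReal C2 * a + (1 *
        (ENNReal.ofReal B * (ENNReal.ofReal C2 * a)) + 1 *
        (ENNReal.ofReal C2 * b))) := by rw [hDe]; gcongr
    _ ≤ ENNReal.ofReal C1 * e2 (d / r) * (ENNReal.ofReal C2 * a + (1 *
        (ENNReal.ofReal B * (ENNReal.ofReal C2 * a)) + (ENNReal.ofReal B + 1) *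
        (ENNReal.ofReal C2 * b))) := by gcongr; exact le_add_self
    _ = _ := by
        rw [ENNReal.ofReal_mul hC1, ENNReal.ofReal_mul hC2, ENNReal.ofReal_add hB0 zero_le_one,
          ENNReal.ofReal_one]
        ring

end ShortVariation

namespace ShortVariation

/-- A quantitative form of the class `𝒰`, invariant under dilations and positive multiples. -/
structure PhaseClass (c : ℝ) (C : ℕ → ℝ) (γ : ℝ → ℝ) : Prop where
  smooth : ContDiffOn ℝ (⊤ : ℕ∞) γ (Ioi 0)
  pos : ∀ s, 0 < s → 0 < γ s
  deriv_ge : ∀ s, 0 < s → c * γ s ≤ s * deriv γ s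
  second_ge : ∀ s, 0 < s → c * γ s ≤ |s ^ 2 * iteratedDeriv 2 γ s|
  bound : ∀ i s, 0 < s → |s ^ i * iteratedDeriv i γ s| ≤ C i * γ s

theorem phaseClass_of_isGammaU {Γ : ℝ → ℝ} (hΓ : IsGammaU Γ) :
    ∃ (c : ℝ) (C : ℕ → ℝ), 0 < c ∧ PhaseClass c C Γ := by
  have hmono : StrictMonoOn Γ (Ici 0) :=
    strictMonoOn_of_deriv_pos (convex_Ici 0) hΓ.continuousOn fun s hs => by
      rw [interior_Ici] at hs
      exact hΓ.deriv_pos s hs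
  have hpos : ∀ s, 0 < s → 0 < Γ s := fun s hs => by
    have := hmono self_mem_Ici hs.le hs
    rwa [hΓ.map_zero] at this
  obtain ⟨c1, hc1, H1⟩ := hΓ.lower 1 (by simp)
  obtain ⟨c2, hc2, H2⟩ := hΓ.lower 2 (by simp)
  have hup : ∀ j : ℕ, ∃ b : ℝ, ∀ s, 0 < s → |s ^ j * iteratedDeriv j Γ s| ≤ b * Γ s := by
    intro j
    rcases Nat.eq_zero_or_pos j with rfl | hj
    · refine ⟨1, fun s hs => ?_⟩
      simp [_root_.abs_of_pos (hpos s hs)]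
    · obtain ⟨b, -, hb⟩ := hΓ.upper j hj
      refine ⟨b, fun s hs => ?_⟩
      have := hb s hs
      rwa [abs_div, _root_.abs_of_pos (hpos s hs), div_le_iff₀ (hpos s hs)] at this
  choose C hC using hup
  refine ⟨min c1 c2, C, lt_min hc1 hc2, hΓ.smooth, hpos, fun s hs => ?_, fun s hs => ?_, hC⟩
  · have h := H1 s hs
    rw [abs_div, _root_.abs_of_pos (hpos s hs), le_div_iff₀ (hpos s hs), pow_one, iteratedDeriv_one,
      _root_.abs_of_pos (mul_pos hs (hΓ.deriv_pos s hs))] at h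
    exact (mul_le_mul_of_nonneg_right (min_le_left _ _) (hpos s hs).le).trans h
  · have h := H2 s hs
    rw [abs_div, _root_.abs_of_pos (hpos s hs), le_div_iff₀ (hpos s hs)] at h
    exact (mul_le_mul_of_nonneg_right (min_le_right _ _) (hpos s hs).le).trans h

theorem iteratedDeriv_const_mul_comp_mul (γ : ℝ → ℝ) (a b : ℝ) (i : ℕ) :
    iteratedDeriv i (fun s => a * γ (b * s)) = fun s => a * (b ^ i * iteratedDeriv i γ (b * s)) := by
  induction i with
  | zero => simp
  | succ i ih =>
    rw [iteratedDeriv_succ, ih]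
    ext s
    rw [deriv_const_mul_field, deriv_const_mul_field, iteratedDeriv_succ,
      deriv_comp_mul_left b (iteratedDeriv i γ) s]
    simp only [smul_eq_mul]
    ring

section PhaseClass

variable {c : ℝ} {C : ℕ → ℝ} {γ : ℝ → ℝ}

theorem PhaseClass.scale (h : PhaseClass c C γ) {a b : ℝ} (ha : 0 < a) (hb : 0 < b) :
    PhaseClass c C (fun s => a * γ (b * s)) where
  smooth := contDiffOn_const.mul (h.smooth.comp (contDiffOn_const.mul contDiffOn_id)
    fun s hs => mul_pos hb hs)
  pos s hs := mul_pos ha (h.pos _ (mul_pos hb hs))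
  deriv_ge s hs := by
    have := h.deriv_ge (b * s) (mul_pos hb hs)
    rw [deriv_const_mul_field, deriv_comp_mul_left b γ s, smul_eq_mul]
    nlinarith
  second_ge s hs := by
    have := h.second_ge (b * s) (mul_pos hb hs)
    rw [iteratedDeriv_const_mul_comp_mul]
    have e : s ^ 2 * (a * (b ^ 2 * iteratedDeriv 2 γ (b * s))) =
      a * ((b * s) ^ 2 * iteratedDeriv 2 γ (b * s)) := by ring
    simp only [e]
    rw [abs_mul, _root_.abs_of_pos ha]
    nlinarith
  bound i s hs := by
    have := h.bound i (b * s) (mul_pos hb hs)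
    rw [iteratedDeriv_const_mul_comp_mul]
    have e : s ^ i * (a * (b ^ i * iteratedDeriv i γ (b * s))) =
      a * ((b * s) ^ i * iteratedDeriv i γ (b * s)) := by ring
    simp only [e]
    rw [abs_mul, _root_.abs_of_pos ha]
    nlinarith

theorem PhaseClass.differentiableAt (h : PhaseClass c C γ) {s : ℝ} (hs : 0 < s) :
    DifferentiableAt ℝ γ s :=
  (h.smooth.differentiableOn (by simp)).differentiableAt (Ioi_mem_nhds hs)

theorem PhaseClass.hasDerivAt_mul_rpow (h : PhaseClass c C γ) (q : ℝ) {s : ℝ} (hs : 0 < s) :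
    HasDerivAt (fun s => γ s * s ^ (-q)) (s ^ (-q - 1) * (s * deriv γ s - q * γ s)) s := by
  have h1 := (h.differentiableAt hs).hasDerivAt.mul
    (Real.hasDerivAt_rpow_const (x := s) (p := -q) (Or.inl hs.ne'))
  refine h1.congr_deriv ?_
  have : s ^ (-q) = s ^ (-q - 1) * s := by
    rw [← Real.rpow_add_one hs.ne']; ring_nf
  rw [this]; ring

theorem PhaseClass.rpow_mul_le (h : PhaseClass c C γ) {s t : ℝ} (hs : 0 < s) (hst : s ≤ t) :
    (t / s) ^ c * γ s ≤ γ t := by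
  have hm : MonotoneOn (fun s => γ s * s ^ (-c)) (Ioi 0) := by
    refine monotoneOn_of_deriv_nonneg (convex_Ioi 0)
      (fun s hs => (h.hasDerivAt_mul_rpow c hs).continuousAt.continuousWithinAt) ?_ ?_
    · rw [interior_Ioi]
      exact fun s hs => (h.hasDerivAt_mul_rpow c hs).differentiableAt.differentiableWithinAt
    · rw [interior_Ioi]
      intro s hs
      rw [(h.hasDerivAt_mul_rpow c hs).deriv]
      exact mul_nonneg (Real.rpow_nonneg (mem_Ioi.1 hs).le _) (sub_nonneg.2 (h.deriv_ge s hs))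
  have ht : 0 < t := hs.trans_le hst
  have := hm hs ht hst
  simp only [Real.rpow_neg hs.le, Real.rpow_neg ht.le] at this
  rw [Real.div_rpow ht.le hs.le]
  have h1 : 0 < s ^ c := Real.rpow_pos_of_pos hs _
  have h2 : 0 < t ^ c := Real.rpow_pos_of_pos ht _
  rw [← div_eq_mul_inv, ← div_eq_mul_inv, div_le_div_iff₀ h1 h2] at this
  rw [div_mul_eq_mul_div, div_le_iff₀ h1]
  linarith

theorem PhaseClass.le_rpow_mul (h : PhaseClass c C γ) {s t : ℝ} (hs : 0 < s) (hst : s ≤ t) :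
    γ t ≤ (t / s) ^ C 1 * γ s := by
  have hm : AntitoneOn (fun s => γ s * s ^ (-C 1)) (Ioi 0) := by
    refine antitoneOn_of_deriv_nonpos (convex_Ioi 0)
      (fun s hs => (h.hasDerivAt_mul_rpow _ hs).continuousAt.continuousWithinAt) ?_ ?_
    · rw [interior_Ioi]
      exact fun s hs => (h.hasDerivAt_mul_rpow _ hs).differentiableAt.differentiableWithinAt
    · rw [interior_Ioi]
      intro s hs
      rw [(h.hasDerivAt_mul_rpow _ hs).deriv]
      have := (le_abs_self _).trans (h.bound 1 s hs)
      rw [pow_one, iteratedDeriv_one] at this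
      exact mul_nonpos_of_nonneg_of_nonpos (Real.rpow_nonneg (mem_Ioi.1 hs).le _)
        (sub_nonpos.2 this)
  have ht : 0 < t := hs.trans_le hst
  have := hm hs ht hst
  simp only [Real.rpow_neg hs.le, Real.rpow_neg ht.le] at this
  rw [Real.div_rpow ht.le hs.le]
  have h1 : 0 < s ^ C 1 := Real.rpow_pos_of_pos hs _
  have h2 : 0 < t ^ C 1 := Real.rpow_pos_of_pos ht _
  rw [← div_eq_mul_inv, ← div_eq_mul_inv, div_le_div_iff₀ h2 h1] at this
  rw [div_mul_eq_mul_div, le_div_iff₀ h1]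
  linarith

theorem PhaseClass.C_one_pos (h : PhaseClass c C γ) (hc : 0 < c) : 0 < C 1 := by
  have h1 := (le_abs_self _).trans (h.bound 1 1 one_pos)
  rw [pow_one, iteratedDeriv_one] at h1
  have h2 := h.deriv_ge 1 one_pos
  have h3 := h.pos 1 one_pos
  nlinarith [mul_pos hc h3]

theorem PhaseClass.monotone (h : PhaseClass c C γ) (hc : 0 < c) {s t : ℝ} (hs : 0 < s)
    (hst : s ≤ t) : γ s ≤ γ t := by
  refine le_trans ?_ (h.rpow_mul_le hs hst)
  refine le_mul_of_one_le_left (h.pos s hs).le (Real.one_le_rpow ?_ hc.le)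
  rwa [one_le_div hs]

/-- The defining inequalities of `kstar`. -/
theorem PhaseClass.kstar_spec (h : PhaseClass c C γ) (hc : 0 < c) (j : ℤ) :
    (2 : ℝ) ^ j * γ (2 ^ kstar γ j) ≤ 1 ∧ 1 < (2 : ℝ) ^ j * γ (2 ^ (kstar γ j + 1)) := by
  have hlim : Tendsto (fun m : ℕ => ((2 : ℝ) ^ c) ^ m) atTop atTop :=
    tendsto_pow_atTop_atTop_of_one_lt (Real.one_lt_rpow one_lt_two hc)
  have hγ1 := h.pos 1 one_pos
  have h2j : (0 : ℝ) < 2 ^ j := by positivity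
  have hpw : ∀ m : ℕ, ((2 : ℝ) ^ m) ^ c = ((2 : ℝ) ^ c) ^ m := fun m => by
    rw [← Real.rpow_natCast, ← Real.rpow_natCast, ← Real.rpow_mul zero_le_two,
      ← Real.rpow_mul zero_le_two, mul_comm]
  have hne : {m : ℤ | (2 : ℝ) ^ j * γ (2 ^ m) ≤ 1}.Nonempty := by
    obtain ⟨m, hm⟩ := (hlim.eventually_ge_atTop ((2 : ℝ) ^ j * γ 1)).exists
    refine ⟨-(m : ℤ), ?_⟩
    have h0 : (0 : ℝ) < 2 ^ (-(m : ℤ)) := by positivity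
    have h1 := h.rpow_mul_le (t := 1) h0
      (zpow_le_one_of_nonpos₀ one_le_two (by simp))
    rw [one_div, ← zpow_neg, neg_neg, zpow_natCast, hpw] at h1
    have h3 := h.pos _ h0
    have h4 : (0 : ℝ) < (2 ^ c) ^ m := by positivity
    simp only [mem_ofPred_eq]
    by_contra! h5
    have h6 : ((2 : ℝ) ^ c) ^ m * 1 < (2 ^ c) ^ m * (2 ^ j * γ (2 ^ (-(m : ℤ)))) :=
      mul_lt_mul_of_pos_left h5 h4
    nlinarith
  have hbd : BddAbove {m : ℤ | (2 : ℝ) ^ j * γ (2 ^ m) ≤ 1} := by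
    obtain ⟨m, hm⟩ := (hlim.eventually_gt_atTop (1 / ((2 : ℝ) ^ j * γ 1))).exists
    refine ⟨m, fun i hi => ?_⟩
    by_contra! h5
    have h1 := h.rpow_mul_le (t := 2 ^ m) one_pos (one_le_pow₀ one_le_two)
    rw [div_one, hpw] at h1
    have h2 : γ (2 ^ m) ≤ γ (2 ^ i) := by
      refine h.monotone hc (by positivity) ?_
      rw [← zpow_natCast]
      exact zpow_le_zpow_right₀ one_le_two h5.le
    rw [div_lt_iff₀ (by positivity)] at hm
    have hi' : (2 : ℝ) ^ j * γ (2 ^ i) ≤ 1 := hi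
    nlinarith
  refine ⟨Int.csSup_mem hne hbd, ?_⟩
  by_contra! h5
  have : kstar γ j + 1 ≤ kstar γ j := le_csSup hbd h5
  lia

theorem PhaseClass.kstar_lower (h : PhaseClass c C γ) (hc : 0 < c) (j : ℤ) :
    (2 : ℝ) ^ (-C 1) < 2 ^ j * γ (2 ^ kstar γ j) := by
  have h1 := (h.kstar_spec hc j).2
  have h2 := h.le_rpow_mul (s := 2 ^ kstar γ j) (t := 2 ^ (kstar γ j + 1)) (by positivity)
    (zpow_le_zpow_right₀ one_le_two (by lia))
  rw [← zpow_sub₀ two_ne_zero, add_sub_cancel_left, zpow_one] at h2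
  rw [Real.rpow_neg zero_le_two, inv_lt_iff_one_lt_mul₀ (by positivity)]
  refine h1.trans_le ?_
  calc _ ≤ (2 : ℝ) ^ j * (2 ^ C 1 * γ (2 ^ kstar γ j)) := by gcongr
    _ = _ := by ring

theorem PhaseClass.encard_kstar_preimage (h : PhaseClass c C γ) (hc : 0 < c) :
    ∃ Mu : ℕ, ∀ k : ℤ, {j : ℤ | kstar γ j = k}.encard ≤ Mu := by
  refine ⟨2 * ⌈C 1⌉₊ + 1, fun k => ?_⟩
  rcases {j : ℤ | kstar γ j = k}.eq_empty_or_nonempty with he | ⟨j0, hj0⟩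
  · simp [he]
  have key : ∀ j j' : ℤ, kstar γ j = k → kstar γ j' = k → j' - j ≤ ⌈C 1⌉₊ := by
    intro j j' hj hj'
    have h1 := h.kstar_lower hc j
    have h2 := (h.kstar_spec hc j').1
    rw [hj] at h1
    rw [hj'] at h2
    have h3 := h.pos (2 ^ k) (by positivity)
    have h4 : (2 : ℝ) ^ j' * γ (2 ^ k) = 2 ^ (j' - j) * (2 ^ j * γ (2 ^ k)) := by
      rw [← mul_assoc, ← zpow_add₀ two_ne_zero, sub_add_cancel]
    have h5 : (2 : ℝ) ^ (j' - j) * 2 ^ (-C 1) < 1 := by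
      refine lt_of_lt_of_le ?_ (h4 ▸ h2)
      exact mul_lt_mul_of_pos_left h1 (by positivity)
    rw [← Real.rpow_intCast, ← Real.rpow_add two_pos,
      Real.rpow_lt_one_iff_of_pos two_pos] at h5
    have h6 : ((j' - j : ℤ) : ℝ) < C 1 := by
      rcases h5 with h5 | h5
      · linarith [h5.2]
      · linarith [h5.1]
    have h7 := h6.le.trans (Nat.le_ceil (C 1))
    exact_mod_cast h7
  have hsub : {j : ℤ | kstar γ j = k} ⊆ (Finset.Icc (j0 - ⌈C 1⌉₊) (j0 + ⌈C 1⌉₊) : Finset ℤ) := by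
    intro j hj
    have a1 := key j j0 hj hj0
    have a2 := key j0 j hj0 hj
    simp only [Finset.coe_Icc, mem_Icc]
    constructor <;> lia
  refine (encard_le_encard hsub).trans ?_
  rw [encard_coe_eq_coe_finsetCard, Int.card_Icc]
  norm_cast
  lia

end PhaseClass

end ShortVariation

namespace ShortVariation
variable {n : ℕ}

theorem SB.of_hasCompactSupport {f : Rn n → ℝ} (hf : ContDiff ℝ (⊤ : ℕ∞) f)
    (hc : HasCompactSupport f) (N : ℕ) : ∃ M, SB N M f := by
  have hb : ∀ i, ∃ B, ∀ x, ‖iteratedFDeriv ℝ i f x‖ ≤ B := fun i =>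
    (hc.iteratedFDeriv (𝕜 := ℝ) i).exists_bound_of_continuous
      (hf.continuous_iteratedFDeriv (m := i) (by exact_mod_cast le_top))
  choose B hB using hb
  refine ⟨∑ i ∈ Finset.range (N + 1), |B i|, hf, fun i hi x => ?_⟩
  exact (hB i x).trans ((le_abs_self _).trans
    (Finset.single_le_sum (f := fun i => |B i|) (fun _ _ => abs_nonneg _) (by simp; lia)))

/-- A smooth substitute for the norm, with values in a compact subset of `(0,∞)`. -/
theorem exists_smooth_norm (n : ℕ) : ∃ ρ : Rn n → ℝ, (∀ x, ρ x ∈ Icc (1 / 4 : ℝ) 4) ∧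
    (∀ x, 1 / 3 < ‖x‖ → ‖x‖ < 3 → ρ x = ‖x‖) ∧ ∀ N, ∃ M, SB N M ρ := by
  let b : ContDiffBump (5 : ℝ) := ⟨4.9, 4.93, by norm_num, by norm_num⟩
  have hb1 : ∀ s : ℝ, 1 / 9 < s → s < 9 → b s = 1 := fun s h1 h2 =>
    b.one_of_mem_closedBall (by
      rw [Metric.mem_closedBall, Real.dist_eq, _root_.abs_le]
      change -4.9 ≤ s - 5 ∧ s - 5 ≤ 4.9
      constructor <;> linarith)
  have hb0 : ∀ s : ℝ, b s ≠ 0 → 1 / 16 < s ∧ s < 16 := fun s hs => by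
    have : s ∈ Function.support b := hs
    rw [b.support_eq, Metric.mem_ball, Real.dist_eq, abs_lt] at this
    change -4.93 < s - 5 ∧ s - 5 < 4.93 at this
    constructor <;> linarith
  set F : Rn n → ℝ := fun x => b (‖x‖ ^ 2) * (‖x‖ - 1) with hF
  have hnb : ∀ x : Rn n, b (‖x‖ ^ 2) ≠ 0 → 1 / 4 < ‖x‖ ∧ ‖x‖ < 4 := fun x hx => by
    have := hb0 _ hx
    have := norm_nonneg x
    constructor <;> nlinarith
  have hFs : ContDiff ℝ (⊤ : ℕ∞) F := by
    rw [contDiff_iff_contDiffAt]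
    intro x
    rcases eq_or_ne x 0 with rfl | hx
    · have : F =ᶠ[𝓝 0] fun _ => 0 := by
        filter_upwards [Metric.ball_mem_nhds (0 : Rn n) (by norm_num : (0 : ℝ) < 1 / 4)] with y hy
        rw [mem_ball_zero_iff] at hy
        rw [hF]
        simp only [mul_eq_zero]
        left
        by_contra h
        linarith [(hnb y h).1]
      exact contDiffAt_const.congr_of_eventuallyEq this
    · exact ((b.contDiff.contDiffAt).comp x (contDiff_norm_sq ℝ).contDiffAt).mul
        ((contDiffAt_norm ℝ hx).sub contDiffAt_const)
  have hFc : HasCompactSupport F := hasCompactSupport_of_ball (x0 := 0) (R := 4) fun x hx => by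
    rw [sub_zero]
    exact (hnb x (left_ne_zero_of_mul hx)).2.le
  refine ⟨fun x => 1 + F x, fun x => ?_, fun x h1 h2 => ?_, fun N => ?_⟩
  · by_cases hx : b (‖x‖ ^ 2) = 0
    · simp only [hF, hx]; norm_num
    · have h1 := hnb x hx
      have h2 := b.nonneg (x := ‖x‖ ^ 2)
      have h3 := b.le_one (x := ‖x‖ ^ 2)
      simp only [hF]
      constructor <;> nlinarith
  · simp only [hF]
    rw [hb1 (‖x‖ ^ 2) (by nlinarith) (by nlinarith [norm_nonneg x])]
    ring
  · obtain ⟨M, hM⟩ := SB.of_hasCompactSupport hFs hFc N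
    exact ⟨_, (SB.const 1).add hM⟩

theorem PhaseClass.sb_comp (c : ℝ) (C : ℕ → ℝ) (N : ℕ) (B M : ℝ) (hc : 0 < c) :
    ∃ M', ∀ (γ : ℝ → ℝ) (ρ : Rn n → ℝ), PhaseClass c C γ → γ 1 ≤ B →
      (∀ x, ρ x ∈ Icc (1 / 4 : ℝ) 4) → SB N M ρ → SB N M' (fun x => γ (ρ x)) := by
  set C0 : ℝ := ∑ i ∈ Finset.range (N + 1), |C i| * (4 : ℝ) ^ i * (4 ^ C 1 * |B|) with hC0
  refine ⟨N.factorial * C0 * (max 1 M) ^ N, fun γ ρ hγ hB hρ hs => ?_⟩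
  have hρ0 : ∀ x, 0 < ρ x := fun x => by linarith [(hρ x).1]
  have hC1 := hγ.C_one_pos hc
  have hterm : ∀ i, 0 ≤ |C i| * (4 : ℝ) ^ i * (4 ^ C 1 * |B|) := fun i => by positivity
  have hC0' : 0 ≤ C0 := Finset.sum_nonneg fun i _ => hterm i
  have hmaps : MapsTo ρ univ (Ioi 0) := fun x _ => hρ0 x
  refine ⟨contDiffOn_univ.1 (hγ.smooth.comp hs.1.contDiffOn hmaps), fun i hi x => ?_⟩
  have hder : ∀ k ≤ i, ‖iteratedFDerivWithin ℝ k γ (Ioi 0) (ρ x)‖ ≤ C0 := by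
    intro k hk
    rw [iteratedFDerivWithin_of_isOpen k isOpen_Ioi (hρ0 x), norm_iteratedFDeriv_eq_norm_iteratedDeriv,
      Real.norm_eq_abs]
    have h1 := hγ.bound k (ρ x) (hρ0 x)
    rw [abs_mul, abs_pow, _root_.abs_of_pos (hρ0 x)] at h1
    have h2 : γ (ρ x) ≤ 4 ^ C 1 * |B| := by
      have h3 := hγ.le_rpow_mul (s := 1) (t := 4) one_pos (by norm_num)
      rw [div_one] at h3
      refine (hγ.monotone hc (hρ0 x) (hρ x).2).trans (h3.trans ?_)
      gcongr
      exact hB.trans (le_abs_self B)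
    have h4 : 1 ≤ (4 * ρ x) ^ k := one_le_pow₀ (by linarith [(hρ x).1])
    have h5 := hγ.pos _ (hρ0 x)
    refine le_trans ?_ (Finset.single_le_sum
      (f := fun i => |C i| * (4 : ℝ) ^ i * (4 ^ C 1 * |B|)) (fun i _ => hterm i)
      (show k ∈ Finset.range (N + 1) by simp; lia))
    calc |iteratedDeriv k γ (ρ x)| ≤ (4 * ρ x) ^ k * |iteratedDeriv k γ (ρ x)| :=
          le_mul_of_one_le_left (abs_nonneg _) h4
      _ = 4 ^ k * (ρ x ^ k * |iteratedDeriv k γ (ρ x)|) := by rw [mul_pow]; ring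
      _ ≤ 4 ^ k * (C k * γ (ρ x)) := by gcongr
      _ ≤ 4 ^ k * (|C k| * (4 ^ C 1 * |B|)) := by
          gcongr
          exact le_abs_self _
      _ = _ := by ring
  have h1 : (1 : ℝ) ≤ max 1 M := le_max_left _ _
  have := norm_iteratedFDerivWithin_comp_le (n := i) (N := ((⊤ : ℕ∞) : WithTop ℕ∞)) hγ.smooth
    (hs.1.contDiffOn (s := univ)) (by exact_mod_cast le_top)
    isOpen_Ioi.uniqueDiffOn uniqueDiffOn_univ hmaps (mem_univ x) (C := C0) (D := max 1 M) hder
    (fun k hk1 hk => by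
      rw [iteratedFDerivWithin_univ]
      exact ((hs.2 k (hk.trans hi) x).trans (le_max_right 1 M)).trans
        (le_self_pow₀ (le_max_left _ _) (by lia)))
  rw [iteratedFDerivWithin_univ] at this
  refine this.trans ?_
  gcongr

theorem pd_norm {x : Rn n} (hx : x ≠ 0) (q : Fin n) : pd q (fun x : Rn n => ‖x‖) x = x q / ‖x‖ := by
  have h0 := norm_ne_zero_iff.2 hx
  have h1 : HasFDerivAt (fun x : Rn n => ‖x‖) (fderiv ℝ (fun x : Rn n => ‖x‖) x) x :=
    ((contDiffAt_norm ℝ hx (n := 1)).differentiableAt (by simp)).hasFDerivAt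
  have h2 := (h1.pow 2).unique (hasStrictFDerivAt_norm_sq x).hasFDerivAt
  have h3 := congrArg (fun L => L (EuclideanSpace.single q (1 : ℝ))) h2
  simp only [smul_apply, smul_eq_mul, innerSL_apply_apply,
    EuclideanSpace.inner_single_right] at h3
  unfold pd
  rw [eq_div_iff h0]
  simp at h3
  linarith

theorem pd_radial {G : Rn n → ℝ} {γ : ℝ → ℝ} {x : Rn n} (hx : x ≠ 0)
    (hG : G =ᶠ[𝓝 x] fun x => γ ‖x‖) (hγ : DifferentiableAt ℝ γ ‖x‖) (q : Fin n) :
    pd q G x = deriv γ ‖x‖ * (x q / ‖x‖) := by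
  have h1 : HasFDerivAt (fun x : Rn n => ‖x‖) (fderiv ℝ (fun x : Rn n => ‖x‖) x) x :=
    ((contDiffAt_norm ℝ hx (n := 1)).differentiableAt (by simp)).hasFDerivAt
  have h2 := hγ.hasDerivAt.comp_hasFDerivAt x h1
  rw [← pd_norm hx q]
  unfold pd
  rw [hG.fderiv_eq]
  have h3 : fderiv ℝ (fun x => γ ‖x‖) x = _ := h2.fderiv
  rw [h3]
  simp

theorem sum_sq_radial {x x' : Rn n} (hx : x ≠ 0) (hx' : x' ≠ 0) (a b : ℝ) :
    ∑ q, (a * (x q / ‖x‖) - b * (x' q / ‖x'‖)) ^ 2 =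
      (a - b) ^ 2 + 2 * a * b * (1 - inner ℝ x x' / (‖x‖ * ‖x'‖)) := by
  have h1 := norm_ne_zero_iff.2 hx
  have h2 := norm_ne_zero_iff.2 hx'
  have e1 : ∑ q, x q ^ 2 = ‖x‖ ^ 2 := by rw [EuclideanSpace.norm_sq_eq]; simp
  have e2 : ∑ q, x' q ^ 2 = ‖x'‖ ^ 2 := by rw [EuclideanSpace.norm_sq_eq]; simp
  have e3 : ∑ q, x q * x' q = inner ℝ x x' := by
    rw [PiLp.inner_apply]; simp [mul_comm]
  have e : ∀ q, (a * (x q / ‖x‖) - b * (x' q / ‖x'‖)) ^ 2 = a ^ 2 / ‖x‖ ^ 2 * x q ^ 2 +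
      b ^ 2 / ‖x'‖ ^ 2 * x' q ^ 2 - 2 * a * b / (‖x‖ * ‖x'‖) * (x q * x' q) := fun q => by
    field_simp
    ring
  simp_rw [e]
  rw [Finset.sum_sub_distrib, Finset.sum_add_distrib, ← Finset.mul_sum, ← Finset.mul_sum,
    ← Finset.mul_sum, e1, e2, e3]
  field_simp
  ring

end ShortVariation

namespace ShortVariation
variable {n : ℕ} {c : ℝ} {C : ℕ → ℝ} {γ : ℝ → ℝ}

theorem PhaseClass.le_of_half_le (h : PhaseClass c C γ) (hc : 0 < c) {b s : ℝ} (hb : b ≤ γ 1)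
    (hs : 1 / 2 ≤ s) : 2 ^ (-C 1) * b ≤ γ s := by
  have h1 := h.le_rpow_mul (s := 1 / 2) (t := 1) (by norm_num) (by norm_num)
  have h2 := h.monotone hc (by norm_num) hs
  have h3 : (0 : ℝ) < 2 ^ C 1 := by positivity
  rw [Real.rpow_neg zero_le_two, inv_mul_le_iff₀ h3]
  have h4 : (1 : ℝ) / (1 / 2) = 2 := by norm_num
  rw [h4] at h1
  exact hb.trans (h1.trans (by gcongr))

theorem PhaseClass.deriv_separation (h : PhaseClass c C γ) {κ : ℝ}
    (hκ : ∀ s ∈ Icc (1 / 2 : ℝ) 2, κ ≤ |iteratedDeriv 2 γ s|) {s t : ℝ}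
    (hs : s ∈ Icc (1 / 2 : ℝ) 2) (ht : t ∈ Icc (1 / 2 : ℝ) 2) :
    κ * |s - t| ≤ |deriv γ s - deriv γ t| := by
  wlog hst : s < t generalizing s t
  · rcases (not_lt.1 hst).eq_or_lt with rfl | h2
    · simp
    · rw [abs_sub_comm, abs_sub_comm (deriv γ s)]
      exact this ht hs h2
  have hd : ∀ x, 0 < x → DifferentiableAt ℝ (deriv γ) x := fun x hx =>
    ((h.smooth.deriv_of_isOpen isOpen_Ioi (m := 1) (by norm_cast)).differentiableOn
      (by simp)).differentiableAt (Ioi_mem_nhds hx)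
  obtain ⟨ξ, hξ, he⟩ := exists_deriv_eq_slope (deriv γ) hst
    (fun x hx => (hd x (by linarith [hx.1, hs.1])).continuousAt.continuousWithinAt)
    (fun x hx => (hd x (by linarith [hx.1, hs.1])).differentiableWithinAt)
  have h1 := hκ ξ ⟨hs.1.trans hξ.1.le, hξ.2.le.trans ht.2⟩
  rw [iteratedDeriv_succ, iteratedDeriv_one, he, abs_div, le_div_iff₀ (by
    rw [abs_pos]; linarith)] at h1
  rwa [abs_sub_comm, abs_sub_comm (deriv γ s)]

theorem PhaseClass.gradient_separation (h : PhaseClass c C γ) (hc : 0 < c) {b : ℝ} (hb : 0 < b)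
    (hb1 : b ≤ γ 1) {G : Rn n → ℝ} (hG : ∀ x, 1 / 3 < ‖x‖ → ‖x‖ < 3 → G x = γ ‖x‖) {x x' : Rn n}
    (hx : ‖x‖ ∈ Icc (1 / 2 : ℝ) 2) (hx' : ‖x'‖ ∈ Icc (1 / 2 : ℝ) 2) :
    ‖x - x'‖ ^ 2 ≤ 4 / (c * (2 ^ (-C 1) * b) / 4) ^ 2 * ∑ q, (pd q G x - pd q G x') ^ 2 := by
  set β := (2 : ℝ) ^ (-C 1) * b
  have hβ : 0 < β := by positivity
  set κ := c * β / 4 with hκ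
  have hκ0 : 0 < κ := by positivity
  have hpd : ∀ {y : Rn n}, ‖y‖ ∈ Icc (1 / 2 : ℝ) 2 → ∀ q,
      pd q G y = deriv γ ‖y‖ * (y q / ‖y‖) := fun {y} hy q => by
    have hy0 : 0 < ‖y‖ := by linarith [hy.1]
    refine pd_radial (norm_pos_iff.1 hy0) ?_ (h.differentiableAt hy0) q
    filter_upwards [continuous_norm.continuousAt.preimage_mem_nhds
      (Ioo_mem_nhds (show 1 / 3 < ‖y‖ by linarith [hy.1]) (show ‖y‖ < 3 by linarith [hy.2]))]
      with z hz using hG z hz.1 hz.2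
  have hder : ∀ s ∈ Icc (1 / 2 : ℝ) 2, κ ≤ deriv γ s := fun s hs => by
    have h1 := h.deriv_ge s (by linarith [hs.1])
    have h2 := h.le_of_half_le hc hb1 hs.1
    have h3 : c * β ≤ s * deriv γ s := le_trans (by gcongr) h1
    by_contra! h4
    nlinarith [hs.1, hs.2, mul_lt_mul_of_pos_left h4 (show 0 < s by linarith [hs.1])]
  have hder2 : ∀ s ∈ Icc (1 / 2 : ℝ) 2, κ ≤ |iteratedDeriv 2 γ s| := fun s hs => by
    have h1 := h.second_ge s (by linarith [hs.1])
    have h2 := h.le_of_half_le hc hb1 hs.1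
    have h3 : c * β ≤ s ^ 2 * |iteratedDeriv 2 γ s| := by
      rw [abs_mul, abs_pow, sq_abs] at h1
      exact le_trans (by gcongr) h1
    have h4 : s ^ 2 ≤ 4 := by nlinarith [hs.1, hs.2]
    nlinarith [abs_nonneg (iteratedDeriv 2 γ s)]
  have h0 : x ≠ 0 := norm_pos_iff.1 (by linarith [hx.1])
  have h0' : x' ≠ 0 := norm_pos_iff.1 (by linarith [hx'.1])
  simp_rw [hpd hx, hpd hx']
  rw [sum_sq_radial h0 h0']
  have hs1 := h.deriv_separation hder2 hx hx'
  have ha := hder _ hx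
  have hb' := hder _ hx'
  have hcs : inner ℝ x x' / (‖x‖ * ‖x'‖) ≤ 1 :=
    div_le_one_of_le₀ (real_inner_le_norm x x') (by positivity)
  have hn : ‖x - x'‖ ^ 2 = (‖x‖ - ‖x'‖) ^ 2 +
      2 * (‖x‖ * ‖x'‖) * (1 - inner ℝ x x' / (‖x‖ * ‖x'‖)) := by
    rw [norm_sub_sq_real]
    have h1 := norm_ne_zero_iff.2 h0
    have h2 := norm_ne_zero_iff.2 h0'
    field_simp
    ring
  rw [hn, div_mul_eq_mul_div, le_div_iff₀ (by positivity)]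
  set a := deriv γ ‖x‖
  set a' := deriv γ ‖x'‖
  set s := ‖x‖
  set t := ‖x'‖
  set e := 1 - inner ℝ x x' / (s * t)
  have he : 0 ≤ e := sub_nonneg.2 hcs
  have e1 : (s - t) ^ 2 * κ ^ 2 ≤ (a - a') ^ 2 := by
    rw [← mul_pow, ← sq_abs, ← sq_abs (a - a'), abs_mul, _root_.abs_of_pos hκ0, mul_comm]
    gcongr
  have e2 : κ ^ 2 ≤ a * a' := by nlinarith
  have e3 : s * t ≤ 4 := by nlinarith [hx.1, hx.2, hx'.1, hx'.2]
  have e4 : (s * t) * κ ^ 2 ≤ 4 * (a * a') :=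
    mul_le_mul e3 e2 (by positivity) (by norm_num)
  nlinarith [mul_le_mul_of_nonneg_right e4 he, sq_nonneg (a - a')]

/-- Functions that factor as a radial function times an angular function of mean zero have
vanishing integral. -/
theorem integral_radial_mul_angular (hn : 0 < n) {Ω : Rn n → ℝ}
    (hΩ : ∀ c : ℝ, 0 < c → ∀ t : Rn n, Ω (c • t) = Ω t)
    (hΩ0 : ∫ θ : Metric.sphere (0 : Rn n) 1, Ω θ ∂((volume : Measure (Rn n)).toSphere) = 0)
    (F : ℝ → ℂ) : ∫ x : Rn n, (Ω x : ℂ) * F ‖x‖ = 0 := by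
  have : Nonempty (Fin n) := ⟨⟨0, hn⟩⟩
  have h1 := (volume : Measure (Rn n)).measurePreserving_homeomorphUnitSphereProd.integral_comp
    (Homeomorph.measurableEmbedding _)
    (fun z : Metric.sphere (0 : Rn n) 1 × Ioi (0 : ℝ) => (Ω z.1 : ℂ) * F z.2)
  rw [integral_prod_mul (fun z : Metric.sphere (0 : Rn n) 1 => (Ω z : ℂ))
    (fun z : Ioi (0 : ℝ) => F z)] at h1
  rw [integral_complex_ofReal, hΩ0, Complex.ofReal_zero, zero_mul] at h1
  have h3 : ∫ x : Rn n, (Ω x : ℂ) * F ‖x‖ = ∫ x : ({0}ᶜ : Set (Rn n)), (Ω x : ℂ) * F ‖(x : Rn n)‖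
      ∂((volume : Measure (Rn n)).comap (↑)) := by
    rw [integral_subtype_comap (μ := (volume : Measure (Rn n))) (s := {0}ᶜ) (by measurability)
      fun x : Rn n => (Ω x : ℂ) * F ‖x‖, restrict_compl_singleton]
  rw [h3, ← h1]
  refine integral_congr_ae (Eventually.of_forall fun x => ?_)
  have hx : (x : Rn n) ≠ 0 := x.2
  have h2 : Ω (x : Rn n) = Ω ((homeomorphUnitSphereProd (Rn n) x).1 : Rn n) := by
    rw [homeomorphUnitSphereProd_apply_fst_coe]
    exact (hΩ _ (inv_pos.2 (norm_pos_iff.2 hx)) _).symm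
  simp only [h2, homeomorphUnitSphereProd_apply_snd_coe]

end ShortVariation

namespace ShortVariation
variable {n : ℕ} {c : ℝ} {C : ℕ → ℝ} {γ ψ : ℝ → ℝ} {K : Rn n → ℝ}

theorem norm_mem_of_cutoff_ne_zero (hψ : IsLPCutoff ψ) {t : Rn n} (h : ψ ‖t‖ ≠ 0) :
    ‖t‖ ∈ Icc (1 / 2 : ℝ) 2 := by
  have := hψ.2.2.1 _ h
  rwa [abs_norm] at this

theorem exists_sb_kernel (hψ : IsLPCutoff ψ) (hK : IsHomCZKernel n K) (N : ℕ) :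
    ∃ M, SB N M fun t => ψ ‖t‖ * K t := by
  obtain ⟨Ω, hΩ, -, -, hΩK⟩ := hK
  refine SB.of_hasCompactSupport ?_ (hasCompactSupport_of_ball (x0 := 0) (R := 2) fun t ht => ?_) N
  · rw [contDiff_iff_contDiffAt]
    intro t
    rcases eq_or_ne t 0 with rfl | ht
    · have : (fun t : Rn n => ψ ‖t‖ * K t) =ᶠ[𝓝 0] fun _ => 0 := by
        filter_upwards [Metric.ball_mem_nhds (0 : Rn n) (by norm_num : (0 : ℝ) < 1 / 2)] with y hy
        rw [mem_ball_zero_iff] at hy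
        rw [cutoff_eq_zero hψ (Or.inl (by rwa [abs_norm])), zero_mul]
      exact contDiffAt_const.congr_of_eventuallyEq this
    · have hnt : {x : Rn n | x ≠ 0} ∈ 𝓝 t := isOpen_ne.mem_nhds ht
      have hKt : K =ᶠ[𝓝 t] fun t => Ω t / ‖t‖ ^ n := by
        filter_upwards [hnt] with y hy using hΩK y hy
      refine ContDiffAt.mul (hψ.1.contDiffAt.comp t (contDiffAt_norm ℝ ht)) ?_
      refine ContDiffAt.congr_of_eventuallyEq ?_ hKt
      exact (hΩ.contDiffAt hnt).div ((contDiffAt_norm ℝ ht).pow n)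
        (pow_ne_zero _ (norm_ne_zero_iff.2 ht))
  · rw [sub_zero]
    exact (norm_mem_of_cutoff_ne_zero hψ (left_ne_zero_of_mul ht)).2

theorem exists_adm (hψ : IsLPCutoff ψ) (hK : IsHomCZKernel n K) (C : ℕ → ℝ) (hc : 0 < c) {b : ℝ}
    (hb : 0 < b) (B : ℝ) {ρ : Rn n → ℝ} (hρ : ∀ x, ρ x ∈ Icc (1 / 4 : ℝ) 4)
    (hρn : ∀ x, 1 / 3 < ‖x‖ → ‖x‖ < 3 → ρ x = ‖x‖) (hρs : ∀ N, ∃ M, SB N M ρ) :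
    ∃ M, ∀ γ : ℝ → ℝ, PhaseClass c C γ → b ≤ γ 1 → γ 1 ≤ B →
      Adm M (fun x => γ (ρ x)) (fun t => ψ ‖t‖ * K t) ∧
      Adm M (fun x => γ (ρ x)) (fun t => γ (ρ t) * (ψ ‖t‖ * K t)) ∧
      Adm M (fun x => γ (ρ x)) (fun t => γ (ρ t) * (γ (ρ t) * (ψ ‖t‖ * K t))) := by
  obtain ⟨Mρ, hMρ⟩ := hρs (n + 3)
  obtain ⟨M1, hM1⟩ := PhaseClass.sb_comp (n := n) c C (n + 3) B Mρ hc
  obtain ⟨M2, hM2⟩ := exists_sb_kernel hψ hK (n + 3)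
  set M3 := 2 ^ (n + 3) * M1 * M2
  set M4 := 2 ^ (n + 3) * M1 * M3
  set M5 := 4 / (c * (2 ^ (-C 1) * b) / 4) ^ 2
  have key : ∀ γ : ℝ → ℝ, PhaseClass c C γ → b ≤ γ 1 → γ 1 ≤ B → ∀ A : Rn n → ℝ, ∀ M',
      SB (n + 3) M' A → (∀ t, A t ≠ 0 → ψ ‖t‖ ≠ 0) →
      Adm (max (max M1 M5) M') (fun x => γ (ρ x)) A := by
    intro γ hγ hb1 hB A M' hA hAs
    refine ⟨(hM1 γ ρ hγ hB hρ hMρ).mono le_rfl ((le_max_left _ _).trans (le_max_left _ _)),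
      hA.mono le_rfl (le_max_right _ _),
      fun x hx => (norm_mem_of_cutoff_ne_zero hψ (hAs x hx)).2, fun x x' hx hx' => ?_⟩
    refine (hγ.gradient_separation hc hb hb1 (G := fun x => γ (ρ x))
      (fun x h1 h2 => by simp only [hρn x h1 h2])
      (norm_mem_of_cutoff_ne_zero hψ (hAs x hx))
      (norm_mem_of_cutoff_ne_zero hψ (hAs x' hx'))).trans ?_
    exact mul_le_mul_of_nonneg_right ((le_max_right M1 M5).trans (le_max_left _ _))
      (Finset.sum_nonneg fun q _ => sq_nonneg _)
  refine ⟨max (max (max M1 M5) M2) (max (max (max M1 M5) M3) (max (max M1 M5) M4)),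
    fun γ hγ hb1 hB => ?_⟩
  have hG := hM1 γ ρ hγ hB hρ hMρ
  have h3 := hG.mul hM2
  have h4 := hG.mul h3
  exact ⟨(key γ hγ hb1 hB _ _ hM2 fun t ht => left_ne_zero_of_mul ht).mono (le_max_left _ _),
    (key γ hγ hb1 hB _ _ h3 fun t ht => left_ne_zero_of_mul (right_ne_zero_of_mul ht)).mono
      ((le_max_left _ _).trans (le_max_right _ _)),
    (key γ hγ hb1 hB _ _ h4 fun t ht =>
      left_ne_zero_of_mul (right_ne_zero_of_mul (right_ne_zero_of_mul ht))).mono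
      ((le_max_right _ _).trans (le_max_right _ _))⟩

theorem integral_kap_radial (hn : 0 < n) (hψ : IsLPCutoff ψ) (hK : IsHomCZKernel n K)
    {ρ : Rn n → ℝ} (hρn : ∀ x, 1 / 3 < ‖x‖ → ‖x‖ < 3 → ρ x = ‖x‖) (γ g : ℝ → ℝ) (lam : ℝ) :
    ∫ x, kap lam (fun x => γ (ρ x)) (fun t => g (ρ t) * (ψ ‖t‖ * K t)) x = 0 := by
  have : Nonempty (Fin n) := ⟨⟨0, hn⟩⟩
  obtain ⟨Ω, -, hΩh, hΩ0, hΩK⟩ := hK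
  rw [← integral_radial_mul_angular hn hΩh hΩ0 fun s =>
    Complex.exp (Complex.I * (lam * γ s : ℝ)) * (g s * (ψ s / s ^ n) : ℝ)]
  refine integral_congr_ae ?_
  have h0 : ∀ᵐ x : Rn n, x ≠ 0 := by simp [ae_iff]
  filter_upwards [h0] with x hx
  unfold kap osc
  by_cases h : ψ ‖x‖ = 0
  · simp [h]
  · have hm := norm_mem_of_cutoff_ne_zero hψ h
    simp only [hρn x (by linarith [hm.1]) (by linarith [hm.2]), hΩK x hx]
    push_cast
    ring

theorem Hloc_eq_TT (hψ : IsLPCutoff ψ) (hK : IsHomCZKernel n K) {Γ : ℝ → ℝ} {w lam : ℝ} {k : ℤ}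
    {G : Rn n → ℝ} (h : ∀ t, ‖t‖ ∈ Icc (1 / 2 : ℝ) 2 → w * Γ (2 ^ k * ‖t‖) = lam * G t)
    (f : Rn n → ℂ) (x : Rn n) :
    Hloc Γ K ψ w k f x = TT k lam G (fun t => ψ ‖t‖ * K t) f x := by
  obtain ⟨Ω, -, hΩh, -, hΩK⟩ := hK
  have h2 : (2 : ℝ) ^ k ≠ 0 := by positivity
  have h2p : (0 : ℝ) < 2 ^ k := by positivity
  have h2n : (0 : ℝ) < 2 ^ (-k) := by positivity
  have h2i : (2 : ℝ) ^ k * 2 ^ (-k) = 1 := by rw [← zpow_add₀ two_ne_zero]; simp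
  set H : Rn n → ℂ := fun t => osc lam G ((2 : ℝ) ^ (-k) • t) *
    ((ψ ‖(2 : ℝ) ^ (-k) • t‖ * K ((2 : ℝ) ^ (-k) • t) : ℝ) : ℂ) * f (x - t)
  have e1 : TT k lam G (fun t => ψ ‖t‖ * K t) f x = ∫ s, H ((2 : ℝ) ^ k • s) := by
    unfold TT cv opK oscKer
    rw [← integral_sub_left_eq_self (fun s => H ((2 : ℝ) ^ k • s)) _ ((2 : ℝ) ^ (-k) • x)]
    refine integral_congr_ae (Eventually.of_forall fun y => ?_)
    simp only [H, smul_sub, smul_smul, h2i, mul_comm ((2 : ℝ) ^ (-k)), one_smul, sub_sub_cancel]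
  rw [e1, Measure.integral_comp_smul, ← integral_smul]
  unfold Hloc
  refine integral_congr_ae (Eventually.of_forall fun t => ?_)
  have hnorm : ‖(2 : ℝ) ^ (-k) • t‖ = 2 ^ (-k) * ‖t‖ := by
    rw [norm_smul, Real.norm_of_nonneg h2n.le]
  simp only [H, hnorm]
  by_cases hz : ψ (2 ^ (-k) * ‖t‖) = 0
  · simp only [hz, zero_mul, Complex.ofReal_zero, mul_zero, smul_zero]
  have hm := norm_mem_of_cutoff_ne_zero hψ (t := (2 : ℝ) ^ (-k) • t) (by rwa [hnorm])
  have ht := h _ hm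
  rw [hnorm, ← mul_assoc, h2i, one_mul] at ht
  have ht0 : t ≠ 0 := by
    rintro rfl
    simp at hm
    norm_num at hm
  have hK2 : K ((2 : ℝ) ^ (-k) • t) = (2 ^ k) ^ n * K t := by
    rw [hΩK _ (smul_ne_zero h2n.ne' ht0), hΩK _ ht0, hΩh _ h2n, hnorm, mul_pow, zpow_neg, inv_pow]
    field_simp
  rw [hK2]
  unfold osc
  rw [← ht, finrank_euclideanSpace, Fintype.card_fin, _root_.abs_of_pos (by positivity)]
  rw [Complex.real_smul]
  push_cast
  have h2c : ((2 : ℂ) ^ k) ^ n ≠ 0 := by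
    exact pow_ne_zero _ (zpow_ne_zero _ two_ne_zero)
  field_simp

end ShortVariation

namespace ShortVariation
variable {n : ℕ}

theorem lpNormENN_tsum_le {ι : Type*} [Countable ι] {p r : ℝ} (hp : 1 < p) (hr : 0 < r)
    (hpr : p ≤ r) {W T : ℝ≥0∞} (hW : W ≠ ∞) {X a b : ι → Rn n → ℝ≥0∞}
    (hX : ∀ j x, X j x ≤ W * (a j x + b j x)) (ha : ∀ j, Measurable (a j))
    (hTa : ∫⁻ x, (∑' j, a j x ^ r) ^ (p / r) ≤ T) (hTb : ∫⁻ x, (∑' j, b j x ^ r) ^ (p / r) ≤ T) :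
    lpNormENN p (fun x => (∑' j, X j x ^ r) ^ (1 / r)) volume ≤ 2 * W * (2 * T) ^ (1 / p) := by
  have hp0 : 0 < p := by linarith
  have hpt : ∀ x, ((∑' j, X j x ^ r) ^ (1 / r)) ^ p ≤
      (2 * W) ^ p * ((∑' j, a j x ^ r) ^ (p / r) + (∑' j, b j x ^ r) ^ (p / r)) := by
    intro x
    have h1 : ∑' j, X j x ^ r ≤ (2 * W) ^ r * (∑' j, a j x ^ r + ∑' j, b j x ^ r) := by
      rw [← ENNReal.tsum_add, ← ENNReal.tsum_mul_left]
      refine ENNReal.tsum_le_tsum fun j => ?_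
      calc X j x ^ r ≤ (W * (a j x + b j x)) ^ r := ENNReal.rpow_le_rpow (hX j x) hr.le
        _ = W ^ r * (a j x + b j x) ^ r := ENNReal.mul_rpow_of_nonneg _ _ hr.le
        _ ≤ W ^ r * (2 ^ r * (a j x ^ r + b j x ^ r)) :=
            mul_le_mul_right (rpow_add_le_two_mul _ _ hr.le) _
        _ = _ := by rw [ENNReal.mul_rpow_of_nonneg _ _ hr.le]; ring
    rw [← ENNReal.rpow_mul, one_div_mul_eq_div]
    refine (ENNReal.rpow_le_rpow h1 (by positivity)).trans ?_
    rw [ENNReal.mul_rpow_of_nonneg _ _ (by positivity), ← ENNReal.rpow_mul, mul_div_cancel₀ _ hr.ne']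
    exact mul_le_mul_right
      (ENNReal.rpow_add_le_add_rpow _ _ (by positivity) ((div_le_one hr).2 hpr)) _
  have hm : Measurable fun x => (∑' j, a j x ^ r) ^ (p / r) :=
    (Measurable.tsum fun j => (ha j).pow_const r).pow_const _
  unfold lpNormENN
  calc _ ≤ ((2 * W) ^ p * (2 * T)) ^ (1 / p) := by
        refine ENNReal.rpow_le_rpow ?_ (by positivity)
        refine (lintegral_mono hpt).trans ?_
        have hW' : (2 * W) ^ p ≠ ∞ :=
          ENNReal.rpow_ne_top_of_nonneg hp0.le (ENNReal.mul_ne_top (by simp) hW)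
        rw [lintegral_const_mul' _ _ hW', lintegral_add_left hm, two_mul T]
        gcongr
    _ = _ := by
        rw [ENNReal.mul_rpow_of_nonneg _ _ (by positivity), ← ENNReal.rpow_mul,
          mul_one_div_cancel hp0.ne', ENNReal.rpow_one]

theorem phase_at_one_mem {c : ℝ} {C : ℕ → ℝ} {Γ : ℝ → ℝ} (h : PhaseClass c C Γ) (hc : 0 < c)
    {l m j : ℤ} (hj : j ∈ Slm Γ l m) :
    (2 : ℝ) ^ (-C 1) ≤ 2 ^ (j - (m + l)) * Γ (2 ^ (l + kstar Γ j) * 1) ∧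
      2 ^ (j - (m + l)) * Γ (2 ^ (l + kstar Γ j) * 1) ≤ 2 := by
  obtain ⟨h1, h2⟩ := hj
  have h3 := h.kstar_lower hc j
  have h4 := (h.kstar_spec hc j).1
  have hpos := h.pos (2 ^ kstar Γ j) (by positivity)
  rw [le_div_iff₀ hpos] at h1
  rw [div_lt_iff₀ hpos] at h2
  have hd : (0 : ℝ) < 2 ^ (m + l) := by positivity
  have hj0 : (0 : ℝ) < 2 ^ j := by positivity
  rw [mul_one, zpow_sub₀ two_ne_zero, div_mul_eq_mul_div, le_div_iff₀ hd, div_le_iff₀ hd]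
  rw [zpow_add₀ two_ne_zero (m + l) 1, zpow_one] at h2
  constructor
  · calc (2 : ℝ) ^ (-C 1) * 2 ^ (m + l) ≤ (2 ^ j * Γ (2 ^ kstar Γ j)) * 2 ^ (m + l) := by gcongr
      _ = 2 ^ j * (2 ^ (m + l) * Γ (2 ^ kstar Γ j)) := by ring
      _ ≤ _ := by gcongr
  · calc (2 : ℝ) ^ j * Γ (2 ^ (l + kstar Γ j))
        ≤ 2 ^ j * (2 ^ (m + l) * 2 * Γ (2 ^ kstar Γ j)) := by gcongr
      _ = 2 * 2 ^ (m + l) * (2 ^ j * Γ (2 ^ kstar Γ j)) := by ring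
      _ ≤ 2 * 2 ^ (m + l) * 1 := by gcongr
      _ = _ := mul_one _

theorem add_nonneg_of_mem_Slm {c : ℝ} {C : ℕ → ℝ} {Γ : ℝ → ℝ} (h : PhaseClass c C Γ) (hc : 0 < c)
    {l m j : ℤ} (hl : 1 ≤ l) (hj : j ∈ Slm Γ l m) : 0 ≤ m + l := by
  have hpos := h.pos (2 ^ kstar Γ j) (by positivity)
  have h1 : 1 ≤ Γ (2 ^ (l + kstar Γ j)) / Γ (2 ^ kstar Γ j) := by
    rw [one_le_div hpos]
    exact h.monotone hc (by positivity) (zpow_le_zpow_right₀ one_le_two (by lia))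
  have h2 := h1.trans_lt hj.2
  rw [one_lt_zpow_iff_right₀ one_lt_two] at h2
  lia

end ShortVariation

open ShortVariation in
/-- Proposition 6.1 (small `p`). -/
theorem short_variation_small_p (n : ℕ) (hn : 2 ≤ n) (Γ : ℝ → ℝ) (hΓ : IsGammaU Γ)
    (K : Rn n → ℝ) (hK : IsHomCZKernel n K) (ψ : ℝ → ℝ) (hψ : IsLPCutoff ψ)
    (χ : ℝ → ℝ) (hχ : IsChiCutoff χ) (p r : ℝ) (hp : 1 < p)
    (hp2 : p < 2 * n / (2 * n - 1)) (hr1 : p / (p - 1) / n < r) (hr2 : r ≤ p / (p - 1)) :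
    ∃ C > (0 : ℝ), ∀ l : ℤ, 1 ≤ l → ∀ m : ℤ, ∀ f : SchwartzMap (Rn n) ℂ,
      lpNormENN p
          (fun x => (∑' j : Slm Γ l m,
            besovNorm ψ r (fun u =>
              Complex.ofReal (χ u) *
                Hloc Γ K ψ ((2 : ℝ) ^ (j : ℤ) * u) (l + kstar Γ (j : ℤ)) (⇑f) x) ^ r)
              ^ (1 / r)) volume
        ≤ ENNReal.ofReal (C * (2 : ℝ) ^ (((m : ℝ) + (l : ℝ)) * (1 / r - n / (p / (p - 1))))) *
            eLpNorm (⇑f) (ENNReal.ofReal p) volume := by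
  have hn2 : (2 : ℝ) ≤ n := by exact_mod_cast hn
  have hpp : 0 < p - 1 := by linarith
  have hp0 : 0 < p := by linarith
  rw [lt_div_iff₀ (by linarith)] at hp2
  have hr : 2 ≤ r := by
    refine le_trans ?_ hr1.le
    rw [le_div_iff₀ (by linarith), le_div_iff₀ hpp]
    nlinarith
  have hp3 : p * (n + 1) < 2 * n := by nlinarith
  have hr0 : 0 < r := by linarith
  have hpr : p ≤ r := by nlinarith
  obtain ⟨c, Cs, hc, hγ⟩ := phaseClass_of_isGammaU hΓ
  obtain ⟨Mu, hMu⟩ := hγ.encard_kstar_preimage hc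
  obtain ⟨ρ, hρ, hρn, hρs⟩ := exists_smooth_norm n
  obtain ⟨M, hM⟩ := exists_adm hψ hK Cs hc (b := 2 ^ (-Cs 1)) (by positivity) 2 hρ hρn hρs
  obtain ⟨C1, hC1, H1⟩ := besovNorm_TT_le hψ hχ hr hr2
  obtain ⟨C2, hC2, H2⟩ := full_sum n hn M Mu hp hp3 hr
  refine ⟨2 * C1 * (2 * C2) ^ (1 / p) + 1, by positivity, fun l hl m f => ?_⟩
  rcases isEmpty_or_nonempty (Slm Γ l m) with he | ⟨⟨j0, hj0⟩⟩
  · have h0 : 0 < 1 / r := by positivity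
    have h1 : 0 < 1 / p := by positivity
    simp [lpNormENN, ENNReal.zero_rpow_of_pos, hp0, hr0]
  have hd := add_nonneg_of_mem_Slm hγ hc hl hj0
  set d : ℤ := m + l with hddef
  let k : Slm Γ l m → ℤ := fun j => l + kstar Γ j
  let γ : Slm Γ l m → ℝ → ℝ := fun j s => 2 ^ ((j : ℤ) - d) * Γ (2 ^ k j * s)
  let G : Slm Γ l m → Rn n → ℝ := fun j x => γ j (ρ x)
  let A : Rn n → ℝ := fun t => ψ ‖t‖ * K t
  have hγj : ∀ j, PhaseClass c Cs (γ j) := fun j => hγ.scale (by positivity) (by positivity)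
  have hadm := fun j => hM (γ j) (hγj j) (phase_at_one_mem hγ hc j.2).1
    (phase_at_one_mem hγ hc j.2).2
  have hT : ∀ j : Slm Γ l m, ∀ u x, Hloc Γ K ψ ((2 : ℝ) ^ (j : ℤ) * u) (l + kstar Γ (j : ℤ)) (⇑f) x =
      TT (k j) (u * 2 ^ d) (G j) A f x := fun j u x =>
    Hloc_eq_TT hψ hK (fun t ht => by
      simp only [G, γ, k]
      rw [hρn t (by linarith [ht.1]) (by linarith [ht.2]), zpow_sub₀ two_ne_zero]
      field_simp) f x
  have hk : ∀ i, (k ⁻¹' {i}).encard ≤ Mu := fun i => by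
    rw [← Subtype.val_injective.encard_image]
    refine (encard_le_encard ?_).trans (hMu (i - l))
    rintro _ ⟨j, hj, rfl⟩
    have : l + kstar Γ j = i := hj
    change kstar Γ j = i - l
    lia
  obtain ⟨B, hB⟩ : ∃ B : ℝ, ∀ x, ‖f x‖ ≤ B := by
    obtain ⟨B, -, hB⟩ := f.decay 0 0
    exact ⟨B, fun x => by simpa using hB x⟩
  have hBM : BM (f : Rn n → ℂ) := ⟨f.continuous.measurable, B, hB⟩
  have hz0 : ∀ j lam, ∫ x, kap lam (G j) A x = 0 := fun j lam => by
    have := integral_kap_radial (by lia) hψ hK hρn (γ j) (fun _ => 1) lam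
    simpa only [one_mul] using this
  have hz1 : ∀ j lam, ∫ x, kap lam (G j) (fun t => G j t * A t) x = 0 := fun j lam =>
    integral_kap_radial (by lia) hψ hK hρn (γ j) (γ j) lam
  have hz2 : ∀ j lam, ∫ x, kap lam (G j) (fun t => G j t * (G j t * A t)) x = 0 := fun j lam => by
    have := integral_kap_radial (by lia) hψ hK hρn (γ j) (fun s => γ j s * γ j s) lam
    simpa only [mul_assoc] using this
  have hTa := H2 (Slm Γ l m) k G (fun _ => A) d (fun j => (hadm j).1) (fun j => (hadm j).2.1) hd hk
    hz0 hz1 f f.integrable f.continuous ⟨B, hB⟩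
  have hTb := H2 (Slm Γ l m) k G (fun j t => G j t * A t) d (fun j => (hadm j).2.1)
    (fun j => (hadm j).2.2) hd hk hz1 hz2 f f.integrable f.continuous ⟨B, hB⟩
  simp_rw [hT]
  refine (lpNormENN_tsum_le hp hr0 hpr (ENNReal.mul_ne_top ENNReal.ofReal_ne_top (e2_ne_top _))
    (fun j x => H1 M d n (k j) (G j) A f x hd (hadm j).1 (hadm j).2.1 hBM)
    (fun j => measurable_uN (hadm j).1 hBM.1) hTa hTb).trans ?_
  have hfp : eLpNorm f (ENNReal.ofReal p) volume = (∫⁻ x, ‖f x‖ₑ ^ p) ^ (1 / p) := by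
    rw [eLpNorm_eq_lintegral_rpow_enorm_toReal (by simpa using hp0) ENNReal.ofReal_ne_top,
      ENNReal.toReal_ofReal hp0.le]
  have hip : 0 ≤ 1 / p := by positivity
  have hexp : (d : ℝ) / r + -(n * d * (p - 1)) * (1 / p) =
      ((m : ℝ) + (l : ℝ)) * (1 / r - n / (p / (p - 1))) := by
    rw [hddef]
    push_cast
    field_simp
    ring
  rw [hfp, ← mul_assoc (2 : ℝ≥0∞) (ENNReal.ofReal C2 * _), ENNReal.mul_rpow_of_nonneg _ _ hip,
    ← mul_assoc (2 : ℝ≥0∞) (ENNReal.ofReal C2), ENNReal.mul_rpow_of_nonneg _ _ hip, e2_rpow,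
    ENNReal.ofReal_mul (by positivity), ← e2, ← hexp, e2_add]
  have h2 : (2 : ℝ≥0∞) = ENNReal.ofReal 2 := by simp
  have hC : 2 * ENNReal.ofReal C1 * (2 * ENNReal.ofReal C2) ^ (1 / p) ≤
      ENNReal.ofReal (2 * C1 * (2 * C2) ^ (1 / p) + 1) := by
    rw [h2, ← ENNReal.ofReal_mul zero_le_two, ← ENNReal.ofReal_mul zero_le_two,
      ENNReal.ofReal_rpow_of_nonneg (by positivity) hip, ← ENNReal.ofReal_mul (by positivity)]
    exact ENNReal.ofReal_le_ofReal (by linarith)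
  calc _ = 2 * ENNReal.ofReal C1 * (2 * ENNReal.ofReal C2) ^ (1 / p) *
        (e2 (d / r) * e2 (-(n * d * (p - 1)) * (1 / p))) * (∫⁻ x, ‖f x‖ₑ ^ p) ^ (1 / p) := by ring
    _ ≤ _ := by gcongr
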